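/- Let G be a Kleinian group and suppose that some component S of Ω(G)/G is not a triply punctured sphere. Then there is a loxodromic element of G that represents a simple closed curve on S. -/

import Mathlib

/- # Background definitions for Kleinian groups
We model the Riemann sphere as `OnePoint ℂ`, `PSL(2,ℂ)` as the quotient of
`SL(2,ℂ)` by its center, acting by Möbius transformations on the sphere and by
Poincaré extension on upper half-space (the model `W = OnePoint (ℂ × ℝ)` of the
closed ball, whose open upper part is hyperbolic 3-space `ℍ³`). -/

noncomputable section

abbrev SL2C := Matrix.SpecialLinearGroup (Fin 2) ℂ

instance : TopologicalSpace SL2C :=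
  TopologicalSpace.induced (fun A : SL2C => (A.1 : Matrix (Fin 2) (Fin 2) ℂ)) inferInstance
abbrev PSL2C := SL2C ⧸ Subgroup.center SL2C
abbrev RSphere := OnePoint ℂ

/-- The Möbius transformation of the Riemann sphere attached to a matrix in `SL(2,ℂ)`. -/
def mobiusSL (A : SL2C) (z : RSphere) : RSphere :=
  Option.elim z
    (if A.1 1 0 = 0 then OnePoint.infty else (((A.1 0 0) / (A.1 1 0) : ℂ) : RSphere))
    (fun w => if A.1 1 0 * w + A.1 1 1 = 0 then OnePoint.infty
      else (((A.1 0 0 * w + A.1 0 1) / (A.1 1 0 * w + A.1 1 1) : ℂ) : RSphere))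

/-- The action of `PSL(2,ℂ)` on the Riemann sphere (via a representative matrix;
the Möbius transformation does not depend on the choice of sign). -/
def psl (g : PSL2C) : RSphere → RSphere := mobiusSL (Quotient.out g)

/-- Region of discontinuity of a subgroup of `PSL(2,ℂ)`. -/
def omegaSet (G : Subgroup PSL2C) : Set RSphere :=
  {z | ∃ U : Set RSphere, IsOpen U ∧ z ∈ U ∧
    {g : PSL2C | g ∈ G ∧ (psl g '' U ∩ U).Nonempty}.Finite}

/-- The limit set `Λ(G)`. -/
def limitSet (G : Subgroup PSL2C) : Set RSphere := (omegaSet G)ᶜ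

/-- Parabolic element: not the identity, with exactly one fixed point on the sphere. -/
def IsParabolic (g : PSL2C) : Prop := g ≠ 1 ∧ ∃! z : RSphere, psl g z = z

/-- A rotation: fixes `0` and `∞` and acts as multiplication by a unimodular number. -/
def IsRotation (g : PSL2C) : Prop :=
  ∃ u : ℂ, ‖u‖ = 1 ∧ ∀ z : ℂ, psl g (z : RSphere) = ((u * z : ℂ) : RSphere)

/-- Loxodromic element: exactly two fixed points, and not conjugate to a rotation. -/
def IsLoxodromic (g : PSL2C) : Prop :=
  (∃ z w : RSphere, z ≠ w ∧ ∀ x, psl g x = x ↔ x = z ∨ x = w) ∧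
  ¬ ∃ h : PSL2C, IsRotation (h * g * h⁻¹)

def TorsionFree (G : Subgroup PSL2C) : Prop :=
  ∀ g ∈ G, ∀ n : ℕ, 0 < n → g ^ n = 1 → g = 1

/-- Non-elementary: at least three limit points. -/
def NonElementary (G : Subgroup PSL2C) : Prop :=
  ∃ a b c : RSphere, a ∈ limitSet G ∧ b ∈ limitSet G ∧ c ∈ limitSet G ∧
    a ≠ b ∧ a ≠ c ∧ b ≠ c

/-- Our standing hypotheses: a discrete, finitely generated, torsion-free,
non-elementary subgroup of `PSL(2,ℂ)` with nonempty region of discontinuity. -/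
def IsKleinian (G : Subgroup PSL2C) : Prop :=
  DiscreteTopology ↥G ∧ G.FG ∧ TorsionFree G ∧ NonElementary G ∧ (omegaSet G).Nonempty

/- ## Hyperbolic 3-space and the closed-ball model `W` -/

/-- The closed ball model: one-point compactification of the closed half space
`{(z,t) : t ≥ 0}` (points with `t < 0` are irrelevant junk). -/
abbrev W := OnePoint (ℂ × ℝ)

/-- Poincaré extension of the Möbius transformation of `A ∈ SL(2,ℂ)` to upper
half-space, in coordinates `(z,t)`, `t > 0`. -/
def poincare (A : SL2C) (z : ℂ) (t : ℝ) : ℂ × ℝ :=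
  let a := A.1 0 0; let b := A.1 0 1; let c := A.1 1 0; let d := A.1 1 1
  let D : ℝ := Complex.normSq (c * z + d) + Complex.normSq c * t ^ 2
  (((a * z + b) * (starRingEnd ℂ) (c * z + d) + a * (starRingEnd ℂ) c * (t : ℂ) ^ 2) / (D : ℂ),
    t / D)

/-- The action of a matrix on the closed ball model `W`: Poincaré extension on the
open upper half space, Möbius action on the boundary sphere `{t = 0} ∪ {∞}`. -/
def actWSL (A : SL2C) (x : W) : W :=
  Option.elim x
    (if A.1 1 0 = 0 then OnePoint.infty
      else (((A.1 0 0 / A.1 1 0 : ℂ), (0 : ℝ)) : ℂ × ℝ))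
    (fun p => if 0 < p.2 then ((poincare A p.1 p.2 : ℂ × ℝ) : W)
      else if A.1 1 0 * p.1 + A.1 1 1 = 0 then OnePoint.infty
      else ((((A.1 0 0 * p.1 + A.1 0 1) / (A.1 1 0 * p.1 + A.1 1 1) : ℂ), (0 : ℝ)) : ℂ × ℝ))

def actW (g : PSL2C) : W → W := actWSL (Quotient.out g)

/-- The boundary sphere embedded in the closed ball model. -/
def embS : RSphere → W :=
  fun z => Option.elim z OnePoint.infty (fun w => (((w, (0 : ℝ)) : ℂ × ℝ) : W))

/-- Hyperbolic 3-space, as the open upper part of `W`. -/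
def upperW : Set W := {x | ∃ p : ℂ × ℝ, x = (p : W) ∧ 0 < p.2}

/-- The domain `ℍ³ ∪ Ω(G)` inside the closed ball. -/
def domSet (G : Subgroup PSL2C) : Set W := upperW ∪ embS '' omegaSet G

/-- The quotient manifold `M(G) = (ℍ³ ∪ Ω(G))/G`. -/
def mrel (G : Subgroup PSL2C) : Setoid ↥(domSet G) :=
  Relation.EqvGen.setoid fun x y : ↥(domSet G) => ∃ g ∈ G, actW g ↑x = ↑y

def MSpace (G : Subgroup PSL2C) : Type := Quotient (mrel G)

instance (G : Subgroup PSL2C) : TopologicalSpace (MSpace G) :=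
  inferInstanceAs (TopologicalSpace (Quotient (mrel G)))

/-- Projection to the quotient manifold. -/
def mproj (G : Subgroup PSL2C) : ↥(domSet G) → MSpace G := Quotient.mk (mrel G)

/- ## Cores, curves on surfaces, and the boundary characteristic -/

/-- A core of `M(G)`: a compact connected subset whose inclusion induces an
isomorphism of fundamental groups (injectivity and surjectivity on loops up to
homotopy rel endpoints). -/
def IsCore (G : Subgroup PSL2C) (K : Set (MSpace G)) : Prop :=
  IsCompact K ∧ IsConnected K ∧
  ∃ x₀ : ↥K,
    (∀ γ : Path ((x₀ : MSpace G)) (x₀ : MSpace G),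
       ∃ δ : Path x₀ x₀, (δ.map continuous_subtype_val).Homotopic γ) ∧
    (∀ δ₁ δ₂ : Path x₀ x₀,
       (δ₁.map continuous_subtype_val).Homotopic (δ₂.map continuous_subtype_val) →
         δ₁.Homotopic δ₂)

abbrev S1 := AddCircle (1 : ℝ)

def circleReverse : C(S1, S1) := ⟨fun x => -x, continuous_neg⟩

/-- A space supports `n` disjoint homotopically distinct (essential) simple closed
curves. Homotopic distinctness is free homotopy, allowing reversal of orientation. -/
def SuppCurves (X : Type*) [TopologicalSpace X] (n : ℕ) : Prop :=
  ∃ f : Fin n → C(S1, X),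
    (∀ i, Function.Injective (f i)) ∧
    (∀ i j, i ≠ j → Disjoint (Set.range (f i)) (Set.range (f j))) ∧
    (∀ i (x : X), ¬ (f i).Homotopic (ContinuousMap.const S1 x)) ∧
    (∀ i j, i ≠ j → ¬ (f i).Homotopic (f j) ∧ ¬ (f i).Homotopic ((f j).comp circleReverse))

/-- The maximal number of disjoint homotopically distinct simple closed curves
supported on the boundary of the given core. -/
def coreCurveSup (G : Subgroup PSL2C) (K : Set (MSpace G)) : ℕ :=
  sSup {n : ℕ | SuppCurves ↥(frontier K) n}

/-- The maximal number of disjoint homotopically distinct simple closed curves on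
the boundary of any core of `M(G)`. -/
def curveMax (G : Subgroup PSL2C) : ℕ :=
  sSup {n : ℕ | ∃ K, IsCore G K ∧ SuppCurves ↥(frontier K) n}

def FixesAll (H : Subgroup PSL2C) (p : RSphere) : Prop := ∀ h ∈ H, psl h p = p

/-- A parabolic subgroup of `G`: a nontrivial subgroup of `G` with a common fixed
point, all of whose nontrivial elements are parabolic. -/
def IsParabolicSubgroup (G H : Subgroup PSL2C) : Prop :=
  H ≤ G ∧ H ≠ ⊥ ∧ (∃ p, FixesAll H p) ∧ ∀ h ∈ H, h = 1 ∨ IsParabolic h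

def IsMaxParabolic (G H : Subgroup PSL2C) : Prop :=
  IsParabolicSubgroup G H ∧ ∀ H', IsParabolicSubgroup G H' → H ≤ H' → H' = H

/-- Rank 1: isomorphic to `ℤ`. -/
def HasRank1 (H : Subgroup PSL2C) : Prop := Nonempty (↥H ≃* Multiplicative ℤ)

/-- Rank 2: isomorphic to `ℤ × ℤ`. -/
def HasRank2 (H : Subgroup PSL2C) : Prop := Nonempty (↥H ≃* Multiplicative (ℤ × ℤ))

/-- The number of `G`-conjugacy classes of subgroups satisfying `P`. -/
def numClasses (G : Subgroup PSL2C) (P : Subgroup PSL2C → Prop) : ℕ :=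
  Nat.card (Quotient (Relation.EqvGen.setoid fun H₁ H₂ : {H : Subgroup PSL2C // P H} =>
    ∃ g ∈ G, Subgroup.map (MulAut.conj g).toMonoidHom H₁.1 = H₂.1))

def numRank2Classes (G : Subgroup PSL2C) : ℕ :=
  numClasses G fun H => IsMaxParabolic G H ∧ HasRank2 H

def numRank1Classes (G : Subgroup PSL2C) : ℕ :=
  numClasses G fun H => IsMaxParabolic G H ∧ HasRank1 H

/-- The boundary characteristic `b(G) = n - τ`. -/
def bChar (G : Subgroup PSL2C) : ℤ := (curveMax G : ℤ) - (numRank2Classes G : ℤ)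

/-- Maximally parabolic: `G` has `b(G)` conjugacy classes of rank 1 maximal
parabolic subgroups. -/
def MaximallyParabolic (G : Subgroup PSL2C) : Prop :=
  (numRank1Classes G : ℤ) = bChar G

/- ## Geometric finiteness -/

/-- `cosh` of the hyperbolic distance between two points of upper half space. -/
def hcosh (p q : ℂ × ℝ) : ℝ :=
  1 + (Complex.normSq (p.1 - q.1) + (p.2 - q.2) ^ 2) / (2 * p.2 * q.2)

/-- Hyperbolic half-space, as the points at least as close to `a` as to `b`. -/
def hHalfSpace (a b : ℂ × ℝ) : Set (ℂ × ℝ) := {p | hcosh p a ≤ hcosh p b}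

/-- Action of `PSL(2,ℂ)` on the upper half-space coordinates. -/
def actH (g : PSL2C) (p : ℂ × ℝ) : ℂ × ℝ := poincare (Quotient.out g) p.1 p.2

def upperH : Set (ℂ × ℝ) := {p | 0 < p.2}

/-- Geometric finiteness: `G` has a finite-sided convex fundamental polyhedron in
`ℍ³` (a finite intersection of hyperbolic half-spaces whose `G`-translates cover
`ℍ³` and whose interiors are pairwise disjoint translates). -/
def GeomFinite (G : Subgroup PSL2C) : Prop :=
  ∃ s : Finset ((ℂ × ℝ) × (ℂ × ℝ)),
    (∀ q ∈ s, q.1 ∈ upperH ∧ q.2 ∈ upperH ∧ q.1 ≠ q.2) ∧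
    ∃ P : Set (ℂ × ℝ), P = upperH ∩ ⋂ q ∈ s, hHalfSpace q.1 q.2 ∧
      (∀ x ∈ upperH, ∃ g ∈ G, actH g x ∈ P) ∧
      (∀ g ∈ G, g ≠ 1 → Disjoint (actH g '' interior P) (interior P))

/- ## Round discs, precise invariance, cusps -/

def unitDiscS : Set RSphere := {z | ∃ w : ℂ, z = (w : RSphere) ∧ ‖w‖ < 1}
def unitCircleS : Set RSphere := {z | ∃ w : ℂ, z = (w : RSphere) ∧ ‖w‖ = 1}

/-- A round disc: a Möbius image of the open unit disc. -/
def IsRoundDisc (D : Set RSphere) : Prop := ∃ g : PSL2C, D = psl g '' unitDiscS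

/-- A round circle: a Möbius image of the unit circle. -/
def IsRoundCircle (S : Set RSphere) : Prop := ∃ g : PSL2C, S = psl g '' unitCircleS

/-- `E` is precisely invariant under `H` in `G`. -/
def PreciselyInvariant (G H : Subgroup PSL2C) (E : Set RSphere) : Prop :=
  (∀ h ∈ H, psl h '' E = E) ∧ ∀ g ∈ G, g ∉ H → Disjoint (psl g '' E) E

def PreciselyInvariantW (G H : Subgroup PSL2C) (E : Set W) : Prop :=
  (∀ h ∈ H, actW h '' E = E) ∧ ∀ g ∈ G, g ∉ H → Disjoint (actW g '' E) E

/-- `p` is doubly cusped with cusp discs `D₁, D₂`: two disjoint round discs in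
`Ω(G)`, mutually tangent at `p`, whose union is precisely invariant under `H`. -/
def DoublyCuspedWith (G H : Subgroup PSL2C) (p : RSphere) (D₁ D₂ : Set RSphere) : Prop :=
  IsRoundDisc D₁ ∧ IsRoundDisc D₂ ∧ D₁ ⊆ omegaSet G ∧ D₂ ⊆ omegaSet G ∧
  Disjoint D₁ D₂ ∧ closure D₁ ∩ closure D₂ = {p} ∧ PreciselyInvariant G H (D₁ ∪ D₂)

def DoublyCusped (G H : Subgroup PSL2C) (p : RSphere) : Prop :=
  ∃ D₁ D₂, DoublyCuspedWith G H p D₁ D₂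

/- ## The quotient surface `Ω(G)/G` -/

def orel (G : Subgroup PSL2C) : Setoid ↥(omegaSet G) :=
  Relation.EqvGen.setoid fun z w : ↥(omegaSet G) => ∃ g ∈ G, psl g ↑z = ↑w

def QuotOmega (G : Subgroup PSL2C) : Type := Quotient (orel G)

instance (G : Subgroup PSL2C) : TopologicalSpace (QuotOmega G) :=
  inferInstanceAs (TopologicalSpace (Quotient (orel G)))

def oproj (G : Subgroup PSL2C) : ↥(omegaSet G) → QuotOmega G := Quotient.mk (orel G)

/-- A triply punctured sphere: homeomorphic to the Riemann sphere minus 3 points. -/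
def IsTriplyPuncturedSphere (X : Type*) [TopologicalSpace X] : Prop :=
  ∃ p₁ p₂ p₃ : RSphere, p₁ ≠ p₂ ∧ p₁ ≠ p₃ ∧ p₂ ≠ p₃ ∧
    Nonempty (X ≃ₜ ↥({p₁, p₂, p₃}ᶜ : Set RSphere))

def IsTorus (X : Type*) [TopologicalSpace X] : Prop := Nonempty (X ≃ₜ (S1 × S1))

/-- The union of the non-toral connected components of a subset `X`. -/
def nonToralPart {Y : Type*} [TopologicalSpace Y] (X : Set Y) : Set Y :=
  {y | y ∈ X ∧ ¬ IsTorus ↥(connectedComponentIn X y)}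

/-- A closed curve in `Ω(G)/G` is represented by `g ∈ G` if it lifts to a path in
`Ω(G)` whose endpoints are translates by `g`. -/
def RepresentedByOmega (G : Subgroup PSL2C) (f : C(S1, QuotOmega G)) (g : PSL2C) : Prop :=
  g ∈ G ∧ ∃ γ : C(ℝ, ↥(omegaSet G)),
    (∀ t : ℝ, (↑(γ (t + 1)) : RSphere) = psl g ↑(γ t)) ∧
    (∀ t : ℝ, oproj G (γ t) = f (↑t : S1))

/-- A closed curve in `M(G)` is represented by `g ∈ G` if it lifts to a path in
`ℍ³ ∪ Ω(G)` whose endpoints are translates by `g`. -/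
def RepresentedByM (G : Subgroup PSL2C) (f : C(S1, MSpace G)) (g : PSL2C) : Prop :=
  g ∈ G ∧ ∃ γ : C(ℝ, ↥(domSet G)),
    (∀ t : ℝ, (↑(γ (t + 1)) : W) = actW g ↑(γ t)) ∧
    (∀ t : ℝ, mproj G (γ t) = f (↑t : S1))

/- ## Components, function groups, pinched function groups -/

def IsComponentOf (G : Subgroup PSL2C) (C : Set RSphere) : Prop :=
  ∃ z ∈ omegaSet G, C = connectedComponentIn (omegaSet G) z

def GInvariant (G : Subgroup PSL2C) (A : Set RSphere) : Prop := ∀ g ∈ G, psl g '' A = A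

def FunctionGroup (G : Subgroup PSL2C) : Prop :=
  ∃ C, IsComponentOf G C ∧ GInvariant G C

/-- Two components are adjacent if a doubly cusped rank 1 maximal parabolic
subgroup has its pair of tangent discs lying one in each. -/
def AdjacentComp (G : Subgroup PSL2C) (C₁ C₂ : Set RSphere) : Prop :=
  ∃ H p D₁ D₂, IsMaxParabolic G H ∧ HasRank1 H ∧ FixesAll H p ∧
    DoublyCuspedWith G H p D₁ D₂ ∧ D₁ ⊆ C₁ ∧ D₂ ⊆ C₂

/-- An augmented component: the union of an equivalence class of components under
the equivalence relation generated by adjacency. -/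
def IsAugmentedComponent (G : Subgroup PSL2C) (A : Set RSphere) : Prop :=
  ∃ C₀, IsComponentOf G C₀ ∧
    A = ⋃₀ {C : Set RSphere | IsComponentOf G C ∧
      Relation.EqvGen (fun X Y => IsComponentOf G X ∧ IsComponentOf G Y ∧ AdjacentComp G X Y) C₀ C}

/-- A pinched function group: a Kleinian group with an invariant augmented component. -/
def PinchedFunctionGroup (G : Subgroup PSL2C) : Prop :=
  ∃ A, IsAugmentedComponent G A ∧ GInvariant G A

/- ## Fuchsian subgroups and the peripheral families ℱ(G), ℱ₀(G) -/

def IsRealElt (g : PSL2C) : Prop :=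
  ∃ A : SL2C, (∀ i j, (A.1 i j).im = 0) ∧ (QuotientGroup.mk A : PSL2C) = g

/-- Fuchsian: conjugate in `PSL(2,ℂ)` to a subgroup of `PSL(2,ℝ)`. -/
def IsFuchsian (F : Subgroup PSL2C) : Prop :=
  ∃ h : PSL2C, ∀ f ∈ F, IsRealElt (h * f * h⁻¹)

/-- `ℱ(G)`: Fuchsian subgroups of `G` generated by three parabolics with product
the identity. -/
def InFF (G F : Subgroup PSL2C) : Prop :=
  F ≤ G ∧ IsFuchsian F ∧ ∃ h₁ h₂ h₃ : PSL2C, IsParabolic h₁ ∧ IsParabolic h₂ ∧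
    IsParabolic h₃ ∧ h₁ * h₂ * h₃ = 1 ∧ F = Subgroup.closure {h₁, h₂, h₃}

/-- `ℱ₀(G)`: the peripheral members of `ℱ(G)`, i.e. those which are component
subgroups (stabilizers in `G` of a component of `Ω(G)`). -/
def InFF0 (G F : Subgroup PSL2C) : Prop :=
  InFF G F ∧ ∃ C, IsComponentOf G C ∧ ∀ x : PSL2C, x ∈ F ↔ x ∈ G ∧ psl x '' C = C

/-- Image of a subgroup `F ≤ G` under an isomorphism `φ : G ≃ G'`, as a subgroup
of `PSL(2,ℂ)`. -/
def pushSub {G G' : Subgroup PSL2C} (φ : ↥G ≃* ↥G') (F : Subgroup PSL2C) :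
    Subgroup PSL2C :=
  Subgroup.map (G'.subtype.comp φ.toMonoidHom) (F.subgroupOf G)

/- ## Horoballs and the natural truncation -/

def upperBallW (s : ℝ) : Set W := {x | ∃ p : ℂ × ℝ, x = (p : W) ∧ s < p.2}

/-- A horoball in `ℍ³` tangent to the sphere at `p`. -/
def IsHoroballAt (B : Set W) (p : RSphere) : Prop :=
  ∃ g : PSL2C, ∃ s : ℝ, 0 < s ∧ psl g OnePoint.infty = p ∧ B = actW g '' upperBallW s

/-- The hyperbolic half-space of `ℍ³` lying above a round disc `D`. -/
def IsHalfSpaceAbove (S : Set W) (D : Set RSphere) : Prop :=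
  ∃ g : PSL2C, D = psl g '' unitDiscS ∧
    S = actW g '' {x | ∃ p : ℂ × ℝ, x = (p : W) ∧ 0 < p.2 ∧ Complex.normSq p.1 + p.2 ^ 2 < 1}

/-- The piece removed from `M(G)` at (the fixed point of) a maximal parabolic
subgroup `H`: a precisely invariant horoball (cusp torus) if `H` has rank 2; a
horoball together with the two half-spaces over the tangent discs and the
punctured discs themselves (pairing tube) if `H` has rank 1 and its fixed point
is doubly cusped; nothing otherwise. -/
def IsCuspPiece (G H : Subgroup PSL2C) (E : Set W) : Prop :=
  ∃ p, FixesAll H p ∧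
    ((HasRank2 H ∧ ∃ B, IsHoroballAt B p ∧ E = B) ∨
     (HasRank1 H ∧ DoublyCusped G H p ∧
        ∃ B D₁ D₂ S₁ S₂, IsHoroballAt B p ∧ DoublyCuspedWith G H p D₁ D₂ ∧
          IsHalfSpaceAbove S₁ D₁ ∧ IsHalfSpaceAbove S₂ D₂ ∧
          E = B ∪ S₁ ∪ S₂ ∪ embS '' ((D₁ ∪ D₂) \ {p})) ∨
     (HasRank1 H ∧ ¬ DoublyCusped G H p ∧ E = ∅))

/-- `R ⊆ ℍ³ ∪ Ω(G)` is (the preimage of) the removed part defining the natural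
truncation `T(G)`: a `G`-invariant union of precisely invariant, pairwise
disjoint cusp pieces, one for each maximal parabolic subgroup. -/
def IsTruncation (G : Subgroup PSL2C) (R : Set W) : Prop :=
  ∃ ch : {H : Subgroup PSL2C // IsMaxParabolic G H} → Set W,
    (∀ H, IsCuspPiece G H.1 (ch H)) ∧
    (∀ H, PreciselyInvariantW G H.1 (ch H)) ∧
    (∀ H₁ H₂, H₁ ≠ H₂ → Disjoint (ch H₁) (ch H₂)) ∧
    R = ⋃ H, ⋃ g ∈ (G : Set PSL2C), actW g '' ch H

/-- The natural truncation `T(G)` (for the removed region `R`), as a subset of `M(G)`. -/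
def truncSet (G : Subgroup PSL2C) (R : Set W) : Set (MSpace G) :=
  mproj G '' {x : ↥(domSet G) | (x : W) ∉ R}


/- ## Further notions: (anti-)Möbius maps, quasiconformal deformations, the
hyperbolic plane -/

/-- Complex conjugation on the Riemann sphere. -/
def conjSphere : RSphere → RSphere :=
  fun z => Option.elim z OnePoint.infty (fun w => (((starRingEnd ℂ) w : ℂ) : RSphere))

/-- An (orientation preserving) Möbius transformation of the sphere. -/
def IsMobiusMap (α : RSphere ≃ RSphere) : Prop := ∃ h : PSL2C, ∀ z, α z = psl h z

/-- An orientation reversing Möbius transformation of the sphere. -/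
def IsAntiMobiusMap (α : RSphere ≃ RSphere) : Prop :=
  ∃ h : PSL2C, ∀ z, α z = psl h (conjSphere z)

/-- The chordal metric on the Riemann sphere. -/
def chordal : RSphere → RSphere → ℝ := fun x y =>
  Option.elim x
    (Option.elim y 0 (fun w => 2 / Real.sqrt (1 + ‖w‖ ^ 2)))
    (fun z => Option.elim y (2 / Real.sqrt (1 + ‖z‖ ^ 2))
      (fun w => 2 * ‖z - w‖ / (Real.sqrt (1 + ‖z‖ ^ 2) * Real.sqrt (1 + ‖w‖ ^ 2))))

/-- Quasiconformality of a homeomorphism of the sphere, via the metric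
definition: the circular distortion is uniformly bounded. -/
def IsQuasiconformal (w : RSphere ≃ RSphere) : Prop :=
  Continuous w ∧ Continuous w.symm ∧
  ∃ K : ℝ, 1 ≤ K ∧ ∀ x : RSphere,
    Filter.limsup (fun r : ℝ =>
        sSup {d | ∃ y, chordal x y = r ∧ d = chordal (w x) (w y)} /
        sInf {d | ∃ y, chordal x y = r ∧ d = chordal (w x) (w y)})
      (nhdsWithin 0 (Set.Ioi 0)) ≤ K

/-- A representation `ρ : G → PSL(2,ℂ)` is a point of the quasiconformal
deformation space `𝒯(G)` if it is induced by conjugation by a quasiconformal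
homeomorphism of the sphere. -/
def InTeich (G : Subgroup PSL2C) (ρ : ↥G → PSL2C) : Prop :=
  (∀ a b : ↥G, ρ (a * b) = ρ a * ρ b) ∧ Function.Injective ρ ∧
  ∃ w : RSphere ≃ RSphere, IsQuasiconformal w ∧
    ∀ (g : ↥G) (z : RSphere), psl (ρ g) (w z) = w (psl (g : PSL2C) z)

/-- A point of the boundary `∂𝒯(G)`: an algebraic limit (in the topology of
pointwise convergence on representations) of quasiconformal deformations of `G`
which is not itself one; by Jørgensen's inequality such a representation is a
discrete faithful homomorphism. -/
def OnTeichBoundary (G : Subgroup PSL2C) (ρ : ↥G → PSL2C) : Prop :=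
  ρ ∈ closure {σ : ↥G → PSL2C | InTeich G σ} ∧ ¬ InTeich G ρ ∧
  (∀ a b : ↥G, ρ (a * b) = ρ a * ρ b) ∧ Function.Injective ρ

/-- The hyperbolic plane, as the upper half plane in `ℂ`. -/
def upperPlane : Set ℂ := {z | 0 < z.im}

/-- Orbit equivalence on the hyperbolic plane under a subgroup of `PSL(2,ℂ)`
(of interest when the subgroup is Fuchsian, so that it preserves `upperPlane`). -/
def prel (F : Subgroup PSL2C) : Setoid ↥upperPlane :=
  Relation.EqvGen.setoid fun z w : ↥upperPlane =>
    ∃ g ∈ F, psl g ((z : ℂ) : RSphere) = (((w : ℂ) : RSphere))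

/-- The quotient surface of the hyperbolic plane by a Fuchsian group. -/
def QuotPlane (F : Subgroup PSL2C) : Type := Quotient (prel F)

instance (F : Subgroup PSL2C) : TopologicalSpace (QuotPlane F) :=
  inferInstanceAs (TopologicalSpace (Quotient (prel F)))

/-- The extended real line `ℝ ∪ {∞}`, the limit set of a Fuchsian group of the
first kind. -/
def realCircleS : Set RSphere :=
  {z | z = OnePoint.infty ∨ ∃ r : ℝ, z = ((r : ℂ) : RSphere)}


noncomputable section
open Set Filter Topology

lemma mobiusSL_infty (A : SL2C) : mobiusSL A OnePoint.infty =
    if A.1 1 0 = 0 then OnePoint.infty else (((A.1 0 0) / (A.1 1 0) : ℂ) : RSphere) := rfl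

lemma mobiusSL_coe (A : SL2C) (w : ℂ) : mobiusSL A (w : RSphere) =
    if A.1 1 0 * w + A.1 1 1 = 0 then OnePoint.infty
      else (((A.1 0 0 * w + A.1 0 1) / (A.1 1 0 * w + A.1 1 1) : ℂ) : RSphere) := rfl

lemma mobiusSL_eq_smul (A : SL2C) (z : RSphere) :
    mobiusSL A z = (Matrix.SpecialLinearGroup.toGL A : GL (Fin 2) ℂ) • z := by
  induction z using OnePoint.rec with
  | infty => rw [mobiusSL_infty, OnePoint.smul_infty_eq_ite]; congr
  | coe w => rw [mobiusSL_coe, OnePoint.smul_some_eq_ite]; congr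

lemma mobiusSL_mul (A B : SL2C) (z : RSphere) : mobiusSL (A * B) z = mobiusSL A (mobiusSL B z) := by
  simp only [mobiusSL_eq_smul, map_mul, mul_smul]

lemma mobiusSL_one (z : RSphere) : mobiusSL 1 z = z := by
  simp only [mobiusSL_eq_smul, map_one, one_smul]

lemma mobiusSL_neg (A : SL2C) (z : RSphere) : mobiusSL (-A) z = mobiusSL A z := by
  induction z using OnePoint.rec with
  | infty => simp [mobiusSL_infty]
  | coe w =>
    have : -(A.1 1 0 * w) + -A.1 1 1 = -(A.1 1 0 * w + A.1 1 1) := by ring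
    have h2 : -(A.1 0 0 * w) + -A.1 0 1 = -(A.1 0 0 * w + A.1 0 1) := by ring
    simp [mobiusSL_coe, this, h2, -neg_add_rev]

lemma center_cases {A : SL2C} (h : A ∈ Subgroup.center SL2C) : A = 1 ∨ A = -1 := by
  obtain ⟨r, hr, h2⟩ := Matrix.SpecialLinearGroup.mem_center_iff.1 h
  simp only [Fintype.card_fin] at hr
  have : r = 1 ∨ r = -1 := by simpa using hr
  rcases this with rfl | rfl
  · left; apply Subtype.ext; rw [← h2]; simp
  · right; apply Subtype.ext; rw [← h2]; ext i j; fin_cases i <;> fin_cases j <;> simp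

lemma neg_one_center : (-1 : SL2C) ∈ Subgroup.center SL2C := by
  rw [Subgroup.mem_center_iff]; intro g; simp

/-- class of a matrix -/
abbrev mk (A : SL2C) : PSL2C := QuotientGroup.mk A

lemma mk_mul (A B : SL2C) : mk (A * B) = mk A * mk B := rfl
lemma mk_inv (A : SL2C) : mk A⁻¹ = (mk A)⁻¹ := rfl
lemma mk_one : mk 1 = 1 := rfl
lemma mk_neg (A : SL2C) : mk (-A) = mk A := by
  rw [QuotientGroup.eq]
  have : (-A)⁻¹ * A = -1 := by simp
  rw [this]; exact neg_one_center

lemma mk_eq_iff {A B : SL2C} : mk A = mk B ↔ A = B ∨ A = -B := by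
  constructor
  · intro h
    rw [QuotientGroup.eq] at h
    rcases center_cases h with h | h
    · left; exact (inv_mul_eq_one.1 h)
    · right
      have : A * (A⁻¹ * B) = A * (-1) := by rw [h]
      simp only [mul_inv_cancel_left, mul_neg, mul_one] at this
      rw [this]; simp
  · rintro (rfl | rfl)
    · rfl
    · exact mk_neg B

lemma exists_mk (g : PSL2C) : ∃ A : SL2C, mk A = g := QuotientGroup.mk_surjective g

lemma psl_mk (A : SL2C) (z : RSphere) : psl (mk A) z = mobiusSL A z := by
  unfold psl
  have : mk (Quotient.out (mk A)) = mk A := Quotient.out_eq _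
  rcases mk_eq_iff.1 this with h | h
  · rw [h]
  · rw [h, mobiusSL_neg]

lemma psl_mul (g h : PSL2C) (z : RSphere) : psl (g * h) z = psl g (psl h z) := by
  obtain ⟨A, rfl⟩ := exists_mk g
  obtain ⟨B, rfl⟩ := exists_mk h
  rw [← mk_mul, psl_mk, psl_mk, psl_mk, mobiusSL_mul]

lemma psl_one (z : RSphere) : psl 1 z = z := by rw [← mk_one, psl_mk, mobiusSL_one]

instance pslAction : MulAction PSL2C RSphere where
  smul := psl
  one_smul := psl_one
  mul_smul := psl_mul

lemma smul_def' (g : PSL2C) (z : RSphere) : g • z = psl g z := rfl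
lemma mk_smul (A : SL2C) (z : RSphere) : mk A • z = mobiusSL A z := psl_mk A z

lemma sl_det (A : SL2C) : A.1 0 0 * A.1 1 1 - A.1 0 1 * A.1 1 0 = 1 := by
  have := A.2; rwa [Matrix.det_fin_two] at this

lemma mk_smul_coe {A : SL2C} {w : ℂ} (h : A.1 1 0 * w + A.1 1 1 ≠ 0) : mk A • (w : RSphere) =
    (((A.1 0 0 * w + A.1 0 1) / (A.1 1 0 * w + A.1 1 1) : ℂ) : RSphere) := by
  rw [mk_smul, mobiusSL_coe, if_neg h]

lemma mk_smul_coe_infty {A : SL2C} {w : ℂ} (h : A.1 1 0 * w + A.1 1 1 = 0) :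
    mk A • (w : RSphere) = OnePoint.infty := by
  rw [mk_smul, mobiusSL_coe, if_pos h]

lemma mk_smul_infty {A : SL2C} (h : A.1 1 0 ≠ 0) :
    mk A • (OnePoint.infty : RSphere) = ((A.1 0 0 / A.1 1 0 : ℂ) : RSphere) := by
  rw [mk_smul, mobiusSL_infty, if_neg h]

lemma mk_smul_infty_infty {A : SL2C} (h : A.1 1 0 = 0) :
    mk A • (OnePoint.infty : RSphere) = OnePoint.infty := by
  rw [mk_smul, mobiusSL_infty, if_pos h]

lemma tendsto_coe_sphere_infty {α : Type*} {l : Filter α} {f : α → ℂ}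
    (h : Tendsto (fun x => ‖f x‖) l atTop) :
    Tendsto (fun x => (f x : RSphere)) l (𝓝 OnePoint.infty) := by
  refine OnePoint.tendsto_coe_infty.comp ?_
  rw [coclosedCompact_eq_cocompact, ← Metric.cobounded_eq_cocompact]
  exact tendsto_norm_atTop_iff_cobounded.1 h

lemma continuous_mobiusSL (A : SL2C) : Continuous (mobiusSL A) := by
  have hdet := sl_det A
  rw [continuous_iff_continuousAt]
  intro z
  induction z using OnePoint.rec with
  | coe w =>
    rw [OnePoint.continuousAt_coe]
    by_cases h : A.1 1 0 * w + A.1 1 1 = 0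
    · rw [ContinuousAt, Function.comp_apply, mobiusSL_coe, if_pos h]
      have hc : A.1 1 0 ≠ 0 := by
        intro hc; rw [hc] at h hdet; simp at h; rw [h] at hdet; simp at hdet
      rw [← nhdsNE_sup_pure, tendsto_sup]
      constructor
      · have : Tendsto (fun x => (((A.1 0 0 * x + A.1 0 1) / (A.1 1 0 * x + A.1 1 1) : ℂ) : RSphere))
            (𝓝[≠] w) (𝓝 OnePoint.infty) := by
          apply tendsto_coe_sphere_infty
          simp only [norm_div]
          have h1 : Tendsto (fun x => ‖A.1 0 0 * x + A.1 0 1‖) (𝓝[≠] w)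
              (𝓝 ‖A.1 0 0 * w + A.1 0 1‖) := by
            apply Tendsto.mono_left _ nhdsWithin_le_nhds
            exact Continuous.tendsto (by fun_prop) w
          have h2 : Tendsto (fun x => ‖A.1 1 0 * x + A.1 1 1‖) (𝓝[≠] w) (𝓝[>] 0) := by
            rw [tendsto_nhdsWithin_iff]
            constructor
            · apply Tendsto.mono_left _ nhdsWithin_le_nhds
              have : Tendsto (fun x => ‖A.1 1 0 * x + A.1 1 1‖) (𝓝 w)
                (𝓝 ‖A.1 1 0 * w + A.1 1 1‖) := Continuous.tendsto (by fun_prop) w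
              rwa [h, norm_zero] at this
            · filter_upwards [self_mem_nhdsWithin] with x hx
              simp only [mem_Ioi, norm_pos_iff]
              intro h3
              apply hx
              have : A.1 1 0 * (x - w) = 0 := by linear_combination h3 - h
              simpa [hc, sub_eq_zero] using this
          have h3 : 0 < ‖A.1 0 0 * w + A.1 0 1‖ := by
            rw [norm_pos_iff]; intro h3
            have : (1:ℂ) = 0 := by
              linear_combination -hdet + A.1 0 0 * h - A.1 1 0 * h3
            exact one_ne_zero this
          simp only [div_eq_mul_inv]
          exact Tendsto.pos_mul_atTop h3 h1 (tendsto_inv_nhdsGT_zero.comp h2)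
        refine this.congr' ?_
        filter_upwards [self_mem_nhdsWithin] with x hx
        rw [Function.comp_apply, mobiusSL_coe, if_neg]
        intro h3
        apply hx
        have : A.1 1 0 * (x - w) = 0 := by linear_combination h3 - h
        simpa [hc, sub_eq_zero] using this
      · rw [tendsto_pure_left]
        intro s hs
        simp only [Function.comp_apply, mobiusSL_coe, if_pos h]
        exact mem_of_mem_nhds hs
    · have h1 : ContinuousAt (fun x => (((A.1 0 0 * x + A.1 0 1) / (A.1 1 0 * x + A.1 1 1) : ℂ) : RSphere)) w := by
        apply ContinuousAt.comp (g := ((↑) : ℂ → RSphere)) OnePoint.continuous_coe.continuousAt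
        exact ContinuousAt.div (by fun_prop) (by fun_prop) h
      refine h1.congr ?_
      have : ∀ᶠ x in 𝓝 w, A.1 1 0 * x + A.1 1 1 ≠ 0 :=
        ContinuousAt.eventually_ne (by fun_prop) h
      filter_upwards [this] with x hx
      rw [Function.comp_apply, mobiusSL_coe, if_neg hx]
  | infty =>
    rw [OnePoint.continuousAt_infty', coclosedCompact_eq_cocompact, ← Metric.cobounded_eq_cocompact]
    by_cases hc : A.1 1 0 = 0
    · rw [mobiusSL_infty, if_pos hc]
      have hd : A.1 1 1 ≠ 0 := by intro hd; rw [hc, hd] at hdet; simp at hdet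
      have ha : A.1 0 0 ≠ 0 := by intro hd; rw [hc, hd] at hdet; simp at hdet
      have : (mobiusSL A ∘ (↑) : ℂ → RSphere) = fun x => (((A.1 0 0 * x + A.1 0 1) / (A.1 1 1) : ℂ) : RSphere) := by
        ext1 x; rw [Function.comp_apply, mobiusSL_coe, hc, if_neg] <;> simp [hd]
      rw [this]
      apply tendsto_coe_sphere_infty
      rw [tendsto_norm_atTop_iff_cobounded]
      have h1 : Tendsto (fun x : ℂ => (A.1 0 0 / A.1 1 1) * x + A.1 0 1 / A.1 1 1) (Bornology.cobounded ℂ)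
          (Bornology.cobounded ℂ) :=
        (tendsto_add_const_cobounded _).comp (tendsto_mul_left_cobounded (div_ne_zero ha hd))
      refine h1.congr fun x => ?_
      ring
    · rw [mobiusSL_infty, if_neg hc]
      have h1 : Tendsto (fun x : ℂ => A.1 1 0 * x + A.1 1 1) (Bornology.cobounded ℂ)
          (Bornology.cobounded ℂ) :=
        (tendsto_add_const_cobounded _).comp (tendsto_mul_left_cobounded hc)
      have h2 : Tendsto (fun x : ℂ => A.1 0 0 / A.1 1 0 - 1 / A.1 1 0 * (A.1 1 0 * x + A.1 1 1)⁻¹)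
          (Bornology.cobounded ℂ) (𝓝 (A.1 0 0 / A.1 1 0 - 1 / A.1 1 0 * 0)) :=
        ((tendsto_inv₀_cobounded.comp h1).const_mul _).const_sub _
      rw [mul_zero, sub_zero] at h2
      refine ((OnePoint.continuous_coe.tendsto _).comp h2).congr' ?_
      have : ∀ᶠ x in Bornology.cobounded ℂ, A.1 1 0 * x + A.1 1 1 ≠ 0 :=
        h1.eventually (Bornology.eventually_ne_cobounded 0)
      filter_upwards [this] with x hx
      rw [Function.comp_apply, Function.comp_apply, mobiusSL_coe, if_neg hx]
      congr 1
      field_simp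
      linear_combination hdet

instance : ContinuousConstSMul PSL2C RSphere where
  continuous_const_smul g := by
    obtain ⟨A, rfl⟩ := exists_mk g
    have : (fun z : RSphere => mk A • z) = mobiusSL A := by ext1 z; exact mk_smul A z
    rw [this]; exact continuous_mobiusSL A

lemma omega_open (G : Subgroup PSL2C) : IsOpen (omegaSet G) := by
  rw [isOpen_iff_forall_mem_open]
  rintro z ⟨U, hU, hz, hf⟩
  exact ⟨U, fun w hw => ⟨U, hU, hw, hf⟩, hU, hz⟩

lemma omega_smul {G : Subgroup PSL2C} {g : PSL2C} (hg : g ∈ G) {z : RSphere} (hz : z ∈ omegaSet G) :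
    g • z ∈ omegaSet G := by
  obtain ⟨U, hU, hz, hf⟩ := hz
  refine ⟨(g • ·) '' U, (isOpenMap_smul g) _ hU, ⟨z, hz, rfl⟩, ?_⟩
  refine (hf.image (fun k => g * k * g⁻¹)).subset ?_
  rintro k ⟨hk, _, ⟨_, ⟨u, hu, rfl⟩, rfl⟩, v, hv, hv2⟩
  refine ⟨g⁻¹ * k * g, ⟨G.mul_mem (G.mul_mem (G.inv_mem hg) hk) hg, v, ⟨u, hu, ?_⟩, hv⟩, by group⟩
  change (g⁻¹ * k * g) • u = v
  have : g • v = k • (g • u) := hv2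
  rw [mul_smul, mul_smul, ← this, inv_smul_smul]

lemma omega_free {G : Subgroup PSL2C} (hT : TorsionFree G) {g : PSL2C} (hg : g ∈ G) {z : RSphere}
    (hz : z ∈ omegaSet G) (h : g • z = z) : g = 1 := by
  obtain ⟨U, hU, hz, hf⟩ := hz
  by_contra hne
  have hinj : Function.Injective (fun n : ℕ => g ^ n) := by
    rw [injective_pow_iff_not_isOfFinOrder, isOfFinOrder_iff_pow_eq_one]
    rintro ⟨n, hn, h⟩
    exact hne (hT g hg n hn h)
  refine Set.infinite_of_injective_forall_mem hinj (fun n => ?_) hf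
  refine ⟨G.pow_mem hg n, z, ⟨z, hz, ?_⟩, hz⟩
  change g ^ n • z = z
  induction n with
  | zero => simp
  | succ n ih => rw [pow_succ, mul_smul, h, ih]

/-- class has a lift with trace two -/
def Par (g : PSL2C) : Prop := ∃ A : SL2C, mk A = g ∧ A.1 0 0 + A.1 1 1 = 2

lemma norm_one_recur (u : ℂ) (hu : ‖u‖ = 1) (N : ℕ) :
    ∃ n : ℕ → ℕ, (∀ k, N ≤ n k) ∧ Tendsto (fun k => u ^ n k) atTop (𝓝 1) := by
  obtain ⟨v, hv, φ, hφ, ht⟩ := (isCompact_sphere (0:ℂ) 1).tendsto_subseq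
    (x := fun n => u ^ n) (fun n => by simp [hu])
  have hv1 : v ≠ 0 := by rintro rfl; simp at hv
  have hu0 : u ≠ 0 := by rintro rfl; simp at hu
  have hle : ∀ k, φ k + N ≤ φ (k + N) := by
    intro k
    induction N with
    | zero => simp
    | succ N ih => have := hφ (show k + N < k + (N + 1) by omega); omega
  refine ⟨fun k => φ (k + N) - φ k, fun k => by have := hle k; dsimp only; omega, ?_⟩
  have h1 := (ht.comp (tendsto_add_atTop_nat N)).div ht hv1
  rw [div_self hv1] at h1
  refine h1.congr fun k => ?_
  simp only [Pi.div_apply, Function.comp_apply]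
  rw [pow_sub₀ _ hu0 (by have := hle k; omega), div_eq_mul_inv]

lemma two_fixed {A : SL2C} (h : (A.1 0 0 + A.1 1 1) ^ 2 ≠ 4) :
    ∃ z w : RSphere, z ≠ w ∧ ∀ x, psl (mk A) x = x ↔ x = z ∨ x = w := by
  have hdet := sl_det A
  obtain ⟨s, hs⟩ := IsAlgClosed.exists_pow_nat_eq ((A.1 0 0 + A.1 1 1) ^ 2 - 4) (n := 2) (by norm_num)
  have hs0 : s ≠ 0 := by
    rintro rfl; apply h; linear_combination -hs
  simp only [psl_mk]
  by_cases hc : A.1 1 0 = 0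
  · have had : A.1 0 0 - A.1 1 1 ≠ 0 := by
      intro h1; apply h; rw [hc] at hdet
      linear_combination (A.1 0 0 - A.1 1 1) * h1 + 4 * hdet
    have hd : A.1 1 1 ≠ 0 := by intro hd; rw [hc, hd] at hdet; simp at hdet
    refine ⟨OnePoint.infty, ((A.1 0 1 / (A.1 1 1 - A.1 0 0) : ℂ) : RSphere), by simp, ?_⟩
    intro x
    induction x using OnePoint.rec with
    | infty => simp [mobiusSL_infty, hc]
    | coe w =>
      rw [mobiusSL_coe, hc, if_neg (by simpa using hd)]
      simp only [zero_mul, zero_add, OnePoint.coe_eq_coe, OnePoint.coe_ne_infty, false_or]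
      have h2 : A.1 1 1 - A.1 0 0 ≠ 0 := by
        intro h; apply had; linear_combination -h
      rw [div_eq_iff hd, eq_div_iff h2]
      constructor <;> intro h3 <;> linear_combination -h3
  · refine ⟨(((A.1 0 0 - A.1 1 1 + s) / (2 * A.1 1 0) : ℂ) : RSphere),
      (((A.1 0 0 - A.1 1 1 - s) / (2 * A.1 1 0) : ℂ) : RSphere), ?_, ?_⟩
    · rw [Ne, OnePoint.coe_eq_coe, div_left_inj' (by simpa using hc)]
      intro h1; apply hs0; linear_combination h1 / 2
    · intro x
      induction x using OnePoint.rec with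
      | infty => simp [mobiusSL_infty, hc]
      | coe w =>
        rw [mobiusSL_coe]
        have key : A.1 1 0 * w + A.1 1 1 ≠ 0 →
          ((A.1 0 0 * w + A.1 0 1) / (A.1 1 0 * w + A.1 1 1) = w ↔ w = (A.1 0 0 - A.1 1 1 + s) / (2 * A.1 1 0) ∨
            w = (A.1 0 0 - A.1 1 1 - s) / (2 * A.1 1 0)) := by
          intro h1
          rw [div_eq_iff h1, eq_div_iff (by simpa using hc), eq_div_iff (by simpa using hc),
            ← sub_eq_zero (b := _ + s), ← sub_eq_zero (b := _ - s), ← mul_eq_zero]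
          constructor
          · intro h2; linear_combination (-4 * A.1 1 0) * h2 - hs - 4 * hdet
          · intro h2
            have : (4 * A.1 1 0) * (A.1 0 0 * w + A.1 0 1 - w * (A.1 1 0 * w + A.1 1 1)) = 0 := by
              linear_combination -h2 - hs - 4 * hdet
            simp only [mul_eq_zero, hc, OfNat.ofNat_ne_zero, or_self, false_or] at this
            linear_combination this
        split_ifs with h1
        · simp only [OnePoint.infty_ne_coe, OnePoint.coe_eq_coe, false_iff, not_or]
          have hw : w = -A.1 1 1 / A.1 1 0 := by rw [eq_div_iff hc]; linear_combination h1
          have : ∀ e : ℂ, e ^ 2 = 1 → w ≠ (A.1 0 0 - A.1 1 1 + e * s) / (2 * A.1 1 0) := by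
            intro e he h2
            rw [hw, div_eq_div_iff hc (by simpa using hc)] at h2
            have h3 : A.1 1 0 * (A.1 0 0 + A.1 1 1 + e * s) = 0 := by linear_combination -h2
            simp only [mul_eq_zero, hc, false_or] at h3
            have : (4 : ℂ) = 0 := by linear_combination hs + (A.1 0 0 + A.1 1 1 - e * s) * h3 + s ^ 2 * he
            norm_num at this
          exact ⟨by simpa using this 1 (by simp), by simpa [sub_eq_add_neg] using this (-1) (by simp)⟩
        · simp only [OnePoint.coe_eq_coe]; exact key h1

lemma par_of_not_lox {G : Subgroup PSL2C} (hT : TorsionFree G) (hne : (omegaSet G).Nonempty)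
    {g : PSL2C} (hg : g ∈ G) (hl : ¬ IsLoxodromic g) : Par g := by
  by_cases h1 : g = 1
  · exact ⟨1, by rw [h1, mk_one], by simp; norm_num⟩
  obtain ⟨A, rfl⟩ := exists_mk g
  by_cases h : (A.1 0 0 + A.1 1 1) ^ 2 = 4
  · have : (A.1 0 0 + A.1 1 1 - 2) * (A.1 0 0 + A.1 1 1 + 2) = 0 := by linear_combination h
    rcases mul_eq_zero.1 this with h | h
    · exact ⟨A, rfl, by linear_combination h⟩
    · refine ⟨-A, mk_neg A, ?_⟩
      simp only [Matrix.SpecialLinearGroup.coe_neg, Matrix.neg_apply]; linear_combination -h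
  exfalso
  unfold IsLoxodromic at hl
  push Not at hl
  obtain ⟨k, u, hu, hk⟩ := hl (two_fixed h)
  set g := mk A with hgdef
  obtain ⟨z, U, hU, hz, hf⟩ := hne
  have hinj : Function.Injective (fun n : ℕ => g ^ n) := by
    rw [injective_pow_iff_not_isOfFinOrder, isOfFinOrder_iff_pow_eq_one]
    rintro ⟨n, hn, h⟩
    exact h1 (hT g hg n hn h)
  have hu0 : u ≠ 0 := by rintro rfl; simp at hu
  have hfin := hf.preimage (f := fun n : ℕ => g ^ n) hinj.injOn
  obtain ⟨N, hN⟩ := hfin.bddAbove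
  obtain ⟨n, hn, ht⟩ := norm_one_recur u hu (N + 1)
  have hpow : ∀ (m : ℕ) (w : ℂ), (k * g * k⁻¹) ^ m • (w : RSphere) = ((u ^ m * w : ℂ) : RSphere) := by
    intro m
    induction m with
    | zero => intro w; simp
    | succ m ih =>
      intro w
      rw [pow_succ, mul_smul]
      rw [show (k * g * k⁻¹) • (w : RSphere) = ((u * w : ℂ) : RSphere) from hk w, ih]
      congr 1; ring
  have hpowi : ∀ (m : ℕ), (k * g * k⁻¹) ^ m • (OnePoint.infty : RSphere) = OnePoint.infty := by
    intro m
    induction m with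
    | zero => simp
    | succ m ih =>
      rw [pow_succ, mul_smul]
      have : (k * g * k⁻¹) • (OnePoint.infty : RSphere) = OnePoint.infty := by
        by_contra hne
        obtain ⟨v, hv⟩ := OnePoint.ne_infty_iff_exists.1 hne
        have h2 : (k * g * k⁻¹) • (((u⁻¹ * v : ℂ) : ℂ) : RSphere) = ((v : ℂ) : RSphere) := by
          rw [show (k * g * k⁻¹) • (((u⁻¹ * v : ℂ) : ℂ) : RSphere) = ((u * (u⁻¹ * v) : ℂ) : RSphere) from hk _]
          rw [mul_inv_cancel_left₀ hu0]
        rw [hv] at h2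
        exact OnePoint.coe_ne_infty _ (smul_left_cancel _ h2)
      rw [this, ih]
  have hconv : Tendsto (fun j => (k * g * k⁻¹) ^ (n j) • (k • z)) atTop (𝓝 (k • z)) := by
    generalize k • z = w
    induction w using OnePoint.rec with
    | infty => simp only [hpowi]; exact tendsto_const_nhds
    | coe w =>
      simp only [hpow]
      have : Tendsto (fun j => u ^ n j * w) atTop (𝓝 (1 * w)) := ht.mul_const w
      rw [one_mul] at this
      exact (OnePoint.continuous_coe.tendsto w).comp this
  have h2 := ((continuous_const_smul k⁻¹).tendsto (k • z)).comp hconv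
  rw [inv_smul_smul] at h2
  have h3 := h2.eventually (hU.mem_nhds hz)
  obtain ⟨j, hj⟩ := h3.exists
  simp only [Function.comp_apply, conj_pow, mul_smul, inv_smul_smul] at hj
  have := hN (show n j ∈ _ from ⟨G.pow_mem hg _, _, ⟨z, hz, rfl⟩, hj⟩)
  have := hn j
  omega
end

noncomputable section
open Set Filter Topology

lemma exists_clog {f : ℂ → ℂ} (hf : Continuous f) (h0 : ∀ z, f z ≠ 0) :
    ∃ L : ℂ → ℂ, Continuous L ∧ ∀ z, Complex.exp (L z) = f z := by
  obtain ⟨F, ⟨-, hF⟩, -⟩ := Complex.isCoveringMap_exp.existsUnique_continuousMap_lifts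
    (A := ℂ) ⟨fun z => (⟨f z, h0 z⟩ : {z : ℂ // z ≠ 0}), by fun_prop⟩ 0 (Complex.log (f 0))
    (by ext; simp [Complex.exp_log (h0 0)])
  refine ⟨F, F.continuous, fun z => ?_⟩
  have := congrFun hF z
  simpa using congrArg Subtype.val this

lemma exp_one_const {α : Type*} [TopologicalSpace α] {s : Set α} (hs : IsPreconnected s) {f : α → ℂ}
    (hf : ContinuousOn f s) (h1 : ∀ x ∈ s, Complex.exp (f x) = 1) {x y : α} (hx : x ∈ s) (hy : y ∈ s) :
    f x = f y := by
  have hd : DiscreteTopology (range ((↑) : ℤ → ℝ)) :=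
    (Int.isClosedEmbedding_coe_real.isEmbedding.toHomeomorph).symm.isEmbedding.discreteTopology
  have key : ∀ x ∈ s, ∃ n : ℤ, f x = n * (2 * Real.pi * Complex.I) := fun x hx =>
    Complex.exp_eq_one_iff.1 (h1 x hx)
  have hc : ContinuousOn (fun x => (f x).im / (2 * Real.pi)) s :=
    (Complex.continuous_im.comp_continuousOn hf).div_const _
  have := hs.constant_of_mapsTo (T := range ((↑) : ℤ → ℝ)) ⟨hd⟩ hc (fun x hx => by
    obtain ⟨n, hn⟩ := key x hx
    refine ⟨n, ?_⟩
    simp [hn]) hx hy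
  obtain ⟨n, hn⟩ := key x hx
  obtain ⟨m, hm⟩ := key y hy
  simp [hn, hm] at this
  rw [hn, hm]
  have h2 : (n : ℝ) = m := by
    have h4 : (2 * Real.pi) ≠ 0 := by positivity
    simpa using this
  have h3 : n = m := by exact_mod_cast h2
  rw [h3]

/-- gluing lemma -/
lemma star_lemma {O1 O2 D : Set ℂ} (h1 : IsOpen O1) (h2 : IsOpen O2) (hcov : O1 ∪ O2 = univ)
    (hD : IsOpen D) (hD' : IsOpen ((O1 ∩ O2) \ D)) (hsub : D ⊆ O1 ∩ O2)
    (hC1 : IsPreconnected O1) (hC2 : IsPreconnected O2) {p q : ℂ} (hp : p ∈ O1 ∩ O2)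
    (hq : q ∈ O1 ∩ O2) (hpD : p ∈ D) : q ∈ D := by
  classical
  by_contra hqD
  obtain ⟨χ, hχ0, hχ1, -⟩ := exists_continuous_zero_one_of_isClosed h2.isClosed_compl h1.isClosed_compl
    (by rw [Set.disjoint_left]; intro x hx hx'
        have : x ∈ O1 ∪ O2 := by rw [hcov]; trivial
        rcases this with h | h
        · exact hx' h
        · exact hx h)
  -- general continuity principle
  have cont : ∀ (F : ℝ → ℂ) (c : ℂ), Continuous F → ∀ z : ℂ, (z ∉ O2 → F 0 = c) → (z ∉ O1 → F 1 = c) →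
      ContinuousAt (fun z => if z ∈ D then F (χ z) else c) z := by
    intro F c hF z hz2 hz1
    have hFχ : Continuous (fun z => F (χ z)) := hF.comp χ.continuous
    by_cases hz : z ∈ O1 ∩ O2
    · by_cases hzD : z ∈ D
      · refine hFχ.continuousAt.congr ?_
        filter_upwards [hD.mem_nhds hzD] with w hw
        rw [if_pos hw]
      · refine (continuousAt_const (y := c)).congr ?_
        filter_upwards [hD'.mem_nhds ⟨hz, hzD⟩] with w hw
        rw [if_neg hw.2]
    · have hval : F (χ z) = c := by
        by_cases h : z ∈ O2
        · have : z ∉ O1 := fun h' => hz ⟨h', h⟩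
          rw [hχ1 this]; exact hz1 this
        · rw [hχ0 h]; exact hz2 h
      have hzD : z ∉ D := fun h => hz (hsub h)
      rw [ContinuousAt, if_neg hzD]
      refine Tendsto.if' ?_ tendsto_const_nhds
      have := hFχ.tendsto z
      rwa [hval] at this
  have hE : Continuous (fun z => if z ∈ D then Complex.exp (2 * Real.pi * Complex.I * (χ z : ℝ)) else 1) := by
    rw [continuous_iff_continuousAt]
    intro z
    refine cont (fun t => Complex.exp (2 * Real.pi * Complex.I * t)) 1 (by fun_prop) z (by simp) ?_
    intro; simp [Complex.exp_two_pi_mul_I]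
  obtain ⟨L, hL, hLE⟩ := exists_clog hE (fun z => by split_ifs <;> simp [Complex.exp_ne_zero])
  have e1 := exp_one_const hC1 (f := fun z => L z - if z ∈ D then (2 * Real.pi * Complex.I * (χ z : ℝ)) else 0)
    (by
      refine ContinuousOn.sub hL.continuousOn (fun z hz => ContinuousAt.continuousWithinAt ?_)
      exact cont (fun t => 2 * Real.pi * Complex.I * t) 0 (by fun_prop) z (by simp) (fun h => absurd hz h))
    (by
      intro z hz
      simp only [Complex.exp_sub, hLE]
      split_ifs <;> simp [Complex.exp_ne_zero]) hp.1 hq.1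
  have e2 := exp_one_const hC2 (f := fun z => L z - if z ∈ D then (2 * Real.pi * Complex.I * ((χ z : ℝ) - 1)) else 0)
    (by
      refine ContinuousOn.sub hL.continuousOn (fun z hz => ContinuousAt.continuousWithinAt ?_)
      exact cont (fun t => 2 * Real.pi * Complex.I * (t - 1)) 0 (by fun_prop) z (fun h => absurd hz h) (by simp))
    (by
      intro z hz
      simp only [Complex.exp_sub, hLE]
      split_ifs
      · rw [mul_sub, Complex.exp_sub]; simp [Complex.exp_ne_zero, Complex.exp_two_pi_mul_I]
      · simp) hp.2 hq.2
  simp only [if_pos hpD, if_neg hqD] at e1 e2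
  have : (2 * Real.pi * Complex.I : ℂ) = 0 := by linear_combination e2 - e1
  simp [Real.pi_ne_zero] at this

/-- a retract of the plane which is compact does not separate -/
lemma compl_retract_preconnected {A : Set ℂ} (hA : IsCompact A) {ρ : ℂ → ℂ} (hρ : Continuous ρ)
    (hρA : ∀ z, ρ z ∈ A) (hid : ∀ z ∈ A, ρ z = z) : IsPreconnected Aᶜ := by
  classical
  obtain ⟨R, hR⟩ := hA.isBounded.subset_ball (0 : ℂ)
  have hR0 : 0 ≤ R := by
    by_contra hneg
    have : ρ 0 ∈ Metric.ball (0:ℂ) R := hR (hρA 0)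
    rw [Metric.ball_eq_empty.2 (not_le.1 hneg).le] at this
    exact this
  have hout : IsPreconnected (Metric.closedBall (0 : ℂ) R)ᶜ := by
    have h1 : (Metric.closedBall (0 : ℂ) R)ᶜ =
        (fun p : ℝ × ℝ => (p.1 * Complex.exp (p.2 * Complex.I) : ℂ)) '' (Ioi R ×ˢ univ) := by
      ext z
      simp only [mem_compl_iff, Metric.mem_closedBall, dist_zero_right, not_le, mem_image, mem_prod,
        mem_Ioi, mem_univ, and_true, Prod.exists]
      constructor
      · intro h; exact ⟨‖z‖, z.arg, h, Complex.norm_mul_exp_arg_mul_I z⟩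
      · rintro ⟨a, b, h, rfl⟩
        rw [norm_mul, Complex.norm_exp_ofReal_mul_I, mul_one, Complex.norm_real]
        exact h.trans_le (le_abs_self a)
    rw [h1]
    exact (isPreconnected_Ioi.prod isPreconnected_univ).image _ (by fun_prop)
  have houtA : (Metric.closedBall (0 : ℂ) R)ᶜ ⊆ Aᶜ :=
    compl_subset_compl.2 (hR.trans Metric.ball_subset_closedBall)
  -- core claim
  have core : ∀ u v : Set ℂ, IsOpen u → IsOpen v → Aᶜ ⊆ u ∪ v → Aᶜ ∩ (u ∩ v) = ∅ →
      (Metric.closedBall (0 : ℂ) R)ᶜ ⊆ v → ¬ (Aᶜ ∩ u).Nonempty := by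
    rintro u v hu hv huv hdis hbig ⟨z0, hz0A, hz0⟩
    have hAc : IsClosed A := hA.isClosed
    have hC1 : IsClosed (Aᶜ ∩ v)ᶜ := (hAc.isOpen_compl.inter hv).isClosed_compl
    have hC2 : IsClosed (Aᶜ ∩ u)ᶜ := (hAc.isOpen_compl.inter hu).isClosed_compl
    let r : ℂ → ℂ := fun z => if z ∈ (Aᶜ ∩ v)ᶜ then ρ z else z
    have hr : Continuous r := by
      refine continuous_if ?_ hρ.continuousOn continuous_id.continuousOn
      intro a ha
      apply hid
      by_contra haA
      rcases huv haA with h | h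
      · have : (Aᶜ ∩ u) ∈ 𝓝 a := (hAc.isOpen_compl.inter hu).mem_nhds ⟨haA, h⟩
        have h2 := ha
        rw [frontier_eq_closure_inter_closure] at h2
        obtain ⟨w, hw1, hw2⟩ := mem_closure_iff_nhds.1 h2.2 _ this
        simp only [mem_compl_iff, mem_ofPred_eq, not_not] at hw2
        have : w ∈ Aᶜ ∩ (u ∩ v) := ⟨hw1.1, hw1.2, hw2.2⟩
        rw [hdis] at this; exact this
      · have : (Aᶜ ∩ v) ∈ 𝓝 a := (hAc.isOpen_compl.inter hv).mem_nhds ⟨haA, h⟩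
        have h2 := ha
        rw [frontier_eq_closure_inter_closure] at h2
        obtain ⟨w, hw1, hw2⟩ := mem_closure_iff_nhds.1 h2.1 _ this
        exact hw2 hw1
    have hrne : ∀ z, r z - z0 ≠ 0 := by
      intro z h
      rw [sub_eq_zero] at h
      by_cases hz : z ∈ (Aᶜ ∩ v)ᶜ
      · rw [show r z = ρ z from if_pos hz] at h
        exact hz0A (h ▸ hρA z)
      · rw [show r z = z from if_neg hz] at h
        rw [mem_compl_iff, not_not] at hz
        have : z0 ∈ Aᶜ ∩ (u ∩ v) := ⟨hz0A, hz0, h ▸ hz.2⟩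
        rw [hdis] at this; exact this
    obtain ⟨L, hL, hLr⟩ := exists_clog (f := fun z => r z - z0) (by fun_prop) hrne
    set M : ℝ := R + ‖z0‖ + 1 with hM
    have hMpos : 0 < M := by positivity
    have hval : ∀ t : ℝ, r (z0 + M * Complex.exp (t * Complex.I)) = z0 + M * Complex.exp (t * Complex.I) := by
      intro t
      apply if_neg
      rw [mem_compl_iff, not_not]
      have : z0 + M * Complex.exp (t * Complex.I) ∈ (Metric.closedBall (0 : ℂ) R)ᶜ := by
        simp only [mem_compl_iff, Metric.mem_closedBall, dist_zero_right, not_le]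
        have h1 : ‖(M * Complex.exp (t * Complex.I) : ℂ)‖ = M := by
          rw [norm_mul, Complex.norm_exp_ofReal_mul_I, mul_one, Complex.norm_real, Real.norm_of_nonneg hMpos.le]
        have h2 := norm_sub_norm_le (M * Complex.exp (t * Complex.I) : ℂ) (-z0)
        rw [h1, norm_neg, sub_neg_eq_add, add_comm _ z0] at h2
        linarith
      exact ⟨houtA this, hbig this⟩
    have hM0 : (M : ℂ) ≠ 0 := by exact_mod_cast hMpos.ne'
    have := exp_one_const (s := (univ : Set ℝ)) isPreconnected_univ
      (f := fun t => L (z0 + M * Complex.exp (t * Complex.I)) - t * Complex.I - Complex.log M)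
      (by fun_prop) (by
        intro t _
        rw [Complex.exp_sub, Complex.exp_sub, hLr, hval, Complex.exp_log hM0, add_sub_cancel_left]
        field_simp [Complex.exp_ne_zero]) (mem_univ 0) (mem_univ (2 * Real.pi))
    simp only [Complex.ofReal_zero, zero_mul, Complex.exp_zero, Complex.ofReal_mul, Complex.ofReal_ofNat,
      Complex.exp_two_pi_mul_I] at this
    have h3 : (2 * Real.pi * Complex.I : ℂ) = 0 := by linear_combination this
    simp [Real.pi_ne_zero] at h3
  rw [isPreconnected_iff_subset_of_disjoint]
  intro u v hu hv huv hdis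
  have := isPreconnected_iff_subset_of_disjoint.1 hout u v hu hv (houtA.trans huv)
    (by apply Set.eq_empty_of_subset_empty; rw [← hdis]; exact Set.inter_subset_inter_left _ houtA)
  rcases this with h | h
  · left
    have h2 := core v u hv hu (by rwa [union_comm]) (by rwa [inter_comm v]) h
    intro z hz
    exact (huv hz).resolve_right fun h3 => h2 ⟨z, hz, h3⟩
  · right
    have h2 := core u v hu hv huv hdis h
    intro z hz
    exact (huv hz).resolve_left fun h3 => h2 ⟨z, hz, h3⟩

lemma compl_arc_preconnected {γ : ℝ → ℂ} (hγ : ContinuousOn γ (Icc 0 1)) (hinj : InjOn γ (Icc 0 1)) :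
    IsPreconnected (γ '' Icc 0 1)ᶜ := by
  have hc : Continuous ((Icc (0:ℝ) 1).domRestrict γ) := hγ.domRestrict
  have hemb : IsClosedEmbedding ((Icc (0:ℝ) 1).domRestrict γ) :=
    hc.isClosedEmbedding (injOn_iff_injective.1 hinj)
  obtain ⟨g, hg⟩ := ContinuousMap.exists_extension hemb
    (Y := unitInterval) (ContinuousMap.id (Icc (0:ℝ) 1))
  refine compl_retract_preconnected (isCompact_Icc.image_of_continuousOn hγ) (ρ := fun z => γ (g z))
    (hc.comp g.continuous) (fun z => ⟨g z, (g z).2, rfl⟩) ?_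
  rintro _ ⟨t, ht, rfl⟩
  have := DFunLike.congr_fun hg (⟨t, ht⟩ : Icc (0:ℝ) 1)
  exact congrArg (fun s : Icc (0:ℝ) 1 => γ s) this

lemma diff_arc_preconnected {N : Set ℂ} (hN : IsOpen N) (hNc : IsPreconnected N) {γ : ℝ → ℂ}
    (hγ : ContinuousOn γ (Icc 0 1)) (hinj : InjOn γ (Icc 0 1)) (hsub : γ '' Icc 0 1 ⊆ N) :
    IsPreconnected (N \ γ '' Icc 0 1) := by
  set A := γ '' Icc 0 1
  have hA : IsClosed A := (isCompact_Icc.image_of_continuousOn hγ).isClosed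
  rw [isPreconnected_iff_subset_of_disjoint]
  intro u v hu hv huv hdis
  by_contra hcon
  push Not at hcon
  obtain ⟨h1, h2⟩ := hcon
  obtain ⟨q, hq, hqu⟩ := not_subset.1 h1
  obtain ⟨p, hp, hpv⟩ := not_subset.1 h2
  have hpu : p ∈ u := (huv hp).resolve_right hpv
  have hqv : q ∈ v := (huv hq).resolve_left hqu
  have hNA : IsOpen (N \ A) := hN.sdiff hA
  refine hqu (star_lemma (O1 := N) (O2 := Aᶜ) (D := (N \ A) ∩ u) hN hA.isOpen_compl ?_
    (hNA.inter hu) ?_ inter_subset_left hNc (compl_arc_preconnected hγ hinj) hp hq ⟨hp, hpu⟩).2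
  · ext x; simp only [mem_union, mem_compl_iff, mem_univ, iff_true]
    by_cases h : x ∈ A
    · left; exact hsub h
    · right; exact h
  · have : (N ∩ Aᶜ) \ ((N \ A) ∩ u) = (N \ A) ∩ v := by
      ext x
      constructor
      · rintro ⟨hx, hx2⟩
        exact ⟨hx, (huv hx).resolve_left fun h => hx2 ⟨hx, h⟩⟩
      · rintro ⟨hx, hxv⟩
        refine ⟨hx, fun h => ?_⟩
        have : x ∈ N \ A ∩ (u ∩ v) := ⟨hx, h.2, hxv⟩
        rw [hdis] at this; exact this
    rw [this]; exact hNA.inter hv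

lemma ball_diff_countable {C : Set ℂ} (hC : C.Countable) (a : ℂ) {r : ℝ} (hr : 0 < r) :
    IsPreconnected (Metric.ball a r \ C) := by
  let e := OpenPartialHomeomorph.univBall a r
  have h1 : e '' (e.symm '' (C ∩ Metric.ball a r))ᶜ = Metric.ball a r \ C := by
    have hs : e.source = univ := OpenPartialHomeomorph.univBall_source a r
    have ht : e.target = Metric.ball a r := OpenPartialHomeomorph.univBall_target a hr
    ext z
    constructor
    · rintro ⟨w, hw, rfl⟩
      have hm : e w ∈ Metric.ball a r := by rw [← ht]; exact e.map_source (by rw [hs]; trivial)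
      refine ⟨hm, fun hc => hw ⟨e w, ⟨hc, hm⟩, e.left_inv (by rw [hs]; trivial)⟩⟩
    · rintro ⟨hz, hzC⟩
      refine ⟨e.symm z, ?_, e.right_inv (by rw [ht]; exact hz)⟩
      rintro ⟨w, ⟨hw, hwb⟩, h⟩
      have := e.symm.injOn (by simpa [ht] using hwb) (by simpa [ht] using hz) h
      exact hzC (this ▸ hw)
  rw [← h1]
  refine IsPreconnected.image ?_ _ (OpenPartialHomeomorph.continuous_univBall a r).continuousOn
  exact (Set.Countable.isConnected_compl_of_one_lt_rank (by simp)
    ((hC.mono inter_subset_left).image _)).isPreconnected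

lemma diff_countable_preconnected {N C : Set ℂ} (hN : IsOpen N) (hNc : IsPreconnected N)
    (hC : C.Countable) : IsPreconnected (N \ C) := by
  rw [isPreconnected_iff_subset_of_disjoint]
  intro u v hu hv huv hdis
  have hdense : Dense Cᶜ := hC.dense_compl ℝ
  have key : ∀ z ∈ N, ∃ r > 0, Metric.ball z r ⊆ N ∧ (Metric.ball z r \ C ⊆ u ∨ Metric.ball z r \ C ⊆ v) := by
    intro z hz
    obtain ⟨r, hr, hrN⟩ := Metric.isOpen_iff.1 hN z hz
    refine ⟨r, hr, hrN, ?_⟩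
    refine isPreconnected_iff_subset_of_disjoint.1 (ball_diff_countable hC z hr) u v hu hv ?_ ?_
    · exact (sdiff_subset_sdiff_left hrN).trans huv
    · apply eq_empty_of_subset_empty; rw [← hdis]
      exact inter_subset_inter_left _ (sdiff_subset_sdiff_left hrN)
  let U' := ⋃₀ {B : Set ℂ | IsOpen B ∧ B ⊆ N ∧ B \ C ⊆ u}
  let V' := ⋃₀ {B : Set ℂ | IsOpen B ∧ B ⊆ N ∧ B \ C ⊆ v}
  have hU' : IsOpen U' := isOpen_sUnion fun B hB => hB.1
  have hV' : IsOpen V' := isOpen_sUnion fun B hB => hB.1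
  have := isPreconnected_iff_subset_of_disjoint.1 hNc U' V' hU' hV' (by
      intro z hz
      obtain ⟨r, hr, hrN, h | h⟩ := key z hz
      · left; exact ⟨_, ⟨Metric.isOpen_ball, hrN, h⟩, Metric.mem_ball_self hr⟩
      · right; exact ⟨_, ⟨Metric.isOpen_ball, hrN, h⟩, Metric.mem_ball_self hr⟩) (by
      apply eq_empty_of_subset_empty
      rintro z ⟨hz, ⟨B, ⟨hB, hBN, hBu⟩, hzB⟩, ⟨B', ⟨hB', hBN', hBv⟩, hzB'⟩⟩
      obtain ⟨w, hw, hwC⟩ := hdense.exists_mem_open (hB.inter hB') ⟨z, hzB, hzB'⟩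
      have : w ∈ N \ C ∩ (u ∩ v) := ⟨⟨hBN hwC.1, hw⟩, hBu ⟨hwC.1, hw⟩, hBv ⟨hwC.2, hw⟩⟩
      rw [hdis] at this; exact this)
  rcases this with h | h
  · left
    rintro z ⟨hz, hzC⟩
    obtain ⟨B, ⟨_, _, hB⟩, hzB⟩ := h hz
    exact hB ⟨hzB, hzC⟩
  · right
    rintro z ⟨hz, hzC⟩
    obtain ⟨B, ⟨_, _, hB⟩, hzB⟩ := h hz
    exact hB ⟨hzB, hzC⟩
end

noncomputable section
set_option linter.unusedSectionVars false
open Set Filter Topology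

section surf
variable {X : Type*} [TopologicalSpace X] {H : Type*} [Group H] [MulAction H X]

/-- planar surface with a free properly discontinuous action -/
structure Surf (H X : Type*) [TopologicalSpace X] [Group H] [MulAction H X] : Prop where
  conn : IsConnected (univ : Set X)
  emb : ∃ e : X → ℂ, IsOpenEmbedding e
  cont : ∀ h : H, Continuous (fun x : X => h • x)
  pd : ∀ x y : X, ∃ U ∈ 𝓝 x, ∃ V ∈ 𝓝 y, ∀ g : H, ∀ u ∈ U, g • u ∈ V → g • x = y
  free : ∀ (g : H) (x : X), g • x = x → g = 1

/-- projection to the orbit space -/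
def pr (H : Type*) {X : Type*} [Group H] [MulAction H X] (x : X) : MulAction.orbitRel.Quotient H X :=
  Quotient.mk'' x

lemma pr_eq {x y : X} : pr H x = pr H y ↔ ∃ g : H, g • y = x := by
  unfold pr; rw [Quotient.eq'', MulAction.orbitRel_apply, MulAction.mem_orbit_iff]

lemma pr_smul (g : H) (x : X) : pr H (g • x) = pr H x := pr_eq.2 ⟨g, rfl⟩

lemma pr_surj (s : MulAction.orbitRel.Quotient H X) : ∃ x : X, pr H x = s := Quotient.exists_rep s

lemma pr_cont : Continuous (pr H : X → _) := continuous_quotient_mk'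

lemma Surf.homeo (hS : Surf H X) : ContinuousConstSMul H X := ⟨hS.cont⟩

lemma pr_open (hS : Surf H X) : IsOpenMap (pr H : X → _) := by
  have := hS.homeo
  exact isOpenMap_quotient_mk'_mul

/-- an arc: the set `Γ` is the image of a path from `a` to `b`, injective in the quotient
(possibly degenerate) -/
def J (H : Type*) {X : Type*} [TopologicalSpace X] [Group H] [MulAction H X] (Γ : Set X) (a b : X) : Prop :=
  ∃ (γ : ℝ → X) (s t : ℝ), s ≤ t ∧ ContinuousOn γ (Icc s t) ∧
    InjOn (fun r => pr H (γ r)) (Icc s t) ∧ γ s = a ∧ γ t = b ∧ Γ = γ '' Icc s t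

namespace J
variable {Γ Γ' : Set X} {a b c : X}

lemma refl (a : X) : J H {a} a a := ⟨fun _ => a, 0, 0, le_rfl, continuousOn_const, by simp, rfl, rfl, by simp⟩

lemma left (h : J H Γ a b) : a ∈ Γ := by
  obtain ⟨γ, s, t, hst, -, -, rfl, -, rfl⟩ := h; exact ⟨s, ⟨le_rfl, hst⟩, rfl⟩

lemma right (h : J H Γ a b) : b ∈ Γ := by
  obtain ⟨γ, s, t, hst, -, -, -, rfl, rfl⟩ := h; exact ⟨t, ⟨hst, le_rfl⟩, rfl⟩

lemma symm (h : J H Γ a b) : J H Γ b a := by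
  obtain ⟨γ, s, t, hst, hc, hi, ha, hb, rfl⟩ := h
  refine ⟨fun r => γ (-r), -t, -s, by linarith, ?_, ?_, by simpa, by simpa, ?_⟩
  · refine hc.comp continuous_neg.continuousOn fun r hr => ?_
    simp only [mem_Icc] at hr ⊢; constructor <;> linarith
  · intro x hx y hy hxy
    simp only [mem_Icc] at hx hy
    have := hi (x₁ := -x) (x₂ := -y) ⟨by linarith, by linarith⟩ ⟨by linarith, by linarith⟩ hxy
    linarith
  · ext z; constructor
    · rintro ⟨r, hr, rfl⟩; exact ⟨-r, by simp only [mem_Icc] at hr ⊢; constructor <;> linarith, by simp⟩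
    · rintro ⟨r, hr, rfl⟩; exact ⟨-r, by simp only [mem_Icc] at hr ⊢; constructor <;> linarith, by simp⟩

lemma smul (hS : Surf H X) (g : H) (h : J H Γ a b) : J H ((g • ·) '' Γ) (g • a) (g • b) := by
  obtain ⟨γ, s, t, hst, hc, hi, ha, hb, rfl⟩ := h
  refine ⟨fun r => g • γ r, s, t, hst, (hS.cont g).comp_continuousOn hc, ?_, by simp [ha], by simp [hb], ?_⟩
  · simpa only [pr_smul] using hi
  · rw [image_image]

lemma injOn (h : J H Γ a b) : InjOn (pr H) Γ := by
  obtain ⟨γ, s, t, hst, hc, hi, ha, hb, rfl⟩ := h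
  rintro _ ⟨r, hr, rfl⟩ _ ⟨r', hr', rfl⟩ hh
  rw [hi hr hr' hh]

lemma compact (h : J H Γ a b) : IsCompact Γ := by
  obtain ⟨γ, s, t, hst, hc, hi, ha, hb, rfl⟩ := h
  exact isCompact_Icc.image_of_continuousOn hc

lemma preconn (h : J H Γ a b) : IsPreconnected Γ := by
  obtain ⟨γ, s, t, hst, hc, hi, ha, hb, rfl⟩ := h
  exact isPreconnected_Icc.image _ hc

lemma eq_of (h : J H Γ a a) : Γ = {a} := by
  obtain ⟨γ, s, t, hst, hc, hi, ha, hb, rfl⟩ := h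
  have : s = t := hi ⟨le_rfl, hst⟩ ⟨hst, le_rfl⟩ (by simp [ha, hb])
  subst this; simp [ha]

lemma reparam (h : J H Γ a b) (hne : a ≠ b) : ∃ γ : ℝ → X, ContinuousOn γ (Icc 0 1) ∧
    InjOn (fun r => pr H (γ r)) (Icc 0 1) ∧ γ 0 = a ∧ γ 1 = b ∧ Γ = γ '' Icc 0 1 := by
  obtain ⟨γ, s, t, hst, hc, hi, ha, hb, rfl⟩ := h
  have hlt : s < t := by
    rcases hst.lt_or_eq with h | h
    · exact h
    · subst h; exact absurd (ha.symm.trans hb) hne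
  have hmap : MapsTo (fun r => s + (t - s) * r) (Icc 0 1) (Icc s t) := by
    intro r hr; simp only [mem_Icc] at hr ⊢; constructor <;> nlinarith
  refine ⟨fun r => γ (s + (t - s) * r), hc.comp (by fun_prop) hmap, ?_, by simp [ha], by simp [hb], ?_⟩
  · intro x hx y hy hxy
    have := hi (hmap hx) (hmap hy) hxy
    have h2 : (t - s) * (x - y) = 0 := by linarith
    rcases mul_eq_zero.1 h2 with h | h <;> linarith
  · ext z; constructor
    · rintro ⟨r, hr, rfl⟩
      simp only [mem_Icc] at hr
      refine ⟨(r - s) / (t - s), ⟨div_nonneg (by linarith) (by linarith), (div_le_one (by linarith)).2 (by linarith)⟩, ?_⟩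
      dsimp only; congr 1; field_simp [sub_ne_zero.2 hlt.ne']; ring
    · rintro ⟨r, hr, rfl⟩; exact ⟨_, hmap hr, rfl⟩

lemma concat (h : J H Γ a b) (h' : J H Γ' b c)
    (hd : ∀ x ∈ Γ, ∀ y ∈ Γ', pr H x = pr H y → pr H x = pr H b) : J H (Γ ∪ Γ') a c := by
  classical
  obtain ⟨γ, s, t, hst, hc, hi, ha, hb, rfl⟩ := h
  obtain ⟨δ, s', t', hst', hc', hi', ha', hb', rfl⟩ := h'
  set f : ℝ → X := fun r => if r ≤ t then γ r else δ (r - t + s') with hf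
  have f1 : ∀ r ≤ t, f r = γ r := fun r hr => if_pos hr
  have f2 : ∀ r, t ≤ r → f r = δ (r - t + s') := by
    intro r hr
    rcases hr.eq_or_lt with h | h
    · subst h; rw [f1 t le_rfl, hb]; simp [ha']
    · exact if_neg (not_le.2 h)
  have m2 : MapsTo (fun r => r - t + s') (Icc t (t + (t' - s'))) (Icc s' t') := by
    intro r hr; simp only [mem_Icc] at hr ⊢; constructor <;> linarith
  refine ⟨f, s, t + (t' - s'), by linarith, ?_, ?_, by rw [f1 s hst, ha], ?_, ?_⟩
  · rw [← Icc_union_Icc_eq_Icc hst (show t ≤ t + (t' - s') by linarith)]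
    apply ContinuousOn.union_of_isClosed _ _ isClosed_Icc isClosed_Icc
    · exact hc.congr fun r hr => f1 r hr.2
    · exact (hc'.comp (by fun_prop) m2).congr fun r hr => f2 r hr.1
  · have key : ∀ x y, s ≤ x → x ≤ t → t ≤ y → y ≤ t + (t' - s') → pr H (f x) = pr H (f y) → x = y := by
      intro x y h1 h2 h3 h4 hxy
      rw [f1 x h2, f2 y h3] at hxy
      have h5 := hd (γ x) ⟨x, ⟨h1, h2⟩, rfl⟩ (δ (y - t + s')) ⟨_, m2 ⟨h3, h4⟩, rfl⟩ hxy
      have h6 : x = t := hi ⟨h1, h2⟩ ⟨hst, le_rfl⟩ (by simp only [h5, hb])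
      have h7 : y - t + s' = s' := hi' (m2 ⟨h3, h4⟩) ⟨le_rfl, hst'⟩ (by simp only [← hxy, h5, ha'])
      linarith
    intro x hx y hy hxy
    simp only [mem_Icc] at hx hy
    dsimp only at hxy
    rcases le_total x t with h1 | h1 <;> rcases le_total y t with h2 | h2
    · rw [f1 x h1, f1 y h2] at hxy; exact hi ⟨hx.1, h1⟩ ⟨hy.1, h2⟩ hxy
    · exact key x y hx.1 h1 h2 hy.2 hxy
    · exact (key y x hy.1 h2 h1 hx.2 hxy.symm).symm
    · rw [f2 x h1, f2 y h2] at hxy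
      have := hi' (m2 ⟨h1, hx.2⟩) (m2 ⟨h2, hy.2⟩) hxy
      linarith
  · rw [f2 _ (by linarith)]; simp [← hb']
  · rw [← Icc_union_Icc_eq_Icc hst (show t ≤ t + (t' - s') by linarith), image_union]
    congr 1
    · exact image_congr fun r hr => (f1 r hr.2).symm
    · ext z; constructor
      · rintro ⟨r, hr, rfl⟩
        simp only [mem_Icc] at hr
        refine ⟨r - s' + t, ⟨by linarith, by linarith⟩, ?_⟩
        rw [f2 _ (by linarith)]; congr 1; ring
      · rintro ⟨r, hr, rfl⟩; rw [f2 r hr.1]; exact ⟨_, m2 hr, rfl⟩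

lemma split (h : J H Γ a b) (hc : c ∈ Γ) : ∃ Γ1 Γ2, J H Γ1 a c ∧ J H Γ2 c b ∧ Γ = Γ1 ∪ Γ2 ∧
    ∀ x ∈ Γ1, ∀ y ∈ Γ2, pr H x = pr H y → x = c ∧ y = c := by
  obtain ⟨γ, s, t, hst, hco, hi, ha, hb, rfl⟩ := h
  obtain ⟨r, hr, rfl⟩ := hc
  refine ⟨γ '' Icc s r, γ '' Icc r t, ⟨γ, s, r, hr.1, hco.mono (Icc_subset_Icc le_rfl hr.2),
    hi.mono (Icc_subset_Icc le_rfl hr.2), ha, rfl, rfl⟩, ⟨γ, r, t, hr.2, hco.mono (Icc_subset_Icc hr.1 le_rfl),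
    hi.mono (Icc_subset_Icc hr.1 le_rfl), rfl, hb, rfl⟩, ?_, ?_⟩
  · rw [← image_union, Icc_union_Icc_eq_Icc hr.1 hr.2]
  · rintro _ ⟨x, hx, rfl⟩ _ ⟨y, hy, rfl⟩ hxy
    have : x = y := hi ⟨hx.1, hx.2.trans hr.2⟩ ⟨hr.1.trans hy.1, hy.2⟩ hxy
    have h1 : x = r := le_antisymm hx.2 (this ▸ hy.1)
    exact ⟨by rw [h1], by rw [← this, h1]⟩

/-- first hit on a closed set -/
lemma first_hit (h : J H Γ a b) {F : Set X} (hF : IsClosed F) (hne : (Γ ∩ F).Nonempty) :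
    ∃ c Γ1 Γ2, c ∈ F ∧ J H Γ1 a c ∧ J H Γ2 c b ∧ Γ = Γ1 ∪ Γ2 ∧ (∀ x ∈ Γ1, x ∈ F → x = c) ∧
    ∀ x ∈ Γ1, ∀ y ∈ Γ2, pr H x = pr H y → x = c ∧ y = c := by
  obtain ⟨γ, s, t, hst, hco, hi, ha, hb, rfl⟩ := h
  have hcl : IsClosed (Icc s t ∩ γ ⁻¹' F) := hco.preimage_isClosed_of_isClosed isClosed_Icc hF
  have hcp : IsCompact (Icc s t ∩ γ ⁻¹' F) := isCompact_Icc.of_isClosed_subset hcl inter_subset_left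
  obtain ⟨_, ⟨r0, hr0, rfl⟩, hr0F⟩ := hne
  obtain ⟨r, ⟨hr, hrF⟩, hmin⟩ := hcp.exists_isMinOn ⟨r0, hr0, hr0F⟩ continuous_id.continuousOn
  refine ⟨γ r, γ '' Icc s r, γ '' Icc r t, hrF, ⟨γ, s, r, hr.1, hco.mono (Icc_subset_Icc le_rfl hr.2),
    hi.mono (Icc_subset_Icc le_rfl hr.2), ha, rfl, rfl⟩, ⟨γ, r, t, hr.2, hco.mono (Icc_subset_Icc hr.1 le_rfl),
    hi.mono (Icc_subset_Icc hr.1 le_rfl), rfl, hb, rfl⟩, ?_, ?_, ?_⟩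
  · rw [← image_union, Icc_union_Icc_eq_Icc hr.1 hr.2]
  · rintro _ ⟨x, hx, rfl⟩ hxF
    have : r ≤ x := hmin ⟨⟨hx.1, hx.2.trans hr.2⟩, hxF⟩
    rw [le_antisymm this hx.2]
  · rintro _ ⟨x, hx, rfl⟩ _ ⟨y, hy, rfl⟩ hxy
    have : x = y := hi ⟨hx.1, hx.2.trans hr.2⟩ ⟨hr.1.trans hy.1, hy.2⟩ hxy
    have h1 : x = r := le_antisymm hx.2 (this ▸ hy.1)
    exact ⟨by rw [h1], by rw [← this, h1]⟩

end J

lemma closed_rel (hS : Surf H X) (P : Set H) : IsClosed {p : X × X | ∃ k ∈ P, k • p.1 = p.2} := by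
  rw [← isOpen_compl_iff, isOpen_iff_mem_nhds]
  rintro ⟨x, y⟩ hxy
  obtain ⟨U, hU, V, hV, h⟩ := hS.pd x y
  filter_upwards [prod_mem_nhds hU hV]
  rintro ⟨u, v⟩ ⟨hu, hv⟩ ⟨k, hk, hkuv⟩
  simp only at hkuv
  exact hxy ⟨k, hk, h k u hu (hkuv ▸ hv)⟩

/-- saturation of a compact set by a set of group elements is closed -/
lemma closed_sat (hS : Surf H X) (P : Set H) {C : Set X} (hC : IsCompact C) :
    IsClosed {x : X | ∃ k ∈ P, k • x ∈ C} := by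
  have h1 : IsClosed {p : X × C | ∃ k ∈ P, k • p.1 = (p.2 : X)} :=
    (closed_rel hS P).preimage (f := fun p : X × C => (p.1, (p.2 : X))) (by fun_prop)
  have := isCompact_iff_compactSpace.1 hC
  have h2 := isClosedMap_fst_of_compactSpace _ h1
  convert h2 using 1
  ext x; constructor
  · rintro ⟨k, hk, hx⟩; exact ⟨(x, ⟨_, hx⟩), ⟨k, hk, rfl⟩, rfl⟩
  · rintro ⟨⟨_, y⟩, ⟨k, hk, hx⟩, rfl⟩; refine ⟨k, hk, ?_⟩; simp only at hx ⊢; rw [hx]; exact y.2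

lemma Surf.t2 (hS : Surf H X) : T2Space X := by
  obtain ⟨e, he⟩ := hS.emb; exact he.isEmbedding.t2Space

lemma closed_sat' (hS : Surf H X) {C : Set X} (hC : IsCompact C) : IsClosed {x : X | pr H x ∈ pr H '' C} := by
  convert closed_sat hS univ hC using 1
  ext x; constructor
  · rintro ⟨c, hc, h⟩; obtain ⟨g, hg⟩ := pr_eq.1 h; exact ⟨g, trivial, by rwa [hg]⟩
  · rintro ⟨g, -, hg⟩; exact ⟨_, hg, pr_smul g x⟩

/-- every compact set on which `pr` is injective has a neighbourhood with that property -/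
lemma exists_inj_nhd (hS : Surf H X) {C : Set X} (hC : IsCompact C) (hi : InjOn (pr H) C) :
    ∃ N : Set X, IsOpen N ∧ C ⊆ N ∧ InjOn (pr H) N := by
  have h1 := (closed_rel hS {k : H | k ≠ 1}).isOpen_compl
  obtain ⟨u, v, hu, hv, hCu, hCv, huv⟩ := generalized_tube_lemma hC hC h1 (by
    rintro ⟨x, y⟩ ⟨hx, hy⟩ ⟨k, hk, hkxy⟩
    simp only at hkxy hx hy
    have : x = y := hi hx hy (by rw [← hkxy, pr_smul])
    exact hk (hS.free k x (hkxy.trans this.symm)))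
  refine ⟨u ∩ v, hu.inter hv, subset_inter hCu hCv, ?_⟩
  intro x hx y hy hxy
  obtain ⟨g, hg⟩ := pr_eq.1 hxy
  by_cases h : g = 1
  · rw [← hg, h, one_smul]
  · exact absurd ⟨g, h, hg⟩ (huv (show (y, x) ∈ u ×ˢ v from ⟨hy.1, hx.2⟩))

lemma local_chord (hS : Surf H X) {x : X} {U : Set X} (hU : U ∈ 𝓝 x) :
    ∃ V : Set X, IsOpen V ∧ x ∈ V ∧ V ⊆ U ∧ InjOn (pr H) V ∧ ∀ p ∈ V, ∀ r ∈ V, ∃ Γ ⊆ V, J H Γ p r := by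
  obtain ⟨e, he⟩ := hS.emb
  obtain ⟨N, hN, hxN, hNi⟩ := exists_inj_nhd hS (isCompact_singleton (x := x)) (H := H) (by simp)
  have : e '' (U ∩ N) ∈ 𝓝 (e x) := by
    rw [← he.map_nhds_eq]; exact image_mem_map (inter_mem hU (hN.mem_nhds (hxN rfl)))
  obtain ⟨ε, hε, hball⟩ := Metric.mem_nhds_iff.1 this
  have hsub : e ⁻¹' Metric.ball (e x) ε ⊆ U ∩ N := by
    intro y hy; obtain ⟨z, hz, hzy⟩ := hball hy; rwa [← he.injective hzy]
  refine ⟨e ⁻¹' Metric.ball (e x) ε, Metric.isOpen_ball.preimage he.continuous, by simpa using hε,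
    fun y hy => (hsub hy).1, hNi.mono fun y hy => (hsub hy).2, ?_⟩
  intro p hp r hr
  by_cases hpr : p = r
  · subst hpr; exact ⟨{p}, by simpa using hp, J.refl p⟩
  have hseg : ∀ t ∈ Icc (0:ℝ) 1, (AffineMap.lineMap (e p) (e r) t : ℂ) ∈ Metric.ball (e x) ε := by
    intro t ht
    exact (convex_ball (e x) ε).lineMap_mem hp hr ht
  have hex : ∀ t : ℝ, ∃ y : X, t ∈ Icc (0:ℝ) 1 → e y = AffineMap.lineMap (e p) (e r) t := by
    intro t
    by_cases ht : t ∈ Icc (0:ℝ) 1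
    · obtain ⟨y, _, hy⟩ := hball (hseg t ht); exact ⟨y, fun _ => hy⟩
    · exact ⟨p, fun h => absurd h ht⟩
  choose γ hγ using hex
  have hγV : γ '' Icc 0 1 ⊆ e ⁻¹' Metric.ball (e x) ε := by
    rintro _ ⟨t, ht, rfl⟩; rw [mem_preimage, hγ t ht]; exact hseg t ht
  refine ⟨γ '' Icc 0 1, hγV, γ, 0, 1, zero_le_one, ?_, ?_, ?_, ?_, rfl⟩
  · rw [he.isInducing.continuousOn_iff]
    exact (AffineMap.lineMap_continuous.continuousOn).congr fun t ht => hγ t ht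
  · intro t ht t' ht' h
    have h1 := hNi ((hsub (hγV ⟨t, ht, rfl⟩)).2) ((hsub (hγV ⟨t', ht', rfl⟩)).2) h
    have h2 : AffineMap.lineMap (e p) (e r) t = (AffineMap.lineMap (e p) (e r) t' : ℂ) := by
      rw [← hγ t ht, ← hγ t' ht', h1]
    exact AffineMap.lineMap_injective ℝ (he.injective.ne hpr) h2
  · exact he.injective (by rw [hγ 0 (by simp)]; simp)
  · exact he.injective (by rw [hγ 1 (by simp)]; simp)

/-- arcs do not separate the quotient -/
lemma arc_compl (hS : Surf H X) {Γ : Set X} {a b : X} (h : J H Γ a b) : IsPreconnected (pr H '' Γ)ᶜ := by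
  obtain ⟨e, he⟩ := hS.emb
  have := hS.t2
  obtain ⟨N0, hN0, hΓN0, hi⟩ := exists_inj_nhd hS h.compact h.injOn
  set N := connectedComponentIn (e '' N0) (e a) with hNdef
  have hNo : IsOpen N := (he.isOpenMap _ hN0).connectedComponentIn
  have hNc : IsPreconnected N := isPreconnected_connectedComponentIn
  have hNsub : N ⊆ e '' N0 := connectedComponentIn_subset _ _
  have hΓN : e '' Γ ⊆ N := (h.preconn.image e he.continuous.continuousOn).subset_connectedComponentIn
    ⟨a, h.left, rfl⟩ (image_mono hΓN0)
  have hdiff : IsPreconnected (N \ e '' Γ) := by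
    by_cases hab : a = b
    · subst hab
      rw [h.eq_of, image_singleton]
      exact diff_countable_preconnected hNo hNc (countable_singleton _)
    · obtain ⟨γ, hc, hγi, -, -, rfl⟩ := h.reparam hab
      rw [image_image]
      rw [image_image] at hΓN
      refine diff_arc_preconnected hNo hNc (γ := fun t => e (γ t)) (he.continuous.comp_continuousOn hc) ?_ hΓN
      intro x hx y hy hxy
      exact hγi hx hy (congrArg (pr H) (he.injective hxy))
  set M := e ⁻¹' N with hM
  have hMo : IsOpen M := hNo.preimage he.continuous
  have hΓM : Γ ⊆ M := fun x hx => hΓN ⟨x, hx, rfl⟩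
  have hMN0 : M ⊆ N0 := by
    intro x hx; obtain ⟨y, hy, hxy⟩ := hNsub hx; rwa [← he.injective hxy]
  have hMdiff : IsPreconnected (M \ Γ) := by
    have h2 : M \ Γ = e ⁻¹' (N \ e '' Γ) := by
      ext x; simp [hM, he.injective.eq_iff]
    rw [h2]
    exact hdiff.preimage_of_isOpenMap he.injective he.isOpenMap (fun z hz => by
      obtain ⟨y, _, hy⟩ := hNsub hz.1; exact ⟨y, hy⟩)
  have hcl : IsClosed (pr H '' Γ) := by
    have := closed_sat' hS h.compact
    exact (isQuotientMap_quotient_mk' (X := X) (s := MulAction.orbitRel H X)).isClosed_preimage.1 this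
  rw [isPreconnected_iff_subset_of_disjoint]
  have core : ∀ u v : Set (MulAction.orbitRel.Quotient H X), IsOpen u → IsOpen v → (pr H '' Γ)ᶜ ⊆ u ∪ v →
      (pr H '' Γ)ᶜ ∩ (u ∩ v) = ∅ → pr H '' (M \ Γ) ⊆ u → (pr H '' Γ)ᶜ ⊆ u := by
    intro u v hu hv huv hdis hMu
    have huniv : IsPreconnected (univ : Set (MulAction.orbitRel.Quotient H X)) := by
      have := hS.conn.isPreconnected.image (pr H) pr_cont.continuousOn
      rwa [image_univ, show range (pr H : X → _) = univ from range_eq_univ.2 pr_surj] at this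
    have := isPreconnected_iff_subset_of_disjoint.1 huniv (((pr H '' Γ)ᶜ ∩ u) ∪ pr H '' M) ((pr H '' Γ)ᶜ ∩ v)
      ((hcl.isOpen_compl.inter hu).union (pr_open hS _ hMo)) (hcl.isOpen_compl.inter hv) (by
        intro s _
        by_cases hs : s ∈ pr H '' Γ
        · left; right; exact image_mono hΓM hs
        · rcases huv hs with h | h
          · left; left; exact ⟨hs, h⟩
          · right; exact ⟨hs, h⟩) (by
        apply eq_empty_of_subset_empty
        rintro s ⟨-, hs1, hs2, hs3⟩
        rw [← hdis]
        refine ⟨hs2, ?_, hs3⟩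
        rcases hs1 with h | ⟨m, hm, rfl⟩
        · exact h.2
        · exact hMu ⟨m, ⟨hm, fun h => hs2 ⟨m, h, rfl⟩⟩, rfl⟩)
    rcases this with h | h
    · intro s hs
      rcases h (mem_univ s) with h | ⟨m, hm, rfl⟩
      · exact h.2
      · exact hMu ⟨m, ⟨hm, fun h => hs ⟨m, h, rfl⟩⟩, rfl⟩
    · exact absurd ⟨a, J.left ‹_›, rfl⟩ (h (mem_univ (pr H a))).1
  intro u v hu hv huv hdis
  have hsub2 : pr H '' (M \ Γ) ⊆ (pr H '' Γ)ᶜ := by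
    rintro _ ⟨m, hm, rfl⟩ ⟨x, hx, hxm⟩
    have := hi (hΓN0 hx) (hMN0 hm.1) hxm
    exact hm.2 (this ▸ hx)
  have := isPreconnected_iff_subset_of_disjoint.1 (hMdiff.image (pr H) pr_cont.continuousOn) u v hu hv
    (hsub2.trans huv) (by
      apply eq_empty_of_subset_empty; rw [← hdis]; exact inter_subset_inter_left _ hsub2)
  rcases this with h | h
  · left; exact core u v hu hv huv hdis h
  · right; exact core v u hv hu (by rwa [union_comm]) (by rwa [inter_comm v]) h
end surf
end

noncomputable section
set_option linter.unusedSectionVars false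
open Set Filter Topology

section gauge
variable {X : Type*} [TopologicalSpace X] {H : Type*} [Group H] [MulAction H X]

lemma J.hit (hS : Surf H X) {Γ Γ' : Set X} {a b c d : X} (h : J H Γ a b) (h' : J H Γ' c d)
    (hm : (pr H '' Γ ∩ pr H '' Γ').Nonempty) :
    ∃ (g : H) (Δ : Set X), J H Δ a (g • d) ∧ pr H '' Δ ⊆ pr H '' Γ ∪ pr H '' Γ' := by
  obtain ⟨_, ⟨x, hx, rfl⟩, hx'⟩ := hm
  obtain ⟨p, Γ1, Γ2, hp, hΓ1, -, hΓ, h1, -⟩ := h.first_hit (closed_sat' hS h'.compact) ⟨x, hx, hx'⟩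
  obtain ⟨q, hq, hqp⟩ := hp
  obtain ⟨g, rfl⟩ := pr_eq.1 hqp.symm
  obtain ⟨Δ1, Δ2, -, hΔ2, hΔ, -⟩ := h'.split hq
  refine ⟨g, Γ1 ∪ (g • ·) '' Δ2, hΓ1.concat (hΔ2.smul hS g) ?_, ?_⟩
  · rintro x hx _ ⟨y, hy, rfl⟩ hxy
    rw [pr_smul] at hxy
    rw [h1 x hx ⟨y, hΔ ▸ Or.inr hy, hxy.symm⟩]
  · rw [image_union]
    apply union_subset_union
    · exact image_mono (hΓ ▸ subset_union_left)
    · rintro _ ⟨_, ⟨y, hy, rfl⟩, rfl⟩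
      exact ⟨y, hΔ ▸ Or.inr hy, (pr_smul g y).symm⟩

lemma arc_conn (hS : Surf H X) {O : Set (MulAction.orbitRel.Quotient H X)} (hO : IsOpen O)
    (hOc : IsPreconnected O) {a : X} (ha : pr H a ∈ O) {t : X} (ht : pr H t ∈ O) :
    ∃ b Γ, pr H b = pr H t ∧ J H Γ a b ∧ pr H '' Γ ⊆ O := by
  set R : Set X := {t | ∃ b Γ, pr H b = pr H t ∧ J H Γ a b ∧ pr H '' Γ ⊆ O} with hR
  have inv : ∀ x y, pr H x = pr H y → x ∈ R → y ∈ R := by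
    rintro x y hxy ⟨b, Γ, h1, h2⟩; exact ⟨b, Γ, h1.trans hxy, h2⟩
  have key : ∀ x, pr H x ∈ O → ∃ V, IsOpen V ∧ x ∈ V ∧ (∀ y ∈ V, pr H y ∈ O) ∧ ∀ p ∈ V, ∀ r ∈ V, p ∈ R → r ∈ R := by
    intro x hx
    obtain ⟨V, hV, hxV, hVU, -, hch⟩ := local_chord (H := H) hS ((hO.preimage pr_cont).mem_nhds hx)
    refine ⟨V, hV, hxV, hVU, ?_⟩
    rintro p hp r hr ⟨b, Γ, hb, hJ, hsub⟩
    obtain ⟨Δ, hΔ, hJ'⟩ := hch p hp r hr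
    obtain ⟨g, E, hE, hEs⟩ := hJ.hit hS hJ' ⟨pr H p, ⟨b, hJ.right, hb⟩, ⟨p, hJ'.left, rfl⟩⟩
    refine ⟨g • r, E, pr_smul g r, hE, hEs.trans (union_subset hsub ?_)⟩
    rintro _ ⟨y, hy, rfl⟩; exact hVU (hΔ hy)
  have o1 : IsOpen (pr H '' (R ∩ {x | pr H x ∈ O})) := by
    apply pr_open hS
    rw [isOpen_iff_mem_nhds]
    rintro x ⟨hx, hxO⟩
    obtain ⟨V, hV, hxV, hVO, h⟩ := key x hxO
    exact mem_of_superset (hV.mem_nhds hxV) fun y hy => ⟨h x hxV y hy hx, hVO y hy⟩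
  have o2 : IsOpen (pr H '' (Rᶜ ∩ {x | pr H x ∈ O})) := by
    apply pr_open hS
    rw [isOpen_iff_mem_nhds]
    rintro x ⟨hx, hxO⟩
    obtain ⟨V, hV, hxV, hVO, h⟩ := key x hxO
    exact mem_of_superset (hV.mem_nhds hxV) fun y hy => ⟨fun hyR => hx (h y hy x hxV hyR), hVO y hy⟩
  by_contra hcon
  obtain ⟨s, -, ⟨x, hx, rfl⟩, ⟨y, hy, hyx⟩⟩ := hOc _ _ o1 o2 (by
    intro s hs
    obtain ⟨x, rfl⟩ := pr_surj s
    by_cases h : x ∈ R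
    · exact Or.inl ⟨x, ⟨h, hs⟩, rfl⟩
    · exact Or.inr ⟨x, ⟨h, hs⟩, rfl⟩)
    ⟨pr H a, ha, a, ⟨⟨a, {a}, rfl, J.refl a, by simpa using ha⟩, ha⟩, rfl⟩ ⟨pr H t, ht, t, ⟨hcon, ht⟩, rfl⟩
  exact hy.1 (inv x y hyx.symm hx.1)

lemma closed_of_sat {F : Set (MulAction.orbitRel.Quotient H X)} (h : IsClosed {x : X | pr H x ∈ F}) : IsClosed F :=
  (isQuotientMap_quotient_mk' (X := X) (s := MulAction.orbitRel H X)).isClosed_preimage.1 h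

/-- hypotheses of the gauge theorem -/
structure Gauge (Θ : Set X) (K : Subgroup H) : Prop where
  closed : IsClosed {x : X | pr H x ∈ pr H '' Θ}
  two : ∀ s : X, ∃ x ∈ Θ, pr H x ≠ pr H s
  smul : ∀ k ∈ K, ∀ x ∈ Θ, k • x ∈ Θ
  mem : ∀ (g : H) (x : X), x ∈ Θ → g • x ∈ Θ → g ∈ K
  nhd : ∀ x ∈ Θ, ∃ U ∈ 𝓝 x, ∀ y ∈ U, pr H y ∈ pr H '' Θ → y ∈ Θ
  ear : ∀ (B : Set X) (b c : X), J H B b c → b ∈ Θ → pr H c ∈ pr H '' Θ → pr H b ≠ pr H c →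
    (∀ x ∈ B, pr H x ∈ pr H '' Θ → pr H x = pr H b ∨ pr H x = pr H c) → c ∈ Θ

/-- tail of Θ -/
def Tail (H : Type*) {X : Type*} [TopologicalSpace X] [Group H] [MulAction H X] (Θ T : Set X) (b m : X) : Prop :=
  J H T b m ∧ b ∈ Θ ∧ ∀ x ∈ T, pr H x ∈ pr H '' Θ → pr H x = pr H b

variable {Θ : Set X} {K : Subgroup H}

lemma sat_smul (g : H) (x : X) : pr H (g • x) ∈ pr H '' Θ ↔ pr H x ∈ pr H '' Θ := by rw [pr_smul]

lemma lolli_core (hS : Surf H X) (hG : Gauge Θ K) {T L1 L2 Δ : Set X} {b m n q c : X} {h : H}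
    (hT : Tail H Θ T b m) (h1 : J H L1 m n) (h2 : J H L2 n (h • m))
    (h12 : ∀ x ∈ L1, ∀ y ∈ L2, pr H x = pr H y → pr H x = pr H m ∨ pr H x = pr H n)
    (h1T : ∀ x ∈ L1, ∀ y ∈ T, pr H x = pr H y → pr H x = pr H m)
    (h2T : ∀ x ∈ L2, ∀ y ∈ T, pr H x = pr H y → pr H x = pr H m)
    (h1Q : ∀ x ∈ L1, pr H x ∈ pr H '' Θ → pr H x = pr H m)
    (h2Q : ∀ x ∈ L2, pr H x ∈ pr H '' Θ → pr H x = pr H m)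
    (hq : q ∈ L1) (hΔ : J H Δ q c) (hc : pr H c ∈ pr H '' Θ)
    (hΔ1 : ∀ x ∈ Δ, ∀ y ∈ L1, pr H x = pr H y → pr H x = pr H q)
    (hΔ2 : ∀ x ∈ Δ, ∀ y ∈ L2, pr H x = pr H y → pr H x = pr H q)
    (hΔT : ∀ x ∈ Δ, ∀ y ∈ T, pr H x ≠ pr H y)
    (hΔQ : ∀ x ∈ Δ, pr H x ∈ pr H '' Θ → pr H x = pr H c) : h ∈ K := by
  obtain ⟨hTJ, hbΘ, hTQ⟩ := hT
  have hbc : pr H b ≠ pr H c := fun h => hΔT c hΔ.right b hTJ.left h.symm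
  have hqm : pr H q ≠ pr H m := hΔT q hΔ.left m hTJ.right
  obtain ⟨S1, S2, hS1, hS2, hSu, hS12⟩ := h1.split hq
  have s1 : ∀ x ∈ S1, x ∈ L1 := fun x hx => hSu ▸ Or.inl hx
  have s2 : ∀ x ∈ S2, x ∈ L1 := fun x hx => hSu ▸ Or.inr hx
  have mQ : pr H m ∈ pr H '' Θ → pr H m = pr H b := hTQ m hTJ.right
  -- first ear
  have e1 : J H (T ∪ S1) b q := hTJ.concat hS1 fun x hx y hy hxy => by
    rw [hxy]; exact h1T y (s1 y hy) x hx hxy.symm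
  have e2 : J H (T ∪ S1 ∪ Δ) b c := e1.concat hΔ fun x hx y hy hxy => by
    rcases hx with hx | hx
    · exact absurd hxy.symm (hΔT y hy x hx)
    · rw [hxy]; exact hΔ1 y hy x (s1 x hx) hxy.symm
  have cΘ : c ∈ Θ := hG.ear _ b c e2 hbΘ hc hbc fun x hx hxQ => by
    rcases hx with (hx | hx) | hx
    · exact Or.inl (hTQ x hx hxQ)
    · have := h1Q x (s1 x hx) hxQ
      left; rw [this]; exact mQ (this ▸ hxQ)
    · exact Or.inr (hΔQ x hx hxQ)
  -- second ear
  have f0 : J H ((h • ·) '' T) (h • b) (h • m) := hTJ.smul hS h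
  have f1 : J H ((h • ·) '' T ∪ L2) (h • b) n := f0.concat h2.symm fun x hx y hy hxy => by
    obtain ⟨x, hx, rfl⟩ := hx
    simp only [pr_smul] at hxy ⊢
    rw [hxy]; exact h2T y hy x hx hxy.symm
  have f2 : J H ((h • ·) '' T ∪ L2 ∪ S2) (h • b) q := f1.concat hS2.symm fun x hx y hy hxy => by
    have hym : pr H y ≠ pr H m := fun hh => by
      have := (hS12 m hS1.left y hy hh.symm).1
      exact hqm (by rw [this])
    rcases hx with ⟨x, hx, rfl⟩ | hx
    · simp only [pr_smul] at hxy ⊢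
      exact absurd (h1T y (s2 y hy) x hx hxy.symm) hym
    · rcases h12 y (s2 y hy) x hx hxy.symm with h' | h'
      · exact absurd h' hym
      · rw [hxy, h']
  have f3 : J H ((h • ·) '' T ∪ L2 ∪ S2 ∪ Δ) (h • b) c := f2.concat hΔ fun x hx y hy hxy => by
    rcases hx with (⟨x, hx, rfl⟩ | hx) | hx
    · simp only [pr_smul] at hxy ⊢
      exact absurd hxy.symm (hΔT y hy x hx)
    · rw [hxy]; exact hΔ2 y hy x hx hxy.symm
    · rw [hxy]; exact hΔ1 y hy x (s2 x hx) hxy.symm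
  have f4 := f3.smul hS h⁻¹
  rw [inv_smul_smul] at f4
  have cΘ' : h⁻¹ • c ∈ Θ := hG.ear _ b (h⁻¹ • c) f4 hbΘ (by rwa [pr_smul]) (by rwa [pr_smul]) fun x hx hxQ => by
    obtain ⟨x, hx, rfl⟩ := hx
    simp only [pr_smul] at hxQ ⊢
    rcases hx with ((⟨x, hx, rfl⟩ | hx) | hx) | hx
    · simp only [pr_smul] at hxQ ⊢
      exact Or.inl (hTQ x hx hxQ)
    · have := h2Q x hx hxQ
      left; rw [this]; exact mQ (this ▸ hxQ)
    · have := h1Q x (s2 x hx) hxQ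
      left; rw [this]; exact mQ (this ▸ hxQ)
    · exact Or.inr (hΔQ x hx hxQ)
  exact inv_mem_iff.1 (hG.mem h⁻¹ c cΘ cΘ')

lemma lollipop (hS : Surf H X) (hG : Gauge Θ K) {T L1 L2 : Set X} {b m n : X} {h : H}
    (hT : Tail H Θ T b m) (h1 : J H L1 m n) (h2 : J H L2 n (h • m)) (hnm : pr H n ≠ pr H m)
    (h12 : ∀ x ∈ L1, ∀ y ∈ L2, pr H x = pr H y → pr H x = pr H m ∨ pr H x = pr H n)
    (h1T : ∀ x ∈ L1, ∀ y ∈ T, pr H x = pr H y → pr H x = pr H m)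
    (h2T : ∀ x ∈ L2, ∀ y ∈ T, pr H x = pr H y → pr H x = pr H m)
    (h1Q : ∀ x ∈ L1, pr H x ∈ pr H '' Θ → pr H x = pr H m)
    (h2Q : ∀ x ∈ L2, pr H x ∈ pr H '' Θ → pr H x = pr H m) : h ∈ K := by
  obtain ⟨s', hs', hsb⟩ := hG.two b
  have hO : IsOpen (pr H '' T)ᶜ := (closed_of_sat (closed_sat' hS hT.1.compact)).isOpen_compl
  obtain ⟨s, Γ, hss, hΓ, hΓO⟩ := arc_conn hS hO (arc_compl hS hT.1) (a := n) (t := s')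
    (by rintro ⟨y, hy, hyn⟩; exact hnm (h1T n h1.right y hy hyn.symm))
    (by rintro ⟨y, hy, hyn⟩; exact hsb (hyn ▸ hT.2.2 y hy (hyn ▸ ⟨s', hs', rfl⟩)))
  obtain ⟨c, Γ1, Γ2, hc, hΓ1, -, hΓu, hΓ1Q, -⟩ := hΓ.first_hit hG.closed
    ⟨s, hΓ.right, ⟨s', hs', hss.symm⟩⟩
  obtain ⟨p, Δ, Γ4, hp, hΔ, -, hΔu, hΔF, -⟩ := hΓ1.symm.first_hit
    (closed_sat' hS (h1.compact.union h2.compact)) ⟨n, hΓ1.left, ⟨n, Or.inl h1.right, rfl⟩⟩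
  have dΓ1 : ∀ x ∈ Δ, x ∈ Γ1 := fun x hx => hΔu ▸ Or.inl hx
  have dT : ∀ x ∈ Δ, ∀ y ∈ T, pr H x ≠ pr H y := fun x hx y hy hxy =>
    hΓO ⟨x, hΓu ▸ Or.inl (dΓ1 x hx), rfl⟩ ⟨y, hy, hxy.symm⟩
  obtain ⟨q, hq, hqp⟩ := hp
  obtain ⟨g, rfl⟩ := pr_eq.1 hqp
  have hΔ' := (hΔ.smul hS g).symm
  have F : ∀ x ∈ (g • ·) '' Δ, ∀ y ∈ L1 ∪ L2, pr H x = pr H y → pr H x = pr H (g • p) := by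
    rintro _ ⟨x, hx, rfl⟩ y hy hxy
    simp only [pr_smul] at hxy ⊢
    rw [hΔF x hx ⟨y, hy, hxy.symm⟩]
  have FT : ∀ x ∈ (g • ·) '' Δ, ∀ y ∈ T, pr H x ≠ pr H y := by
    rintro _ ⟨x, hx, rfl⟩ y hy hxy
    simp only [pr_smul] at hxy
    exact dT x hx y hy hxy
  have FQ : ∀ x ∈ (g • ·) '' Δ, pr H x ∈ pr H '' Θ → pr H x = pr H (g • c) := by
    rintro _ ⟨x, hx, rfl⟩ hxQ
    simp only [pr_smul] at hxQ ⊢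
    rw [hΓ1Q x (dΓ1 x hx) hxQ]
  rcases hq with hq | hq
  · exact lolli_core hS hG hT h1 h2 h12 h1T h2T h1Q h2Q hq hΔ' (by rw [pr_smul]; exact hc)
      (fun x hx y hy => F x hx y (Or.inl hy)) (fun x hx y hy => F x hx y (Or.inr hy)) FT FQ
  · have k1 := h2.symm.smul hS h⁻¹
    rw [inv_smul_smul] at k1
    have k2 := h1.symm.smul hS h⁻¹
    have k3 := hΔ'.smul hS h⁻¹
    refine inv_mem_iff.1 (lolli_core hS hG hT k1 k2 (q := h⁻¹ • g • p) ?_ ?_ ?_ ?_ ?_ ⟨_, hq, rfl⟩ k3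
      (by rw [pr_smul, pr_smul]; exact hc) ?_ ?_ ?_ ?_)
    · rintro _ ⟨x, hx, rfl⟩ _ ⟨y, hy, rfl⟩ hxy
      simp only [pr_smul] at hxy ⊢
      rw [hxy]; exact h12 y hy x hx hxy.symm
    · rintro _ ⟨x, hx, rfl⟩ y hy hxy
      simp only [pr_smul] at hxy ⊢
      exact h2T x hx y hy hxy
    · rintro _ ⟨x, hx, rfl⟩ y hy hxy
      simp only [pr_smul] at hxy ⊢
      exact h1T x hx y hy hxy
    · rintro _ ⟨x, hx, rfl⟩ hxQ
      simp only [pr_smul] at hxQ ⊢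
      exact h2Q x hx hxQ
    · rintro _ ⟨x, hx, rfl⟩ hxQ
      simp only [pr_smul] at hxQ ⊢
      exact h1Q x hx hxQ
    · rintro _ ⟨x, hx, rfl⟩ _ ⟨y, hy, rfl⟩ hxy
      rw [pr_smul, pr_smul] at hxy
      rw [pr_smul, pr_smul h⁻¹]
      exact F x hx y (Or.inr hy) hxy
    · rintro _ ⟨x, hx, rfl⟩ _ ⟨y, hy, rfl⟩ hxy
      rw [pr_smul, pr_smul] at hxy
      rw [pr_smul, pr_smul h⁻¹]
      exact F x hx y (Or.inl hy) hxy
    · rintro _ ⟨x, hx, rfl⟩ y hy hxy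
      rw [pr_smul] at hxy
      exact FT x hx y hy hxy
    · rintro _ ⟨x, hx, rfl⟩ hxQ
      rw [pr_smul] at hxQ
      rw [pr_smul, pr_smul h⁻¹]
      exact FQ x hx hxQ

lemma tails_mem (hS : Surf H X) (hG : Gauge Θ K) {C T : Set X} {n m b : X} {g : H}
    (hC : Tail H Θ C n m) (hT : Tail H Θ T b (g • m)) : g ∈ K := by
  by_contra hgK
  have := hS.t2
  obtain ⟨⟨c, s, t, hst, cc, ci, cs, ct, rfl⟩, hn, hCQ⟩ := hC
  obtain ⟨⟨τ, s', t', hst', tc, ti, ts, tt, rfl⟩, hb, hTQ⟩ := hT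
  have cQ : ∀ y ∈ Icc s t, pr H (c y) ∈ pr H '' Θ → y = s := fun y hy h =>
    ci hy ⟨le_rfl, hst⟩ (by have := hCQ _ ⟨y, hy, rfl⟩ h; simpa [cs] using this)
  have tQ : ∀ y ∈ Icc s' t', pr H (τ y) ∈ pr H '' Θ → y = s' := fun y hy h =>
    ti hy ⟨le_rfl, hst'⟩ (by have := hTQ _ ⟨y, hy, rfl⟩ h; simpa [ts] using this)
  have comp : ∀ P : Set H, IsCompact {y | y ∈ Icc s t ∧ ∃ r ∈ Icc s' t', ∃ k ∈ P, k • c y = τ r} := by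
    intro P
    have h1 : ContinuousOn (fun p : ℝ × ℝ => (c p.1, τ p.2)) (Icc s t ×ˢ Icc s' t') :=
      (cc.comp continuousOn_fst fun p hp => hp.1).prodMk (tc.comp continuousOn_snd fun p hp => hp.2)
    have h2 := h1.preimage_isClosed_of_isClosed (isClosed_Icc.prod isClosed_Icc) (closed_rel hS P)
    have h3 : IsCompact ((Icc s t ×ˢ Icc s' t') ∩ _) :=
      (isCompact_Icc.prod isCompact_Icc).of_isClosed_subset h2 inter_subset_left
    convert h3.image continuous_fst using 1
    ext y; constructor
    · rintro ⟨hy, r, hr, k, hk, h⟩; exact ⟨(y, r), ⟨⟨hy, hr⟩, k, hk, h⟩, rfl⟩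
    · rintro ⟨⟨_, r⟩, ⟨⟨hy, hr⟩, k, hk, h⟩, rfl⟩; exact ⟨hy, r, hr, k, hk, h⟩
  obtain ⟨y1, ⟨hy1, r1, hr1, k1, hk1, e1⟩, hmin⟩ := (comp {k | k ∉ K}).exists_isMinOn
    ⟨t, ⟨hst, le_rfl⟩, t', ⟨hst', le_rfl⟩, g, hgK, by rw [ct, tt]⟩ continuous_id.continuousOn
  have hmin' : ∀ y ∈ Icc s t, ∀ r ∈ Icc s' t', ∀ k : H, k ∉ K → k • c y = τ r → y1 ≤ y :=
    fun y hy r hr k hk h => hmin ⟨hy, r, hr, k, hk, h⟩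
  have jT : ∀ u v, s' ≤ u → u ≤ v → v ≤ t' → J H (τ '' Icc u v) (τ u) (τ v) := fun u v h1 h2 h3 =>
    ⟨τ, u, v, h2, tc.mono (Icc_subset_Icc h1 h3), ti.mono (Icc_subset_Icc h1 h3), rfl, rfl, rfl⟩
  have jC : ∀ u v, s ≤ u → u ≤ v → v ≤ t → J H (c '' Icc u v) (c u) (c v) := fun u v h1 h2 h3 =>
    ⟨c, u, v, h2, cc.mono (Icc_subset_Icc h1 h3), ci.mono (Icc_subset_Icc h1 h3), rfl, rfl, rfl⟩
  have tail : ∀ v, s' ≤ v → v ≤ t' → Tail H Θ (τ '' Icc s' v) b (τ v) := fun v h1 h2 =>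
    ⟨ts ▸ jT s' v le_rfl h1 h2, hb, fun x hx => hTQ x (image_mono (Icc_subset_Icc le_rfl h2) hx)⟩
  by_cases hgood : ({y | y ∈ Icc s t ∧ ∃ r ∈ Icc s' t', ∃ k ∈ (K : Set H), k • c y = τ r} ∩ Iic y1).Nonempty
  · obtain ⟨y0, ⟨⟨hy0, r0, hr0, k0, hk0, e0⟩, hy01⟩, hmax⟩ := ((comp K).inter_right isClosed_Iic).exists_isMaxOn
      hgood continuous_id.continuousOn
    have hmax' : ∀ y ∈ Icc s t, ∀ r ∈ Icc s' t', ∀ k ∈ K, k • c y = τ r → y ≤ y1 → y ≤ y0 :=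
      fun y hy r hr k hk h h1 => hmax ⟨⟨hy, r, hr, k, hk, h⟩, h1⟩
    have p0 : pr H (c y0) = pr H (τ r0) := by rw [← e0, pr_smul]
    have p1 : pr H (c y1) = pr H (τ r1) := by rw [← e1, pr_smul]
    have hits : ∀ y ∈ Icc y0 y1, ∀ r ∈ Icc s' t', pr H (c y) = pr H (τ r) →
        (y = y0 ∧ r = r0) ∨ (y = y1 ∧ r = r1) := by
      intro y hy r hr h
      have hy' : y ∈ Icc s t := ⟨hy0.1.trans hy.1, hy.2.trans hy1.2⟩
      obtain ⟨k, hk⟩ := pr_eq.1 h.symm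
      by_cases hkK : k ∈ K
      · have : y = y0 := le_antisymm (hmax' y hy' r hr k hkK hk hy.2) hy.1
        subst this
        exact Or.inl ⟨rfl, ti hr hr0 (h.symm.trans p0)⟩
      · have : y = y1 := le_antisymm hy.2 (hmin' y hy' r hr k hkK hk)
        subst this
        exact Or.inr ⟨rfl, ti hr hr1 (h.symm.trans p1)⟩
    rcases lt_trichotomy r0 r1 with hlt | heq | hlt
    · have j2 := ((jC y0 y1 hy0.1 hy01 hy1.2).smul hS k1).symm
      have ee : k1 • c y0 = (k1 * k0⁻¹) • τ r0 := by rw [← e0, mul_smul, inv_smul_smul]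
      rw [e1, ee] at j2
      have hne : pr H (τ r1) ≠ pr H (τ r0) := fun h => hlt.ne' (ti hr1 hr0 h)
      have := lollipop hS hG (tail r0 hr0.1 hr0.2) (jT r0 r1 hr0.1 hlt.le hr1.2) j2 hne
        (by
          rintro _ ⟨r, hr, rfl⟩ _ ⟨_, ⟨y, hy, rfl⟩, rfl⟩ h
          rw [pr_smul] at h
          rcases hits y hy r ⟨hr0.1.trans hr.1, hr.2.trans hr1.2⟩ h.symm with ⟨-, rfl⟩ | ⟨-, rfl⟩
          · exact Or.inl rfl
          · exact Or.inr rfl)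
        (by
          rintro _ ⟨r, hr, rfl⟩ _ ⟨y, hy, rfl⟩ h
          have : r = y := ti ⟨hr0.1.trans hr.1, hr.2.trans hr1.2⟩ ⟨hy.1, hy.2.trans hr0.2⟩ h
          have : r = r0 := le_antisymm (this ▸ hy.2) hr.1
          rw [this])
        (by
          rintro _ ⟨_, ⟨y, hy, rfl⟩, rfl⟩ _ ⟨r, hr, rfl⟩ h
          rw [pr_smul] at h
          simp only [pr_smul]
          rcases hits y hy r ⟨hr.1, hr.2.trans hr0.2⟩ h with ⟨rfl, rfl⟩ | ⟨-, rfl⟩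
          · exact p0
          · exact absurd hr.2 (not_le.2 hlt))
        (by
          rintro _ ⟨r, hr, rfl⟩ h
          have : r = s' := tQ r ⟨hr0.1.trans hr.1, hr.2.trans hr1.2⟩ h
          have : r = r0 := le_antisymm (this ▸ hr0.1) hr.1
          rw [this])
        (by
          rintro _ ⟨_, ⟨y, hy, rfl⟩, rfl⟩ h
          simp only [pr_smul] at h ⊢
          have : y = s := cQ y ⟨hy0.1.trans hy.1, hy.2.trans hy1.2⟩ h
          have : y = y0 := le_antisymm (this ▸ hy0.1) hy.1
          rw [this, p0])
      exact hk1 (by simpa using K.mul_mem this hk0)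
    · have : y0 = y1 := ci hy0 hy1 (by simp only [p0, p1, heq])
      subst this
      subst heq
      have : k0 = k1 := by
        have h : (k1⁻¹ * k0) • c y0 = c y0 := by rw [mul_smul, e0, ← e1, inv_smul_smul]
        exact (inv_mul_eq_one.1 (hS.free _ _ h)).symm
      exact hk1 (this ▸ hk0)
    · have j2 := ((jC y0 y1 hy0.1 hy01 hy1.2).smul hS k0)
      have ee : k0 • c y1 = (k0 * k1⁻¹) • τ r1 := by rw [← e1, mul_smul, inv_smul_smul]
      rw [e0, ee] at j2
      have hne : pr H (τ r0) ≠ pr H (τ r1) := fun h => hlt.ne' (ti hr0 hr1 h)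
      have := lollipop hS hG (tail r1 hr1.1 hr1.2) (jT r1 r0 hr1.1 hlt.le hr0.2) j2 hne
        (by
          rintro _ ⟨r, hr, rfl⟩ _ ⟨_, ⟨y, hy, rfl⟩, rfl⟩ h
          rw [pr_smul] at h
          rcases hits y hy r ⟨hr1.1.trans hr.1, hr.2.trans hr0.2⟩ h.symm with ⟨-, rfl⟩ | ⟨-, rfl⟩
          · exact Or.inr rfl
          · exact Or.inl rfl)
        (by
          rintro _ ⟨r, hr, rfl⟩ _ ⟨y, hy, rfl⟩ h
          have : r = y := ti ⟨hr1.1.trans hr.1, hr.2.trans hr0.2⟩ ⟨hy.1, hy.2.trans hr1.2⟩ h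
          have : r = r1 := le_antisymm (this ▸ hy.2) hr.1
          rw [this])
        (by
          rintro _ ⟨_, ⟨y, hy, rfl⟩, rfl⟩ _ ⟨r, hr, rfl⟩ h
          rw [pr_smul] at h
          simp only [pr_smul]
          rcases hits y hy r ⟨hr.1, hr.2.trans hr1.2⟩ h with ⟨-, rfl⟩ | ⟨rfl, rfl⟩
          · exact absurd hr.2 (not_le.2 hlt)
          · exact p1)
        (by
          rintro _ ⟨r, hr, rfl⟩ h
          have : r = s' := tQ r ⟨hr1.1.trans hr.1, hr.2.trans hr0.2⟩ h
          have : r = r1 := le_antisymm (this ▸ hr1.1) hr.1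
          rw [this])
        (by
          rintro _ ⟨_, ⟨y, hy, rfl⟩, rfl⟩ h
          simp only [pr_smul] at h ⊢
          have : y = s := cQ y ⟨hy0.1.trans hy.1, hy.2.trans hy1.2⟩ h
          have : y = y0 := le_antisymm (this ▸ hy0.1) hy.1
          rw [this, p0] at h
          exact absurd (tQ r0 hr0 h) (hr1.1.trans_lt hlt).ne')
      have h2 := K.mul_mem (K.inv_mem this) hk0
      simp at h2
      exact hk1 h2
  · have e : J H (τ '' Icc s' r1 ∪ (k1 • ·) '' (c '' Icc s y1)) b (k1 • n) := by
      have j1 := (tail r1 hr1.1 hr1.2).1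
      have j2 := ((jC s y1 le_rfl hy1.1 hy1.2).smul hS k1).symm
      rw [e1, cs] at j2
      refine j1.concat j2 ?_
      rintro _ ⟨r, hr, rfl⟩ _ ⟨_, ⟨y, hy, rfl⟩, rfl⟩ h
      rw [pr_smul] at h
      obtain ⟨k, hk⟩ := pr_eq.1 h
      by_cases hkK : k ∈ K
      · exact absurd ⟨y, ⟨⟨hy.1, hy.2.trans hy1.2⟩, r, ⟨hr.1, hr.2.trans hr1.2⟩, k, hkK, hk⟩, hy.2⟩ hgood
      · have : y = y1 := le_antisymm hy.2 (hmin' y ⟨hy.1, hy.2.trans hy1.2⟩ r ⟨hr.1, hr.2.trans hr1.2⟩ k hkK hk)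
        rw [h, this, ← e1, pr_smul]
    by_cases hbn : pr H b = pr H n
    · have e' : b = k1 • n := e.injOn e.left e.right (by rw [pr_smul, hbn])
      exact hk1 (hG.mem k1 n hn (e' ▸ hb))
    · refine hk1 (hG.mem k1 n hn (hG.ear _ _ _ e hb (by rw [pr_smul]; exact ⟨n, hn, rfl⟩) (by rwa [pr_smul]) ?_))
      rintro x (hx | ⟨x, hx, rfl⟩) hxQ
      · exact Or.inl (hTQ x (image_mono (Icc_subset_Icc le_rfl hr1.2) hx) hxQ)
      · simp only [pr_smul] at hxQ ⊢
        exact Or.inr (hCQ x (image_mono (Icc_subset_Icc le_rfl hy1.2) hx) hxQ)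

theorem gauge_top (hS : Surf H X) (hG : Gauge Θ K) : K = ⊤ := by
  have := hS.t2
  have := hS.homeo
  set Y : Set X := {m | ∃ T b, Tail H Θ T b m} with hY
  have yK : ∀ (g : H) m, m ∈ Y → g • m ∈ Y → g ∈ K := by
    rintro g m ⟨C, n, hC⟩ ⟨T, b, hT⟩; exact tails_mem hS hG hC hT
  have yU : ∀ x : X, ∃ g : H, g • x ∈ Y := by
    intro x
    obtain ⟨θ, hθ, -⟩ := hG.two x
    have huniv : IsPreconnected (univ : Set (MulAction.orbitRel.Quotient H X)) := by
      have := hS.conn.isPreconnected.image (pr H) pr_cont.continuousOn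
      rwa [image_univ, show range (pr H : X → _) = univ from range_eq_univ.2 pr_surj] at this
    obtain ⟨b, Γ, hb, hΓ, -⟩ := arc_conn hS isOpen_univ huniv (a := x) (t := θ) trivial trivial
    obtain ⟨p, Γ1, Γ2, hp, hΓ1, -, -, hΓQ, -⟩ := hΓ.first_hit hG.closed ⟨b, hΓ.right, ⟨θ, hθ, hb.symm⟩⟩
    obtain ⟨q, hq, hqp⟩ := hp
    obtain ⟨g, rfl⟩ := pr_eq.1 hqp
    refine ⟨g, _, _, (hΓ1.smul hS g).symm, hq, ?_⟩
    rintro _ ⟨y, hy, rfl⟩ hyQ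
    simp only [pr_smul] at hyQ ⊢
    rw [hΓQ y hy hyQ]
  have yO : IsOpen Y := by
    rw [isOpen_iff_mem_nhds]
    rintro m ⟨T, b, hT, hb, hTQ⟩
    by_cases hm : pr H m ∈ pr H '' Θ
    · have : m = b := hT.injOn hT.right hT.left (hTQ m hT.right hm)
      subst this
      obtain ⟨U, hU, hUΘ⟩ := hG.nhd m hb
      obtain ⟨V, hV, hmV, hVU, -, hch⟩ := local_chord (H := H) hS hU
      refine mem_of_superset (hV.mem_nhds hmV) fun r hr => ?_
      obtain ⟨Γ, hΓV, hΓ⟩ := hch r hr m hmV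
      obtain ⟨p, Γ1, Γ2, hp, hΓ1, -, hu, hΓQ, -⟩ := hΓ.first_hit hG.closed ⟨m, hΓ.right, hm⟩
      refine ⟨Γ1, p, hΓ1.symm, hUΘ p (hVU (hΓV (hu ▸ Or.inl hΓ1.right))) hp, fun x hx hxQ => ?_⟩
      rw [hΓQ x hx hxQ]
    · have c1 := closed_sat hS {k : H | k ≠ 1} hT.compact
      have n1 : {x : X | pr H x ∈ pr H '' Θ}ᶜ ∩ {x : X | ∃ k ∈ {k : H | k ≠ 1}, k • x ∈ T}ᶜ ∈ 𝓝 m := by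
        refine inter_mem (hG.closed.isOpen_compl.mem_nhds hm) (c1.isOpen_compl.mem_nhds ?_)
        rintro ⟨k, hk, hkm⟩
        exact hk (hS.free k m (hT.injOn hkm hT.right (pr_smul k m)))
      obtain ⟨V, hV, hmV, hVU, -, hch⟩ := local_chord (H := H) hS n1
      refine mem_of_superset (hV.mem_nhds hmV) fun r hr => ?_
      obtain ⟨Γ, hΓV, hΓ⟩ := hch r hr m hmV
      obtain ⟨p, Γ1, Γ2, hp, hΓ1, -, hu, hΓT, -⟩ := hΓ.first_hit hT.compact.isClosed ⟨m, hΓ.right, hT.right⟩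
      obtain ⟨T1, T2, hT1, -, hTu, -⟩ := hT.split hp
      refine ⟨T1 ∪ Γ1, b, hT1.concat hΓ1.symm ?_, hb, ?_⟩
      · intro x hx y hy hxy
        have hyV : y ∈ V := hΓV (hu ▸ Or.inl hy)
        obtain ⟨k, hk⟩ := pr_eq.1 hxy
        have hxT : x ∈ T := hTu ▸ Or.inl hx
        by_cases hk1 : k = 1
        · subst hk1
          rw [one_smul] at hk
          subst hk
          rw [hΓT y hy hxT]
        · exact absurd ⟨k, hk1, hk ▸ hxT⟩ (hVU hyV).2
      · rintro x (hx | hx) hxQ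
        · exact hTQ x (hTu ▸ Or.inl hx) hxQ
        · exact absurd hxQ (hVU (hΓV (hu ▸ Or.inl hx))).1
  have yC : IsOpen Yᶜ := by
    rw [isOpen_iff_mem_nhds]
    intro x hx
    obtain ⟨g, hg⟩ := yU x
    have : (fun y => g • y) ⁻¹' Y ∈ 𝓝 x := (yO.preimage (hS.cont g)).mem_nhds hg
    refine mem_of_superset this fun y hy hyY => hx ?_
    have hgK := yK g y hyY hy
    obtain ⟨T, b, hT, hb, hTQ⟩ := hg
    refine ⟨_, _, by simpa using hT.smul hS g⁻¹, hG.smul _ (K.inv_mem hgK) b hb, ?_⟩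
    rintro _ ⟨y, hy, rfl⟩ hyQ
    simp only [pr_smul] at hyQ ⊢
    exact hTQ y hy hyQ
  have yuniv : Y = univ := by
    have := hS.conn
    have : PreconnectedSpace X := ⟨hS.conn.isPreconnected⟩
    obtain ⟨x0, -⟩ := hS.conn.nonempty
    obtain ⟨g, hg⟩ := yU x0
    exact IsClopen.eq_univ ⟨⟨yC⟩, yO⟩ ⟨_, hg⟩
  obtain ⟨x0, -⟩ := hS.conn.nonempty
  rw [eq_top_iff]
  intro g _
  exact yK g x0 (yuniv ▸ trivial) (yuniv ▸ trivial)

end gauge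
end

noncomputable section
open Set Filter Topology

/-- upper unipotent matrix -/
def Uu (β : ℂ) : SL2C := ⟨!![1, β; 0, 1], by simp [Matrix.det_fin_two]⟩
/-- lower unipotent matrix -/
def Ll (β : ℂ) : SL2C := ⟨!![1, 0; β, 1], by simp [Matrix.det_fin_two]⟩

/-- essential pair of parabolics -/
def Ess (x y : PSL2C) : Prop := ∃ A B : SL2C, mk A = x ∧ mk B = y ∧ A.1 0 0 + A.1 1 1 = 2 ∧ B.1 0 0 + B.1 1 1 = 2 ∧
  (A * B⁻¹).1 0 0 + (A * B⁻¹).1 1 1 = -2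

lemma sl_ext {A B : SL2C} (h00 : A.1 0 0 = B.1 0 0) (h01 : A.1 0 1 = B.1 0 1) (h10 : A.1 1 0 = B.1 1 0)
    (h11 : A.1 1 1 = B.1 1 1) : A = B := by
  apply Subtype.ext; ext i j; fin_cases i <;> fin_cases j <;> assumption

lemma sl_mul (A B : SL2C) (i j : Fin 2) : (A * B).1 i j = A.1 i 0 * B.1 0 j + A.1 i 1 * B.1 1 j := by
  rw [Matrix.SpecialLinearGroup.coe_mul, Matrix.mul_apply, Fin.sum_univ_two]

lemma sl_inv (A : SL2C) : A⁻¹.1 0 0 = A.1 1 1 ∧ A⁻¹.1 0 1 = - A.1 0 1 ∧ A⁻¹.1 1 0 = - A.1 1 0 ∧ A⁻¹.1 1 1 = A.1 0 0 := by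
  rw [Matrix.SpecialLinearGroup.coe_inv, Matrix.adjugate_fin_two]; simp

lemma sl_neg (A : SL2C) (i j : Fin 2) : (-A).1 i j = - A.1 i j := by
  rw [Matrix.SpecialLinearGroup.coe_neg, Matrix.neg_apply]

/-- explicit matrix -/
def slm (a b c d : ℂ) (h : a * d - b * c = 1) : SL2C := ⟨!![a, b; c, d], by simp [Matrix.det_fin_two, h]⟩

lemma conj_of {M A B : SL2C} (h : M * A = B * M) : M * A * M⁻¹ = B := by rw [h, mul_assoc, mul_inv_cancel, mul_one]

lemma Uu_mul (a b : ℂ) : Uu a * Uu b = Uu (a + b) := by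
  apply sl_ext <;> rw [sl_mul] <;> simp [Uu]; ring

lemma Uu_zero : Uu 0 = 1 := by apply sl_ext <;> simp [Uu]

lemma Uu_inv (a : ℂ) : (Uu a)⁻¹ = Uu (-a) := by
  rw [inv_eq_iff_mul_eq_one, Uu_mul, add_neg_cancel, Uu_zero]

lemma unip_norm (A : SL2C) (h : A.1 0 0 + A.1 1 1 = 2) : ∃ (M : SL2C) (β : ℂ), M * A * M⁻¹ = Uu β := by
  have hd := sl_det A
  by_cases hc : A.1 1 0 = 0
  · refine ⟨1, A.1 0 1, ?_⟩
    have h1 : A.1 0 0 = 1 := by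
      have : (A.1 0 0 - 1) ^ 2 = 0 := by rw [hc] at hd; linear_combination A.1 0 0 * h - hd
      exact sub_eq_zero.1 (pow_eq_zero_iff two_ne_zero |>.1 this)
    simp only [one_mul, inv_one, mul_one]
    apply sl_ext <;> simp [Uu, h1, hc]
    linear_combination h - h1
  · obtain ⟨p, hp'⟩ : ∃ p, 2 * A.1 1 0 * p = A.1 0 0 - A.1 1 1 :=
      ⟨(A.1 0 0 - A.1 1 1) / (2 * A.1 1 0), by field_simp⟩
    have e1 : A.1 1 0 * p + A.1 1 1 = 1 := by linear_combination hp' / 2 + h / 2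
    refine ⟨slm 0 (-1) 1 (-p) (by ring), -A.1 1 0, conj_of ?_⟩
    apply sl_ext <;> rw [sl_mul, sl_mul] <;> simp [Uu, slm]
    · linear_combination -e1
    · linear_combination h - e1
    · apply mul_left_cancel₀ hc; linear_combination -hd + A.1 1 1 * h + (1 - A.1 1 1) * e1

lemma par_tr {g : PSL2C} (h : Par g) {A : SL2C} (hA : mk A = g) : A.1 0 0 + A.1 1 1 = 2 ∨ A.1 0 0 + A.1 1 1 = -2 := by
  obtain ⟨B, hB, hB2⟩ := h
  rcases mk_eq_iff.1 (hA.trans hB.symm) with rfl | rfl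
  · exact Or.inl hB2
  · right; rw [sl_neg, sl_neg]; linear_combination -hB2

lemma tr_conj (M A : SL2C) : (M * A * M⁻¹).1 0 0 + (M * A * M⁻¹).1 1 1 = A.1 0 0 + A.1 1 1 := by
  obtain ⟨h1, h2, h3, h4⟩ := sl_inv M
  have := sl_det M
  simp only [sl_mul, h1, h2, h3, h4]
  linear_combination (A.1 0 0 + A.1 1 1) * this

lemma par_conj {g : PSL2C} (h : PSL2C) (hg : Par g) : Par (h * g * h⁻¹) := by
  obtain ⟨A, rfl, hA⟩ := hg
  obtain ⟨M, rfl⟩ := exists_mk h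
  exact ⟨M * A * M⁻¹, rfl, by rw [tr_conj, hA]⟩

lemma ess_norm {x y : PSL2C} (h : Ess x y) : ∃ M : PSL2C, M * x * M⁻¹ = mk (Uu 2) ∧ M * y * M⁻¹ = mk (Ll 2) := by
  obtain ⟨A, B, rfl, rfl, hA, hB, hAB⟩ := h
  obtain ⟨M, β, hM⟩ := unip_norm A hA
  obtain ⟨B', hB'⟩ : ∃ B', B' = M * B * M⁻¹ := ⟨_, rfl⟩
  have t1 : B'.1 0 0 + B'.1 1 1 = 2 := by rw [hB', tr_conj, hB]
  have t2 : (Uu β * B'⁻¹).1 0 0 + (Uu β * B'⁻¹).1 1 1 = -2 := by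
    rw [← hAB, ← tr_conj M (A * B⁻¹), ← hM, hB']
    congr 2 <;> group
  obtain ⟨h1, h2, h3, h4⟩ := sl_inv B'
  have hbc : β * B'.1 1 0 = 4 := by
    rw [sl_mul, sl_mul, h1, h2, h3, h4] at t2
    simp [Uu] at t2
    linear_combination t1 - t2
  have hd := sl_det B'
  have hβ : β ≠ 0 := by rintro rfl; simp at hbc
  have hc : B'.1 1 0 ≠ 0 := by intro h; rw [h] at hbc; simp at hbc
  obtain ⟨p, hp'⟩ : ∃ p, 2 * B'.1 1 0 * p = B'.1 0 0 - B'.1 1 1 :=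
    ⟨(B'.1 0 0 - B'.1 1 1) / (2 * B'.1 1 0), by field_simp⟩
  obtain ⟨l, hl⟩ : ∃ l : ℂ, 2 / β = l ^ 2 := by
    obtain ⟨l, hl⟩ := Complex.isSquare (2 / β); exact ⟨l, by rw [hl, sq]⟩
  have hl' : l ^ 2 * β = 2 := by rw [← hl]; field_simp
  have hl0 : l ≠ 0 := by rintro rfl; simp at hl'
  have e1 : B'.1 1 0 * p + B'.1 1 1 = 1 := by linear_combination hp' / 2 + t1 / 2
  have hcl : B'.1 1 0 = 2 * l ^ 2 := by apply mul_left_cancel₀ hβ; linear_combination hbc - 2 * hl'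
  set N : SL2C := slm l (-l * p) 0 l⁻¹ (by field_simp; ring) with hN
  have k1 : N * Uu β * N⁻¹ = Uu 2 := by
    apply conj_of
    apply sl_ext <;> rw [sl_mul, sl_mul] <;> simp [Uu, slm, hN]
    · field_simp; linear_combination hl'
  have k2 : N * B' * N⁻¹ = Ll 2 := by
    apply conj_of
    clear hB'
    apply sl_ext <;> simp only [sl_mul] <;> simp [Ll, slm, hN]
    · linear_combination l * t1 - l * e1
    · apply mul_left_cancel₀ hc; linear_combination l * (-hd + B'.1 1 1 * t1 + (1 - B'.1 1 1) * e1)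
    · field_simp; linear_combination hcl
    · field_simp; linear_combination e1 - p * hcl
  refine ⟨mk N * mk M, ?_, ?_⟩
  · rw [← k1, ← hM]; simp only [mk_mul, mk_inv]; group
  · rw [← k2, hB']; simp only [mk_mul, mk_inv]; group

lemma ess_swap {x y : PSL2C} (h : Ess x y) : Ess y x := by
  obtain ⟨A, B, rfl, rfl, hA, hB, hAB⟩ := h
  refine ⟨B, A, rfl, rfl, hB, hA, ?_⟩
  obtain ⟨h1, h2, h3, h4⟩ := sl_inv A
  obtain ⟨k1, k2, k3, k4⟩ := sl_inv B
  simp only [sl_mul, h1, h2, h3, h4, k1, k2, k3, k4] at hAB ⊢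
  linear_combination hAB

lemma ess_rot {x y : PSL2C} (h : Ess x y) : Ess (x * y⁻¹) y⁻¹ := by
  obtain ⟨A, B, rfl, rfl, hA, hB, hAB⟩ := h
  obtain ⟨k1, k2, k3, k4⟩ := sl_inv B
  refine ⟨-(A * B⁻¹), B⁻¹, by rw [mk_neg]; rfl, rfl, ?_, ?_, ?_⟩
  · rw [sl_neg, sl_neg]; linear_combination -hAB
  · rw [k1, k4]; linear_combination hB
  · rw [inv_inv, show -(A * B⁻¹) * B = -A by rw [neg_mul, mul_assoc, inv_mul_cancel, mul_one], sl_neg, sl_neg]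
    linear_combination -hA

lemma k4 {x y z : PSL2C} (h : Ess x y) (h1 : Par z) (h2 : Par (z * y)) (h3 : Par (z * x⁻¹))
    (h4 : Par (z * y * x⁻¹)) : z = 1 ∨ z = x * y⁻¹ := by
  obtain ⟨M, hx, hy⟩ := ess_norm h
  obtain ⟨Z, hZ, hZt⟩ := par_conj M h1
  have p2 := par_tr (par_conj M h2) (A := Z * Ll 2) (by rw [mk_mul, hZ, ← hy]; group)
  have p3 := par_tr (par_conj M h3) (A := Z * Uu (-2)) (by
    rw [mk_mul, hZ, ← Uu_inv, mk_inv, ← hx]; group)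
  have p4 := par_tr (par_conj M h4) (A := Z * Ll 2 * Uu (-2)) (by
    rw [mk_mul, mk_mul, hZ, ← Uu_inv, mk_inv, ← hx, ← hy]; group)
  have hd := sl_det Z
  simp only [sl_mul] at p2 p3 p4
  simp [Uu, Ll] at p2 p3 p4
  have hb : Z.1 0 1 = 0 ∨ Z.1 0 1 = -2 := by
    rcases p2 with h | h
    · left; linear_combination h / 2 - hZt / 2
    · right; linear_combination h / 2 - hZt / 2
  have hc : Z.1 1 0 = 0 ∨ Z.1 1 0 = 2 := by
    rcases p3 with h | h
    · left; linear_combination -h / 2 + hZt / 2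
    · right; linear_combination -h / 2 + hZt / 2
  have back : ∀ W : SL2C, Z = W → z = M⁻¹ * mk W * M := by
    rintro W rfl; rw [hZ]; group
  have hdd : (Z.1 1 1 - 1) ^ 2 = - (Z.1 0 1 * Z.1 1 0) := by linear_combination Z.1 1 1 * hZt - hd
  by_cases h0 : Z.1 0 1 * Z.1 1 0 = 0
  · have d1 : Z.1 1 1 = 1 := by
      rw [h0, neg_zero] at hdd; exact sub_eq_zero.1 (pow_eq_zero_iff two_ne_zero |>.1 hdd)
    have a1 : Z.1 0 0 = 1 := by linear_combination hZt - d1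
    rw [a1, d1] at p4
    rcases hb with hb | hb <;> rcases hc with hc | hc <;> rw [hb, hc] at p4 h0
    · left
      have : Z = 1 := by apply sl_ext <;> simp [hb, hc, a1, d1]
      rw [back _ this, mk_one]; group
    · norm_num at p4
    · norm_num at p4
    · norm_num at h0
  · have hb' : Z.1 0 1 = -2 := by rcases hb with h | h; · simp [h] at h0
                                  · exact h
    have hc' : Z.1 1 0 = 2 := by rcases hc with h | h; · simp [h] at h0
                                 · exact h
    rw [hb', hc'] at hdd p4
    have : (Z.1 1 1 - 3) * (Z.1 1 1 + 1) = 0 := by linear_combination hdd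
    have a1 : Z.1 0 0 = 2 - Z.1 1 1 := by linear_combination hZt
    rcases mul_eq_zero.1 this with h | h
    · have h3 : Z.1 1 1 = 3 := by linear_combination h
      rw [a1, h3] at p4; norm_num at p4
    · have h3 : Z.1 1 1 = -1 := by linear_combination h
      right
      have e : Z = -(Uu 2 * (Ll 2)⁻¹) := by
        obtain ⟨k1, k2, k3, k4⟩ := sl_inv (Ll 2)
        apply sl_ext <;> rw [sl_neg, sl_mul] <;> simp only [k1, k2, k3, k4] <;> simp [Uu, Ll, a1, h3, hb', hc'] <;> norm_num
      rw [back _ e, mk_neg, mk_mul, mk_inv, ← hx, ← hy]; group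

/-- no essential pair: unipotent with the same fixed point -/
lemma unip_or_ess {M : PSL2C} {β : ℂ} (hβ : β ≠ 0) {x g : PSL2C} (hx : M * x * M⁻¹ = mk (Uu β)) (hg : Par g)
    (hgx : Par (g * x⁻¹)) : Ess g x ∨ ∃ b, M * g * M⁻¹ = mk (Uu b) := by
  obtain ⟨A, hA, hAt⟩ := par_conj M hg
  have p2 := par_tr (par_conj M hgx) (A := A * (Uu β)⁻¹) (by rw [mk_mul, mk_inv, hA, ← hx]; group)
  rcases p2 with h | h
  · right
    rw [Uu_inv] at h
    simp only [sl_mul] at h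
    simp [Uu] at h
    have hc : A.1 1 0 = 0 := by
      have : A.1 1 0 * β = 0 := by linear_combination hAt - h
      exact (mul_eq_zero.1 this).resolve_right hβ
    have hd := sl_det A
    have h1 : A.1 0 0 = 1 := by
      have : (A.1 0 0 - 1) ^ 2 = 0 := by rw [hc] at hd; linear_combination A.1 0 0 * hAt - hd
      exact sub_eq_zero.1 (pow_eq_zero_iff two_ne_zero |>.1 this)
    refine ⟨A.1 0 1, ?_⟩
    rw [← hA]; congr 1
    apply sl_ext <;> simp [Uu, hc, h1]
    linear_combination hAt - h1
  · left
    obtain ⟨N, rfl⟩ := exists_mk M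
    refine ⟨N⁻¹ * A * N, N⁻¹ * Uu β * N, ?_, ?_, ?_, ?_, ?_⟩
    · rw [mk_mul, mk_mul, mk_inv, hA]; group
    · rw [mk_mul, mk_mul, mk_inv, ← hx]; group
    · have := tr_conj N⁻¹ A; rw [inv_inv] at this; rw [this, hAt]
    · have := tr_conj N⁻¹ (Uu β); rw [inv_inv] at this; rw [this]; simp [Uu]; norm_num
    · have := tr_conj N⁻¹ (A * (Uu β)⁻¹); rw [inv_inv] at this; rw [← h, ← this]
      congr 2 <;> group
end

noncomputable section
open Set Filter Topology
set_option linter.unusedSectionVars false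

variable {X : Type*} [TopologicalSpace X] {H : Type*} [Group H] [MulAction H X]

lemma gauge_mk (hS : Surf H X) {K : Subgroup H} (C : Set X)
    (hcl : ∀ P : Set H, IsClosed {x : X | ∃ k ∈ P, k • x ∈ C})
    (two : ∀ s : X, ∃ x ∈ C, pr H x ≠ pr H s)
    (mem : ∀ (g : H) (x : X), x ∈ C → g • x ∈ C → g ∈ K)
    (ear : ∀ (B : Set X) (b c : X) (g : H), b ∈ C → c ∈ C → J H B b (g • c) → pr H b ≠ pr H c →
      (∀ x ∈ B, pr H x ∈ pr H '' C → pr H x = pr H b ∨ pr H x = pr H c) → g ∈ K) : K = ⊤ := by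
  set Θ : Set X := {x | ∃ k ∈ K, k • x ∈ C} with hΘ
  have hCΘ : C ⊆ Θ := fun x hx => ⟨1, K.one_mem, by simpa⟩
  have him : pr H '' Θ = pr H '' C := by
    apply subset_antisymm
    · rintro _ ⟨x, ⟨k, -, hk⟩, rfl⟩; exact ⟨_, hk, pr_smul k x⟩
    · exact image_mono hCΘ
  refine gauge_top hS (Θ := Θ) ⟨?_, ?_, ?_, ?_, ?_, ?_⟩
  · rw [him]
    convert hcl univ using 1
    ext x; constructor
    · rintro ⟨c, hc, h⟩; obtain ⟨g, hg⟩ := pr_eq.1 h; exact ⟨g, trivial, by rwa [hg]⟩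
    · rintro ⟨g, -, hg⟩; exact ⟨_, hg, pr_smul g x⟩
  · intro s; obtain ⟨x, hx, h⟩ := two s; exact ⟨x, hCΘ hx, h⟩
  · rintro k hk x ⟨k', hk', hx⟩
    exact ⟨k' * k⁻¹, K.mul_mem hk' (K.inv_mem hk), by rwa [mul_smul, inv_smul_smul]⟩
  · rintro g x ⟨k, hk, hx⟩ ⟨l, hl, hx'⟩
    have := mem (l * g * k⁻¹) (k • x) hx (by rwa [mul_smul, mul_smul, inv_smul_smul])
    have h2 := K.mul_mem (K.mul_mem (K.inv_mem hl) this) hk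
    simpa [mul_assoc] using h2
  · rintro x ⟨k, hk, hx⟩
    refine ⟨_, (hcl {k | k ∉ K}).isOpen_compl.mem_nhds ?_, ?_⟩
    · rintro ⟨l, hl, hlx⟩
      apply hl
      have := mem (l * k⁻¹) (k • x) hx (by rwa [mul_smul, inv_smul_smul])
      simpa using K.mul_mem this hk
    · intro y hy hyC
      rw [him] at hyC
      obtain ⟨c, hc, h⟩ := hyC
      obtain ⟨g, rfl⟩ := pr_eq.1 h
      by_contra hn
      exact hy ⟨g, fun hg => hn ⟨g, hg, hc⟩, hc⟩
  · rintro B b c hB ⟨k, hk, hb⟩ hc hbc hBC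
    rw [him] at hc hBC
    obtain ⟨c', hc', h⟩ := hc
    obtain ⟨g, rfl⟩ := pr_eq.1 h.symm
    have := ear _ (k • b) c' (k * g) hb hc' (by rw [mul_smul]; exact hB.smul hS k)
      (by rw [pr_smul]; rwa [pr_smul] at hbc) (by
        rintro _ ⟨x, hx, rfl⟩ hxC
        simp only [pr_smul] at hxC ⊢
        simpa [pr_smul] using hBC x hx hxC)
    have hg : g ∈ K := by simpa using K.mul_mem (K.inv_mem hk) this
    exact ⟨g⁻¹, K.inv_mem hg, by simpa⟩

/-- group elements represented by simple cycles -/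
def Cyc (X : Type*) {H : Type*} [TopologicalSpace X] [Group H] [MulAction H X] (h : H) : Prop :=
  ∃ (A B : Set X) (a b : X), J H A a b ∧ J H B b (h • a) ∧ pr H a ≠ pr H b ∧
    ∀ x ∈ A, ∀ y ∈ B, pr H x = pr H y → pr H x = pr H a ∨ pr H x = pr H b

lemma cyc_of (hS : Surf H X) {A B : Set X} {u v : X} {s t : H} (hA : J H A u (s • v)) (hB : J H B u (t • v))
    (huv : pr H u ≠ pr H v) (hAB : ∀ x ∈ A, ∀ y ∈ B, pr H x = pr H y → pr H x = pr H u ∨ pr H x = pr H v) :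
    Cyc X (s * t⁻¹) := by
  refine ⟨A, _, u, s • v, hA, by simpa [mul_smul] using (hB.smul hS (s * t⁻¹)).symm, by rwa [pr_smul], ?_⟩
  rintro x hx _ ⟨y, hy, rfl⟩ hxy
  simp only [pr_smul] at hxy ⊢
  exact hAB x hx y hy hxy

lemma J.sub {Γ : Set X} {a b p q : X} (h : J H Γ a b) (hp : p ∈ Γ) (hq : q ∈ Γ) : ∃ Γ' ⊆ Γ, J H Γ' p q := by
  obtain ⟨Γ1, Γ2, h1, h2, rfl, -⟩ := h.split hp
  rcases hq with hq | hq
  · obtain ⟨Δ1, Δ2, -, h3, rfl, -⟩ := h1.split hq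
    exact ⟨Δ2, fun x hx => Or.inl (Or.inr hx), h3.symm⟩
  · obtain ⟨Δ1, Δ2, h3, -, rfl, -⟩ := h2.split hq
    exact ⟨Δ1, fun x hx => Or.inr (Or.inl hx), h3⟩

lemma J.mid {Γ : Set X} {a b : X} (h : J H Γ a b) (hne : a ≠ b) : ∃ m ∈ Γ, pr H m ≠ pr H a ∧ pr H m ≠ pr H b := by
  obtain ⟨γ, hc, hi, rfl, rfl, rfl⟩ := h.reparam hne
  refine ⟨γ (1/2), ⟨1/2, by norm_num, rfl⟩, fun h => ?_, fun h => ?_⟩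
  · have := hi (by norm_num) (by norm_num) h; norm_num at this
  · have := hi (by norm_num) (by norm_num) h; norm_num at this

lemma surf_nontriv (hS : Surf H X) : ∃ (Γ : Set X) (a b : X), J H Γ a b ∧ a ≠ b := by
  obtain ⟨e, he⟩ := hS.emb
  obtain ⟨x, -⟩ := hS.conn.nonempty
  obtain ⟨V, hV, hxV, -, hVi, h⟩ := local_chord hS (x := x) (univ_mem)
  have ho := he.isOpenMap _ hV
  obtain ⟨ε, hε, hb⟩ := Metric.isOpen_iff.1 ho (e x) ⟨x, hxV, rfl⟩
  obtain ⟨y, hy, hye⟩ := hb (show e x + (ε / 2 : ℝ) ∈ _ by simp [abs_of_pos hε, hε])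
  obtain ⟨Γ, -, hΓ⟩ := h x hxV y hy
  refine ⟨Γ, x, y, hΓ, ?_⟩
  rintro rfl
  have : ((ε / 2 : ℝ) : ℂ) = 0 := by linear_combination -hye
  rw [Complex.ofReal_eq_zero] at this
  linarith

lemma case0 (hS : Surf H X) (h0 : ∀ h : H, Cyc X h → h = 1) : ∀ h : H, h = 1 := by
  obtain ⟨Γ, a, b, hΓ, hab⟩ := surf_nontriv hS
  have : (⊥ : Subgroup H) = ⊤ := by
    refine gauge_mk hS Γ (fun P => closed_sat hS P hΓ.compact) ?_ ?_ ?_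
    · intro s
      by_contra! hh
      exact hab (hΓ.injOn hΓ.left hΓ.right ((hh a hΓ.left).trans (hh b hΓ.right).symm))
    · intro g x hx hgx
      have := hΓ.injOn hgx hx (pr_smul g x)
      exact Subgroup.mem_bot.2 (hS.free _ _ this)
    · intro B p q g hp hq hB hpq hBΓ
      obtain ⟨Γ', hsub, hΓ'⟩ := hΓ.sub hp hq
      have := h0 _ (cyc_of hS (t := 1) hB (by rwa [one_smul]) hpq
        (fun x hx y hy hxy => hBΓ x hx ⟨y, hsub hy, hxy.symm⟩))
      simpa using this
  intro h
  exact Subgroup.mem_bot.1 (this ▸ Subgroup.mem_top h)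

lemma cyc_line (hS : Surf H X) {h : H} (hh : Cyc X h) : ∃ γ : ℝ → X, Continuous γ ∧ (∀ t, γ (t + 1) = h • γ t) ∧
    ∀ s t, pr H (γ s) = pr H (γ t) → ∃ n : ℤ, s - t = n := by
  obtain ⟨A, B, a, b, hA, hB, hab, hAB⟩ := hh
  have hne : a ≠ b := fun h => hab (by rw [h])
  have hne' : b ≠ h • a := fun h => hab (by rw [h, pr_smul])
  obtain ⟨α, αc, αi, α0, α1, rfl⟩ := hA.reparam hne
  obtain ⟨β, βc, βi, β0, β1, rfl⟩ := hB.reparam hne'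
  clear hA hB
  set δ : ℝ → X := fun r => if r ≤ 1/2 then α (2 * r) else β (2 * r - 1) with hδ
  have d1 : ∀ r ≤ 1/2, δ r = α (2 * r) := fun r hr => if_pos hr
  have d2 : ∀ r, 1/2 ≤ r → δ r = β (2 * r - 1) := by
    intro r hr
    rcases hr.lt_or_eq with hr | hr
    · exact if_neg (not_le.2 hr)
    · rw [d1 r hr.ge, ← hr]; norm_num [α1, β0]
  have dc : ContinuousOn δ (Icc 0 1) := by
    have : Icc (0:ℝ) 1 = Icc 0 (1/2) ∪ Icc (1/2) 1 := (Icc_union_Icc_eq_Icc (by norm_num) (by norm_num)).symm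
    rw [this]
    apply ContinuousOn.union_of_isClosed _ _ isClosed_Icc isClosed_Icc
    · refine (αc.comp (f := fun r : ℝ => 2 * r) (by fun_prop) ?_).congr (fun r hr => d1 r hr.2)
      intro r hr; simp only [mem_Icc] at hr ⊢; constructor <;> linarith
    · refine (βc.comp (f := fun r : ℝ => 2 * r - 1) (by fun_prop) ?_).congr (fun r hr => d2 r hr.1)
      intro r hr; simp only [mem_Icc] at hr ⊢; constructor <;> linarith
  have e0 : δ 0 = a := by rw [d1 0 (by norm_num)]; simpa
  have e1 : δ 1 = h • a := by rw [d2 1 (by norm_num)]; norm_num; exact β1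
  have dia : ∀ r ∈ Ico (0:ℝ) 1, ∀ s ∈ Ico (0:ℝ) 1, r ≤ s → pr H (δ r) = pr H (δ s) → r = s := by
    intro r hr s hs hrs hh
    simp only [mem_Ico] at hr hs
    rcases le_total s (1/2) with h1 | h1
    · rw [d1 _ h1, d1 _ (by linarith)] at hh
      have := αi (x₁ := 2 * r) (x₂ := 2 * s) ⟨by linarith, by linarith⟩ ⟨by linarith, by linarith⟩ hh
      linarith
    rcases le_total (1/2) r with h2 | h2
    · rw [d2 _ h1, d2 _ (by linarith)] at hh
      have := βi (x₁ := 2 * r - 1) (x₂ := 2 * s - 1) ⟨by linarith, by linarith⟩ ⟨by linarith, by linarith⟩ hh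
      linarith
    rw [d2 _ h1, d1 _ h2] at hh
    rcases hAB _ ⟨2 * r, ⟨by linarith, by linarith⟩, rfl⟩ _ ⟨2 * s - 1, ⟨by linarith, by linarith⟩, rfl⟩ hh with h3 | h3
    · have := βi (x₁ := 2 * s - 1) (x₂ := 1) ⟨by linarith, by linarith⟩ ⟨by linarith, by linarith⟩
        (by show pr H _ = pr H _; rw [← hh, h3, β1, pr_smul])
      linarith
    · have := βi (x₁ := 2 * s - 1) (x₂ := 0) ⟨by linarith, by linarith⟩ ⟨by linarith, by linarith⟩
        (by show pr H _ = pr H _; rw [← hh, h3, β0])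
      have := αi (x₁ := 2 * r) (x₂ := 1) ⟨by linarith, by linarith⟩ ⟨by linarith, by linarith⟩
        (by show pr H _ = pr H _; rw [h3, α1])
      linarith
  set γ : ℝ → X := fun t => h ^ ⌊t⌋ • δ (Int.fract t) with hγ
  have gn : ∀ (n : ℤ) t, t ∈ Icc (n : ℝ) (n + 1) → γ t = h ^ n • δ (t - n) := by
    intro n t ht
    rcases ht.2.lt_or_eq with h1 | h1
    · have : ⌊t⌋ = n := Int.floor_eq_iff.2 ⟨ht.1, h1⟩
      simp only [hγ, Int.fract, this]
    · have h2 : t = ((n + 1 : ℤ) : ℝ) := by push_cast; exact h1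
      have h3 : t - n = 1 := by linarith
      rw [h3, e1]
      simp only [hγ, h2, Int.floor_intCast, Int.fract_intCast, e0]
      rw [zpow_add_one, mul_smul]
  refine ⟨γ, ?_, ?_, ?_⟩
  · have lf : LocallyFinite (fun n : ℤ => Icc (n : ℝ) (n + 1)) := by
      intro x
      refine ⟨Ioo (x - 1) (x + 1), Ioo_mem_nhds (by linarith) (by linarith), ?_⟩
      refine (finite_Icc (⌊x⌋ - 2) (⌊x⌋ + 2)).subset ?_
      rintro n ⟨y, hy1, hy2⟩
      simp only [mem_Icc, mem_Ioo] at hy1 hy2 ⊢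
      have := Int.floor_le x; have := Int.lt_floor_add_one x
      constructor
      · have : ((⌊x⌋ - 2 : ℤ) : ℝ) ≤ n := by push_cast; linarith
        exact_mod_cast this
      · have : (n : ℝ) ≤ ((⌊x⌋ + 2 : ℤ) : ℝ) := by push_cast; linarith
        exact_mod_cast this
    refine lf.continuous ?_ (fun n => isClosed_Icc) (fun n => ?_)
    · rw [eq_univ_iff_forall]; intro x
      exact mem_iUnion.2 ⟨⌊x⌋, Int.floor_le x, (Int.lt_floor_add_one x).le⟩
    · refine ContinuousOn.congr ?_ (gn n)
      refine (hS.cont (h ^ n)).comp_continuousOn (dc.comp (f := fun t : ℝ => t - n) (by fun_prop) ?_)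
      intro r hr; simp only [mem_Icc] at hr ⊢; constructor <;> linarith
  · intro t
    simp only [hγ, Int.floor_add_one, Int.fract_add_one]
    rw [zpow_add_one, mul_smul, smul_smul, smul_smul, (Commute.self_zpow h _).eq.symm]
  · intro s t hst
    simp only [hγ, pr_smul] at hst
    have : Int.fract s = Int.fract t := by
      have m1 : Int.fract s ∈ Ico (0:ℝ) 1 := ⟨Int.fract_nonneg s, Int.fract_lt_one s⟩
      have m2 : Int.fract t ∈ Ico (0:ℝ) 1 := ⟨Int.fract_nonneg t, Int.fract_lt_one t⟩
      rcases le_total (Int.fract s) (Int.fract t) with h | h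
      · exact dia _ m1 _ m2 h hst
      · exact (dia _ m2 _ m1 h hst.symm).symm
    rw [Int.fract_eq_fract] at this
    exact this
end

noncomputable section
open Set Filter Topology
set_option linter.unusedSectionVars false

variable {X : Type*} [TopologicalSpace X] {H : Type*} [Group H] [MulAction H X]

/-- essential theta graph -/
structure Theta (ρ : H →* PSL2C) (P Q R : Set X) (u v : X) (p q r : H) : Prop where
  hP : J H P u (p • v)
  hQ : J H Q u (q • v)
  hR : J H R u (r • v)
  ne : pr H u ≠ pr H v
  pq : ∀ x ∈ P, ∀ y ∈ Q, pr H x = pr H y → pr H x = pr H u ∨ pr H x = pr H v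
  pr' : ∀ x ∈ P, ∀ y ∈ R, pr H x = pr H y → pr H x = pr H u ∨ pr H x = pr H v
  qr : ∀ x ∈ Q, ∀ y ∈ R, pr H x = pr H y → pr H x = pr H u ∨ pr H x = pr H v
  ess : Ess (ρ (p * r⁻¹)) (ρ (q * r⁻¹))

variable {ρ : H →* PSL2C} {P Q R : Set X} {u v : X} {p q r : H} {K : Subgroup H}

lemma Theta.swap12 (h : Theta ρ P Q R u v p q r) : Theta ρ Q P R u v q p r where
  hP := h.hQ
  hQ := h.hP
  hR := h.hR
  ne := h.ne
  pq := fun x hx y hy hxy => hxy ▸ h.pq y hy x hx hxy.symm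
  pr' := h.qr
  qr := h.pr'
  ess := ess_swap h.ess

lemma Theta.swap23 (h : Theta ρ P Q R u v p q r) : Theta ρ P R Q u v p r q where
  hP := h.hP
  hQ := h.hR
  hR := h.hQ
  ne := h.ne
  pq := h.pr'
  pr' := h.pq
  qr := fun x hx y hy hxy => hxy ▸ h.qr y hy x hx hxy.symm
  ess := by
    have := ess_rot h.ess
    rw [← map_inv, ← map_mul] at this
    simpa using this

lemma sm_mem {S : Set X} {g : H} {y : X} (h : y ∈ (g • ·) '' S) : ∃ y' ∈ S, pr H y = pr H y' := by
  obtain ⟨y', hy', rfl⟩ := h; exact ⟨y', hy', pr_smul g y'⟩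

lemma ear_diff (hS : Surf H X) (hC : ∀ h : H, Cyc X h → Par (ρ h)) (hρ : Function.Injective ρ)
    (hT : Theta ρ P Q R u v p q r) (hpr : p * r⁻¹ ∈ K) (hqr : q * r⁻¹ ∈ K)
    {D : Set X} {w w' : X} {z : H} (hw : w ∈ P) (hw' : w' ∈ Q)
    (hwu : pr H w ≠ pr H u) (hwv : pr H w ≠ pr H v) (hwu' : pr H w' ≠ pr H u) (hwv' : pr H w' ≠ pr H v)
    (hD : J H D w (z • w'))
    (hDC : ∀ x ∈ D, pr H x ∈ pr H '' (P ∪ Q ∪ R) → pr H x = pr H w ∨ pr H x = pr H w') : z ∈ K := by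
  obtain ⟨A1, A2, a1, a2, rfl, hA⟩ := hT.hP.split hw
  obtain ⟨B1, B2, b1, b2, rfl, hB⟩ := hT.hQ.split hw'
  have ww' : pr H w ≠ pr H w' := fun h => by rcases hT.pq w hw w' hw' h with h | h <;> contradiction
  have A1v : ∀ x ∈ A1, pr H x ≠ pr H v := fun x hx h =>
    hwv (by have := (hA x hx _ a2.right (by rw [h, pr_smul])).2; rw [← this, pr_smul])
  have A2u : ∀ x ∈ A2, pr H x ≠ pr H u := fun x hx h =>
    hwu (by have := (hA _ a1.left x hx h.symm).1; rw [← this])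
  have B1v : ∀ x ∈ B1, pr H x ≠ pr H v := fun x hx h =>
    hwv' (by have := (hB x hx _ b2.right (by rw [h, pr_smul])).2; rw [← this, pr_smul])
  have B2u : ∀ x ∈ B2, pr H x ≠ pr H u := fun x hx h =>
    hwu' (by have := (hB _ b1.left x hx h.symm).1; rw [← this])
  have key : ∀ (t : H) (E : Set X), J H E w (t • w') → (∀ x ∈ E, pr H x ∈ pr H '' ((A1 ∪ A2) ∪ (B1 ∪ B2) ∪ R)) →
      Par (ρ (z * t⁻¹)) := by
    intro t E hE hEs
    refine hC _ (cyc_of hS hD hE ww' ?_)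
    intro x hx y hy hxy
    exact hDC x hx (hxy ▸ hEs y hy)
  have sA1 : ∀ x ∈ A1, pr H x ∈ pr H '' ((A1 ∪ A2) ∪ (B1 ∪ B2) ∪ R) := fun x hx => ⟨x, by simp [hx], rfl⟩
  have sA2 : ∀ x ∈ A2, pr H x ∈ pr H '' ((A1 ∪ A2) ∪ (B1 ∪ B2) ∪ R) := fun x hx => ⟨x, by simp [hx], rfl⟩
  have sB1 : ∀ x ∈ B1, pr H x ∈ pr H '' ((A1 ∪ A2) ∪ (B1 ∪ B2) ∪ R) := fun x hx => ⟨x, by simp [hx], rfl⟩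
  have sB2 : ∀ x ∈ B2, pr H x ∈ pr H '' ((A1 ∪ A2) ∪ (B1 ∪ B2) ∪ R) := fun x hx => ⟨x, by simp [hx], rfl⟩
  have sR : ∀ x ∈ R, pr H x ∈ pr H '' ((A1 ∪ A2) ∪ (B1 ∪ B2) ∪ R) := fun x hx => ⟨x, by simp [hx], rfl⟩
  have sm : ∀ (S : Set X) (g : H), (∀ x ∈ S, pr H x ∈ pr H '' ((A1 ∪ A2) ∪ (B1 ∪ B2) ∪ R)) →
     ∀ x ∈ (g • ·) '' S, pr H x ∈ pr H '' ((A1 ∪ A2) ∪ (B1 ∪ B2) ∪ R) := by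
    intro S g hS x hx
    obtain ⟨y, hy, h⟩ := sm_mem hx
    rw [h]; exact hS y hy
  have su : ∀ (S T : Set X), (∀ x ∈ S, pr H x ∈ pr H '' ((A1 ∪ A2) ∪ (B1 ∪ B2) ∪ R)) →
     (∀ x ∈ T, pr H x ∈ pr H '' ((A1 ∪ A2) ∪ (B1 ∪ B2) ∪ R)) →
     ∀ x ∈ S ∪ T, pr H x ∈ pr H '' ((A1 ∪ A2) ∪ (B1 ∪ B2) ∪ R) := by
    rintro S T hS hT x (hx | hx)
    · exact hS x hx
    · exact hT x hx
  have p1 : J H (A1 ∪ B1) w ((1 : H) • w') := by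
    rw [one_smul]
    refine a1.symm.concat b1 fun x hx y hy hxy => ?_
    exact (hT.pq x (Or.inl hx) y (Or.inl hy) hxy).resolve_right (A1v x hx)
  have p2 : J H (A2 ∪ ((p * q⁻¹) • ·) '' B2) w ((p * q⁻¹) • w') := by
    refine a2.concat (by simpa [mul_smul] using (b2.smul hS (p * q⁻¹)).symm) fun x hx y hy hxy => ?_
    obtain ⟨y', hy', h⟩ := sm_mem hy
    rw [pr_smul]
    exact (hT.pq x (Or.inr hx) y' (Or.inr hy') (hxy.trans h)).resolve_left (A2u x hx)
  have p3 : J H (A1 ∪ R ∪ ((r * q⁻¹) • ·) '' B2) w ((r * q⁻¹) • w') := by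
    refine (a1.symm.concat hT.hR fun x hx y hy hxy => ?_).concat
      (by simpa [mul_smul] using (b2.smul hS (r * q⁻¹)).symm) fun x hx y hy hxy => ?_
    · exact (hT.pr' x (Or.inl hx) y hy hxy).resolve_right (A1v x hx)
    · obtain ⟨y', hy', h⟩ := sm_mem hy
      rw [pr_smul]
      rcases hx with hx | hx
      · exact (hT.pq x (Or.inl hx) y' (Or.inr hy') (hxy.trans h)).resolve_left
          (by rw [hxy, h]; exact B2u y' hy')
      · rw [hxy, h]
        exact (hT.qr y' (Or.inr hy') x hx (hxy.trans h).symm).resolve_left (B2u y' hy')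
  have p4 : J H (A2 ∪ ((p * r⁻¹) • ·) '' R ∪ ((p * r⁻¹) • ·) '' B1) w ((p * r⁻¹) • w') := by
    refine (a2.concat (c := (p * r⁻¹) • u) (by simpa [mul_smul] using (hT.hR.smul hS (p * r⁻¹)).symm) fun x hx y hy hxy => ?_).concat
      (b1.smul hS (p * r⁻¹)) fun x hx y hy hxy => ?_
    · obtain ⟨y', hy', h⟩ := sm_mem hy
      rw [pr_smul]
      exact (hT.pr' x (Or.inr hx) y' hy' (hxy.trans h)).resolve_left (A2u x hx)
    · obtain ⟨y', hy', h⟩ := sm_mem hy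
      rw [pr_smul]
      rcases hx with hx | hx
      · exact (hT.pq x (Or.inr hx) y' (Or.inl hy') (hxy.trans h)).resolve_right
          (by rw [hxy, h]; exact B1v y' hy')
      · obtain ⟨x', hx', h'⟩ := sm_mem hx
        rw [hxy, h]
        exact (hT.qr y' (Or.inl hy') x' hx' (h'.symm.trans (hxy.trans h)).symm).resolve_right (B1v y' hy')
  have e1 := key _ _ p1 (su _ _ sA1 sB1)
  have e2 := key _ _ p2 (su _ _ sA2 (sm _ _ sB2))
  have e3 := key _ _ p3 (su _ _ (su _ _ sA1 sR) (sm _ _ sB2))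
  have e4 := key _ _ p4 (su _ _ (su _ _ sA2 (sm _ _ sR)) (sm _ _ sB1))
  have := k4 (z := ρ z) hT.ess (by simpa using e1) (by simpa using e3) (by simpa using e4)
    (by rw [← map_inv, ← map_mul, ← map_mul]; convert e2 using 2; group)
  rcases this with h | h
  · have : z = 1 := hρ (by rw [h, map_one])
    rw [this]; exact K.one_mem
  · have : z = p * r⁻¹ * (q * r⁻¹)⁻¹ := hρ (by rw [h, map_mul _ (p * r⁻¹), map_inv _ (q * r⁻¹)])
    rw [this]; exact K.mul_mem hpr (K.inv_mem hqr)

lemma ear_same (hS : Surf H X) (hC : ∀ h : H, Cyc X h → Par (ρ h)) (hρ : Function.Injective ρ)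
    (hT : Theta ρ P Q R u v p q r) (hpr : p * r⁻¹ ∈ K) (hqr : q * r⁻¹ ∈ K)
    {B : Set X} {w w' : X} {z : H} (hw : w ∈ P) (hw' : w' ∈ P) (ww' : pr H w ≠ pr H w')
    (hwu : pr H w ≠ pr H u) (hwv : pr H w ≠ pr H v) (hwu' : pr H w' ≠ pr H u) (hwv' : pr H w' ≠ pr H v)
    (hB : J H B w (z • w'))
    (hBC : ∀ x ∈ B, pr H x ∈ pr H '' (P ∪ Q ∪ R) → pr H x = pr H w ∨ pr H x = pr H w') : z ∈ K := by
  have := hS.t2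
  obtain ⟨m, hm, hmw, hmw'⟩ := hB.mid (fun h => ww' (by rw [h, pr_smul]))
  rw [pr_smul] at hmw'
  obtain ⟨t, ht, htu, htv⟩ := hT.hQ.mid (fun h => hT.ne (by rw [h, pr_smul]))
  rw [pr_smul] at htv
  have hO : IsOpen (pr H '' P)ᶜ := (closed_of_sat (closed_sat' hS hT.hP.compact)).isOpen_compl
  obtain ⟨q', D, hq', hD, hDO⟩ := arc_conn hS hO (arc_compl hS hT.hP) (a := m) (t := t)
    (fun h => by
      rcases hBC m hm (image_mono (fun x hx => Or.inl (Or.inl hx)) h) with h | h <;> contradiction)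
    (by
      rintro ⟨x, hx, hxt⟩
      rcases hT.pq x hx t ht hxt with h | h <;> rw [hxt] at h <;> contradiction)
  obtain ⟨c, D1, D2, hc, hD1, -, hDe, hD1c, -⟩ := hD.first_hit
    (closed_sat' hS (hT.hQ.compact.union hT.hR.compact)) ⟨q', hD.right, t, Or.inl ht, hq'.symm⟩
  obtain ⟨m', E1, E2, hm', hE1, -, hEe, hE1m, -⟩ := hD1.symm.first_hit (closed_sat' hS hB.compact)
    ⟨m, hD1.left, m, hm, rfl⟩
  obtain ⟨n, hn, hnm⟩ := hm'
  obtain ⟨k, rfl⟩ := pr_eq.1 hnm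
  -- F goes from a point of `B` to a point over `Q ∪ R`
  have hF := (hE1.smul hS k).symm
  set F := (k • ·) '' E1 with hFdef
  have hED : E1 ⊆ D := by rw [hDe]; refine subset_union_of_subset_left ?_ _; rw [hEe]; exact subset_union_left
  have hE1D1 : E1 ⊆ D1 := by rw [hEe]; exact subset_union_left
  have FO : ∀ x ∈ F, pr H x ∉ pr H '' P := by
    intro x hx
    obtain ⟨y, hy, h⟩ := sm_mem hx
    rw [h]; exact hDO ⟨y, hED hy, rfl⟩
  have Fc : ∀ x ∈ F, pr H x ∈ pr H '' (P ∪ Q ∪ R) → pr H x = pr H c := by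
    intro x hx hxC
    have h1 := FO x hx
    obtain ⟨y, hy, h⟩ := sm_mem hx
    rw [h] at hxC h1 ⊢
    rw [hD1c y (hE1D1 hy)]
    obtain ⟨s, (hs | hs) | hs, h2⟩ := hxC
    · exact absurd ⟨s, hs, h2⟩ h1
    · exact ⟨s, Or.inl hs, h2⟩
    · exact ⟨s, Or.inr hs, h2⟩
  have FB : ∀ x ∈ F, ∀ y ∈ B, pr H x = pr H y → pr H x = pr H (k • m') := by
    rintro _ ⟨x, hx, rfl⟩ y hy hxy
    simp only [pr_smul] at hxy ⊢
    rw [hE1m x hx ⟨y, hy, hxy.symm⟩]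
  obtain ⟨B1, B2, hB1, hB2, hBe, hsp⟩ := hB.split hn
  obtain ⟨c0, hc0, hcc⟩ := hc
  obtain ⟨l, rfl⟩ := pr_eq.1 hcc.symm
  have hcP : pr H c0 ∉ pr H '' P := by
    have := FO _ hF.right; rwa [pr_smul, pr_smul] at this
  have hcu : pr H c0 ≠ pr H u := fun h => hcP ⟨u, hT.hP.left, h.symm⟩
  have hcv : pr H c0 ≠ pr H v := fun h => hcP ⟨_, hT.hP.right, by rw [h, pr_smul]⟩
  have nP : pr H (k • m') ∉ pr H '' P := FO _ hF.left
  have nC : pr H (k • m') ∉ pr H '' (P ∪ Q ∪ R) := by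
    intro h
    rcases hBC _ hn h with h | h
    · exact nP ⟨w, hw, h.symm⟩
    · exact nP ⟨w', hw', h.symm⟩
  have m1 : ∀ x ∈ B1, x ∈ B := fun x hx => hBe ▸ Or.inl hx
  have m2 : ∀ x ∈ B2, x ∈ B := fun x hx => hBe ▸ Or.inr hx
  have ear1 : J H (B1 ∪ F) w ((k * l) • c0) := by
    rw [mul_smul]
    exact hB1.concat hF fun x hx y hy hxy => by rw [hxy]; exact FB y hy x (m1 x hx) hxy.symm
  have ear2 : J H ((z⁻¹ • ·) '' (B2 ∪ F)) w' ((z⁻¹ * (k * l)) • c0) := by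
    have : J H (B2 ∪ F) (z • w') (k • l • c0) :=
      hB2.symm.concat hF fun x hx y hy hxy => by rw [hxy]; exact FB y hy x (m2 x hx) hxy.symm
    have := this.smul hS z⁻¹
    rwa [inv_smul_smul, ← mul_smul, ← mul_smul, mul_assoc] at this
  have pB1 : ∀ x ∈ B1, pr H x ∈ pr H '' (P ∪ Q ∪ R) → pr H x = pr H w := by
    intro x hx hxC
    rcases hBC x (m1 x hx) hxC with h | h
    · exact h
    · exfalso
      have := (hsp x hx _ hB2.right (by rw [h, pr_smul])).1
      exact nC (this ▸ hxC)
  have pB2 : ∀ x ∈ B2, pr H x ∈ pr H '' (P ∪ Q ∪ R) → pr H x = pr H w' := by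
    intro x hx hxC
    rcases hBC x (m2 x hx) hxC with h | h
    · exfalso
      have := (hsp _ hB1.left x hx h.symm).2
      exact nC (this ▸ hxC)
    · exact h
  have c1 : ∀ x ∈ B1 ∪ F, pr H x ∈ pr H '' (P ∪ Q ∪ R) → pr H x = pr H w ∨ pr H x = pr H c0 := by
    rintro x (hx | hx) hxC
    · exact Or.inl (pB1 x hx hxC)
    · right; rw [Fc x hx hxC, pr_smul]
  have c2 : ∀ x ∈ (z⁻¹ • ·) '' (B2 ∪ F), pr H x ∈ pr H '' (P ∪ Q ∪ R) → pr H x = pr H w' ∨ pr H x = pr H c0 := by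
    rintro _ ⟨x, hx | hx, rfl⟩ hxC
    · simp only [pr_smul] at hxC ⊢; exact Or.inl (pB2 x hx hxC)
    · simp only [pr_smul] at hxC ⊢; right; rw [Fc x hx hxC, pr_smul]
  have fin : k * l ∈ K ∧ z⁻¹ * (k * l) ∈ K := by
    rcases hc0 with hc0 | hc0
    · exact ⟨ear_diff hS hC hρ hT hpr hqr hw hc0 hwu hwv hcu hcv ear1 c1,
        ear_diff hS hC hρ hT hpr hqr hw' hc0 hwu' hwv' hcu hcv ear2 c2⟩
    · have hT' := hT.swap23
      have h1 : p * q⁻¹ ∈ K := by simpa using K.mul_mem hpr (K.inv_mem hqr)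
      have h2 : r * q⁻¹ ∈ K := by simpa using K.inv_mem hqr
      rw [show P ∪ Q ∪ R = P ∪ R ∪ Q by ac_rfl] at c1 c2
      exact ⟨ear_diff hS hC hρ hT' h1 h2 hw hc0 hwu hwv hcu hcv ear1 c1,
        ear_diff hS hC hρ hT' h1 h2 hw' hc0 hwu' hwv' hcu hcv ear2 c2⟩
  have := K.mul_mem fin.1 (K.inv_mem fin.2)
  rwa [show k * l * (z⁻¹ * (k * l))⁻¹ = z by group] at this

lemma ear_first (hS : Surf H X) (hC : ∀ h : H, Cyc X h → Par (ρ h)) (hρ : Function.Injective ρ)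
    (hT : Theta ρ P Q R u v p q r) (hpr : p * r⁻¹ ∈ K) (hqr : q * r⁻¹ ∈ K)
    {B : Set X} {w w' : X} {z : H} (hw : w ∈ P) (hw' : w' ∈ P ∪ Q ∪ R) (ww' : pr H w ≠ pr H w')
    (hwu : pr H w ≠ pr H u) (hwv : pr H w ≠ pr H v) (hwu' : pr H w' ≠ pr H u) (hwv' : pr H w' ≠ pr H v)
    (hB : J H B w (z • w'))
    (hBC : ∀ x ∈ B, pr H x ∈ pr H '' (P ∪ Q ∪ R) → pr H x = pr H w ∨ pr H x = pr H w') : z ∈ K := by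
  have h1 : p * q⁻¹ ∈ K := by simpa using K.mul_mem hpr (K.inv_mem hqr)
  have h2 : r * q⁻¹ ∈ K := by simpa using K.inv_mem hqr
  rcases hw' with (hw' | hw') | hw'
  · exact ear_same hS hC hρ hT hpr hqr hw hw' ww' hwu hwv hwu' hwv' hB hBC
  · exact ear_diff hS hC hρ hT hpr hqr hw hw' hwu hwv hwu' hwv' hB hBC
  · rw [show P ∪ Q ∪ R = P ∪ R ∪ Q by ac_rfl] at hBC
    exact ear_diff hS hC hρ hT.swap23 h1 h2 hw hw' hwu hwv hwu' hwv' hB hBC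

lemma ear_all (hS : Surf H X) (hC : ∀ h : H, Cyc X h → Par (ρ h)) (hρ : Function.Injective ρ)
    (hT : Theta ρ P Q R u v p q r) (hpr : p * r⁻¹ ∈ K) (hqr : q * r⁻¹ ∈ K)
    {B : Set X} {w w' : X} {z : H} (hw : w ∈ P ∪ Q ∪ R) (hw' : w' ∈ P ∪ Q ∪ R) (ww' : pr H w ≠ pr H w')
    (hwu : pr H w ≠ pr H u) (hwv : pr H w ≠ pr H v) (hwu' : pr H w' ≠ pr H u) (hwv' : pr H w' ≠ pr H v)
    (hB : J H B w (z • w'))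
    (hBC : ∀ x ∈ B, pr H x ∈ pr H '' (P ∪ Q ∪ R) → pr H x = pr H w ∨ pr H x = pr H w') : z ∈ K := by
  have h1 : p * q⁻¹ ∈ K := by simpa using K.mul_mem hpr (K.inv_mem hqr)
  have h2 : r * q⁻¹ ∈ K := by simpa using K.inv_mem hqr
  rcases hw with (hw | hw) | hw
  · exact ear_first hS hC hρ hT hpr hqr hw hw' ww' hwu hwv hwu' hwv' hB hBC
  · rw [show P ∪ Q ∪ R = Q ∪ P ∪ R by ac_rfl] at hBC hw'
    exact ear_first hS hC hρ hT.swap12 hqr hpr hw hw' ww' hwu hwv hwu' hwv' hB hBC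
  · rw [show P ∪ Q ∪ R = R ∪ P ∪ Q by ac_rfl] at hBC hw'
    exact ear_first hS hC hρ hT.swap23.swap12 h2 h1 hw hw' ww' hwu hwv hwu' hwv' hB hBC

/-- complement of two orbits -/
def cut (H : Type*) {X : Type*} [TopologicalSpace X] [Group H] [MulAction H X] (u v : X) : SubMulAction H X where
  carrier := {x | pr H x ≠ pr H u ∧ pr H x ≠ pr H v}
  smul_mem' := fun g x hx => by
    show pr H (g • x) ≠ pr H u ∧ pr H (g • x) ≠ pr H v
    rw [pr_smul]; exact hx

lemma cut_pr {u v : X} (x y : cut H u v) : pr H x = pr H y ↔ pr H (x : X) = pr H (y : X) := by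
  rw [pr_eq, pr_eq]
  simp [Subtype.ext_iff]

lemma cut_surf [Countable H] (hS : Surf H X) (u v : X) (hne : ∃ x : X, pr H x ≠ pr H u ∧ pr H x ≠ pr H v) :
    Surf H (cut H u v) where
  conn := by
    have : IsPreconnected (univ : Set (cut H u v)) := by
      rw [← Topology.IsInducing.subtypeVal.isPreconnected_image, image_univ, Subtype.range_coe_subtype]
      obtain ⟨e, he⟩ := hS.emb
      rw [← he.isInducing.isPreconnected_image]
      have h1 := diff_countable_preconnected (C := e '' (range (fun g : H => g • u) ∪ range (fun g : H => g • v)))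
        he.isOpen_range (by rw [← image_univ]; exact hS.conn.isPreconnected.image e he.continuous.continuousOn)
        (((countable_range _).union (countable_range _)).image e)
      convert h1 using 1
      rw [← image_univ, ← image_sdiff he.injective]
      congr 1; ext x
      show (pr H x ≠ pr H u ∧ pr H x ≠ pr H v) ↔ _
      simp [pr_eq]
    obtain ⟨x, hx⟩ := hne
    exact ⟨⟨⟨x, hx⟩, trivial⟩, this⟩
  emb := by
    have := hS.t2
    obtain ⟨e, he⟩ := hS.emb
    refine ⟨fun x => e x, he.comp ?_⟩
    apply IsOpen.isOpenEmbedding_subtypeVal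
    have h := closed_sat' hS (C := {u, v}) (((finite_singleton v).insert u).isCompact)
    convert h.isOpen_compl using 1
    ext x
    show (pr H x ≠ pr H u ∧ pr H x ≠ pr H v) ↔ _
    simp [image_pair]
  cont := fun h => by
    apply Continuous.subtype_mk
    exact (hS.cont h).comp continuous_subtype_val
  pd := fun x y => by
    obtain ⟨U, hU, V, hV, h⟩ := hS.pd (x : X) y
    refine ⟨_, continuous_subtype_val.continuousAt hU, _, continuous_subtype_val.continuousAt hV, ?_⟩
    intro g a ha hga
    exact Subtype.ext (h g a ha hga)
  free := fun g x h => hS.free g x (congrArg Subtype.val h)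

lemma cut_J {B : Set (cut H u v)} {b c : cut H u v} (h : J H B b c) :
    J H (Subtype.val '' B) (b : X) (c : X) := by
  obtain ⟨γ, s, t, hst, hc, hi, rfl, rfl, rfl⟩ := h
  refine ⟨fun r => γ r, s, t, hst, continuous_subtype_val.comp_continuousOn hc, ?_, rfl, rfl, ?_⟩
  · intro x hx y hy hxy
    exact hi hx hy ((cut_pr _ _).2 hxy)
  · rw [image_image]

lemma theta_top [Countable H] (hS : Surf H X) (hC : ∀ h : H, Cyc X h → Par (ρ h)) (hρ : Function.Injective ρ)
    (hT : Theta ρ P Q R u v p q r) : Subgroup.closure {p * r⁻¹, q * r⁻¹} = ⊤ := by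
  have := hS.t2
  set K := Subgroup.closure {p * r⁻¹, q * r⁻¹}
  have hpr : p * r⁻¹ ∈ K := Subgroup.subset_closure (by simp)
  have hqr : q * r⁻¹ ∈ K := Subgroup.subset_closure (by simp)
  obtain ⟨m, hm, hmu, hmv⟩ := hT.hP.mid (fun h => hT.ne (by rw [h, pr_smul]))
  obtain ⟨n, hn, hnu, hnv⟩ := hT.hQ.mid (fun h => hT.ne (by rw [h, pr_smul]))
  rw [pr_smul] at hmv hnv
  refine gauge_mk (cut_surf hS u v ⟨m, hmu, hmv⟩) (Subtype.val ⁻¹' (P ∪ Q ∪ R)) ?_ ?_ ?_ ?_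
  · intro S
    exact (closed_sat hS S ((hT.hP.compact.union hT.hQ.compact).union hT.hR.compact)).preimage continuous_subtype_val
  · intro s
    by_contra! hh
    have h1 := hh ⟨m, hmu, hmv⟩ (by simp [hm])
    have h2 := hh ⟨n, hnu, hnv⟩ (by simp [hn])
    have h3 := (cut_pr _ _).1 (h1.trans h2.symm)
    rcases hT.pq m hm n hn h3 with h | h <;> contradiction
  · rintro g ⟨x, hxu, hxv⟩ hx hgx
    have hx : x ∈ P ∪ Q ∪ R := hx
    have hgx : g • x ∈ P ∪ Q ∪ R := hgx
    have one : g • x = x → g ∈ K := fun h => by rw [hS.free g x h]; exact K.one_mem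
    have e : pr H x = pr H (g • x) := (pr_smul g x).symm
    have bad : ¬ (pr H x = pr H u ∨ pr H x = pr H v) := by tauto
    have bad' : ¬ (pr H (g • x) = pr H u ∨ pr H (g • x) = pr H v) := by rwa [pr_smul]
    rcases hx with (hx | hx) | hx <;> rcases hgx with (hgx | hgx) | hgx
    · exact one (hT.hP.injOn hgx hx e.symm)
    · exact absurd (hT.pq _ hx _ hgx e) bad
    · exact absurd (hT.pr' _ hx _ hgx e) bad
    · exact absurd (hT.pq _ hgx _ hx e.symm) bad'
    · exact one (hT.hQ.injOn hgx hx e.symm)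
    · exact absurd (hT.qr _ hx _ hgx e) bad
    · exact absurd (hT.pr' _ hgx _ hx e.symm) bad'
    · exact absurd (hT.qr _ hgx _ hx e.symm) bad'
    · exact one (hT.hR.injOn hgx hx e.symm)
  · rintro B ⟨b, hbu, hbv⟩ ⟨c, hcu, hcv⟩ g hb hc hB hbc hBC
    have hb : b ∈ P ∪ Q ∪ R := hb
    have hc : c ∈ P ∪ Q ∪ R := hc
    refine ear_all hS hC hρ hT hpr hqr hb hc (fun h => hbc ((cut_pr _ _).2 h)) hbu hbv hcu hcv (cut_J hB) ?_
    rintro _ ⟨⟨x, hxu, hxv⟩, hx, rfl⟩ ⟨y, hy, hyx⟩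
    have hyx : pr H y = pr H x := hyx
    have := hBC _ hx ⟨⟨y, by rw [hyx]; exact hxu, by rw [hyx]; exact hxv⟩, hy, (cut_pr _ _).2 hyx⟩
    rwa [cut_pr, cut_pr] at this

lemma line_zpow {h : H} {γ : ℝ → X} (hγ : ∀ t, γ (t + 1) = h • γ t) (n : ℤ) (t : ℝ) : γ (t + n) = h ^ n • γ t := by
  induction n using Int.induction_on with
  | zero => simp
  | succ n ih => rw [zpow_add_one, ← (Commute.self_zpow h _).eq, mul_smul, ← ih, ← hγ]; push_cast; congr 1; ring
  | pred n ih =>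
    have := hγ (t + ((-(n:ℤ) - 1 : ℤ) : ℝ))
    rw [show t + ((-(n:ℤ) - 1 : ℤ) : ℝ) + 1 = t + ((-(n : ℤ) : ℤ) : ℝ) by push_cast; ring, ih] at this
    rw [zpow_sub_one, ← ((Commute.self_zpow h _).inv_left).eq, mul_smul, this, inv_smul_smul]

theorem trichotomy [Countable H] (hS : Surf H X) (hC : ∀ h : H, Cyc X h → Par (ρ h)) (hρ : Function.Injective ρ) :
    (∃ M : PSL2C, ∀ h : H, ∃ β, M * ρ h * M⁻¹ = mk (Uu β)) ∨
    ∃ x y : H, Ess (ρ x) (ρ y) ∧ Subgroup.closure {x, y} = ⊤ := by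
  by_cases hT : ∃ (P Q R : Set X) (u v : X) (p q r : H), Theta ρ P Q R u v p q r
  · obtain ⟨P, Q, R, u, v, p, q, r, hT⟩ := hT
    exact Or.inr ⟨_, _, hT.ess, theta_top hS hC hρ hT⟩
  left
  by_cases h0 : ∀ h : H, Cyc X h → h = 1
  · refine ⟨1, fun h => ⟨0, ?_⟩⟩
    rw [case0 hS h0 h, Uu_zero]; simp
  push Not at h0
  obtain ⟨x, hx, hx1⟩ := h0
  obtain ⟨γ, γc, γ1, γi⟩ := cyc_line hS hx
  obtain ⟨A, hA, hAt⟩ := hC x hx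
  obtain ⟨M, β, hM⟩ := unip_norm A hAt
  have hxM : mk M * ρ x * (mk M)⁻¹ = mk (Uu β) := by rw [← hA, ← hM]; simp
  have hβ : β ≠ 0 := by
    rintro rfl
    apply hx1; apply hρ
    rw [Uu_zero, mk_one] at hxM
    rw [map_one]
    simpa [mul_inv_eq_one] using hxM
  let K : Subgroup H :=
    { carrier := {h | ∃ β, mk M * ρ h * (mk M)⁻¹ = mk (Uu β)}
      one_mem' := ⟨0, by rw [Uu_zero]; simp⟩
      mul_mem' := by
        rintro a b ⟨α, ha⟩ ⟨β, hb⟩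
        refine ⟨α + β, ?_⟩
        rw [← Uu_mul, mk_mul, ← ha, ← hb, map_mul]; group
      inv_mem' := by
        rintro a ⟨α, ha⟩
        refine ⟨-α, ?_⟩
        rw [← Uu_inv, mk_inv, ← ha, map_inv]; group }
  have hxK : x ∈ K := ⟨β, hxM⟩
  have hK : K = ⊤ := by
    refine gauge_mk hS (γ '' Icc 0 1) (fun P => closed_sat hS P (isCompact_Icc.image γc)) ?_ ?_ ?_
    · intro s
      by_contra! hh
      obtain ⟨n, hn⟩ := γi 0 (1/2) ((hh _ ⟨0, by norm_num, rfl⟩).trans (hh _ ⟨1/2, by norm_num, rfl⟩).symm)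
      have h2 : ((2 * n : ℤ) : ℝ) = ((-1 : ℤ) : ℝ) := by push_cast; linarith
      have := Int.cast_injective h2
      omega
    · rintro g _ ⟨s, hs, rfl⟩ ⟨t, ht, hts⟩
      obtain ⟨n, hn⟩ := γi t s (by rw [hts, pr_smul])
      have e : t = s + n := by linarith
      rw [e, line_zpow γ1] at hts
      have : g⁻¹ * x ^ n = 1 := hS.free _ (γ s) (by rw [mul_smul, hts, inv_smul_smul])
      rw [inv_mul_eq_one.1 this]
      exact K.zpow_mem hxK n
    · rintro B _ _ g ⟨s, hs, rfl⟩ ⟨t', ht', rfl⟩ hB hne hBC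
      set n : ℤ := -⌊t' - s⌋ with hn
      set t : ℝ := t' + n with ht
      have f0 : t - s = Int.fract (t' - s) := by simp only [ht, hn, Int.fract]; push_cast; ring
      have f1 : s < t := by
        have h1 := Int.fract_nonneg (t' - s)
        rcases h1.lt_or_eq with h | h
        · linarith
        · exfalso; apply hne
          have : t' = s + ((-n : ℤ) : ℝ) := by push_cast; linarith
          rw [this, line_zpow γ1, pr_smul]
      have f2 : t < s + 1 := by have := Int.fract_lt_one (t' - s); linarith
      have inj : ∀ a b : ℝ, b < a + 1 → InjOn (fun r => pr H (γ r)) (Icc a b) := by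
        intro a b hab r hr r' hr' h
        obtain ⟨m, hm⟩ := γi r r' h
        simp only [mem_Icc] at hr hr'
        have h1 : (m : ℝ) < (1 : ℤ) := by push_cast; linarith
        have h2 : ((-1 : ℤ) : ℝ) < m := by push_cast; linarith
        have h1 := Int.cast_lt.1 h1
        have h2 := Int.cast_lt.1 h2
        have : m = 0 := by omega
        rw [this] at hm; push_cast at hm; linarith
      have a1 : J H (γ '' Icc s t) (γ s) (x ^ n • γ t') :=
        ⟨γ, s, t, f1.le, γc.continuousOn, inj _ _ f2, rfl, by rw [ht, line_zpow γ1], rfl⟩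
      have a2 : J H (γ '' Icc (t - 1) s) (γ s) (x ^ (n - 1) • γ t') :=
        J.symm ⟨γ, t - 1, s, by linarith, γc.continuousOn, inj _ _ (by linarith), by
          rw [ht, ← line_zpow γ1]; congr 1; push_cast; ring, rfl, rfl⟩
      have all : ∀ r : ℝ, pr H (γ r) ∈ pr H '' (γ '' Icc 0 1) := by
        intro r
        refine ⟨_, ⟨Int.fract r, ⟨Int.fract_nonneg r, (Int.fract_lt_one r).le⟩, rfl⟩, ?_⟩
        conv_rhs => rw [← Int.fract_add_floor r, line_zpow γ1, pr_smul]
      have m1 : ∀ a ∈ B, ∀ b ∈ γ '' Icc s t, pr H a = pr H b → pr H a = pr H (γ s) ∨ pr H a = pr H (γ t') := by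
        rintro a ha _ ⟨r, hr, rfl⟩ h
        exact hBC a ha (h ▸ all r)
      have m2 : ∀ a ∈ B, ∀ b ∈ γ '' Icc (t - 1) s, pr H a = pr H b → pr H a = pr H (γ s) ∨ pr H a = pr H (γ t') := by
        rintro a ha _ ⟨r, hr, rfl⟩ h
        exact hBC a ha (h ▸ all r)
      have e1 : Par (ρ (g * (x ^ n)⁻¹)) := hC _ (cyc_of hS hB a1 hne m1)
      have e2 : Par (ρ (g * (x ^ (n - 1))⁻¹)) := hC _ (cyc_of hS hB a2 hne m2)
      have e3 : g * (x ^ (n - 1))⁻¹ = g * (x ^ n)⁻¹ * x⁻¹⁻¹ := by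
        rw [inv_inv, zpow_sub_one, mul_inv_rev, inv_inv, mul_assoc]
        congr 1
        rw [← zpow_neg]; exact (Commute.self_zpow x _).eq
      rw [e3, map_mul, map_inv] at e2
      have hxM' : mk M * ρ x⁻¹ * (mk M)⁻¹ = mk (Uu (-β)) := by
        rw [← Uu_inv, mk_inv, ← hxM, map_inv]; group
      rcases unip_or_ess (neg_ne_zero.2 hβ) hxM' e1 e2 with h | ⟨b, h⟩
      · exfalso
        refine hT ⟨B, _, _, γ s, γ t', g, x ^ (n - 1), x ^ n, hB, a2, a1, hne, m2, m1, ?_, ?_⟩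
        · rintro _ ⟨r, hr, rfl⟩ _ ⟨r', hr', rfl⟩ h
          obtain ⟨m, hm⟩ := γi r r' h
          simp only [mem_Icc] at hr hr'
          have h1 : (m : ℝ) < (1 : ℤ) := by push_cast; linarith
          have h2 : ((-2 : ℤ) : ℝ) < m := by push_cast; linarith
          have h1 := Int.cast_lt.1 h1
          have h2 := Int.cast_lt.1 h2
          have : m = 0 ∨ m = -1 := by omega
          rcases this with rfl | rfl
          · left; congr 2; push_cast at hm; linarith
          · right
            push_cast at hm
            have : r = t' + ((n - 1 : ℤ) : ℝ) := by push_cast; linarith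
            rw [this, line_zpow γ1, pr_smul]
        · convert h using 2
          rw [zpow_sub_one]; group
      · have h1 : g * (x ^ n)⁻¹ ∈ K := ⟨b, h⟩
        simpa using K.mul_mem h1 (K.zpow_mem hxK n)
  refine ⟨mk M, fun h => ?_⟩
  have : h ∈ K := hK ▸ Subgroup.mem_top h
  exact this
end

noncomputable section
open Set Filter Topology

/-- second order Taylor expansion, uniformly on a set -/
def Good (V : ℂ → ℂ) (E : Set ℂ) : Prop :=
  ∃ C : ℝ, 0 ≤ C ∧ ∀ z ∈ E, ∃ D : ℂ, ∀ w ∈ E, ‖V w - V z - D * (w - z)‖ ≤ C * ‖w - z‖ ^ 2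

lemma Good.mono {V : ℂ → ℂ} {E E' : Set ℂ} (h : Good V E) (hs : E' ⊆ E) : Good V E' := by
  obtain ⟨C, h0, h⟩ := h
  refine ⟨C, h0, fun z hz => ?_⟩
  obtain ⟨D, hD⟩ := h z (hs hz)
  exact ⟨D, fun w hw => hD w (hs hw)⟩

lemma Good.smul {V : ℂ → ℂ} {E : Set ℂ} (h : Good V E) (l : ℂ) : Good (fun z => l * V z) E := by
  obtain ⟨C, h0, h⟩ := h
  refine ⟨‖l‖ * C, by positivity, fun z hz => ?_⟩
  obtain ⟨D, hD⟩ := h z hz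
  refine ⟨l * D, fun w hw => ?_⟩
  rw [show l * V w - l * V z - l * D * (w - z) = l * (V w - V z - D * (w - z)) by ring, norm_mul, mul_assoc]
  exact mul_le_mul_of_nonneg_left (hD w hw) (norm_nonneg _)

lemma Good.sum {ι : Type*} (s : Finset ι) {V : ι → ℂ → ℂ} {E : Set ℂ} (h : ∀ i ∈ s, Good (V i) E) :
    Good (fun z => ∑ i ∈ s, V i z) E := by
  classical
  induction s using Finset.induction_on with
  | empty => exact ⟨0, le_rfl, fun z _ => ⟨0, fun w _ => by simp⟩⟩
  | insert i s hi ih =>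
    obtain ⟨C, h0, h1⟩ := ih (fun j hj => h j (Finset.mem_insert_of_mem hj))
    obtain ⟨C', h0', h1'⟩ := h i (Finset.mem_insert_self i s)
    refine ⟨C' + C, by positivity, fun z hz => ?_⟩
    obtain ⟨D, hD⟩ := h1 z hz
    obtain ⟨D', hD'⟩ := h1' z hz
    refine ⟨D' + D, fun w hw => ?_⟩
    show ‖(∑ j ∈ insert i s, V j w) - (∑ j ∈ insert i s, V j z) - (D' + D) * (w - z)‖ ≤ _
    rw [Finset.sum_insert hi, Finset.sum_insert hi, add_mul, add_mul]
    calc _ = ‖(V i w - V i z - D' * (w - z)) + ((∑ j ∈ s, V j w) - (∑ j ∈ s, V j z) - D * (w - z))‖ := by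
            congr 1; ring
      _ ≤ _ := (norm_add_le _ _).trans (add_le_add (hD' w hw) (hD w hw))

lemma Good.continuousOn {V : ℂ → ℂ} {E : Set ℂ} (h : Good V E) : ContinuousOn V E := by
  obtain ⟨C, h0, h⟩ := h
  intro z hz
  obtain ⟨D, hD⟩ := h z hz
  rw [ContinuousWithinAt, tendsto_iff_norm_sub_tendsto_zero]
  have hlim : Tendsto (fun w => C * ‖w - z‖ ^ 2 + ‖D‖ * ‖w - z‖) (𝓝[E] z) (𝓝 0) := by
    have : ContinuousAt (fun w => C * ‖w - z‖ ^ 2 + ‖D‖ * ‖w - z‖) z := by fun_prop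
    have := this.tendsto
    simp at this
    exact this.mono_left nhdsWithin_le_nhds
  refine squeeze_zero' (Eventually.of_forall fun _ => norm_nonneg _) ?_ hlim
  filter_upwards [self_mem_nhdsWithin] with w hw
  calc ‖V w - V z‖ = ‖(V w - V z - D * (w - z)) + D * (w - z)‖ := by congr 1; ring
    _ ≤ _ := (norm_add_le _ _).trans (by rw [norm_mul]; gcongr; exact hD w hw)

lemma quad_deriv {F : ℂ → ℂ} {z D : ℂ} {C : ℝ} (h : ∀ᶠ w in 𝓝 z, ‖F w - F z - D * (w - z)‖ ≤ C * ‖w - z‖ ^ 2) :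
    DifferentiableAt ℂ F z := by
  have : HasDerivAt F D z := by
    rw [hasDerivAt_iff_isLittleO]
    have h1 : (fun w => F w - F z - (w - z) • D) =O[𝓝 z] fun w => ‖w - z‖ ^ 2 := by
      refine Asymptotics.IsBigO.of_bound C ?_
      filter_upwards [h] with w hw
      rw [smul_eq_mul, mul_comm (w - z)]
      simpa using hw
    refine h1.trans_isLittleO ?_
    have h2 : Tendsto (fun w : ℂ => ‖w - z‖) (𝓝 z) (𝓝 0) := by
      have : ContinuousAt (fun w : ℂ => ‖w - z‖) z := by fun_prop
      simpa using this.tendsto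
    rw [← Asymptotics.isLittleO_norm_right]
    simp_rw [sq]
    have := (Asymptotics.isLittleO_one_iff ℝ).2 h2
    have h3 := this.mul_isBigO (Asymptotics.isBigO_refl (fun w : ℂ => ‖w - z‖) (𝓝 z))
    simpa using h3
  exact this.differentiableAt

lemma Good.diff {V : ℂ → ℂ} {E : Set ℂ} (h : Good V E) {z : ℂ} (hz : E ∈ 𝓝 z) : DifferentiableAt ℂ V z := by
  obtain ⟨C, h0, h⟩ := h
  obtain ⟨D, hD⟩ := h z (mem_of_mem_nhds hz)
  exact quad_deriv (D := D) (C := C) (by filter_upwards [hz] with w hw using hD w hw)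

/-- quadratic vanishing at accumulation points of zeros -/
lemma Good.vanish {V : ℂ → ℂ} {E Z : Set ℂ} (h : Good V E) (hZE : Z ⊆ E) (hZ : ∀ z ∈ Z, V z = 0)
    (hacc : ∀ z ∈ Z, ∀ ε > 0, ∃ w ∈ Z, w ≠ z ∧ ‖w - z‖ < ε) :
    ∃ C : ℝ, 0 ≤ C ∧ ∀ z ∈ Z, ∀ w ∈ E, ‖V w‖ ≤ C * ‖w - z‖ ^ 2 := by
  obtain ⟨C, h0, h⟩ := h
  refine ⟨C, h0, fun z hz w hw => ?_⟩
  obtain ⟨D, hD⟩ := h z (hZE hz)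
  have hD0 : D = 0 := by
    by_contra hD0
    have hpos : 0 < ‖D‖ := norm_pos_iff.2 hD0
    obtain ⟨y, hy, hyz, hlt⟩ := hacc z hz (‖D‖ / (C + 1)) (by positivity)
    have h1 := hD y (hZE hy)
    rw [hZ y hy, hZ z hz] at h1
    have h2 : 0 < ‖y - z‖ := norm_pos_iff.2 (sub_ne_zero.2 hyz)
    have h3 : ‖D‖ * ‖y - z‖ ≤ C * ‖y - z‖ ^ 2 := by simpa using h1
    have h4 : ‖D‖ ≤ C * ‖y - z‖ := by
      rw [sq, ← mul_assoc] at h3; exact le_of_mul_le_mul_right h3 h2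
    rw [lt_div_iff₀ (by positivity)] at hlt
    nlinarith
  have := hD w hw
  rw [hZ z hz, hD0] at this
  simpa using this

/-- exceptional set -/
def Eset {ι : Type*} (J p : ι → ℂ) (c : ℝ) : Set ℂ := {z | ∀ i, c * ‖J i‖ ≤ ‖z - p i‖}

lemma ser_summable {ι : Type*} {J p : ι → ℂ} (hJ0 : ∀ i, J i ≠ 0) (hs : Summable fun i => ‖J i‖ ^ 2) {c : ℝ} (hc : 0 < c)
    {z : ℂ} (hz : z ∈ Eset J p c) : Summable fun i => J i ^ 5 / (z - p i) := by
  have hb : ∀ᶠ i in cofinite, ‖J i‖ ^ 2 < 1 := by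
    have := hs.tendsto_cofinite_zero
    exact this.eventually_lt_const one_pos
  refine Summable.of_norm_bounded_eventually (g := fun i => 1 / c * ‖J i‖ ^ 2) (hs.mul_left _) ?_
  filter_upwards [hb] with i hi
  have h0 : 0 < ‖J i‖ := norm_pos_iff.2 (hJ0 i)
  have h1 := hz i
  rw [norm_div, norm_pow, div_le_iff₀ (lt_of_lt_of_le (by positivity) h1)]
  have h2 : ‖J i‖ < 1 := by nlinarith
  calc ‖J i‖ ^ 5 ≤ ‖J i‖ ^ 3 := pow_le_pow_of_le_one h0.le h2.le (by norm_num)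
    _ = 1 / c * ‖J i‖ ^ 2 * (c * ‖J i‖) := by field_simp
    _ ≤ _ := by gcongr

lemma ser_good {ι : Type*} {J p : ι → ℂ} (hJ0 : ∀ i, J i ≠ 0) (hs : Summable fun i => ‖J i‖ ^ 2) {c : ℝ} (hc : 0 < c) :
    Good (fun z => ∑' i, J i ^ 5 / (z - p i)) (Eset J p c) := by
  refine ⟨(∑' i, ‖J i‖ ^ 2) / c ^ 3, by positivity, fun z hz => ?_⟩
  have hS : ∀ w ∈ Eset J p c, Summable fun i => J i ^ 5 / (w - p i) := fun w hw => ser_summable hJ0 hs hc hw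
  have hb : ∀ᶠ i in cofinite, ‖J i‖ ^ 2 < 1 := hs.tendsto_cofinite_zero.eventually_lt_const one_pos
  have hS2 : Summable fun i => J i ^ 5 / (z - p i) ^ 2 := by
    refine Summable.of_norm_bounded_eventually (g := fun i => 1 / c ^ 2 * ‖J i‖ ^ 2) (hs.mul_left _) ?_
    filter_upwards [hb] with i hi
    have h0 : 0 < ‖J i‖ := norm_pos_iff.2 (hJ0 i)
    have h1 := hz i
    have h2 : ‖J i‖ < 1 := by nlinarith
    rw [norm_div, norm_pow, norm_pow, div_le_iff₀ (pow_pos (lt_of_lt_of_le (by positivity) h1) 2)]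
    calc ‖J i‖ ^ 5 ≤ ‖J i‖ ^ 4 := pow_le_pow_of_le_one h0.le h2.le (by norm_num)
      _ = 1 / c ^ 2 * ‖J i‖ ^ 2 * (c * ‖J i‖) ^ 2 := by field_simp
      _ ≤ _ := by gcongr
  refine ⟨-∑' i, J i ^ 5 / (z - p i) ^ 2, fun w hw => ?_⟩
  have e : ((∑' i, J i ^ 5 / (w - p i)) - (∑' i, J i ^ 5 / (z - p i)) - (-∑' i, J i ^ 5 / (z - p i) ^ 2) * (w - z))
      = ∑' i, J i ^ 5 * (w - z) ^ 2 / ((w - p i) * (z - p i) ^ 2) := by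
    have h3 := ((hS w hw).hasSum.sub (hS z hz).hasSum).add (hS2.hasSum.mul_right (w - z))
    rw [← sub_eq_zero]
    have : HasSum (fun i => J i ^ 5 * (w - z) ^ 2 / ((w - p i) * (z - p i) ^ 2)) ((∑' i, J i ^ 5 / (w - p i)) - (∑' i, J i ^ 5 / (z - p i)) + (∑' i, J i ^ 5 / (z - p i) ^ 2) * (w - z)) := by
      refine h3.congr_fun fun i => ?_
      have h0 : 0 < ‖J i‖ := norm_pos_iff.2 (hJ0 i)
      have n1 : w - p i ≠ 0 := norm_pos_iff.1 (lt_of_lt_of_le (by positivity) (hw i))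
      have n2 : z - p i ≠ 0 := norm_pos_iff.1 (lt_of_lt_of_le (by positivity) (hz i))
      field_simp
      ring
    rw [this.tsum_eq]; ring
  show ‖((∑' i, J i ^ 5 / (w - p i)) - (∑' i, J i ^ 5 / (z - p i)) - (-∑' i, J i ^ 5 / (z - p i) ^ 2) * (w - z))‖ ≤ _
  rw [e]
  have hbd : HasSum (fun i => ‖J i‖ ^ 2 * (‖w - z‖ ^ 2 / c ^ 3)) ((∑' i, ‖J i‖ ^ 2) * (‖w - z‖ ^ 2 / c ^ 3)) := hs.hasSum.mul_right _
  refine (tsum_of_norm_bounded hbd fun i => ?_).trans (le_of_eq (by ring))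
  have h0 : 0 < ‖J i‖ := norm_pos_iff.2 (hJ0 i)
  have p1 : 0 < ‖w - p i‖ := lt_of_lt_of_le (by positivity) (hw i)
  have p2 : 0 < ‖z - p i‖ := lt_of_lt_of_le (by positivity) (hz i)
  rw [norm_div, norm_mul, norm_mul, norm_pow, norm_pow, norm_pow, div_le_iff₀ (by positivity)]
  calc ‖J i‖ ^ 5 * ‖w - z‖ ^ 2 = ‖J i‖ ^ 2 * (‖w - z‖ ^ 2 / c ^ 3) * ((c * ‖J i‖) * (c * ‖J i‖) ^ 2) := by
        field_simp
    _ ≤ _ := by gcongr <;> first | exact hw i | exact hz i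
end

noncomputable section
open Set Filter Topology

def aa (g : PSL2C) : ℂ := (Quotient.out g : SL2C).1 0 0
def bb (g : PSL2C) : ℂ := (Quotient.out g : SL2C).1 0 1
def cc (g : PSL2C) : ℂ := (Quotient.out g : SL2C).1 1 0
def dd (g : PSL2C) : ℂ := (Quotient.out g : SL2C).1 1 1
def den (g : PSL2C) (z : ℂ) : ℂ := cc g * z + dd g
def act (g : PSL2C) (z : ℂ) : ℂ := (aa g * z + bb g) / den g z
def pinf (g : PSL2C) : ℂ := aa g / cc g
def ninf (g : PSL2C) : ℂ := - dd g / cc g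

lemma mk_out (g : PSL2C) : mk (Quotient.out g) = g := Quotient.out_eq g
lemma abcd (g : PSL2C) : aa g * dd g - bb g * cc g = 1 := sl_det _

lemma smul_fin {g : PSL2C} {z : ℂ} (h : den g z ≠ 0) : g • (z : RSphere) = (act g z : RSphere) := by
  conv_lhs => rw [← mk_out g]
  exact mk_smul_coe h
lemma smul_fin_inf {g : PSL2C} {z : ℂ} (h : den g z = 0) : g • (z : RSphere) = OnePoint.infty := by
  conv_lhs => rw [← mk_out g]
  exact mk_smul_coe_infty h
lemma smul_inf {g : PSL2C} (h : cc g ≠ 0) : g • (OnePoint.infty : RSphere) = (pinf g : RSphere) := by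
  conv_lhs => rw [← mk_out g]
  exact mk_smul_infty h
lemma smul_inf_inf {g : PSL2C} (h : cc g = 0) : g • (OnePoint.infty : RSphere) = OnePoint.infty := by
  conv_lhs => rw [← mk_out g]
  exact mk_smul_infty_infty h

lemma den_eq {g : PSL2C} (h : cc g ≠ 0) (z : ℂ) : den g z = cc g * (z - ninf g) := by
  rw [den, ninf]; field_simp; ring

lemma den_ninf {g : PSL2C} (h : cc g ≠ 0) : den g (ninf g) = 0 := by rw [den_eq h]; simp

lemma act_sub {g : PSL2C} {z w : ℂ} (hz : den g z ≠ 0) (hw : den g w ≠ 0) :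
    act g z - act g w = (z - w) / (den g z * den g w) := by
  rw [act, act, div_sub_div _ _ hz hw]
  congr 1
  rw [den, den]
  linear_combination (z - w) * abcd g

lemma act_sub_inf {g : PSL2C} {z : ℂ} (hc : cc g ≠ 0) (hz : den g z ≠ 0) :
    act g z - pinf g = - 1 / (cc g * den g z) := by
  rw [act, pinf, div_sub_div _ _ hz hc, mul_comm (cc g)]
  congr 1
  rw [den]
  linear_combination - abcd g

lemma out_mul (g h : PSL2C) : ∃ s : ℂ, s ^ 2 = 1 ∧
    (Quotient.out (g * h) : SL2C).1 = s • ((Quotient.out g : SL2C).1 * (Quotient.out h : SL2C).1) := by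
  have : mk (Quotient.out (g * h)) = mk (Quotient.out g * Quotient.out h) := by
    rw [mk_mul, mk_out, mk_out, mk_out]
  rcases mk_eq_iff.1 this with h | h
  · exact ⟨1, by norm_num, by rw [h]; simp⟩
  · exact ⟨-1, by norm_num, by rw [h]; simp⟩

lemma den_mul (g h : PSL2C) : ∃ s : ℂ, s ^ 2 = 1 ∧ ∀ z, den h z ≠ 0 → den (g * h) z = s * (den g (act h z) * den h z) := by
  obtain ⟨s, hs, e⟩ := out_mul g h
  refine ⟨s, hs, fun z hz => ?_⟩
  have e1 : cc (g * h) = s * (cc g * aa h + dd g * cc h) := by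
    rw [cc, e]; simp [Matrix.mul_apply, Fin.sum_univ_two, cc, aa, dd]
  have e2 : dd (g * h) = s * (cc g * bb h + dd g * dd h) := by
    rw [dd, e]; simp [Matrix.mul_apply, Fin.sum_univ_two, cc, bb, dd]
  have e3 : den g (act h z) * den h z = cc g * (aa h * z + bb h) + dd g * den h z := by
    rw [den, act]; field_simp
  rw [e3, den, e1, e2, den]; ring

lemma act_mul {g h : PSL2C} {z : ℂ} (h1 : den h z ≠ 0) (h2 : den g (act h z) ≠ 0) :
    act (g * h) z = act g (act h z) := by
  obtain ⟨s, hs, e⟩ := den_mul g h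
  have hne : den (g * h) z ≠ 0 := by
    rw [e z h1]
    refine mul_ne_zero (fun h => ?_) (mul_ne_zero h2 h1)
    simp [h] at hs
  have : ((act (g * h) z : ℂ) : RSphere) = (act g (act h z) : ℂ) := by
    rw [← smul_fin hne, mul_smul, smul_fin h1, smul_fin h2]
  exact OnePoint.coe_injective this

lemma out_inv (g : PSL2C) : ∃ s : ℂ, s ^ 2 = 1 ∧ aa g⁻¹ = s * dd g ∧ cc g⁻¹ = - s * cc g ∧ dd g⁻¹ = s * aa g := by
  have : mk (Quotient.out (g⁻¹ : PSL2C)) = mk (Quotient.out g)⁻¹ := by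
    rw [mk_inv, mk_out, mk_out]
  rcases mk_eq_iff.1 this with h | h
  · refine ⟨1, by norm_num, ?_, ?_, ?_⟩ <;>
    simp [aa, cc, dd, h, Matrix.SpecialLinearGroup.SL2_inv_expl]
  · refine ⟨-1, by norm_num, ?_, ?_, ?_⟩ <;>
    simp only [aa, cc, dd, h, sl_neg, (sl_inv (Quotient.out g)).1, (sl_inv (Quotient.out g)).2.2.1, (sl_inv (Quotient.out g)).2.2.2] <;> ring

lemma norm_sq_one {s : ℂ} (hs : s ^ 2 = 1) : ‖s‖ = 1 := by
  have : ‖s‖ ^ 2 = 1 := by rw [← norm_pow, hs]; simp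
  nlinarith [norm_nonneg s]

lemma norm_cc_inv (g : PSL2C) : ‖cc g⁻¹‖ = ‖cc g‖ := by
  obtain ⟨s, hs, -, h, -⟩ := out_inv g
  rw [h, norm_mul, norm_neg, norm_sq_one hs, one_mul]

lemma pinf_inv (g : PSL2C) : pinf g⁻¹ = ninf g := by
  obtain ⟨s, hs, h1, h2, h3⟩ := out_inv g
  have : s ≠ 0 := by rintro rfl; simp at hs
  rw [pinf, ninf, h1, h2, neg_mul, div_neg, mul_div_mul_left _ _ this, neg_div]

lemma ninf_inv (g : PSL2C) : ninf g⁻¹ = pinf g := by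
  rw [← pinf_inv, inv_inv]

lemma key_norm {g : PSL2C} (hc : cc g ≠ 0) {z : ℂ} (hz : den g z ≠ 0) :
    ‖act g z - pinf g‖ * ‖cc g‖ ^ 2 * ‖z - ninf g‖ = 1 := by
  rw [act_sub_inf hc hz, den_eq hc, norm_div, norm_mul, norm_mul, norm_neg, norm_one]
  have h1 : ‖cc g‖ ≠ 0 := norm_ne_zero_iff.2 hc
  have h2 : ‖z - ninf g‖ ≠ 0 := by
    rw [den_eq hc] at hz
    exact norm_ne_zero_iff.2 (right_ne_zero_of_mul hz)
  field_simp

lemma one_den (z : ℂ) : (den 1 z) ^ 2 = 1 ∧ act 1 z = z := by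
  have h1 : mk (Quotient.out (1 : PSL2C)) = mk 1 := by rw [mk_out, mk_one]
  rcases mk_eq_iff.1 h1 with h | h <;> simp [den, act, aa, bb, cc, dd, h]

lemma cc_zero_iff {g : PSL2C} : cc g = 0 ↔ g • (OnePoint.infty : RSphere) = OnePoint.infty := by
  constructor
  · exact smul_inf_inf
  · intro h
    by_contra hc
    rw [smul_inf hc] at h
    exact OnePoint.coe_ne_infty _ h

lemma den_zero_iff {g : PSL2C} {z : ℂ} : den g z = 0 ↔ g • (z : RSphere) = OnePoint.infty := by
  constructor
  · exact smul_fin_inf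
  · intro h
    by_contra hc
    rw [smul_fin hc] at h
    exact OnePoint.coe_ne_infty _ h

/-- normalised position: the exterior of a disc is precisely invariant under the trivial group -/
structure Nrm (G : Subgroup PSL2C) (R : ℝ) : Prop where
  pos : 0 < R
  inf : ∀ g ∈ G, g ≠ 1 → cc g ≠ 0 ∧ ‖pinf g‖ ≤ R
  fin : ∀ g ∈ G, g ≠ 1 → ∀ z : ℂ, R < ‖z‖ → den g z ≠ 0 ∧ ‖act g z‖ ≤ R

namespace Nrm
variable {G : Subgroup PSL2C} {R : ℝ}

lemma ninf_le (h : Nrm G R) {g : PSL2C} (hg : g ∈ G) (h1 : g ≠ 1) : ‖ninf g‖ ≤ R := by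
  rw [← pinf_inv]
  exact (h.inf _ (inv_mem hg) (by simpa using h1)).2

lemma den_ne (h : Nrm G R) {g : PSL2C} (hg : g ∈ G) {z : ℂ} (hz : R < ‖z‖) : den g z ≠ 0 := by
  by_cases h1 : g = 1
  · subst h1
    intro h0
    have := (one_den z).1
    simp [h0] at this
  · exact (h.fin g hg h1 z hz).1

lemma act_le (h : Nrm G R) {g : PSL2C} (hg : g ∈ G) {z : ℂ} (hz : R < ‖z‖) : ‖act g z‖ ≤ ‖z‖ := by
  by_cases h1 : g = 1
  · subst h1
    rw [(one_den z).2]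
  · exact (h.fin g hg h1 z hz).2.trans hz.le

lemma den_le (h : Nrm G R) {g : PSL2C} (hg : g ∈ G) (h1 : g ≠ 1) {z : ℂ} : ‖den g z‖ ≤ ‖cc g‖ * (‖z‖ + R) := by
  rw [den_eq (h.inf g hg h1).1, norm_mul]
  gcongr
  exact (norm_sub_le _ _).trans (by gcongr; exact h.ninf_le hg h1)

lemma le_den (h : Nrm G R) {g : PSL2C} (hg : g ∈ G) (h1 : g ≠ 1) {z : ℂ} (hz : R + 1 ≤ ‖z‖) : ‖cc g‖ ≤ ‖den g z‖ := by
  rw [den_eq (h.inf g hg h1).1, norm_mul]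
  refine le_mul_of_one_le_right (norm_nonneg _) ?_
  have := norm_sub_norm_le z (ninf g)
  have := h.ninf_le hg h1
  linarith

/-- the disc about `g a` is contained in the image of the unit disc about `a` -/
lemma disc (h : Nrm G R) {g : PSL2C} (hg : g ∈ G) {a w : ℂ} (ha : R + 2 ≤ ‖a‖) (hw : ‖w - act g a‖ < ‖(den g a ^ 2)⁻¹‖ / 2) :
    ∃ y : ℂ, ‖y - a‖ < 1 ∧ R < ‖y‖ ∧ den g y ≠ 0 ∧ act g y = w := by
  have hda : den g a ≠ 0 := h.den_ne hg (by linarith)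
  have hcd : ‖cc g‖ ≤ ‖den g a‖ := by
    by_cases h1 : g = 1
    · subst h1
      have : cc (1 : PSL2C) = 0 := cc_zero_iff.2 (one_smul _ _)
      rw [this]; simp
    · exact h.le_den hg h1 (by linarith)
  set D := den g a with hD
  set t := w - act g a with ht
  have hDp : 0 < ‖D‖ := norm_pos_iff.2 hda
  have h2 : ‖t‖ * ‖D‖ ^ 2 < 1 / 2 := by
    rw [norm_inv, norm_pow] at hw
    rw [← lt_div_iff₀ (by positivity)]
    rw [show 1 / 2 / ‖D‖ ^ 2 = (‖D‖ ^ 2)⁻¹ / 2 by ring]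
    exact hw
  have h3 : ‖cc g * D * t‖ < 1 / 2 := by
    rw [norm_mul, norm_mul]
    calc ‖cc g‖ * ‖D‖ * ‖t‖ ≤ ‖D‖ * ‖D‖ * ‖t‖ := by gcongr
      _ = ‖t‖ * ‖D‖ ^ 2 := by ring
      _ < _ := h2
  have h4 : 1 / 2 < ‖1 - cc g * D * t‖ := by
    have := norm_sub_norm_le (1 : ℂ) (cc g * D * t)
    rw [norm_one] at this
    linarith
  have h5 : 1 - cc g * D * t ≠ 0 := norm_pos_iff.1 (by linarith)
  obtain ⟨q, hq⟩ : ∃ q, q = 1 - cc g * D * t := ⟨_, rfl⟩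
  rw [← hq] at h4 h5
  have hya : ‖(a + t * D ^ 2 / q) - a‖ < 1 := by
    rw [add_sub_cancel_left, norm_div, norm_mul, norm_pow, div_lt_one (by linarith)]
    linarith
  have hyR : R < ‖a + t * D ^ 2 / q‖ := by
    have := norm_sub_norm_le a (a + t * D ^ 2 / q)
    rw [norm_sub_rev] at this
    linarith
  refine ⟨a + t * D ^ 2 / q, hya, hyR, h.den_ne hg hyR, ?_⟩
  have hy := h.den_ne hg hyR
  have hs := act_sub hy hda
  have e : den g (a + t * D ^ 2 / q) = D / q := by
    have : den g (a + t * D ^ 2 / q) = D + cc g * (t * D ^ 2 / q) := by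
      rw [hD, den, den]; ring
    rw [this]; field_simp; rw [hq]; ring
  rw [e, ← hD] at hs
  have : act g (a + t * D ^ 2 / q) - act g a = t := by
    rw [hs]; field_simp; ring
  rw [ht] at this
  exact sub_left_injective this

lemma act_ne (h : Nrm G R) {g k : PSL2C} (hg : g ∈ G) (hk : k ∈ G) (hne : g ≠ k) {y y' : ℂ} (hy : R < ‖y‖) (hy' : R < ‖y'‖) :
    act g y ≠ act k y' := by
  intro e
  have h1 : g • (y : RSphere) = k • (y' : RSphere) := by
    rw [smul_fin (h.den_ne hg hy), smul_fin (h.den_ne hk hy'), e]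
  have h2 : (k⁻¹ * g) • (y : RSphere) = y' := by rw [mul_smul, h1, inv_smul_smul]
  have h3 := h.fin (k⁻¹ * g) (mul_mem (inv_mem hk) hg) (fun h0 => hne (by
    rw [inv_mul_eq_one] at h0; exact h0.symm)) y hy
  rw [smul_fin h3.1] at h2
  have := OnePoint.coe_injective h2
  rw [this] at h3
  linarith [h3.2]

lemma summ (h : Nrm G R) {a : ℂ} (ha : R + 2 ≤ ‖a‖) : Summable fun g : G => ‖(den g a ^ 2)⁻¹‖ ^ 2 := by
  have hd : Pairwise (Function.onFun Disjoint fun g : G => Metric.ball (act g a) (‖(den g a ^ 2)⁻¹‖ / 2)) := by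
    intro g k hgk
    refine Set.disjoint_left.2 fun w hw hw' => ?_
    rw [Metric.mem_ball, dist_eq_norm] at hw hw'
    obtain ⟨y, -, hy, -, e⟩ := h.disc g.2 ha hw
    obtain ⟨y', -, hy', -, e'⟩ := h.disc k.2 ha hw'
    exact h.act_ne g.2 k.2 (fun h0 => hgk (Subtype.ext h0)) hy hy' (e.trans e'.symm)
  have hsub : ∀ g : G, Metric.ball (act g a) (‖(den g a ^ 2)⁻¹‖ / 2) ⊆ Metric.ball 0 (‖a‖ + 1 + 1) := by
    intro g w hw
    rw [Metric.mem_ball, dist_eq_norm] at hw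
    obtain ⟨y, hya, hy, -, e⟩ := h.disc g.2 ha hw
    rw [mem_ball_zero_iff, ← e]
    have h1 := h.act_le g.2 hy
    have h2 := norm_sub_norm_le y a
    linarith
  have h1 := MeasureTheory.tsum_meas_le_meas_iUnion_of_disjoint MeasureTheory.volume
    (fun g : G => (Metric.isOpen_ball (x := act g a) (ε := ‖(den g a ^ 2)⁻¹‖ / 2)).measurableSet) hd
  have h2 := h1.trans (MeasureTheory.measure_mono (iUnion_subset hsub))
  have h3 : (∑' g : G, MeasureTheory.volume (Metric.ball (act g a) (‖(den g a ^ 2)⁻¹‖ / 2))) ≠ ⊤ :=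
    ne_top_of_le_ne_top Metric.isBounded_ball.measure_lt_top.ne h2
  have h4 := ENNReal.summable_toReal h3
  have h5 : Summable fun g : G => (‖(den g a ^ 2)⁻¹‖ / 2) ^ 2 * Real.pi := by
    refine h4.congr fun g => ?_
    rw [Complex.volume_ball]
    rw [ENNReal.toReal_mul, ENNReal.toReal_pow, ENNReal.toReal_ofReal (by positivity)]
    rfl
  have h6 := (h5.mul_right (4 / Real.pi))
  refine h6.congr fun g => ?_
  field_simp
  norm_num

lemma countable (h : Nrm G R) : Countable G := by
  have := (h.summ (a := ((R + 2 : ℝ) : ℂ)) (by rw [Complex.norm_real]; exact le_abs_self _)).countable_support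
  rw [← countable_univ_iff]
  refine this.mono fun g _ => ?_
  have : den g ((R + 2 : ℝ) : ℂ) ≠ 0 := h.den_ne g.2 (by
    rw [Complex.norm_real]; exact lt_of_lt_of_le (by linarith) (le_abs_self _))
  simpa using this

lemma finite_cc (h : Nrm G R) (K : ℝ) : {g : PSL2C | g ∈ G ∧ ‖cc g‖ ≤ K}.Finite := by
  set a : ℂ := ((R + 2 : ℝ) : ℂ) with ha
  have hR := h.pos
  have haR : ‖a‖ = R + 2 := by rw [ha, Complex.norm_real, Real.norm_of_nonneg (by linarith)]
  have h1 := (h.summ (a := a) haR.ge).tendsto_cofinite_zero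
  set K' := max K 1 with hK'
  have hK1 : 1 ≤ K' := le_max_right _ _
  have h2 := h1.eventually_lt_const (u := ((K' * (‖a‖ + R)) ^ 4)⁻¹) (by positivity)
  have h3 : {g : G | ‖cc g‖ ≤ K}.Finite := by
    refine Set.Finite.subset (Set.Finite.union (eventually_cofinite.1 h2) (finite_singleton (1 : G))) ?_
    intro g hg
    by_cases h1 : g = 1
    · exact Or.inr h1
    left
    show ¬ _
    rw [not_lt]
    have h5 := h.den_le g.2 (fun h0 => h1 (Subtype.ext h0)) (z := a)
    have h6 : 0 < ‖den g a‖ := norm_pos_iff.2 (h.den_ne g.2 (by linarith))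
    have h7 : ‖den g a‖ ≤ K' * (‖a‖ + R) := h5.trans (by gcongr; exact le_trans hg (le_max_left _ _))
    rw [norm_inv, norm_pow, inv_pow, ← pow_mul]
    gcongr
  refine (h3.image Subtype.val).subset ?_
  rintro g ⟨hg, hgK⟩
  exact ⟨⟨g, hg⟩, hgK, rfl⟩

end Nrm
end

noncomputable section
open Set Filter Topology

lemma orbit_finite {K : Subgroup PSL2C} {z : RSphere} (hz : z ∈ omegaSet K) (a : RSphere) :
    ∃ U : Set RSphere, IsOpen U ∧ z ∈ U ∧ {g : PSL2C | g ∈ K ∧ g • a ∈ U}.Finite := by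
  obtain ⟨U, hU, hzU, hf⟩ := hz
  refine ⟨U, hU, hzU, ?_⟩
  by_cases hne : ∃ g0 ∈ K, g0 • a ∈ U
  · obtain ⟨g0, hg0, h0⟩ := hne
    refine (hf.image (fun g => g * g0)).subset ?_
    rintro g ⟨hg, hgU⟩
    refine ⟨g * g0⁻¹, ⟨mul_mem hg (inv_mem hg0), g • a, ⟨g0 • a, h0, ?_⟩, hgU⟩, by simp⟩
    rw [← smul_def', ← mul_smul]; simp
  · push Not at hne
    convert Set.finite_empty (α := PSL2C)
    ext g
    simp only [mem_ofPred_eq, mem_empty_iff_false, iff_false]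
    exact fun h => hne g h.1 h.2

def Lam (G : Subgroup PSL2C) : Set ℂ := {z | (z : RSphere) ∉ omegaSet G}

lemma ball_of_nhds {U : Set RSphere} (hU : IsOpen U) {z : ℂ} (hz : (z : RSphere) ∈ U) :
    ∃ ε > 0, ∀ w : ℂ, ‖w - z‖ < ε → (w : RSphere) ∈ U := by
  have : (fun w : ℂ => (w : RSphere)) ⁻¹' U ∈ 𝓝 z := (hU.preimage OnePoint.continuous_coe).mem_nhds hz
  obtain ⟨ε, hε, h⟩ := Metric.mem_nhds_iff.1 this
  exact ⟨ε, hε, fun w hw => h (by rwa [Metric.mem_ball, dist_eq_norm])⟩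

lemma orbit_away {K : Subgroup PSL2C} {z : ℂ} (hz : (z : RSphere) ∈ omegaSet K) {a : ℂ}
    (hne : ∀ g ∈ K, g • (a : RSphere) ≠ z) (hd : ∀ g ∈ K, den g a ≠ 0) :
    ∃ ε > 0, ∀ g ∈ K, ε ≤ ‖act g a - z‖ := by
  obtain ⟨U, hU, hzU, hf⟩ := orbit_finite hz a
  obtain ⟨ε, hε, hb⟩ := ball_of_nhds hU hzU
  have : ∀ᶠ ε' in 𝓝[>] (0 : ℝ), ∀ g ∈ {g : PSL2C | g ∈ K ∧ g • (a : RSphere) ∈ U}, ε' ≤ ‖act g a - z‖ := by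
    rw [eventually_all_finite hf]
    rintro g ⟨hg, -⟩
    have h1 : 0 < ‖act g a - z‖ := by
      rw [norm_pos_iff, sub_ne_zero]
      intro h0
      exact hne g hg (by rw [smul_fin (hd g hg), h0])
    filter_upwards [Ioo_mem_nhdsGT h1] with e he using he.2.le
  have h2 : ∀ᶠ ε' in 𝓝[>] (0 : ℝ), 0 < ε' ∧ ε' ≤ ε := by
    filter_upwards [Ioo_mem_nhdsGT hε] with e he using ⟨he.1, he.2.le⟩
  obtain ⟨e, h1, h2, h3⟩ := (this.and h2).exists
  refine ⟨e, h2, fun g hg => ?_⟩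
  by_cases hgU : g • (a : RSphere) ∈ U
  · exact h1 g ⟨hg, hgU⟩
  · by_contra! hlt
    exact hgU (by rw [smul_fin (hd g hg)]; exact hb _ (hlt.trans_le h3))

def Jx (a : ℂ) {G : Subgroup PSL2C} (g : G) : ℂ := (den g a ^ 2)⁻¹
def px (a : ℂ) {G : Subgroup PSL2C} (g : G) : ℂ := act g a
def Va (G : Subgroup PSL2C) (a z : ℂ) : ℂ := ∑' g : G, Jx a g ^ 5 / (z - px a g)
def Qc (G : Subgroup PSL2C) (k : PSL2C) (a : ℂ) (j : ℕ) : ℂ :=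
  ∑' g : G, Jx a g ^ 5 * (cc k / den k (px a g) ^ (j + 1))

namespace Nrm
variable {G : Subgroup PSL2C} {R : ℝ}

lemma ext_omega (h : Nrm G R) : (OnePoint.infty : RSphere) ∈ omegaSet G ∧ ∀ z : ℂ, R < ‖z‖ → (z : RSphere) ∈ omegaSet G := by
  have hO : IsOpen (((fun z : ℂ => (z : RSphere)) '' Metric.closedBall 0 R)ᶜ) :=
    OnePoint.isOpen_compl_image_coe.2 ⟨Metric.isClosed_closedBall, isCompact_closedBall _ _⟩
  have hm : ∀ z : ℂ, (z : RSphere) ∈ ((fun z : ℂ => (z : RSphere)) '' Metric.closedBall 0 R)ᶜ ↔ R < ‖z‖ := by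
    intro z
    rw [mem_compl_iff, OnePoint.coe_injective.mem_set_image, mem_closedBall_zero_iff, not_le]
  have hf : {g : PSL2C | g ∈ G ∧ (psl g '' (((fun z : ℂ => (z : RSphere)) '' Metric.closedBall 0 R)ᶜ) ∩
      (((fun z : ℂ => (z : RSphere)) '' Metric.closedBall 0 R)ᶜ)).Nonempty}.Finite := by
    refine (finite_singleton 1).subset ?_
    rintro g ⟨hg, y, ⟨x, hx, rfl⟩, hy⟩
    by_contra h1
    rw [← smul_def'] at hy
    induction x using OnePoint.rec with
    | infty =>
      rw [smul_inf (h.inf g hg h1).1, hm] at hy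
      linarith [(h.inf g hg h1).2]
    | coe z =>
      rw [hm] at hx
      rw [smul_fin (h.den_ne hg hx), hm] at hy
      linarith [(h.fin g hg h1 z hx).2]
  refine ⟨⟨_, hO, ?_, hf⟩, fun z hz => ⟨_, hO, (hm z).2 hz, hf⟩⟩
  rintro ⟨z, -, hz⟩
  exact OnePoint.coe_ne_infty _ hz

lemma lam_le (h : Nrm G R) {z : ℂ} (hz : z ∈ Lam G) : ‖z‖ ≤ R := by
  by_contra! hlt
  exact hz (h.ext_omega.2 z hlt)

lemma lam_den (h : Nrm G R) {z : ℂ} (hz : z ∈ Lam G) {k : PSL2C} (hk : k ∈ G) : den k z ≠ 0 ∧ act k z ∈ Lam G := by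
  have h1 : den k z ≠ 0 := by
    intro h0
    have := omega_smul (inv_mem hk) h.ext_omega.1
    rw [← smul_fin_inf h0] at this
    exact hz (by simpa [smul_def', ← psl_mul, psl_one] using this)
  refine ⟨h1, fun h2 => hz ?_⟩
  have := omega_smul (inv_mem hk) h2
  rw [← smul_fin h1] at this
  simpa [smul_def', ← psl_mul, psl_one] using this

lemma lam_E (h : Nrm G R) {z a : ℂ} (hz : z ∈ Lam G) (ha : R + 2 ≤ ‖a‖) : z ∈ Eset (fun g : G => Jx a g) (px a) (1 / 2) := by
  intro g
  by_contra! hlt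
  obtain ⟨y, -, hy, hd, e⟩ := h.disc (w := z) g.2 ha (by rw [px, Jx] at hlt; linarith)
  have := omega_smul g.2 (h.ext_omega.2 y hy)
  apply hz
  rw [← e, ← smul_fin hd]
  exact this

lemma approx (h : Nrm G R) {z : ℂ} (hz : z ∈ Lam G) {ε : ℝ} (hε : 0 < ε) (K : ℝ) :
    ∃ g ∈ G, cc g ≠ 0 ∧ ‖pinf g - z‖ < ε ∧ K < ‖cc g‖ := by
  by_contra! hcon
  apply hz
  refine ⟨(fun w : ℂ => (w : RSphere)) '' Metric.ball z (ε / 2), (OnePoint.isOpenEmbedding_coe.isOpenMap _ Metric.isOpen_ball),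
    ⟨z, Metric.mem_ball_self (by positivity), rfl⟩, ?_⟩
  refine (h.finite_cc (max (max K 0) (2 / ε))).subset ?_
  rintro g ⟨hg, y, ⟨x, ⟨u, hu, rfl⟩, e⟩, ⟨v, hv, rfl⟩⟩
  refine ⟨hg, ?_⟩
  by_contra! hlt
  have hlt1 : K < ‖cc g‖ := lt_of_le_of_lt ((le_max_left _ _).trans (le_max_left _ _)) hlt
  have hlt2 : 0 < ‖cc g‖ := lt_of_le_of_lt ((le_max_right _ _).trans (le_max_left _ _)) hlt
  have hlt3 : 2 / ε < ‖cc g‖ := lt_of_le_of_lt (le_max_right _ _) hlt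
  have hc : cc g ≠ 0 := norm_pos_iff.1 hlt2
  rw [Metric.mem_ball, dist_eq_norm] at hu hv
  simp only at e
  rw [← smul_def'] at e
  have hd : den g u ≠ 0 := by
    intro h0
    rw [smul_fin_inf h0] at e
    exact OnePoint.coe_ne_infty _ e.symm
  rw [smul_fin hd] at e
  have e := OnePoint.coe_injective e
  have h1 : ε ≤ ‖pinf g - z‖ := by
    by_contra! h2
    linarith [hcon g hg hc h2]
  have h2 : ε ≤ ‖ninf g - z‖ := by
    by_contra! h2
    rw [← pinf_inv] at h2
    have := hcon g⁻¹ (inv_mem hg) (norm_pos_iff.1 (by rw [norm_cc_inv]; exact hlt2)) h2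
    rw [norm_cc_inv] at this
    linarith
  have h3 := key_norm hc hd
  rw [e] at h3
  have h4 : ε / 2 ≤ ‖v - pinf g‖ := by
    have := norm_sub_le_norm_sub_add_norm_sub (pinf g) v z
    rw [norm_sub_rev (pinf g) v] at this
    linarith
  have h5 : ε / 2 ≤ ‖u - ninf g‖ := by
    have := norm_sub_le_norm_sub_add_norm_sub (ninf g) u z
    rw [norm_sub_rev (ninf g) u] at this
    linarith
  have h6 : (ε / 2) * ‖cc g‖ ^ 2 * (ε / 2) ≤ 1 := by
    rw [← h3]; gcongr
  rw [div_lt_iff₀ hε] at hlt3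
  nlinarith

lemma attr (h : Nrm G R) {z : ℂ} (hz : z ∈ Lam G) {ε δ : ℝ} (hε : 0 < ε) (hδ : 0 < δ) (K : ℝ) :
    ∃ g ∈ G, cc g ≠ 0 ∧ K < ‖cc g‖ ∧ ∀ y, δ ≤ ‖y - ninf g‖ → den g y ≠ 0 ∧ ‖act g y - z‖ < ε := by
  obtain ⟨g, hg, hc, h1, h2⟩ := h.approx hz (half_pos hε) (max K (1 + 2 / (ε * δ)))
  refine ⟨g, hg, hc, lt_of_le_of_lt (le_max_left _ _) h2, fun y hy => ?_⟩
  have h3 := lt_of_le_of_lt (le_max_right _ _) h2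
  have hd : den g y ≠ 0 := by
    rw [den_eq hc]
    exact mul_ne_zero hc (norm_pos_iff.1 (lt_of_lt_of_le hδ hy))
  refine ⟨hd, ?_⟩
  have h4 := key_norm hc hd
  have h5 : ‖act g y - pinf g‖ < ε / 2 := by
    by_contra! h6
    have h7 : (ε / 2) * ‖cc g‖ ^ 2 * δ ≤ 1 := by rw [← h4]; gcongr
    have h8 : 2 / (ε * δ) < ‖cc g‖ ^ 2 := by
      have : 0 < 2 / (ε * δ) := by positivity
      nlinarith
    rw [div_lt_iff₀ (by positivity)] at h8
    nlinarith
  calc ‖act g y - z‖ ≤ ‖act g y - pinf g‖ + ‖pinf g - z‖ := norm_sub_le_norm_sub_add_norm_sub _ _ _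
    _ < ε := by linarith

lemma acc (h : Nrm G R) {p q r : ℂ} (hp : p ∈ Lam G) (hq : q ∈ Lam G) (hr : r ∈ Lam G) (hpq : p ≠ q) (hpr : p ≠ r) (hqr : q ≠ r) :
    ∀ z ∈ Lam G, ∀ ε > 0, ∃ w ∈ Lam G, w ≠ z ∧ ‖w - z‖ < ε := by
  intro z hz ε hε
  obtain ⟨δ, hδ, d1, d2, d3⟩ : ∃ δ > 0, 2 * δ ≤ ‖p - q‖ ∧ 2 * δ ≤ ‖p - r‖ ∧ 2 * δ ≤ ‖q - r‖ := by
    refine ⟨min ‖p - q‖ (min ‖p - r‖ ‖q - r‖) / 2, ?_, ?_, ?_, ?_⟩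
    · have := norm_pos_iff.2 (sub_ne_zero.2 hpq)
      have := norm_pos_iff.2 (sub_ne_zero.2 hpr)
      have := norm_pos_iff.2 (sub_ne_zero.2 hqr)
      positivity
    · rw [mul_div_cancel₀ _ two_ne_zero]; exact min_le_left _ _
    · rw [mul_div_cancel₀ _ two_ne_zero]; exact (min_le_right _ _).trans (min_le_left _ _)
    · rw [mul_div_cancel₀ _ two_ne_zero]; exact (min_le_right _ _).trans (min_le_right _ _)
  obtain ⟨g, hg, hc, -, hgy⟩ := h.attr hz hε hδ 0
  have key : ∀ u v : ℂ, u ∈ Lam G → v ∈ Lam G → u ≠ v → δ ≤ ‖u - ninf g‖ → δ ≤ ‖v - ninf g‖ →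
      ∃ w ∈ Lam G, w ≠ z ∧ ‖w - z‖ < ε := by
    intro u v hu hv huv h1 h2
    obtain ⟨du, eu⟩ := hgy u h1
    obtain ⟨dv, ev⟩ := hgy v h2
    by_cases hz : act g u = z
    · refine ⟨act g v, (h.lam_den hv hg).2, fun h0 => huv ?_, ev⟩
      have := act_sub du dv
      rw [hz, h0, sub_self, eq_comm, div_eq_zero_iff] at this
      rcases this with h | h
      · exact sub_eq_zero.1 h
      · exact absurd h (mul_ne_zero du dv)
    · exact ⟨act g u, (h.lam_den hu hg).2, hz, eu⟩
  have tri : ∀ u v : ℂ, 2 * δ ≤ ‖u - v‖ → δ ≤ ‖u - ninf g‖ ∨ δ ≤ ‖v - ninf g‖ := by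
    intro u v huv
    by_contra! hlt
    have := norm_sub_le_norm_sub_add_norm_sub u (ninf g) v
    rw [norm_sub_rev (ninf g) v] at this
    linarith [hlt.1, hlt.2]
  rcases tri p q d1 with h1 | h1
  · rcases tri q r d3 with h2 | h2
    · exact key p q hp hq hpq h1 h2
    · exact key p r hp hr hpr h1 h2
  · rcases tri p r d2 with h2 | h2
    · exact key p q hp hq hpq h2 h1
    · exact key q r hq hr hqr h1 h2

lemma J_ne (h : Nrm G R) {a : ℂ} (ha : R + 2 ≤ ‖a‖) (g : G) : Jx a g ≠ 0 :=
  inv_ne_zero (pow_ne_zero _ (h.den_ne g.2 (by linarith)))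

lemma den_lower (h : Nrm G R) {k : PSL2C} (hk : k ∈ G) {a : ℂ} (ha : R + 2 ≤ ‖a‖) : ∃ m > 0, ∀ g : G, m ≤ ‖den k (px a g)‖ := by
  have hR := h.pos
  have ha' : R < ‖a‖ := by linarith
  by_cases h1 : k = 1
  · refine ⟨1, one_pos, fun g => ?_⟩
    rw [h1, norm_sq_one (one_den _).1]
  obtain ⟨hc, hp⟩ := h.inf k hk h1
  have hcp : 0 < ‖cc k‖ := norm_pos_iff.2 hc
  refine ⟨1 / (‖cc k‖ * (‖a‖ + R)), by positivity, fun g => ?_⟩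
  have hdg := h.den_ne g.2 ha'
  have hdkg := h.den_ne (mul_mem hk g.2) ha'
  obtain ⟨s, hs, e⟩ := den_mul k g
  have hd : den k (px a g) ≠ 0 := by
    intro h0
    rw [e a hdg, ← px, h0] at hdkg
    simp at hdkg
  have h2 := act_sub_inf hc hd
  have h3 : act k (px a g) = act (k * g) a := (act_mul hdg hd).symm
  have h4 : ‖act k (px a g) - pinf k‖ ≤ ‖a‖ + R :=
    (norm_sub_le _ _).trans (add_le_add (by rw [h3]; exact h.act_le (mul_mem hk g.2) ha') hp)
  rw [h2, norm_div, norm_neg, norm_one, norm_mul] at h4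
  have hdp := norm_pos_iff.2 hd
  rw [div_le_iff₀ (by positivity)] at h4 ⊢
  linarith

lemma Q_summable (h : Nrm G R) {k : PSL2C} (hk : k ∈ G) {a : ℂ} (ha : R + 2 ≤ ‖a‖) (j : ℕ) :
    Summable fun g : G => Jx a g ^ 5 * (cc k / den k (px a g) ^ (j + 1)) := by
  obtain ⟨m, hm, hd⟩ := h.den_lower hk ha
  have hb := (h.summ ha).tendsto_cofinite_zero.eventually_lt_const one_pos
  refine Summable.of_norm_bounded_eventually (g := fun g : G => ‖(den g a ^ 2)⁻¹‖ ^ 2 * (‖cc k‖ / m ^ (j + 1))) ((h.summ ha).mul_right _) ?_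
  filter_upwards [hb] with g hg
  rw [norm_mul, norm_pow, norm_div, norm_pow]
  have h0 : 0 < ‖Jx a g‖ := norm_pos_iff.2 (h.J_ne ha g)
  change ‖Jx a g‖ ^ 2 < 1 at hg
  change _ ≤ ‖Jx a g‖ ^ 2 * _
  have h2 : ‖Jx a g‖ < 1 := by nlinarith
  have h3 : ‖Jx a g‖ ^ 5 ≤ ‖Jx a g‖ ^ 2 := pow_le_pow_of_le_one h0.le h2.le (by norm_num)
  gcongr
  exact hd g

lemma transform (h : Nrm G R) {k : PSL2C} (hk : k ∈ G) {a : ℂ} (ha : R + 2 ≤ ‖a‖) {z : ℂ} (hz : z ∈ Lam G) :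
    Va G a (act k z) * den k z ^ 8 = Va G a z + ∑ j ∈ Finset.range 9, den k z ^ j * Qc G k a j := by
  have ha' : R < ‖a‖ := by linarith
  have s1 : Summable fun g : G => Jx a g ^ 5 / (z - px a g) :=
    ser_summable (h.J_ne ha) (h.summ ha) one_half_pos (h.lam_E hz ha)
  obtain ⟨dz, hkz⟩ := h.lam_den hz hk
  have e1 : Va G a (act k z) * den k z ^ 8 =
      ∑' g : G, Jx a ((⟨k, hk⟩ : G) * g) ^ 5 / (act k z - px a ((⟨k, hk⟩ : G) * g)) * den k z ^ 8 := by
    rw [tsum_mul_right, Va, ← (Equiv.mulLeft (⟨k, hk⟩ : G)).tsum_eq]; rfl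
  rw [e1]
  have s2 := s1.hasSum.add (hasSum_sum fun j (_ : j ∈ Finset.range 9) => (h.Q_summable hk ha j).hasSum.mul_left (den k z ^ j))
  refine (s2.congr_fun fun g => ?_).tsum_eq
  have hdg := h.den_ne g.2 ha'
  have hdkg := h.den_ne (mul_mem hk g.2) ha'
  obtain ⟨s, hs, e⟩ := den_mul k g
  have e2 := e a hdg
  have hd : den k (px a g) ≠ 0 := by
    intro h0
    rw [e2, ← px, h0] at hdkg
    simp at hdkg
  have e3 : px a ((⟨k, hk⟩ : G) * g) = act k (px a g) := act_mul hdg hd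
  have e4 : Jx a ((⟨k, hk⟩ : G) * g) = Jx a g * (den k (px a g) ^ 2)⁻¹ := by
    show (den (k * g) a ^ 2)⁻¹ = (den g a ^ 2)⁻¹ * _
    rw [e2, mul_pow, hs, one_mul, mul_pow, mul_inv, mul_comm]; rfl
  have hzw : z - px a g ≠ 0 := by
    have := h.lam_E hz ha g
    have h0 : 0 < ‖Jx a g‖ := norm_pos_iff.2 (h.J_ne ha g)
    exact norm_pos_iff.1 (by linarith)
  rw [e3, e4, act_sub dz hd]
  have hu : cc k * (z - px a g) = den k z - den k (px a g) := by rw [den, den]; ring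
  generalize px a g = w at *
  generalize Jx a g = J at *
  have e5 : cc k = (den k z - den k w) / (z - w) := by rw [eq_div_iff hzw, hu]
  rw [e5]
  generalize den k z = A at *
  generalize den k w = B at *
  simp only [Finset.sum_range_succ, Finset.sum_range_zero]
  field_simp
  ring

end Nrm
end

noncomputable section
open Set Filter Topology

namespace Nrm
variable {G : Subgroup PSL2C} {R : ℝ}

lemma exists_inv (h : Nrm G R) (hFG : G.FG) : ∃ (N : ℕ) (a l : Fin N → ℂ), l ≠ 0 ∧ Function.Injective a ∧ (∀ i, R + 2 ≤ ‖a i‖) ∧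
    ∀ k ∈ G, ∀ z ∈ Lam G, (∑ i, l i * Va G (a i) (act k z)) * den k z ^ 8 = ∑ i, l i * Va G (a i) z := by
  have hR := h.pos
  obtain ⟨S, hS⟩ := hFG
  set N := S.card * 9 + 1 with hN
  let a : Fin N → ℂ := fun i => ((R + 2 + (i : ℕ) : ℝ) : ℂ)
  have ha : ∀ i, R + 2 ≤ ‖a i‖ := fun i => by
    rw [Complex.norm_real, Real.norm_of_nonneg (by positivity)]
    linarith [Nat.cast_nonneg (α := ℝ) (i : ℕ)]
  have hinj : Function.Injective a := by
    intro i j hij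
    have := Complex.ofReal_injective hij
    have h2 : ((i : ℕ) : ℝ) = ((j : ℕ) : ℝ) := by linarith
    exact Fin.ext (by exact_mod_cast h2)
  let M : Matrix (S × Fin 9) (Fin N) ℂ := fun p i => Qc G p.1 (a i) p.2
  have hker : LinearMap.ker M.mulVecLin ≠ ⊥ := by
    apply LinearMap.ker_ne_bot_of_finrank_lt
    simp [hN]
  obtain ⟨l, hl, hl0⟩ := Submodule.exists_mem_ne_zero_of_ne_bot hker
  refine ⟨N, a, l, hl0, hinj, ha, ?_⟩
  have hQ : ∀ k ∈ S, ∀ j ∈ Finset.range 9, ∑ i, l i * Qc G k (a i) j = 0 := by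
    intro k hk j hj
    have h1 : M.mulVec l = 0 := hl
    have := congrFun h1 (⟨k, hk⟩, ⟨j, Finset.mem_range.1 hj⟩)
    rw [Matrix.mulVec, dotProduct] at this
    rw [← this.trans (Pi.zero_apply _)]
    exact Finset.sum_congr rfl fun i _ => mul_comm _ _
  intro k hk
  have hk' := hk
  rw [← hS] at hk
  induction hk using Subgroup.closure_induction with
  | mem k hkS =>
    intro z hz
    have e : ∀ i, l i * Va G (a i) (act k z) * den k z ^ 8 = l i * Va G (a i) z +
        ∑ j ∈ Finset.range 9, den k z ^ j * (l i * Qc G k (a i) j) := by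
      intro i
      rw [mul_assoc, h.transform hk' (ha i) hz, mul_add, Finset.mul_sum]
      congr 1
      exact Finset.sum_congr rfl fun j _ => by ring
    rw [Finset.sum_mul, Finset.sum_congr rfl fun i _ => e i, Finset.sum_add_distrib, Finset.sum_comm]
    rw [Finset.sum_eq_zero (s := Finset.range 9), add_zero]
    intro j hj
    rw [← Finset.mul_sum, hQ k hkS j hj, mul_zero]
  | one =>
    intro z hz
    have := one_den z
    rw [this.2, show den 1 z ^ 8 = (den 1 z ^ 2) ^ 4 by ring, this.1]; ring
  | mul x y hx hy ihx ihy =>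
    rw [hS] at hx hy
    intro z hz
    obtain ⟨d1, l1⟩ := h.lam_den hz hy
    obtain ⟨d2, l2⟩ := h.lam_den l1 hx
    obtain ⟨s, hs, e⟩ := den_mul x y
    rw [act_mul d1 d2, e z d1]
    have h8 : s ^ 8 = 1 := by rw [show s ^ 8 = (s ^ 2) ^ 4 by ring, hs, one_pow]
    rw [mul_pow, mul_pow, h8, one_mul, ← mul_assoc, ihx hx _ l1, ihy hy z hz]
  | inv x hx ih =>
    rw [hS] at hx
    intro z hz
    obtain ⟨d1, l1⟩ := h.lam_den hz (inv_mem hx)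
    obtain ⟨d2, l2⟩ := h.lam_den l1 hx
    obtain ⟨s, hs, e⟩ := den_mul x x⁻¹
    have h8 : s ^ 8 = 1 := by rw [show s ^ 8 = (s ^ 2) ^ 4 by ring, hs, one_pow]
    have e1 := e z d1
    have e2 := act_mul d1 d2
    rw [mul_inv_cancel] at e1 e2
    rw [(one_den z).2] at e2
    have e3 := ih hx _ l1
    rw [← e2] at e3
    rw [← e3, mul_assoc, ← mul_pow]
    have : (den x (act x⁻¹ z) * den x⁻¹ z) ^ 8 = 1 := by
      have h1 : den 1 z ^ 8 = 1 := by rw [show den 1 z ^ 8 = (den 1 z ^ 2) ^ 4 by ring, (one_den z).1, one_pow]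
      rw [e1, mul_pow, h8, one_mul] at h1
      exact h1
    rw [this, mul_one]

/-- an invariant section vanishes on the limit set -/
lemma zero_lam (h : Nrm G R) {V : ℂ → ℂ} (hG : Good V (Lam G)) (hV : ∀ k ∈ G, ∀ z ∈ Lam G, V (act k z) * den k z ^ 8 = V z)
    {p q : ℂ} (hp : p ∈ Lam G) (hq : q ∈ Lam G) (hpq : p ≠ q) {z : ℂ} (hz : z ∈ Lam G) : V z = 0 := by
  by_contra hne
  have hpos : 0 < ‖V z‖ / 2 := by have := norm_pos_iff.2 hne; positivity
  obtain ⟨ε, hε, hc⟩ := Metric.continuousOn_iff.1 hG.continuousOn z hz _ hpos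
  have hδ : 0 < ‖p - q‖ / 2 := by have := norm_pos_iff.2 (sub_ne_zero.2 hpq); positivity
  set δ := ‖p - q‖ / 2 with hδd
  set B := ‖V p‖ + ‖V q‖ + 1 with hB
  obtain ⟨g, hg, hcg, hK, hgy⟩ := h.attr hz hε hδ (max (1 / δ) (B / (δ * (‖V z‖ / 2))))
  have hBp : 0 < B := by positivity
  have key : ∀ y ∈ Lam G, ‖V y‖ < B → δ ≤ ‖y - ninf g‖ → False := by
    intro y hy hyB hyd
    obtain ⟨d, hd⟩ := hgy y hyd
    have h1 := hc _ (h.lam_den hy hg).2 (by rw [dist_eq_norm]; exact hd)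
    rw [dist_eq_norm] at h1
    have h2 := congrArg norm (hV g hg y hy)
    rw [norm_mul, norm_pow] at h2
    have h3 : ‖V z‖ / 2 < ‖V (act g y)‖ := by
      have := norm_sub_norm_le (V z) (V (act g y))
      rw [norm_sub_rev] at this
      linarith
    have h4 : ‖cc g‖ * δ ≤ ‖den g y‖ := by
      rw [den_eq hcg, norm_mul]; gcongr
    have h5 := lt_of_le_of_lt (le_max_left _ _) hK
    have h6 := lt_of_le_of_lt (le_max_right _ _) hK
    rw [div_lt_iff₀ (by positivity)] at h5 h6
    have h7 : 1 ≤ ‖den g y‖ := by linarith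
    have h8 : ‖den g y‖ ≤ ‖den g y‖ ^ 8 := le_self_pow₀ h7 (by norm_num)
    have : B ≤ ‖V y‖ := by
      rw [← h2]
      calc B ≤ (‖V z‖ / 2) * (‖cc g‖ * δ) := by linarith
        _ ≤ ‖V (act g y)‖ * ‖den g y‖ ^ 8 := by
          refine mul_le_mul h3.le (h4.trans h8) (by positivity) (by positivity)
    linarith
  rcases le_or_gt δ ‖p - ninf g‖ with h1 | h1
  · exact key p hp (by rw [hB]; linarith [norm_nonneg (V q)]) h1
  · refine key q hq (by rw [hB]; linarith [norm_nonneg (V p)]) ?_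
    by_contra! h2
    have := norm_sub_le_norm_sub_add_norm_sub p (ninf g) q
    rw [norm_sub_rev (ninf g) q] at this
    linarith

lemma J_bdd (h : Nrm G R) {a : ℂ} (ha : R + 2 ≤ ‖a‖) : ∃ B > 0, ∀ g : G, ‖Jx a g‖ ≤ B := by
  refine ⟨1 + ∑' g : G, ‖Jx a g‖ ^ 2, by positivity, fun g => ?_⟩
  have h1 : ‖Jx a g‖ ^ 2 ≤ ∑' g : G, ‖Jx a g‖ ^ 2 := (h.summ ha).le_tsum g (fun _ _ => sq_nonneg _)
  nlinarith [norm_nonneg (Jx a g)]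

/-- points of the region of discontinuity off the orbit of `a` are regular for the series -/
lemma E_nhds (h : Nrm G R) {a : ℂ} (ha : R + 2 ≤ ‖a‖) {z : ℂ} {s : Set G} {ε : ℝ} (hε : 0 < ε) (hz : ∀ g ∈ s, ε ≤ ‖act g a - z‖) :
    ∃ c > 0, Eset (fun g : s => Jx a g.1) (fun g : s => px a g.1) c ∈ 𝓝 z := by
  obtain ⟨B, hB, hJ⟩ := h.J_bdd ha
  refine ⟨ε / 2 / B, by positivity, ?_⟩
  filter_upwards [Metric.ball_mem_nhds z (half_pos hε)] with w hw
  intro g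
  rw [Metric.mem_ball, dist_eq_norm] at hw
  have h1 := hz g.1 g.2
  have h2 := norm_sub_le_norm_sub_add_norm_sub (act g.1 a) w z
  rw [norm_sub_rev (act _ a) w] at h2
  calc ε / 2 / B * ‖Jx a g.1‖ ≤ ε / 2 / B * B := by gcongr; exact hJ _
    _ = ε / 2 := by field_simp
    _ ≤ _ := by change _ ≤ ‖w - act g.1 a‖; linarith

lemma Va_diff (h : Nrm G R) {a : ℂ} (ha : R + 2 ≤ ‖a‖) {z : ℂ} (hz : (z : RSphere) ∈ omegaSet G)
    (hne : ∀ g ∈ G, g • (a : RSphere) ≠ z) : DifferentiableAt ℂ (Va G a) z := by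
  obtain ⟨ε, hε, hb⟩ := orbit_away hz hne (fun g hg => h.den_ne hg (by linarith))
  obtain ⟨c, hc, hE⟩ := h.E_nhds ha (s := univ) hε (fun g _ => hb g g.2)
  refine (ser_good (p := px a) (h.J_ne ha) (h.summ ha) hc).diff ?_
  filter_upwards [hE] with w hw g using hw ⟨g, mem_univ g⟩

/-- behaviour at the pole -/
lemma Va_pole (h : Nrm G R) {a : ℂ} (ha : R + 2 ≤ ‖a‖) : Tendsto (fun z => (z - a) * Va G a z) (𝓝[≠] a) (𝓝 1) := by
  have ha' : R < ‖a‖ := by linarith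
  have hb : ∀ g ∈ ({1}ᶜ : Set G), 2 ≤ ‖act g a - a‖ := by
    intro g hg
    have h1 := (h.fin g g.2 (fun h0 => hg (Subtype.ext h0)) a ha').2
    have := norm_sub_norm_le a (act g a)
    rw [norm_sub_rev] at this
    linarith
  obtain ⟨c, hc, hE⟩ := h.E_nhds ha two_pos hb
  have hs : Summable fun g : ({1}ᶜ : Set G) => ‖Jx a g.1‖ ^ 2 := (h.summ ha).subtype _
  have hD := (ser_good (p := fun g : ({1}ᶜ : Set G) => px a g.1) (fun g => h.J_ne ha g.1) hs hc).diff hE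
  have e : ∀ᶠ z in 𝓝[≠] a, (z - a) * Va G a z = 1 + (z - a) * ∑' g : ({1}ᶜ : Set G), Jx a g.1 ^ 5 / (z - px a g.1) := by
    filter_upwards [self_mem_nhdsWithin, nhdsWithin_le_nhds hE] with z hz hzE
    have hza : z - a ≠ 0 := sub_ne_zero.2 hz
    have s1 := ser_summable (p := fun g : ({1}ᶜ : Set G) => px a g.1) (fun g => h.J_ne ha g.1) hs hc hzE
    have s2 : HasSum (fun g : ({1}ᶜ : Set G) => Jx a g.1 ^ 5 / (z - px a g.1)) _ := s1.hasSum
    have s3 : HasSum (fun g : ({1} : Set G) => Jx a g.1 ^ 5 / (z - px a g.1)) (1 / (z - a)) := by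
      have := hasSum_fintype (fun g : ({1} : Set G) => Jx a g.1 ^ 5 / (z - px a g.1))
      convert this using 1
      rw [Fintype.sum_subsingleton _ ⟨1, rfl⟩]
      show _ = ((den 1 a ^ 2)⁻¹) ^ 5 / (z - act 1 a)
      rw [(one_den a).1, (one_den a).2]; simp
    have s4 := s3.add_compl (f := fun g : G => Jx a g ^ 5 / (z - px a g)) s2
    rw [Va, s4.tsum_eq, mul_add, mul_one_div_cancel hza]
  refine (Tendsto.congr' (e.mono fun _ hz => hz.symm) ?_)
  have hcont : ContinuousAt (fun z => 1 + (z - a) * ∑' g : ({1}ᶜ : Set G), Jx a g.1 ^ 5 / (z - px a g.1)) a :=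
    continuousAt_const.add ((continuousAt_id.sub continuousAt_const).mul hD.continuousAt)
  have := hcont.tendsto
  simp only [sub_self, zero_mul, add_zero] at this
  exact this.mono_left nhdsWithin_le_nhds

end Nrm
end

noncomputable section
open Set Filter Topology

lemma exists_inf_to (q : RSphere) : ∃ M : PSL2C, M • (OnePoint.infty : RSphere) = q := by
  induction q using OnePoint.rec with
  | infty => exact ⟨1, one_smul _ _⟩
  | coe w =>
    refine ⟨mk (slm w (-1) 1 0 (by ring)), ?_⟩
    rw [mk_smul_infty (by simp [slm])]
    simp [slm]

lemma chart_emb (M : PSL2C) : IsOpenEmbedding (fun z : ℂ => M • (z : RSphere)) :=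
  (Homeomorph.smul M).isOpenEmbedding.comp OnePoint.isOpenEmbedding_coe

lemma chart_range (M : PSL2C) {x : RSphere} (hx : x ≠ M • (OnePoint.infty : RSphere)) : ∃ z : ℂ, M • (z : RSphere) = x := by
  have : M⁻¹ • x ≠ OnePoint.infty := fun h => hx (by rw [← h, smul_inv_smul])
  obtain ⟨z, hz⟩ := OnePoint.ne_infty_iff_exists.1 this
  exact ⟨z, by rw [hz, smul_inv_smul]⟩

lemma pre_minus {O : Set RSphere} (hO : IsOpen O) (hc : IsPreconnected O) {q : RSphere} (hq : q ∉ O)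
    {C : Set RSphere} (hC : C.Countable) : IsPreconnected (O \ C) := by
  obtain ⟨M, hM⟩ := exists_inf_to q
  have he := chart_emb M
  have hsub : ∀ x ∈ O, ∃ z : ℂ, M • (z : RSphere) = x := fun x hx =>
    chart_range M (by rw [hM]; rintro rfl; exact hq hx)
  have e1 : (fun z : ℂ => M • (z : RSphere)) '' ((fun z : ℂ => M • (z : RSphere)) ⁻¹' O) = O := by
    rw [image_preimage_eq_inter_range]
    exact inter_eq_left.2 hsub
  have h1 : IsPreconnected ((fun z : ℂ => M • (z : RSphere)) ⁻¹' O) := by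
    rw [← he.isInducing.isPreconnected_image, e1]; exact hc
  have h2 := diff_countable_preconnected (hO.preimage he.continuous) h1 (hC.preimage he.injective)
  rw [← preimage_sdiff] at h2
  have h3 := h2.image _ he.continuous.continuousOn
  have e2 : O \ C ∩ range (fun z : ℂ => M • (z : RSphere)) = O \ C :=
    inter_eq_left.2 (fun x hx => hsub x hx.1)
  rw [image_preimage_eq_inter_range, e2] at h3
  exact h3

lemma avoid_countable {C : Set RSphere} (hC : C.Countable) {W : Set ℂ} (hW : IsOpen W) (hne : W.Nonempty) :
    ∃ z ∈ W, (z : RSphere) ∉ C := by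
  have h1 := (hC.preimage OnePoint.coe_injective).dense_compl ℝ
  obtain ⟨z, hz, hz'⟩ := h1.inter_open_nonempty W hW hne
  exact ⟨z, hz, hz'⟩

theorem Nrm.main {G : Subgroup PSL2C} {R : ℝ} (h : Nrm G R) (hFG : G.FG)
    {p q r : ℂ} (hp : p ∈ Lam G) (hq : q ∈ Lam G) (hr : r ∈ Lam G) (hpq : p ≠ q) (hpr : p ≠ r) (hqr : q ≠ r)
    {O : Set RSphere} (hO : IsOpen O) (hc : IsPreconnected O) (hsub : O ⊆ omegaSet G)
    (hext : ∀ z : ℂ, R < ‖z‖ → (z : RSphere) ∈ O) {H : Subgroup PSL2C} (hHG : H ≤ G)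
    (hH : ∀ g ∈ G, ∀ x ∈ O, g • x ∈ O → g ∈ H)
    (hfr : ∀ w : ℂ, (w : RSphere) ∈ closure O → (w : RSphere) ∉ O → w ∈ Lam G)
    {z0 : ℂ} (hz0 : (z0 : RSphere) ∈ closure O) (hz0H : (z0 : RSphere) ∈ omegaSet H) : (z0 : RSphere) ∈ O := by
  classical
  by_contra hz0O
  have hz0L := hfr z0 hz0 hz0O
  obtain ⟨N, a, l, hl0, hinj, ha, hinv⟩ := h.exists_inv hFG
  set V : ℂ → ℂ := fun z => ∑ i, l i * Va G (a i) z with hV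
  have hext' : ∀ i, R < ‖a i‖ := fun i => by linarith [ha i]
  have hac : ∀ z ∈ Lam G, ∀ ε > 0, ∃ w ∈ Lam G, w ≠ z ∧ ‖w - z‖ < ε := h.acc hp hq hr hpq hpr hqr
  set OC : Set ℂ := (fun z : ℂ => (z : RSphere)) ⁻¹' O with hOC
  have hOCo : IsOpen OC := hO.preimage OnePoint.continuous_coe
  have hOLam : ∀ z ∈ OC, z ∉ Lam G := fun z hz hz' => hz' (hsub hz)
  -- vanishing on the limit set
  have hGL : Good V (Lam G) := Good.sum _ fun i _ => Good.smul ((ser_good (p := px (a i)) (h.J_ne (ha i)) (h.summ (ha i))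
    one_half_pos).mono fun z hz => h.lam_E hz (ha i)) _
  have hV0 : ∀ z ∈ Lam G, V z = 0 := fun z hz => h.zero_lam hGL hinv hp hq hpq hz
  -- regularity near z0
  have hloc : ∀ i, ∃ S ∈ 𝓝 z0, Good (Va G (a i)) (S ∩ (OC ∪ Lam G)) := by
    intro i
    obtain ⟨ε, hε, hb⟩ := orbit_away (a := a i) hz0H (fun g hg h0 => by
      have := omega_smul (hHG hg) (h.ext_omega.2 _ (hext' i))
      rw [h0] at this
      exact hz0L this) (fun g hg => h.den_ne (hHG hg) (hext' i))
    obtain ⟨c, hc, hE⟩ := h.E_nhds (ha i) (s := {g : G | g.1 ∈ H}) hε (fun g hg => hb g hg)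
    refine ⟨_, hE, (ser_good (p := px (a i)) (h.J_ne (ha i)) (h.summ (ha i)) (c := min c (1 / 2)) (by positivity)).mono ?_⟩
    rintro w ⟨hw, hw' | hw'⟩ g
    · by_cases hg : g.1 ∈ H
      · refine le_trans ?_ (hw ⟨g, hg⟩)
        gcongr
        exact min_le_left _ _
      · refine le_trans (b := 1 / 2 * ‖Jx (a i) g‖) (by gcongr; exact min_le_right _ _) ?_
        by_contra! hlt
        obtain ⟨y, -, hy, hd, e⟩ := h.disc (w := w) g.2 (ha i) (by rw [px, Jx] at hlt; linarith)
        refine hg (hH g g.2 y (hext y hy) ?_)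
        rw [smul_fin hd, e]; exact hw'
    · refine le_trans (b := 1 / 2 * ‖Jx (a i) g‖) (by gcongr; exact min_le_right _ _) (h.lam_E hw' (ha i) g)
  choose S hS hSG using hloc
  have hSn : (⋂ i, S i) ∈ 𝓝 z0 := iInter_mem.2 hS
  obtain ⟨ρ, hρ, hball⟩ := Metric.mem_nhds_iff.1 hSn
  have hGB : Good V (Metric.ball z0 ρ ∩ (OC ∪ Lam G)) := Good.sum _ fun i _ => Good.smul ((hSG i).mono
    fun w hw => ⟨mem_iInter.1 (hball hw.1) i, hw.2⟩) _
  obtain ⟨C, hC0, hCq⟩ := hGB.vanish (Z := Metric.ball z0 ρ ∩ Lam G) (fun z hz => ⟨hz.1, Or.inr hz.2⟩)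
    (fun z hz => hV0 z hz.2) (by
      rintro z ⟨hz, hz'⟩ ε hε
      obtain ⟨ε', hε', hb⟩ := Metric.isOpen_iff.1 Metric.isOpen_ball z hz
      obtain ⟨w, hw, hwz, hlt⟩ := hac z hz' (min ε ε') (lt_min hε hε')
      exact ⟨w, ⟨hb (by rw [Metric.mem_ball, dist_eq_norm]; exact hlt.trans_le (min_le_right _ _)), hw⟩, hwz,
        hlt.trans_le (min_le_left _ _)⟩)
  -- the extended function
  set F : ℂ → ℂ := fun w => if w ∈ OC then V w else 0 with hF
  have hFd : DifferentiableOn ℂ F (Metric.ball z0 ρ) := by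
    intro w hw
    refine DifferentiableAt.differentiableWithinAt ?_
    by_cases hwO : w ∈ OC
    · have hn : Metric.ball z0 ρ ∩ (OC ∪ Lam G) ∈ 𝓝 w :=
        inter_mem (Metric.isOpen_ball.mem_nhds hw) (mem_of_superset (hOCo.mem_nhds hwO) subset_union_left)
      refine (hGB.diff hn).congr_of_eventuallyEq ?_
      filter_upwards [hOCo.mem_nhds hwO] with y hy
      simp [hF, hy]
    · by_cases hcl : (w : RSphere) ∈ closure O
      · have hwL := hfr w hcl hwO
        refine quad_deriv (D := 0) (C := C) ?_
        filter_upwards [Metric.isOpen_ball.mem_nhds hw] with y hy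
        have e1 : F w = 0 := by simp [hF, hwO]
        rw [e1, zero_mul, sub_zero, sub_zero]
        by_cases hyO : y ∈ OC
        · have : F y = V y := by simp [hF, hyO]
          rw [this]
          exact hCq w ⟨hw, hwL⟩ y ⟨hy, Or.inl hyO⟩
        · have : F y = 0 := by simp [hF, hyO]
          rw [this, norm_zero]; positivity
      · have hn : (fun z : ℂ => (z : RSphere)) ⁻¹' (closure O)ᶜ ∈ 𝓝 w :=
          (isClosed_closure.isOpen_compl.preimage OnePoint.continuous_coe).mem_nhds hcl
        refine (differentiableAt_const (0 : ℂ)).congr_of_eventuallyEq ?_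
        filter_upwards [hn] with y hy
        have : y ∉ OC := fun h0 => hy (subset_closure h0)
        simp [hF, this]
  have hFa : AnalyticAt ℂ F z0 := hFd.analyticAt (Metric.ball_mem_nhds z0 hρ)
  have hF0 : ∀ᶠ z in 𝓝 z0, F z = 0 := by
    rcases hFa.eventually_eq_zero_or_eventually_ne_zero with h1 | h1
    · exact h1
    · exfalso
      rw [eventually_nhdsWithin_iff] at h1
      obtain ⟨ε, hε, hb⟩ := Metric.eventually_nhds_iff.1 h1
      obtain ⟨w, hw, hwz, hlt⟩ := hac z0 hz0L ε hε
      refine hb (by rw [dist_eq_norm]; exact hlt) hwz ?_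
      have : w ∉ OC := fun h0 => hOLam w h0 hw
      simp [hF, this]
  -- poles
  have := h.countable
  set P : Set RSphere := ⋃ i, range fun g : G => g.1 • (a i : RSphere) with hP
  have hPc : P.Countable := countable_iUnion fun i => countable_range _
  set D : Set ℂ := {z | z ∈ OC ∧ (z : RSphere) ∉ P} with hD
  have hne : ∀ z ∈ D, ∀ i, ∀ g ∈ G, g • (a i : RSphere) ≠ z := fun z hz i g hg h0 =>
    hz.2 (mem_iUnion.2 ⟨i, ⟨g, hg⟩, h0⟩)
  have hDo : IsOpen D := by
    rw [isOpen_iff_mem_nhds]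
    intro z hz
    have h1 : ∀ i, ∀ᶠ w : ℂ in 𝓝 z, ∀ g ∈ G, g • (a i : RSphere) ≠ (w : RSphere) := by
      intro i
      obtain ⟨ε, hε, hb⟩ := orbit_away (hsub hz.1) (hne z hz i) (fun g hg => h.den_ne hg (hext' i))
      filter_upwards [Metric.ball_mem_nhds z hε] with w hw g hg h0
      rw [smul_fin (h.den_ne hg (hext' i))] at h0
      have h0 := OnePoint.coe_injective h0
      rw [Metric.mem_ball, dist_eq_norm, ← h0] at hw
      linarith [hb g hg]
    filter_upwards [hOCo.mem_nhds hz.1, eventually_all.2 h1] with w hw hw'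
    refine ⟨hw, fun h0 => ?_⟩
    obtain ⟨i, g, hg⟩ := mem_iUnion.1 h0
    exact hw' i g g.2 hg
  have hVd : DifferentiableOn ℂ V D := by
    intro z hz
    refine DifferentiableAt.differentiableWithinAt ?_
    refine DifferentiableAt.fun_sum fun i _ => ?_
    exact (h.Va_diff (ha i) (hsub hz.1) (hne z hz i)).const_mul _
  have hDc : IsPreconnected D := by
    have h1 := pre_minus hO hc hz0O (hPc.union (countable_singleton OnePoint.infty))
    rw [← OnePoint.isOpenEmbedding_coe.isInducing.isPreconnected_image]
    convert h1 using 1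
    ext x
    constructor
    · rintro ⟨z, hz, rfl⟩
      refine ⟨hz.1, ?_⟩
      rintro (h0 | h0)
      · exact hz.2 h0
      · exact OnePoint.coe_ne_infty _ h0
    · rintro ⟨hx, hx'⟩
      induction x using OnePoint.rec with
      | infty => exact absurd (Or.inr rfl) hx'
      | coe z => exact ⟨z, ⟨hx, fun h0 => hx' (Or.inl h0)⟩, rfl⟩
  obtain ⟨w0, hw0D, hw0⟩ : ∃ w0 ∈ D, V =ᶠ[𝓝 w0] 0 := by
    obtain ⟨ε, hε, hb⟩ := Metric.eventually_nhds_iff_ball.1 hF0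
    have hz0c : z0 ∈ closure OC := by
      have := OnePoint.isOpenEmbedding_coe (X := ℂ) |>.isOpenMap.preimage_closure_eq_closure_preimage OnePoint.continuous_coe O
      rw [hOC, ← this]; exact hz0
    have hne : (OC ∩ Metric.ball z0 ε).Nonempty := by
      obtain ⟨y, hy, hy'⟩ := mem_closure_iff_nhds.1 hz0c _ (Metric.ball_mem_nhds z0 hε)
      exact ⟨y, hy', hy⟩
    have hopen := hOCo.inter (Metric.isOpen_ball (x := z0) (ε := ε))
    obtain ⟨w, hw, hwP⟩ := avoid_countable hPc hopen hne
    refine ⟨w, ⟨hw.1, hwP⟩, ?_⟩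
    filter_upwards [hopen.mem_nhds hw] with y hy
    have := hb y hy.2
    simpa [hF, hy.1] using this
  have hVz : EqOn V 0 D := (hVd.analyticOnNhd hDo).eqOn_zero_of_preconnected_of_eventuallyEq_zero hDc hw0D hw0
  -- contradiction at a pole
  obtain ⟨i0, hi0⟩ := Function.ne_iff.1 hl0
  simp only [Pi.zero_apply] at hi0
  have hlim : Tendsto (fun z => (z - a i0) * V z) (𝓝[≠] a i0) (𝓝 (∑ i, if i = i0 then l i0 else 0)) := by
    have : (fun z => (z - a i0) * V z) = fun z => ∑ i, l i * ((z - a i0) * Va G (a i) z) := by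
      ext z
      rw [hV, Finset.mul_sum]
      exact Finset.sum_congr rfl fun i _ => by ring
    rw [this]
    refine tendsto_finsetSum _ fun i _ => ?_
    by_cases hi : i = i0
    · subst hi
      have := (h.Va_pole (ha i)).const_mul (l i)
      simpa using this
    · have hd : DifferentiableAt ℂ (Va G (a i)) (a i0) := by
        refine h.Va_diff (ha i) (h.ext_omega.2 _ (hext' i0)) fun g hg h0 => ?_
        rw [smul_fin (h.den_ne hg (hext' i))] at h0
        have h0 := OnePoint.coe_injective h0
        by_cases h1 : g = 1
        · rw [h1, (one_den _).2] at h0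
          exact hi (hinj h0)
        · have := (h.fin g hg h1 _ (hext' i)).2
          rw [h0] at this
          linarith [hext' i0]
      have hcont : ContinuousAt (fun z => l i * ((z - a i0) * Va G (a i) z)) (a i0) :=
        continuousAt_const.mul ((continuousAt_id.sub continuousAt_const).mul hd.continuousAt)
      have := hcont.tendsto
      simp only [sub_self, zero_mul, mul_zero] at this
      simpa [hi] using this.mono_left nhdsWithin_le_nhds
  rw [Finset.sum_ite_eq' Finset.univ i0 (fun _ => l i0)] at hlim
  simp only [Finset.mem_univ, if_true] at hlim
  have hev := hlim.eventually_ne hi0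
  rw [eventually_nhdsWithin_iff] at hev
  obtain ⟨W, hW, hWo, haW⟩ := eventually_nhds_iff.1 hev
  obtain ⟨y, hy, hyP⟩ := avoid_countable hPc (hWo.inter hOCo) ⟨a i0, haW, hext _ (hext' i0)⟩
  have hya : y ≠ a i0 := by
    rintro rfl
    exact hyP (mem_iUnion.2 ⟨i0, 1, one_smul _ _⟩)
  apply hW y hy.1 hya
  have : V y = 0 := hVz ⟨hy.2, hyP⟩
  rw [this, mul_zero]
end

noncomputable section
open Set Filter Topology

instance rsphere_lc : LocallyConnectedSpace RSphere := by
  rw [locallyConnectedSpace_iff_subsets_isOpen_isConnected]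
  intro x U hU
  obtain ⟨q, hq⟩ : ∃ q : RSphere, q ≠ x := exists_ne x
  obtain ⟨M, hM⟩ := exists_inf_to q
  obtain ⟨z, rfl⟩ := chart_range M (x := x) (by rw [hM]; exact hq.symm)
  have he := chart_emb M
  obtain ⟨ε, hε, hb⟩ := Metric.mem_nhds_iff.1 (he.continuous.continuousAt hU)
  exact ⟨_, image_subset_iff.2 hb, he.isOpenMap _ Metric.isOpen_ball, ⟨z, Metric.mem_ball_self hε, rfl⟩,
    (Metric.isConnected_ball hε).image _ he.continuous.continuousOn⟩

/-- a point of the closure of a component which lies in the region of discontinuity is in the component -/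
lemma comp_closure_omega {G : Subgroup PSL2C} {z w : RSphere}
    (hw : w ∈ closure (connectedComponentIn (omegaSet G) z)) (hwG : w ∈ omegaSet G) :
    w ∈ connectedComponentIn (omegaSet G) z := by
  have h1 : IsOpen (connectedComponentIn (omegaSet G) w) := (omega_open G).connectedComponentIn
  obtain ⟨y, hy1, hy2⟩ := mem_closure_iff.1 hw _ h1 (mem_connectedComponentIn hwG)
  rw [connectedComponentIn_eq hy2, ← connectedComponentIn_eq hy1]
  exact mem_connectedComponentIn hwG

/-- conjugated group -/
def cj (M : PSL2C) (G : Subgroup PSL2C) : Subgroup PSL2C := G.map (MulAut.conj M).toMonoidHom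

lemma mem_cj {M : PSL2C} {G : Subgroup PSL2C} {k : PSL2C} : k ∈ cj M G ↔ M⁻¹ * k * M ∈ G := by
  constructor
  · rintro ⟨g, hg, rfl⟩
    simpa [mul_assoc] using hg
  · intro h
    exact ⟨_, h, by simp [mul_assoc]⟩

lemma cj_cj {M : PSL2C} {G : Subgroup PSL2C} : cj M⁻¹ (cj M G) = G := by
  ext k; simp [mem_cj, mul_assoc]

lemma cj_omega_aux {M : PSL2C} {G : Subgroup PSL2C} {z : RSphere} (h : z ∈ omegaSet G) :
    M • z ∈ omegaSet (cj M G) := by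
  obtain ⟨U, hU, hzU, hf⟩ := h
  refine ⟨(fun x => M⁻¹ • x) ⁻¹' U, hU.preimage (continuous_const_smul _), by simpa using hzU, ?_⟩
  refine (hf.image (fun g => M * g * M⁻¹)).subset ?_
  rintro k ⟨hk, x, ⟨y, hy, rfl⟩, hx⟩
  refine ⟨M⁻¹ * k * M, ⟨mem_cj.1 hk, M⁻¹ • k • y, ⟨M⁻¹ • y, hy, ?_⟩, ?_⟩, by simp [mul_assoc]⟩
  · rw [← smul_def']; simp [mul_smul]
  · rw [mem_preimage, ← smul_def'] at hx; exact hx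

lemma cj_omega {M : PSL2C} {G : Subgroup PSL2C} {z : RSphere} :
    M • z ∈ omegaSet (cj M G) ↔ z ∈ omegaSet G := by
  refine ⟨fun h => ?_, cj_omega_aux⟩
  have := cj_omega_aux (M := M⁻¹) h
  rwa [cj_cj, inv_smul_smul] at this

lemma cj_free {M : PSL2C} {G : Subgroup PSL2C} (hT : TorsionFree G) : TorsionFree (cj M G) := by
  intro g hg n hn h
  have := hT _ (mem_cj.1 hg) n hn (by
    have : (M⁻¹ * g * M) ^ n = M⁻¹ * g ^ n * M := by
      have := conj_pow (a := M⁻¹) (b := g) (i := n)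
      simpa using this
    rw [this, h]; simp)
  have h2 : g = M * (M⁻¹ * g * M) * M⁻¹ := by simp [mul_assoc]
  rw [h2, this]; simp

/-- normal position at infinity -/
lemma exists_nrm {G : Subgroup PSL2C} (hT : TorsionFree G) (hi : OnePoint.infty ∈ omegaSet G)
    {O : Set RSphere} (hO : IsOpen O) (hiO : OnePoint.infty ∈ O) :
    ∃ R, Nrm G R ∧ ∀ z : ℂ, R < ‖z‖ → (z : RSphere) ∈ O := by
  have hi' := hi
  obtain ⟨U, hU, hzU, hf⟩ := hi
  have h1 : ∀ g : PSL2C, g ∈ G → g ≠ 1 →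
      ∀ᶠ p in 𝓝 (OnePoint.infty : RSphere) ×ˢ 𝓝 (OnePoint.infty : RSphere), g • p.1 ≠ p.2 := by
    intro g hg hg1
    have h2 : g • (OnePoint.infty : RSphere) ≠ OnePoint.infty := fun h0 => hg1 (omega_free hT hg hi' h0)
    rw [← nhds_prod_eq]
    have : IsOpen {p : RSphere × RSphere | g • p.1 ≠ p.2} :=
      isOpen_ne_fun ((continuous_const_smul g).comp continuous_fst) continuous_snd
    exact this.mem_nhds h2
  have h2 : ∀ᶠ p in 𝓝 (OnePoint.infty : RSphere) ×ˢ 𝓝 (OnePoint.infty : RSphere),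
      ∀ g ∈ {g : PSL2C | g ∈ G ∧ (psl g '' U ∩ U).Nonempty}, g ≠ 1 → g • p.1 ≠ p.2 := by
    rw [eventually_all_finite hf]
    rintro g ⟨hg, -⟩
    by_cases hg1 : g = 1
    · exact Eventually.of_forall fun p h => absurd hg1 h
    · filter_upwards [h1 g hg hg1] with p hp _ using hp
  obtain ⟨A, hA, B, hB1, hB2⟩ := eventually_prod_iff.1 h2
  set N : Set RSphere := {x | A x ∧ B x ∧ x ∈ U ∧ x ∈ O} with hN
  have hN1 : N ∈ 𝓝 (OnePoint.infty : RSphere) := by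
    filter_upwards [hA, hB1, hU.mem_nhds hzU, hO.mem_nhds hiO] with x a b c d using ⟨a, b, c, d⟩
  have hN2 : ∀ g ∈ G, g ≠ 1 → ∀ x ∈ N, g • x ∉ N := by
    intro g hg hg1 x hx hx'
    exact hB2 hx.1 hx'.2.1 g ⟨hg, g • x, ⟨x, hx.2.2.1, (smul_def' _ _).symm⟩, hx'.2.2.1⟩ hg1 rfl
  have h3 : ∀ᶠ z : ℂ in Bornology.cobounded ℂ, (z : RSphere) ∈ N :=
    (tendsto_coe_sphere_infty (f := fun z : ℂ => z) tendsto_norm_cobounded_atTop) hN1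
  rw [← comap_norm_atTop, eventually_comap] at h3
  obtain ⟨R, hR⟩ := eventually_atTop.1 h3
  have hR' : ∀ z : ℂ, max R 1 < ‖z‖ → (z : RSphere) ∈ N := fun z hz =>
    hR ‖z‖ (le_of_lt (lt_of_le_of_lt (le_max_left _ _) hz)) z rfl
  have hNi := mem_of_mem_nhds hN1
  have hle : ∀ z : ℂ, (z : RSphere) ∉ N → ‖z‖ ≤ max R 1 := fun z hz => by
    by_contra h0; exact hz (hR' z (not_le.1 h0))
  refine ⟨max R 1, ⟨by positivity, fun g hg hg1 => ?_, fun g hg hg1 z hz => ?_⟩, fun z hz => (hR' z hz).2.2.2⟩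
  · have h4 := hN2 g hg hg1 _ hNi
    have h5 : cc g ≠ 0 := fun h0 => h4 (by rw [smul_inf_inf h0]; exact hNi)
    rw [smul_inf h5] at h4
    exact ⟨h5, hle _ h4⟩
  · have h4 := hN2 g hg hg1 _ (hR' z hz)
    have h5 : den g z ≠ 0 := fun h0 => h4 (by rw [smul_fin_inf h0]; exact hNi)
    rw [smul_fin h5] at h4
    exact ⟨h5, hle _ h4⟩

/-- normal position at a point -/
lemma exists_nrm' {G : Subgroup PSL2C} (hT : TorsionFree G) {z : RSphere} (hz : z ∈ omegaSet G)
    {O : Set RSphere} (hO : IsOpen O) (hiO : z ∈ O) :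
    ∃ M : PSL2C, M • (OnePoint.infty : RSphere) = z ∧ ∃ R, Nrm (cj M⁻¹ G) R ∧
      ∀ w : ℂ, R < ‖w‖ → M • (w : RSphere) ∈ O := by
  obtain ⟨M, hM⟩ := exists_inf_to z
  have h1 : (OnePoint.infty : RSphere) ∈ omegaSet (cj M⁻¹ G) := by
    have := cj_omega_aux (M := M⁻¹) hz
    rwa [← hM, inv_smul_smul] at this
  obtain ⟨R, hR, hR'⟩ := exists_nrm (cj_free hT) h1 (hO.preimage (continuous_const_smul M))
    (show _ ∈ _ by rw [mem_preimage, hM]; exact hiO)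
  exact ⟨M, hM, R, hR, hR'⟩

lemma kleinian_countable {G : Subgroup PSL2C} (hK : IsKleinian G) : Countable G := by
  obtain ⟨-, -, hT, -, z, hz⟩ := hK
  obtain ⟨M, -, R, hR, -⟩ := exists_nrm' hT hz isOpen_univ (mem_univ z)
  have := hR.countable
  refine Function.Injective.countable (f := fun g : G => (⟨M⁻¹ * g.1 * M, mem_cj.2 (by simp [mul_assoc])⟩ : cj M⁻¹ G)) ?_
  intro a b hab
  have := congrArg Subtype.val hab
  simp only [mul_left_inj, mul_right_inj] at this
  exact Subtype.ext this

/-- proper discontinuity -/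
lemma omega_pd {G : Subgroup PSL2C} (hT : TorsionFree G) {x y : RSphere} (hx : x ∈ omegaSet G)
    (hy : y ∈ omegaSet G) : ∃ U ∈ 𝓝 x, ∃ V ∈ 𝓝 y, ∀ g ∈ G, ∀ u ∈ U, g • u ∈ V → g • x = y := by
  -- a third point
  obtain ⟨z, hz, hzx, hzy⟩ : ∃ z ∈ omegaSet G, x ≠ z ∧ y ≠ z := by
    obtain ⟨q, hq⟩ : ∃ q : RSphere, q ≠ x := exists_ne x
    obtain ⟨M, hM⟩ := exists_inf_to q
    obtain ⟨z, hz⟩ := chart_range M (x := x) (by rw [hM]; exact hq.symm)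
    have he := chart_emb M
    have hC : ((fun z : ℂ => M • (z : RSphere)) ⁻¹' {x, y}).Countable :=
      (Set.toFinite {x, y}).countable.preimage he.injective
    obtain ⟨w, hw, hw'⟩ := (hC.dense_compl ℝ).inter_open_nonempty _ ((omega_open G).preimage he.continuous)
      ⟨z, by rw [mem_preimage, hz]; exact hx⟩
    refine ⟨_, hw, fun h0 => hw' (Or.inl h0.symm), fun h0 => hw' (Or.inr h0.symm)⟩
  obtain ⟨M, hM, R, hR, -⟩ := exists_nrm' hT hz isOpen_univ (mem_univ z)
  obtain ⟨x', rfl⟩ := chart_range M (x := x) (by rwa [hM])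
  obtain ⟨y', rfl⟩ := chart_range M (x := y) (by rwa [hM])
  set K := cj M⁻¹ G with hK
  have hx' : (x' : RSphere) ∈ omegaSet K := by
    have := cj_omega_aux (M := M⁻¹) hx; rwa [inv_smul_smul] at this
  have hy' : (y' : RSphere) ∈ omegaSet K := by
    have := cj_omega_aux (M := M⁻¹) hy; rwa [inv_smul_smul] at this
  obtain ⟨U, hU, hxU, hUf⟩ := orbit_finite hx' OnePoint.infty
  obtain ⟨V, hV, hyV, hVf⟩ := orbit_finite hy' OnePoint.infty
  obtain ⟨r1, hr1, hb1⟩ := ball_of_nhds hU hxU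
  obtain ⟨r2, hr2, hb2⟩ := ball_of_nhds hV hyV
  set r := min r1 r2 / 2 with hr
  have hr0 : 0 < r := by have := lt_min hr1 hr2; positivity
  have hr1' : 2 * r ≤ r1 := by rw [hr]; linarith [min_le_left r1 r2]
  have hr2' : 2 * r ≤ r2 := by rw [hr]; linarith [min_le_right r1 r2]
  have hfin : {g : PSL2C | g ∈ K ∧ ∃ u : ℂ, ‖u - x'‖ < r ∧ ∃ v : ℂ, ‖v - y'‖ < r ∧ g • (u : RSphere) = v}.Finite := by
    refine ((((hUf.image (fun g => g⁻¹)).union hVf).union (hR.finite_cc (1 / r))).union (finite_singleton 1)).subset ?_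
    rintro g ⟨hg, u, hu, v, hv, huv⟩
    by_cases hg1 : g = 1
    · exact Or.inr hg1
    left
    obtain ⟨hc, -⟩ := hR.inf g hg hg1
    have hc' : cc g⁻¹ ≠ 0 := by rw [← norm_pos_iff, norm_cc_inv, norm_pos_iff]; exact hc
    by_cases h1 : ‖ninf g - x'‖ < r1
    · refine Or.inl (Or.inl ⟨g⁻¹, ⟨inv_mem hg, ?_⟩, inv_inv g⟩)
      rw [smul_inf hc', pinf_inv]; exact hb1 _ h1
    by_cases h2 : ‖pinf g - y'‖ < r2
    · refine Or.inl (Or.inr ⟨hg, ?_⟩)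
      rw [smul_inf hc]; exact hb2 _ h2
    refine Or.inr ⟨hg, ?_⟩
    have hd : den g u ≠ 0 := fun h0 => by
      rw [smul_fin_inf h0] at huv; exact OnePoint.infty_ne_coe _ huv
    rw [smul_fin hd] at huv
    have huv := OnePoint.coe_injective huv
    have hk := key_norm hc hd
    rw [huv] at hk
    have e1 : r ≤ ‖v - pinf g‖ := by
      have := norm_sub_le_norm_sub_add_norm_sub (pinf g) v y'
      rw [norm_sub_rev (pinf g) v] at this
      linarith [not_lt.1 h2]
    have e2 : r ≤ ‖u - ninf g‖ := by
      have := norm_sub_le_norm_sub_add_norm_sub (ninf g) u x'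
      rw [norm_sub_rev (ninf g) u] at this
      linarith [not_lt.1 h1]
    have e3 : r * ‖cc g‖ ^ 2 * r ≤ 1 := by
      rw [← hk]; gcongr
    rw [le_div_iff₀ hr0]
    nlinarith [norm_nonneg (cc g)]
  have he := chart_emb M
  have hn1 : (fun u : ℂ => M • (u : RSphere)) '' Metric.ball x' r ∈ 𝓝 (M • (x' : RSphere)) :=
    he.isOpenMap.image_mem_nhds (Metric.ball_mem_nhds x' hr0)
  have hn2 : (fun u : ℂ => M • (u : RSphere)) '' Metric.ball y' r ∈ 𝓝 (M • (y' : RSphere)) :=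
    he.isOpenMap.image_mem_nhds (Metric.ball_mem_nhds y' hr0)
  have hsep : ∀ᶠ p in 𝓝 (M • (x' : RSphere)) ×ˢ 𝓝 (M • (y' : RSphere)),
      ∀ g ∈ {g : PSL2C | g ∈ K ∧ ∃ u : ℂ, ‖u - x'‖ < r ∧ ∃ v : ℂ, ‖v - y'‖ < r ∧ g • (u : RSphere) = v},
        (M * g * M⁻¹) • p.1 = p.2 → (M * g * M⁻¹) • M • (x' : RSphere) = M • (y' : RSphere) := by
    rw [eventually_all_finite hfin]
    intro g _
    by_cases h0 : (M * g * M⁻¹) • M • (x' : RSphere) = M • (y' : RSphere)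
    · exact Eventually.of_forall fun p _ => h0
    rw [← nhds_prod_eq]
    have : IsOpen {p : RSphere × RSphere | (M * g * M⁻¹) • p.1 ≠ p.2} :=
      isOpen_ne_fun ((continuous_const_smul _).comp continuous_fst) continuous_snd
    filter_upwards [this.mem_nhds h0] with p hp hp' using absurd hp' hp
  obtain ⟨A, hA, B, hB1, hB2⟩ := eventually_prod_iff.1 hsep
  refine ⟨_, inter_mem hA hn1, _, inter_mem hB1 hn2, ?_⟩
  rintro g hg _ ⟨hu, u, hu', rfl⟩ ⟨hv, v, hv', hv2⟩
  have e : M * (M⁻¹ * g * M) * M⁻¹ = g := by simp [mul_assoc]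
  have := hB2 hu hv (M⁻¹ * g * M) ⟨mem_cj.2 (by simpa [mul_assoc] using hg), u, by simpa [dist_eq_norm] using hu', v,
    by simpa [dist_eq_norm] using hv', ?_⟩
  · simp only [e] at this
    exact this trivial
  · simp only [mul_smul]
    rw [← hv2, inv_smul_smul]

/-- A: the frontier of a component lies in the limit set of its stabiliser -/
theorem comp_closure {G : Subgroup PSL2C} (hK : IsKleinian G) {z : RSphere} (hz : z ∈ omegaSet G)
    {H : Subgroup PSL2C} (hHG : H ≤ G)
    (hH : ∀ g ∈ G, ∀ x ∈ connectedComponentIn (omegaSet G) z, g • x ∈ connectedComponentIn (omegaSet G) z → g ∈ H)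
    {w : RSphere} (hw : w ∈ closure (connectedComponentIn (omegaSet G) z)) (hwH : w ∈ omegaSet H) :
    w ∈ connectedComponentIn (omegaSet G) z := by
  obtain ⟨-, hFG, hT, hne, -⟩ := hK
  set O := connectedComponentIn (omegaSet G) z with hOdef
  have hO : IsOpen O := (omega_open G).connectedComponentIn
  have hzO : z ∈ O := mem_connectedComponentIn hz
  have hsub : O ⊆ omegaSet G := connectedComponentIn_subset _ _
  obtain ⟨M, hM, R, hR, hext⟩ := exists_nrm' hT hz hO hzO
  have hcls : ∀ w : RSphere, w ∈ closure ((fun x => M • x) ⁻¹' O) ↔ M • w ∈ closure O := by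
    intro w
    have := (Homeomorph.smul M : RSphere ≃ₜ RSphere).preimage_closure O
    exact (Set.ext_iff.1 this w).symm
  have hom : ∀ (K : Subgroup PSL2C) (w : RSphere), w ∈ omegaSet (cj M⁻¹ K) ↔ M • w ∈ omegaSet K := by
    intro K w
    have := cj_omega (M := M⁻¹) (G := K) (z := M • w)
    rwa [inv_smul_smul] at this
  have hfin : ∀ a : RSphere, a ∈ limitSet G → ∃ a' : ℂ, M • (a' : RSphere) = a := by
    intro a ha
    refine chart_range M ?_
    rw [hM]; rintro rfl; exact ha hz
  obtain ⟨a, b, c, ha, hb, hc, hab, hac, hbc⟩ := hne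
  obtain ⟨a, rfl⟩ := hfin a ha
  obtain ⟨b, rfl⟩ := hfin b hb
  obtain ⟨c, rfl⟩ := hfin c hc
  have hL : ∀ a : ℂ, M • (a : RSphere) ∈ limitSet G → a ∈ Lam (cj M⁻¹ G) := fun a ha h0 => ha ((hom G a).1 h0)
  by_cases hwz : w = z
  · rw [hwz]; exact hzO
  obtain ⟨w, rfl⟩ := chart_range M (x := w) (by rwa [hM])
  have hFG' : (cj M⁻¹ G).FG := by
    obtain ⟨S, hS, hSf⟩ := (Subgroup.fg_iff G).1 hFG
    refine (Subgroup.fg_iff _).2 ⟨_, ?_, hSf.image (MulAut.conj M⁻¹).toMonoidHom⟩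
    rw [cj, ← hS, MonoidHom.map_closure]
  have hc' : IsPreconnected ((fun x : RSphere => M • x) ⁻¹' O) :=
    (Homeomorph.smul M : RSphere ≃ₜ RSphere).isPreconnected_preimage.2 isPreconnected_connectedComponentIn
  exact hR.main hFG' (hL a ha) (hL b hb) (hL c hc) (fun h => hab (by rw [h])) (fun h => hac (by rw [h]))
    (fun h => hbc (by rw [h])) (O := (fun x => M • x) ⁻¹' O) (hO.preimage (continuous_const_smul M)) hc'
    (fun x hx => (hom G x).2 (hsub hx)) hext (H := cj M⁻¹ H)
    (fun g hg => mem_cj.2 (hHG (mem_cj.1 hg)))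
    (fun g hg x hx hgx => mem_cj.2 (hH _ (mem_cj.1 hg) (M • x) hx (by
      have : (M⁻¹⁻¹ * g * M⁻¹) • M • x = M • g • x := by simp [mul_smul]
      rw [this]; exact hgx)))
    (fun v hv hv' h0 => hv' (comp_closure_omega ((hcls _).1 hv) ((hom G v).1 h0)))
    ((hcls _).2 hw) ((hom H w).2 hwH)
end

noncomputable section
open Set Filter Topology

/-- the group generated by `z+2` and `z/(2 z+1)` -/
def Gam : Subgroup PSL2C := Subgroup.closure {mk (Uu 2), mk (Ll 2)}

/-- integral representative -/
def IntRep (g : PSL2C) (a b c d : ℤ) : Prop :=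
  ∃ A : SL2C, mk A = g ∧ A.1 0 0 = a ∧ A.1 0 1 = b ∧ A.1 1 0 = c ∧ A.1 1 1 = d

lemma IntRep.unique {g g' : PSL2C} {a b c d : ℤ} (h : IntRep g a b c d) (h' : IntRep g' a b c d) : g = g' := by
  obtain ⟨A, rfl, h1, h2, h3, h4⟩ := h
  obtain ⟨B, rfl, h1', h2', h3', h4'⟩ := h'
  rw [sl_ext (h1.trans h1'.symm) (h2.trans h2'.symm) (h3.trans h3'.symm) (h4.trans h4'.symm)]

lemma gam_int {g : PSL2C} (hg : g ∈ Gam) : ∃ a b c d : ℤ, IntRep g a b c d ∧ a * d - b * c = 1 ∧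
    Odd a ∧ Even b ∧ Even c ∧ Odd d := by
  suffices h : ∃ a b c d : ℤ, IntRep g a b c d ∧ Odd a ∧ Even b ∧ Even c ∧ Odd d by
    obtain ⟨a, b, c, d, hr, h⟩ := h
    refine ⟨a, b, c, d, hr, ?_, h⟩
    obtain ⟨A, -, h1, h2, h3, h4⟩ := hr
    have := sl_det A
    rw [h1, h2, h3, h4] at this
    exact_mod_cast this
  refine Subgroup.closure_induction (p := fun g _ => ∃ a b c d : ℤ, IntRep g a b c d ∧ Odd a ∧ Even b ∧ Even c ∧ Odd d)
    ?_ ?_ ?_ ?_ hg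
  · rintro x (rfl | rfl)
    · exact ⟨1, 2, 0, 1, ⟨_, rfl, by simp [Uu], by simp [Uu], by simp [Uu], by simp [Uu]⟩, by decide, by decide, by decide, by decide⟩
    · exact ⟨1, 0, 2, 1, ⟨_, rfl, by simp [Ll], by simp [Ll], by simp [Ll], by simp [Ll]⟩, by decide, by decide, by decide, by decide⟩
  · exact ⟨1, 0, 0, 1, ⟨1, rfl, by simp, by simp, by simp, by simp⟩, by decide, by decide, by decide, by decide⟩
  · rintro x y - - ⟨a, b, c, d, ⟨A, rfl, h1, h2, h3, h4⟩, ha, hb, hc, hd⟩ ⟨a', b', c', d', ⟨A', rfl, h1', h2', h3', h4'⟩, ha', hb', hc', hd'⟩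
    refine ⟨a * a' + b * c', a * b' + b * d', c * a' + d * c', c * b' + d * d',
      ⟨A * A', rfl, ?_, ?_, ?_, ?_⟩, ?_, ?_, ?_, ?_⟩
    · rw [sl_mul, h1, h2, h1', h3']; push_cast; ring
    · rw [sl_mul, h1, h2, h2', h4']; push_cast; ring
    · rw [sl_mul, h3, h4, h1', h3']; push_cast; ring
    · rw [sl_mul, h3, h4, h2', h4']; push_cast; ring
    · exact (ha.mul ha').add_even (hb.mul_right _)
    · exact (hb'.mul_left _).add (hb.mul_right _)
    · exact (hc.mul_right _).add (hc'.mul_left _)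
    · exact (hc.mul_right _).add_odd (hd.mul hd')
  · rintro x - ⟨a, b, c, d, ⟨A, rfl, h1, h2, h3, h4⟩, ha, hb, hc, hd⟩
    obtain ⟨i1, i2, i3, i4⟩ := sl_inv A
    exact ⟨d, -b, -c, a, ⟨A⁻¹, rfl, by rw [i1, h4], by rw [i2, h2]; simp, by rw [i3, h3]; simp, by rw [i4, h1]⟩,
      hd, hb.neg, hc.neg, ha⟩

/-- the action of an integral element off the real line -/
lemma int_act {g : PSL2C} {a b c d : ℤ} (h : IntRep g a b c d) (hdet : a * d - b * c = 1) {z : ℂ} (hz : z.im ≠ 0) :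
    ∃ w : ℂ, g • (z : RSphere) = w ∧ 0 < (c * z.re + d) ^ 2 + (c * z.im) ^ 2 ∧
      w.im * ((c * z.re + d) ^ 2 + (c * z.im) ^ 2) = z.im ∧
      w.re * ((c * z.re + d) ^ 2 + (c * z.im) ^ 2) = a * c * (z.re ^ 2 + z.im ^ 2) + (a * d + b * c) * z.re + b * d ∧
      (w.re ^ 2 + w.im ^ 2) * ((c * z.re + d) ^ 2 + (c * z.im) ^ 2) = (a * z.re + b) ^ 2 + (a * z.im) ^ 2 := by
  obtain ⟨A, rfl, h1, h2, h3, h4⟩ := h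
  have hR : (a * d - b * c : ℝ) = 1 := by exact_mod_cast hdet
  have hpos : 0 < (c * z.re + d) ^ 2 + (c * z.im) ^ 2 := by
    by_contra h0
    have e1 : (c * z.re + d) ^ 2 = 0 := by nlinarith [sq_nonneg (c * z.re + d), sq_nonneg (c * z.im)]
    have e2 : (c * z.im) ^ 2 = 0 := by nlinarith [sq_nonneg (c * z.re + d), sq_nonneg (c * z.im)]
    have e2' := (mul_eq_zero.1 (pow_eq_zero_iff (two_ne_zero) |>.1 e2)).resolve_right hz
    have e1' := pow_eq_zero_iff (two_ne_zero) |>.1 e1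
    rw [e2'] at e1' hR
    simp at e1'
    rw [e1'] at hR
    simp at hR
  have hn : Complex.normSq (c * z + d) = (c * z.re + d) ^ 2 + (c * z.im) ^ 2 := by
    rw [Complex.normSq_apply]; simp; ring
  have hne : (c * z + d : ℂ) ≠ 0 := by
    rw [← Complex.normSq_pos, hn]; exact hpos
  set n := (c * z.re + d) ^ 2 + (c * z.im) ^ 2 with hndef
  have e1 : ((a * z + b) / (c * z + d) : ℂ).im * n = z.im := by
    rw [Complex.div_im, hn, ← sub_div, div_mul_cancel₀ _ hpos.ne']
    simp; linear_combination z.im * hR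
  have e2 : ((a * z + b) / (c * z + d) : ℂ).re * n = a * c * (z.re ^ 2 + z.im ^ 2) + (a * d + b * c) * z.re + b * d := by
    rw [Complex.div_re, hn, ← add_div, div_mul_cancel₀ _ hpos.ne']
    simp; ring
  refine ⟨(a * z + b) / (c * z + d), ?_, hpos, e1, e2, ?_⟩
  · rw [mk_smul_coe (by rw [h3, h4]; exact hne), h1, h2, h3, h4]
  · have : ∀ w : ℂ, w.re ^ 2 + w.im ^ 2 = Complex.normSq w := fun w => by rw [Complex.normSq_apply]; ring
    rw [this, map_div₀, hn, div_mul_cancel₀ _ hpos.ne', Complex.normSq_apply]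
    simp; ring

lemma int_finite (K : ℤ) : {g : PSL2C | ∃ a b c d : ℤ, IntRep g a b c d ∧ |a| ≤ K ∧ |b| ≤ K ∧ |c| ≤ K ∧ |d| ≤ K}.Finite := by
  have hI := Set.finite_Icc (-K) K
  have : {g : PSL2C | ∃ a b c d : ℤ, IntRep g a b c d ∧ |a| ≤ K ∧ |b| ≤ K ∧ |c| ≤ K ∧ |d| ≤ K} ⊆
      ⋃ a ∈ Icc (-K) K, ⋃ b ∈ Icc (-K) K, ⋃ c ∈ Icc (-K) K, ⋃ d ∈ Icc (-K) K, {g | IntRep g a b c d} := by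
    rintro g ⟨a, b, c, d, h, ha, hb, hc, hd⟩
    simp only [mem_iUnion]
    exact ⟨a, abs_le.1 ha, b, abs_le.1 hb, c, abs_le.1 hc, d, abs_le.1 hd, h⟩
  refine Finite.subset ?_ this
  refine hI.biUnion fun a _ => hI.biUnion fun b _ => hI.biUnion fun c _ => hI.biUnion fun d _ => ?_
  exact Set.Subsingleton.finite fun g hg g' hg' => IntRep.unique hg hg'

lemma pq_bound (p q : ℤ) {u : ℂ} {δ K s : ℝ} (hδ : 0 < δ) (hu : δ < |u.im|) (hur : |u.re| < K) (hs : 0 ≤ s)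
    (h : (p * u.re + q) ^ 2 + (p * u.im) ^ 2 ≤ s ^ 2) : |(p : ℝ)| ≤ s / δ ∧ |(q : ℝ)| ≤ s + s / δ * K := by
  have e1 : |p * u.im| ≤ s := abs_le_of_sq_le_sq (by linarith [sq_nonneg (p * u.re + q)]) hs
  have e2 : |p * u.re + q| ≤ s := abs_le_of_sq_le_sq (by linarith [sq_nonneg (p * u.im)]) hs
  have e3 : |(p : ℝ)| ≤ s / δ := by
    rw [le_div_iff₀ hδ]
    rw [abs_mul] at e1
    exact (mul_le_mul_of_nonneg_left hu.le (abs_nonneg _)).trans e1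
  refine ⟨e3, ?_⟩
  have e4 : |(q : ℝ)| ≤ |p * u.re + q| + |p * u.re| := by
    have := abs_sub (p * u.re + q) (p * u.re)
    simpa using this
  rw [abs_mul] at e4
  have e5 : |(p : ℝ)| * |u.re| ≤ s / δ * K := mul_le_mul e3 hur.le (abs_nonneg _) (by positivity)
  linarith

/-- the upper and lower half planes lie in the region of discontinuity of `Gam` -/
lemma gam_omega {z : ℂ} (hz : z.im ≠ 0) : (z : RSphere) ∈ omegaSet Gam := by
  obtain ⟨δ, hδ, hδz⟩ : ∃ δ > 0, δ < |z.im| := exists_between (abs_pos.2 hz)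
  set K := ‖z‖ + 1 with hK
  have hK0 : 0 < K := by positivity
  set B : Set ℂ := {w | δ < |w.im| ∧ ‖w‖ < K} with hB
  have hBo : IsOpen B :=
    (isOpen_lt continuous_const (Complex.continuous_im.abs)).inter (isOpen_lt continuous_norm continuous_const)
  refine ⟨(fun w : ℂ => (w : RSphere)) '' B, OnePoint.isOpen_image_coe.2 hBo, ⟨z, ⟨hδz, by simp [hK]⟩, rfl⟩, ?_⟩
  -- bounds
  obtain ⟨L, hL⟩ : ∃ L : ℤ, (K / δ + 1) * (1 + K) * (1 + K) / δ + (K / δ + 1) * (1 + K) * (1 + K) * (1 + K / δ) ≤ L :=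
    ⟨_, Int.le_ceil _⟩
  refine (int_finite L).subset ?_
  rintro g ⟨hg, _, ⟨_, ⟨u, hu, rfl⟩, hgu⟩, v, hv, hgv⟩
  obtain ⟨a, b, c, d, hr, hdet, -⟩ := gam_int hg
  obtain ⟨w, hw, hn, h1, -, h3⟩ := int_act hr hdet (z := u) (by
    have := hu.1; intro h0; rw [h0] at this; simp at this; linarith)
  have hvw : v = w := by
    have : (v : RSphere) = w := hgv.trans (hgu.symm.trans ((smul_def' _ _).symm.trans hw))
    exact OnePoint.coe_injective this
  subst hvw
  set n := (c * u.re + d) ^ 2 + (c * u.im) ^ 2 with hndef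
  have hub : |u.im| < K := (Complex.abs_im_le_norm u).trans_lt hu.2
  have hur : |u.re| < K := (Complex.abs_re_le_norm u).trans_lt hu.2
  have hvn : v.re ^ 2 + v.im ^ 2 < K ^ 2 := by
    have : v.re ^ 2 + v.im ^ 2 = ‖v‖ ^ 2 := by rw [Complex.sq_norm, Complex.normSq_apply]; ring
    rw [this]; exact pow_lt_pow_left₀ hv.2 (norm_nonneg _) two_ne_zero
  have hnle : n ≤ K / δ := by
    rw [le_div_iff₀ hδ]
    have := congrArg abs h1
    rw [abs_mul, abs_of_pos hn] at this
    nlinarith [hv.1]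
  have hKδ : 0 < K / δ := by positivity
  set m := K / δ + 1 with hm
  have hm1 : 1 ≤ m := by linarith
  have hnm : n ≤ m ^ 2 := by nlinarith
  have key := fun (p q : ℤ) (s : ℝ) (hs : 0 ≤ s) h => pq_bound p q (δ := δ) (K := K) (s := s) hδ hu.1 hur hs h
  obtain ⟨kc, kd⟩ := key c d m (by linarith) hnm
  obtain ⟨ka, kb⟩ := key a b (K * m) (by positivity) (by
    rw [← h3, mul_pow]
    exact mul_le_mul hvn.le hnm hn.le (by positivity))
  have fin : ∀ p : ℤ, |(p : ℝ)| ≤ (K / δ + 1) * (1 + K) * (1 + K) / δ + (K / δ + 1) * (1 + K) * (1 + K) * (1 + K / δ) → |p| ≤ L := by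
    intro p hp
    have := hp.trans hL
    exact_mod_cast this
  have g1 : m ≤ m * (1 + K) * (1 + K) := by nlinarith [mul_pos (by linarith : 0 < m) hK0, mul_pos (mul_pos (by linarith : 0 < m) hK0) hK0]
  have g2 : K * m ≤ m * (1 + K) * (1 + K) := by nlinarith [mul_pos (by linarith : 0 < m) hK0, mul_pos (mul_pos (by linarith : 0 < m) hK0) hK0]
  set E := m * (1 + K) * (1 + K) with hE
  have hE0 : 0 ≤ E := by positivity
  have hd1 : ∀ s, s ≤ E → s / δ ≤ E / δ := fun s hs => by gcongr
  have hd2 : ∀ s, s ≤ E → s + s / δ * K ≤ E * (1 + K / δ) := fun s hs => by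
    have : E * (1 + K / δ) = E + E / δ * K := by ring
    rw [this]; gcongr
  have hp1 : 0 ≤ E / δ := by positivity
  have hp2 : 0 ≤ E * (1 + K / δ) := by positivity
  refine ⟨a, b, c, d, hr, fin a ?_, fin b ?_, fin c ?_, fin d ?_⟩
  · linarith [hd1 _ g2]
  · linarith [hd2 _ g2]
  · linarith [hd1 _ g1]
  · linarith [hd2 _ g1]
end

noncomputable section
open Set Filter Topology

/-- fundamental domain of `Gam` -/
def Qd : Set ℂ := {z | 0 < z.im ∧ |z.re| ≤ 1 ∧ |z.re| ≤ z.re ^ 2 + z.im ^ 2}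
/-- height over the two geodesics -/
def sQ (z : ℂ) : ℝ := z.re ^ 2 + z.im ^ 2 - |z.re|
/-- the uniformising map on the fundamental domain -/
def fQ (z : ℂ) : ℂ := -Complex.cos (((Real.pi * z.re : ℝ) : ℂ) + ((sQ z : ℝ) : ℂ) * Complex.I)

lemma odd_sq {d : ℤ} (h : Odd d) : (1 : ℝ) ≤ (d : ℝ) ^ 2 := by
  have h1 : d ≠ 0 := by rintro rfl; simp at h
  have h2 : 1 ≤ d ^ 2 := by have := sq_pos_of_ne_zero h1; omega
  exact_mod_cast h2

lemma den_ge {z : ℂ} (hz : z ∈ Qd) {c d : ℤ} (hc : Even c) (hd : Odd d) :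
    1 ≤ (c * z.re + d) ^ 2 + (c * z.im) ^ 2 := by
  obtain ⟨h1, h2, h3⟩ := hz
  have e1 := odd_sq hd
  have e2 := odd_sq (hc.add_odd hd)
  have e3 := odd_sq (hc.sub_odd hd)
  push_cast at e2 e3
  rcases abs_cases z.re with ⟨h, h'⟩ | ⟨h, h'⟩ <;> rw [h] at h2 h3
  · have : (c * z.re + d) ^ 2 + (c * z.im) ^ 2 = (c : ℝ) ^ 2 * (z.re ^ 2 + z.im ^ 2 - z.re) + (1 - z.re) * (d : ℝ) ^ 2
      + z.re * ((c : ℝ) + d) ^ 2 := by ring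
    rw [this]
    nlinarith [mul_nonneg (sq_nonneg (c : ℝ)) (sub_nonneg.2 h3), mul_nonneg (sub_nonneg.2 h2) (sub_nonneg.2 e1),
      mul_nonneg h' (sub_nonneg.2 e2)]
  · have : (c * z.re + d) ^ 2 + (c * z.im) ^ 2 = (c : ℝ) ^ 2 * (z.re ^ 2 + z.im ^ 2 - -z.re) + (1 - -z.re) * (d : ℝ) ^ 2
      + (-z.re) * ((c : ℝ) - d) ^ 2 := by ring
    rw [this]
    nlinarith [mul_nonneg (sq_nonneg (c : ℝ)) (sub_nonneg.2 h3), mul_nonneg (sub_nonneg.2 h2) (sub_nonneg.2 e1),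
      mul_nonneg (neg_pos.2 h').le (sub_nonneg.2 e3)]

/-- points of the fundamental domain are highest in their orbit -/
lemma gam_im_le {z w : ℂ} (hz : z ∈ Qd) {g : PSL2C} (hg : g ∈ Gam) (h : g • (z : RSphere) = w) : w.im ≤ z.im := by
  obtain ⟨a, b, c, d, hr, hdet, -, -, hc, hd⟩ := gam_int hg
  obtain ⟨w', hw', hn, h1, -⟩ := int_act hr hdet hz.1.ne'
  obtain rfl : w = w' := OnePoint.coe_injective (h.symm.trans hw')
  have := den_ge hz hc hd
  by_cases h0 : w.im ≤ 0
  · exact h0.trans hz.1.le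
  · nlinarith

lemma fQ_of {z w : ℂ} (him : w.im = z.im) (h : w.re = z.re ∨ (z.re = -1 ∧ w.re = 1) ∨ (z.re = 1 ∧ w.re = -1) ∨
    (w.re = -z.re ∧ z.re ^ 2 + z.im ^ 2 = |z.re|)) : fQ z = fQ w := by
  rcases h with h | ⟨h, h'⟩ | ⟨h, h'⟩ | ⟨h, h'⟩
  · have : z = w := Complex.ext h.symm him.symm
    rw [this]
  · have hs : sQ z = sQ w := by simp [sQ, h, h', him]
    rw [fQ, fQ, hs, h, h', neg_inj, Complex.cos_eq_cos_iff]
    exact ⟨1, Or.inl (by push_cast; ring)⟩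
  · have hs : sQ z = sQ w := by simp [sQ, h, h', him]
    rw [fQ, fQ, hs, h, h', neg_inj, Complex.cos_eq_cos_iff]
    exact ⟨-1, Or.inl (by push_cast; ring)⟩
  · have hs : sQ z = 0 := by rw [sQ, h', sub_self]
    have hs' : sQ w = 0 := by rw [sQ, h, abs_neg, him, neg_sq, h', sub_self]
    rw [fQ, fQ, hs, hs', h, neg_inj, Complex.cos_eq_cos_iff]
    exact ⟨0, Or.inr (by push_cast; ring)⟩

lemma int_sq_one {d : ℤ} (h : (d : ℝ) ^ 2 = 1) : d = 1 ∨ d = -1 := by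
  have : d ^ 2 = 1 := by exact_mod_cast h
  have h2 : (d - 1) * (d + 1) = 0 := by linear_combination this
  rcases mul_eq_zero.1 h2 with h3 | h3
  · left; omega
  · right; omega

lemma fQ_uniq {z w : ℂ} (hz : z ∈ Qd) (hw : w ∈ Qd) {g : PSL2C} (hg : g ∈ Gam) (h : g • (z : RSphere) = w) :
    fQ z = fQ w := by
  have i1 := gam_im_le hz hg h
  have i2 := gam_im_le hw (inv_mem hg) (inv_smul_eq_iff.2 h.symm)
  have him : w.im = z.im := le_antisymm i1 i2
  obtain ⟨a, b, c, d, hr, hdet, ha, hb, hc, hd⟩ := gam_int hg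
  obtain ⟨w', hw', hn, h1, h2, -⟩ := int_act hr hdet hz.1.ne'
  obtain rfl : w = w' := OnePoint.coe_injective (h.symm.trans hw')
  have hn1 : (c * z.re + d) ^ 2 + (c * z.im) ^ 2 = 1 := by
    rw [him] at h1
    exact mul_left_cancel₀ hz.1.ne' (h1.trans (mul_one _).symm)
  rw [hn1, mul_one] at h2
  refine fQ_of him ?_
  obtain ⟨hy, hz1, hz2⟩ := hz
  have hw1 := hw.2.1
  have e1 := odd_sq hd
  have e2 := odd_sq (hc.add_odd hd)
  have e3 := odd_sq (hc.sub_odd hd)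
  push_cast at e2 e3
  by_cases hc0 : c = 0
  · subst hc0
    simp at hn1 h2 hdet
    have had : (a * d : ℝ) = 1 := by exact_mod_cast hdet
    rw [had, one_mul] at h2
    obtain ⟨e, he⟩ : ∃ e : ℤ, b * d = 2 * e := by obtain ⟨k, hk⟩ := hb; exact ⟨k * d, by rw [hk]; ring⟩
    have he' : (b * d : ℝ) = 2 * e := by exact_mod_cast he
    rw [he'] at h2
    rw [abs_le] at hz1 hw1
    have h3 : (e : ℝ) ≤ 1 := by linarith
    have h4 : (-1 : ℝ) ≤ e := by linarith
    have h3' : e ≤ 1 := by exact_mod_cast h3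
    have h4' : -1 ≤ e := by exact_mod_cast h4
    interval_cases e
    · right; right; left; push_cast at h2; constructor <;> linarith
    · left; push_cast at h2; linarith
    · right; left; push_cast at h2; constructor <;> linarith
  · have hc0' : 0 < (c : ℝ) ^ 2 := by positivity
    have hfin : ∀ e : ℤ, Even e → w.re = -z.re + e → |z.re| < 1 → w.re = -z.re := by
      intro e he h5 h6
      rw [abs_lt] at h6; rw [abs_le] at hw1
      have h3 : (e : ℝ) < 2 := by linarith
      have h4 : (-2 : ℝ) < e := by linarith
      have h3' : e < 2 := by exact_mod_cast h3
      have h4' : -2 < e := by exact_mod_cast h4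
      obtain ⟨k, hk⟩ := he
      have : e = 0 := by omega
      rw [h5, this]; simp
    right; right; right
    have hdet' : (a * d - b * c : ℝ) = 1 := by exact_mod_cast hdet
    rcases abs_cases z.re with ⟨h, h'⟩ | ⟨h, h'⟩
    · rw [h] at hz1 hz2
      have A : 0 ≤ (c : ℝ) ^ 2 * (z.re ^ 2 + z.im ^ 2 - z.re) := mul_nonneg hc0'.le (sub_nonneg.2 hz2)
      have B := mul_nonneg (sub_nonneg.2 hz1) (sub_nonneg.2 e1)
      have C := mul_nonneg h' (sub_nonneg.2 e2)
      have S : (c : ℝ) ^ 2 * (z.re ^ 2 + z.im ^ 2 - z.re) + (1 - z.re) * ((d : ℝ) ^ 2 - 1) + z.re * (((c : ℝ) + d) ^ 2 - 1) = 0 := by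
        linear_combination hn1
      have A0 : z.re ^ 2 + z.im ^ 2 - z.re = 0 := (mul_eq_zero.1 (by linarith : (c : ℝ) ^ 2 * (z.re ^ 2 + z.im ^ 2 - z.re) = 0)).resolve_left hc0'.ne'
      have x0 : 0 < z.re := by nlinarith [sq_nonneg z.re, pow_pos hy 2]
      have x1 : z.re < 1 := by nlinarith [pow_pos hy 2]
      have B0 : (d : ℝ) ^ 2 = 1 := by
        have := (mul_eq_zero.1 (by linarith : (1 - z.re) * ((d : ℝ) ^ 2 - 1) = 0)).resolve_left (by linarith)
        linarith
      have C0 : ((c + d : ℤ) : ℝ) ^ 2 = 1 := by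
        have := (mul_eq_zero.1 (by linarith : z.re * (((c : ℝ) + d) ^ 2 - 1) = 0)).resolve_left (by linarith)
        push_cast; linarith
      have hcd : c = -2 * d := by
        rcases int_sq_one B0 with h | h <;> rcases int_sq_one C0 with h' | h' <;> omega
      refine ⟨hfin (b * d) (hb.mul_right _) ?_ (by rw [h]; exact x1), by rw [h]; linarith⟩
      rw [h2]
      have : (z.re ^ 2 + z.im ^ 2) = z.re := by linarith
      rw [this]
      have hcd' : (c : ℝ) = -2 * d := by exact_mod_cast hcd
      rw [hcd'] at hdet' ⊢
      push_cast
      linear_combination (-z.re) * hdet'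
    · rw [h] at hz1 hz2
      have A : 0 ≤ (c : ℝ) ^ 2 * (z.re ^ 2 + z.im ^ 2 - -z.re) := mul_nonneg hc0'.le (sub_nonneg.2 hz2)
      have B := mul_nonneg (sub_nonneg.2 hz1) (sub_nonneg.2 e1)
      have C := mul_nonneg (neg_pos.2 h').le (sub_nonneg.2 e3)
      have S : (c : ℝ) ^ 2 * (z.re ^ 2 + z.im ^ 2 - -z.re) + (1 - -z.re) * ((d : ℝ) ^ 2 - 1) + -z.re * (((c : ℝ) - d) ^ 2 - 1) = 0 := by
        linear_combination hn1
      have A0 : z.re ^ 2 + z.im ^ 2 - -z.re = 0 := (mul_eq_zero.1 (by linarith : (c : ℝ) ^ 2 * (z.re ^ 2 + z.im ^ 2 - -z.re) = 0)).resolve_left hc0'.ne'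
      have x1 : -z.re < 1 := by nlinarith [pow_pos hy 2]
      have B0 : (d : ℝ) ^ 2 = 1 := by
        have := (mul_eq_zero.1 (by linarith : (1 - -z.re) * ((d : ℝ) ^ 2 - 1) = 0)).resolve_left (by linarith)
        linarith
      have C0 : ((c - d : ℤ) : ℝ) ^ 2 = 1 := by
        have := (mul_eq_zero.1 (by linarith : -z.re * (((c : ℝ) - d) ^ 2 - 1) = 0)).resolve_left (by linarith)
        push_cast; linarith
      have hcd : c = 2 * d := by
        rcases int_sq_one B0 with h | h <;> rcases int_sq_one C0 with h' | h' <;> omega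
      refine ⟨hfin (b * d) (hb.mul_right _) ?_ (by rw [h]; exact x1), by rw [h]; linarith⟩
      rw [h2]
      have : (z.re ^ 2 + z.im ^ 2) = -z.re := by linarith
      rw [this]
      have hcd' : (c : ℝ) = 2 * d := by exact_mod_cast hcd
      rw [hcd'] at hdet' ⊢
      push_cast
      linear_combination (-z.re) * hdet'

/-- even translations -/
lemma gam_transl (k : ℤ) : mk (Uu (2 * k)) ∈ Gam := by
  have h0 : mk (Uu 2) ∈ Gam := Subgroup.subset_closure (Or.inl rfl)
  induction k using Int.induction_on with
  | zero => simp [Uu_zero]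
  | succ n ih =>
    have : Uu (2 * ((n + 1 : ℤ) : ℂ)) = Uu (2 * (n : ℤ)) * Uu 2 := by rw [Uu_mul]; congr 1; push_cast; ring
    rw [this, mk_mul]; exact mul_mem ih h0
  | pred n ih =>
    have : Uu (2 * ((-n - 1 : ℤ) : ℂ)) = Uu (2 * ((-n : ℤ) : ℂ)) * (Uu 2)⁻¹ := by
      rw [Uu_inv, Uu_mul]; congr 1; push_cast; ring
    rw [this, mk_mul, mk_inv]; exact mul_mem ih (inv_mem h0)

lemma Uu_smul (β z : ℂ) : mk (Uu β) • (z : RSphere) = ((z + β : ℂ) : RSphere) := by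
  rw [mk_smul_coe (by simp [Uu])]; simp [Uu]

lemma gam_ll (e : ℤ) (he : e = 2 ∨ e = -2) : ∃ g ∈ Gam, IntRep g 1 0 e 1 := by
  have h0 : mk (Ll 2) ∈ Gam := Subgroup.subset_closure (Or.inr rfl)
  rcases he with rfl | rfl
  · exact ⟨_, h0, _, rfl, by simp [Ll], by simp [Ll], by simp [Ll], by simp [Ll]⟩
  · obtain ⟨i1, i2, i3, i4⟩ := sl_inv (Ll 2)
    exact ⟨_, inv_mem h0, (Ll 2)⁻¹, rfl, by rw [i1]; simp [Ll], by rw [i2]; simp [Ll], by rw [i3]; simp [Ll], by rw [i4]; simp [Ll]⟩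
end

noncomputable section
open Set Filter Topology

lemma exists_red {z : ℂ} (hz : 0 < z.im) : ∃ g ∈ Gam, ∃ w ∈ Qd, g • (z : RSphere) = w := by
  set I : Set ℝ := {t | z.im ≤ t ∧ ∃ g ∈ Gam, ∃ w : ℂ, g • (z : RSphere) = w ∧ w.im = t} with hI
  have hIn : z.im ∈ I := ⟨le_rfl, 1, one_mem _, z, one_smul _ _, rfl⟩
  have hIf : I.Finite := by
    obtain ⟨L, hL⟩ : ∃ L : ℤ, 1 / (z.im / 2) + (1 + 1 / (z.im / 2) * (|z.re| + 1)) ≤ L := ⟨_, Int.le_ceil _⟩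
    have hIcc := (Set.finite_Icc (-L) L).prod (Set.finite_Icc (-L) L)
    refine (hIcc.image (fun p : ℤ × ℤ => z.im / ((p.1 * z.re + p.2) ^ 2 + (p.1 * z.im) ^ 2))).subset ?_
    rintro t ⟨ht, g, hg, w, hw, rfl⟩
    obtain ⟨a, b, c, d, hr, hdet, -⟩ := gam_int hg
    obtain ⟨w', hw', hn, h1, -⟩ := int_act hr hdet hz.ne'
    obtain rfl : w = w' := OnePoint.coe_injective (hw.symm.trans hw')
    have hn1 : (c * z.re + d) ^ 2 + (c * z.im) ^ 2 ≤ 1 ^ 2 := by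
      by_contra h0
      nlinarith
    obtain ⟨k1, k2⟩ := pq_bound c d (δ := z.im / 2) (K := |z.re| + 1) (by linarith) (by rw [abs_of_pos hz]; linarith)
      (by linarith) zero_le_one hn1
    have p1 : 0 ≤ 1 / (z.im / 2) := by positivity
    have p2 : 0 ≤ 1 + 1 / (z.im / 2) * (|z.re| + 1) := by positivity
    have l1 : |(c : ℝ)| ≤ L := by linarith
    have l2 : |(d : ℝ)| ≤ L := by linarith
    refine ⟨(c, d), ⟨abs_le.1 (by exact_mod_cast l1), abs_le.1 (by exact_mod_cast l2)⟩, ?_⟩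
    simp only
    rw [div_eq_iff hn.ne', h1]
  obtain ⟨t, ⟨ht, g, hg, w, hw, rfl⟩, hmax⟩ := Set.exists_max_image I id hIf ⟨_, hIn⟩
  have hwpos : 0 < w.im := hz.trans_le ht
  set k := -round (w.re / 2) with hk
  set w1 : ℂ := w + 2 * k with hw1
  have hw1im : w1.im = w.im := by simp [hw1]
  have hw1re : |w1.re| ≤ 1 := by
    have h1 := abs_sub_round (w.re / 2)
    have h2 : w1.re = 2 * (w.re / 2 - round (w.re / 2)) := by simp [hw1, hk]; ring
    rw [h2, abs_mul, abs_two]; linarith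
  have hw1' : (mk (Uu (2 * k)) * g) • (z : RSphere) = w1 := by
    rw [mul_smul, hw, Uu_smul]
  have hg1 : mk (Uu (2 * k)) * g ∈ Gam := mul_mem (gam_transl k) hg
  refine ⟨_, hg1, w1, ⟨by rw [hw1im]; exact hwpos, hw1re, ?_⟩, hw1'⟩
  by_contra hlt
  rw [not_le] at hlt
  obtain ⟨e, he, hea⟩ : ∃ e : ℤ, (e = 2 ∨ e = -2) ∧ (e : ℝ) * w1.re = -2 * |w1.re| := by
    rcases abs_cases w1.re with ⟨h, h'⟩ | ⟨h, h'⟩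
    · exact ⟨-2, Or.inr rfl, by rw [h]; push_cast; ring⟩
    · exact ⟨2, Or.inl rfl, by rw [h]; push_cast; ring⟩
  obtain ⟨g2, hg2, hr⟩ := gam_ll e he
  obtain ⟨w2, hw2, hn, h1, -⟩ := int_act hr (by ring) (z := w1) (by rw [hw1im]; exact hwpos.ne')
  have he2 : (e : ℝ) ^ 2 = 4 := by rcases he with rfl | rfl <;> norm_num
  have hn1 : (e * w1.re + (1 : ℤ)) ^ 2 + (e * w1.im) ^ 2 < 1 := by
    have : (e * w1.re + (1 : ℤ)) ^ 2 + (e * w1.im) ^ 2 = 1 - 4 * (|w1.re| - (w1.re ^ 2 + w1.im ^ 2)) := by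
      push_cast; linear_combination (w1.re ^ 2 + w1.im ^ 2) * he2 + 2 * hea
    rw [this]; linarith
  have hw2im : w.im < w2.im := by
    rw [← hw1im] at hwpos ⊢
    by_contra h0
    rw [not_lt] at h0
    nlinarith
  have := hmax w2.im ⟨by linarith, g2 * (mk (Uu (2 * k)) * g), mul_mem hg2 hg1, w2, by rw [mul_smul, hw1', hw2], rfl⟩
  simp only [id] at this
  linarith

lemma sQ_nonneg {z : ℂ} (hz : z ∈ Qd) : 0 ≤ sQ z := sub_nonneg.2 hz.2.2

lemma int_cases {k : ℤ} {x x' : ℝ} (hx : |x| ≤ 1) (hx' : |x'| ≤ 1) (h : x' = 2 * k + x) : k = 0 ∨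
    (k = 1 ∧ x = -1 ∧ x' = 1) ∨ (k = -1 ∧ x = 1 ∧ x' = -1) := by
  rw [abs_le] at hx hx'
  have h1 : (k : ℝ) ≤ 1 := by linarith
  have h2 : (-1 : ℝ) ≤ k := by linarith
  have h1' : k ≤ 1 := by exact_mod_cast h1
  have h2' : -1 ≤ k := by exact_mod_cast h2
  interval_cases k
  · right; right; push_cast at h; exact ⟨rfl, by linarith, by linarith⟩
  · left; rfl
  · right; left; push_cast at h; exact ⟨rfl, by linarith, by linarith⟩

lemma fQ_inj {z w : ℂ} (hz : z ∈ Qd) (hw : w ∈ Qd) (h : fQ z = fQ w) : ∃ g ∈ Gam, g • (z : RSphere) = w := by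
  have hpi := Real.pi_pos
  rw [fQ, fQ, neg_inj, Complex.cos_eq_cos_iff] at h
  obtain ⟨k, h | h⟩ := h
  · have hre := congrArg Complex.re h
    have him := congrArg Complex.im h
    simp at hre him
    have hre' : w.re = 2 * k + z.re := by
      have : Real.pi * w.re = Real.pi * (2 * k + z.re) := by linear_combination hre
      exact mul_left_cancel₀ hpi.ne' this
    have habs : |w.re| = |z.re| := by
      rcases int_cases hz.2.1 hw.2.1 hre' with rfl | ⟨-, h1, h2⟩ | ⟨-, h1, h2⟩
      · rw [hre']; simp
      · rw [h1, h2]; simp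
      · rw [h1, h2]; simp
    have hsq : w.re ^ 2 = z.re ^ 2 := by rw [← sq_abs, habs, sq_abs]
    have hi : w.im = z.im := by
      have : w.im ^ 2 = z.im ^ 2 := by rw [sQ, sQ, habs, hsq] at him; linarith
      exact (pow_left_inj₀ hw.1.le hz.1.le two_ne_zero).1 this
    refine ⟨_, gam_transl k, ?_⟩
    rw [Uu_smul]
    congr 1
    apply Complex.ext
    · simp [hre']; ring
    · simp [hi]
  · have hre := congrArg Complex.re h
    have him := congrArg Complex.im h
    simp at hre him
    have hre' : -w.re = 2 * (-k : ℤ) + z.re := by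
      have : Real.pi * (-w.re) = Real.pi * (2 * (-k : ℤ) + z.re) := by push_cast; linear_combination -hre
      exact mul_left_cancel₀ hpi.ne' this
    have s0 := sQ_nonneg hz
    have s1 := sQ_nonneg hw
    have sz : sQ z = 0 := by linarith
    have sw : sQ w = 0 := by linarith
    rw [sQ] at sz sw
    have hw1 : |-w.re| ≤ 1 := by rw [abs_neg]; exact hw.2.1
    have hy := pow_pos hz.1 2
    rcases int_cases hz.2.1 hw1 hre' with h0 | ⟨-, h1, h2⟩ | ⟨-, h1, h2⟩
    · rw [h0] at hre'
      have hre2 : w.re = -z.re := by push_cast at hre'; linarith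
      have hi : w.im = z.im := by
        have : w.im ^ 2 = z.im ^ 2 := by rw [hre2, abs_neg] at sw; linarith
        exact (pow_left_inj₀ hw.1.le hz.1.le two_ne_zero).1 this
      obtain ⟨e, he, hea⟩ : ∃ e : ℤ, (e = 2 ∨ e = -2) ∧ (e : ℝ) * z.re = -2 * |z.re| := by
        rcases abs_cases z.re with ⟨h, h'⟩ | ⟨h, h'⟩
        · exact ⟨-2, Or.inr rfl, by rw [h]; push_cast; ring⟩
        · exact ⟨2, Or.inl rfl, by rw [h]; push_cast; ring⟩
      obtain ⟨g2, hg2, hr⟩ := gam_ll e he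
      obtain ⟨w2, hw2, hn, h1, h2, -⟩ := int_act hr (by ring) hz.1.ne'
      have he2 : (e : ℝ) ^ 2 = 4 := by rcases he with rfl | rfl <;> norm_num
      have hn1 : (e * z.re + (1 : ℤ)) ^ 2 + (e * z.im) ^ 2 = 1 := by
        push_cast; linear_combination (z.re ^ 2 + z.im ^ 2) * he2 + 2 * hea + 4 * sz
      rw [hn1, mul_one] at h1 h2
      refine ⟨g2, hg2, hw2.trans ?_⟩
      congr 1
      apply Complex.ext
      · rw [h2, hre2]; push_cast
        have h3 : z.re ^ 2 + z.im ^ 2 = |z.re| := by linarith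
        rw [h3]
        rcases abs_cases z.re with ⟨h, h'⟩ | ⟨h, h'⟩ <;> rw [h] at hea ⊢ <;> linarith
      · rw [h1, hi]
    · rw [h1] at sz; norm_num at sz; exact absurd sz hz.1.ne'
    · rw [h1] at sz; norm_num at sz; exact absurd sz hz.1.ne'

lemma fQ_ne {z : ℂ} (hz : z ∈ Qd) : fQ z ≠ 1 ∧ fQ z ≠ -1 := by
  have hpi := Real.pi_pos
  have main : ∀ (j k : ℤ), sQ z = 0 → z.re = j → False := by
    intro j k h0 h1
    have h2 := hz.2.1
    have hy := pow_pos hz.1 2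
    rw [sQ] at h0
    rw [h1, abs_le] at h2
    have h3 : j ≤ 1 := by exact_mod_cast h2.2
    have h4 : -1 ≤ j := by exact_mod_cast h2.1
    rw [h1] at h0
    interval_cases j <;> norm_num at h0 <;> exact hz.1.ne' h0
  constructor
  · intro h
    have : Complex.cos ((Real.pi : ℝ) : ℂ) = Complex.cos (((Real.pi * z.re : ℝ) : ℂ) + ((sQ z : ℝ) : ℂ) * Complex.I) := by
      rw [Complex.cos_pi, ← h, fQ, neg_neg]
    rw [Complex.cos_eq_cos_iff] at this
    obtain ⟨k, h | h⟩ := this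
    · have hre := congrArg Complex.re h
      have him := congrArg Complex.im h
      simp at hre him
      refine main (2 * k + 1) 0 him ?_
      have : Real.pi * z.re = Real.pi * ((2 * k + 1 : ℤ) : ℝ) := by push_cast; linear_combination hre
      exact mul_left_cancel₀ hpi.ne' this
    · have hre := congrArg Complex.re h
      have him := congrArg Complex.im h
      simp at hre him
      refine main (2 * k - 1) 0 him ?_
      have : Real.pi * z.re = Real.pi * ((2 * k - 1 : ℤ) : ℝ) := by push_cast; linear_combination hre
      exact mul_left_cancel₀ hpi.ne' this
  · intro h
    have : Complex.cos 0 = Complex.cos (((Real.pi * z.re : ℝ) : ℂ) + ((sQ z : ℝ) : ℂ) * Complex.I) := by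
      rw [fQ, neg_inj] at h
      rw [Complex.cos_zero, h]
    rw [Complex.cos_eq_cos_iff] at this
    obtain ⟨k, h | h⟩ := this <;>
    · have hre := congrArg Complex.re h
      have him := congrArg Complex.im h
      simp at hre him
      refine main (2 * k) 0 him ?_
      have : Real.pi * z.re = Real.pi * ((2 * k : ℤ) : ℝ) := by push_cast; linear_combination hre
      exact mul_left_cancel₀ hpi.ne' this

lemma fQ_surj {v : ℂ} (h1 : v ≠ 1) (h2 : v ≠ -1) : ∃ z ∈ Qd, fQ z = v := by
  have hpi := Real.pi_pos
  obtain ⟨ζ, hζ, hη⟩ : ∃ ζ : ℂ, Complex.cos ζ = -v ∧ 0 ≤ ζ.im := by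
    obtain ⟨ζ, hζ⟩ := Complex.cos_surjective (-v)
    by_cases h : 0 ≤ ζ.im
    · exact ⟨ζ, hζ, h⟩
    · exact ⟨-ζ, by rw [Complex.cos_neg, hζ], by simp; linarith⟩
  set k := round (ζ.re / (2 * Real.pi)) with hk
  set x := 2 * (ζ.re / (2 * Real.pi) - k) with hx
  have hx1 : |x| ≤ 1 := by
    have := abs_sub_round (ζ.re / (2 * Real.pi))
    rw [hx, abs_mul, abs_two]; linarith
  have hxre : ζ.re = 2 * k * Real.pi + Real.pi * x := by
    rw [hx]; field_simp; ring
  have hxx : 0 ≤ |x| - x ^ 2 := by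
    rw [← sq_abs]; nlinarith [abs_nonneg x]
  set t := ζ.im + (|x| - x ^ 2) with ht
  have ht0 : 0 ≤ t := by linarith
  have htne : t ≠ 0 := by
    intro h0
    have hη0 : ζ.im = 0 := by linarith
    have hx0 : |x| - x ^ 2 = 0 := by linarith
    have hζ' : ζ = ((2 * k * Real.pi + Real.pi * x : ℝ) : ℂ) := by
      apply Complex.ext
      · rw [Complex.ofReal_re, hxre]
      · rw [Complex.ofReal_im, hη0]
    have hcos : Complex.cos ζ = Complex.cos ((Real.pi * |x| : ℝ) : ℂ) := by
      rw [Complex.cos_eq_cos_iff, hζ']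
      rcases abs_cases x with ⟨h, -⟩ | ⟨h, -⟩
      · exact ⟨-k, Or.inl (by rw [h]; push_cast; ring)⟩
      · exact ⟨k, Or.inr (by rw [h]; push_cast; ring)⟩
    rw [← sq_abs] at hx0
    have : |x| * (1 - |x|) = 0 := by linear_combination hx0
    rcases mul_eq_zero.1 this with h | h
    · rw [h] at hcos; simp at hcos
      exact h2 (by rw [← neg_eq_iff_eq_neg, ← hζ, hcos])
    · have : |x| = 1 := by linarith
      rw [this] at hcos; simp at hcos
      rw [hζ] at hcos
      exact h1 (neg_inj.1 hcos)
  have ht1 : 0 < t := lt_of_le_of_ne ht0 (Ne.symm htne)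
  have hsq := Real.sq_sqrt ht0
  refine ⟨⟨x, Real.sqrt t⟩, ⟨Real.sqrt_pos.2 ht1, hx1, ?_⟩, ?_⟩
  · simp only; rw [hsq]; linarith
  · have hs : sQ ⟨x, Real.sqrt t⟩ = ζ.im := by simp only [sQ]; rw [hsq]; ring
    rw [fQ, hs, neg_eq_iff_eq_neg, ← hζ, Complex.cos_eq_cos_iff]
    refine ⟨k, Or.inl ?_⟩
    apply Complex.ext
    · simp; rw [hxre]
    · simp

lemma fQ_cont : Continuous fQ := by
  unfold fQ sQ
  have h1 := Complex.continuous_re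
  have h2 := Complex.continuous_im
  refine (Complex.continuous_cos.comp ?_).neg
  refine (Complex.continuous_ofReal.comp (continuous_const.mul h1)).add
    ((Complex.continuous_ofReal.comp (((h1.pow 2).add (h2.pow 2)).sub h1.abs)).mul continuous_const)

lemma cos_normSq (a b : ℝ) : Real.sinh b ^ 2 ≤ Complex.normSq (Complex.cos (a + b * Complex.I)) := by
  rw [Complex.cos_add_mul_I, Complex.normSq_apply]
  have h2 := Real.cosh_sq b
  have h3 := Real.sin_sq_add_cos_sq a
  simp only [Complex.sub_re, Complex.mul_re, Complex.sub_im, Complex.mul_im, Complex.I_re, Complex.I_im,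
    Complex.cos_ofReal_re, Complex.cos_ofReal_im, Complex.sin_ofReal_re, Complex.sin_ofReal_im,
    Complex.cosh_ofReal_re, Complex.cosh_ofReal_im, Complex.sinh_ofReal_re, Complex.sinh_ofReal_im]
  have : (Real.cosh b ^ 2) * Real.cos a ^ 2 + Real.sin a ^ 2 * Real.sinh b ^ 2 = Real.cos a ^ 2 + Real.sinh b ^ 2 := by
    rw [h2]; linear_combination Real.sinh b ^ 2 * h3
  nlinarith [sq_nonneg (Real.cos a)]

lemma fQ_norm {z : ℂ} (hz : 0 ≤ sQ z) : sQ z ≤ ‖fQ z‖ := by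
  have h1 : sQ z ≤ Real.sinh (sQ z) := Real.self_le_sinh_iff.2 hz
  refine h1.trans ?_
  rw [fQ, norm_neg, Complex.norm_def]
  exact Real.le_sqrt_of_sq_le (cos_normSq _ _)
end

noncomputable section
open Set Filter Topology

lemma red_bound {z w : ℂ} (hz : 0 < z.im) {g : PSL2C} (hg : g ∈ Gam) (h : g • (z : RSphere) = w) :
    w.im ≤ z.im + 1 / z.im := by
  obtain ⟨a, b, c, d, hr, hdet, -, -, hc, hd⟩ := gam_int hg
  obtain ⟨w', hw', hn, h1, -⟩ := int_act hr hdet hz.ne'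
  obtain rfl : w = w' := OnePoint.coe_injective (h.symm.trans hw')
  have hi : 0 < 1 / z.im := by positivity
  by_cases h0 : w.im ≤ 0
  · linarith
  push Not at h0
  by_cases hc0 : c = 0
  · subst hc0
    have := odd_sq hd
    simp at h1
    nlinarith
  · have hc1 : (1 : ℝ) ≤ (c : ℝ) ^ 2 := by
      have : 1 ≤ c ^ 2 := by have := sq_pos_of_ne_zero hc0; omega
      exact_mod_cast this
    have h2 : z.im ^ 2 ≤ (c * z.re + d) ^ 2 + (c * z.im) ^ 2 := by
      nlinarith [sq_nonneg ((c : ℝ) * z.re + d), sq_nonneg z.im]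
    have h3 : w.im * z.im ^ 2 ≤ z.im :=
      (mul_le_mul_of_nonneg_left h2 h0.le).trans h1.le
    have h4 : w.im ≤ 1 / z.im := by
      rw [le_div_iff₀ hz]
      nlinarith
    linarith

lemma gam_im_le' {z w : ℂ} (hw : w ∈ Qd) {g : PSL2C} (hg : g ∈ Gam) (h : g • (z : RSphere) = w) : z.im ≤ w.im :=
  gam_im_le hw (inv_mem hg) (by rw [← h, inv_smul_smul])

open Classical in
/-- a reduced representative -/
def rQ (z : ℂ) : ℂ := if h : 0 < z.im then (exists_red h).choose_spec.2.choose else 0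

lemma rQ_spec {z : ℂ} (h : 0 < z.im) : rQ z ∈ Qd ∧ ∃ g ∈ Gam, g • (z : RSphere) = rQ z := by
  rw [rQ, dif_pos h]
  exact ⟨(exists_red h).choose_spec.2.choose_spec.1, (exists_red h).choose, (exists_red h).choose_spec.1,
    (exists_red h).choose_spec.2.choose_spec.2⟩

/-- the modular function -/
def phi (z : ℂ) : ℂ := fQ (rQ z)

lemma phi_ne {z : ℂ} (h : 0 < z.im) : phi z ≠ 1 ∧ phi z ≠ -1 := fQ_ne (rQ_spec h).1

lemma phi_eq_iff {z w : ℂ} (hz : 0 < z.im) (hw : 0 < w.im) : phi z = phi w ↔ ∃ g ∈ Gam, g • (z : RSphere) = w := by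
  obtain ⟨h1, g, hg, h2⟩ := rQ_spec hz
  obtain ⟨h3, k, hk, h4⟩ := rQ_spec hw
  constructor
  · intro h
    obtain ⟨l, hl, h5⟩ := fQ_inj h1 h3 h
    refine ⟨k⁻¹ * l * g, mul_mem (mul_mem (inv_mem hk) hl) hg, ?_⟩
    rw [mul_smul, mul_smul, h2, h5, ← h4, inv_smul_smul]
  · rintro ⟨l, hl, h5⟩
    refine fQ_uniq h1 h3 (mul_mem (mul_mem hk hl) (inv_mem hg)) ?_
    rw [mul_smul, mul_smul, ← h2, inv_smul_smul, h5, h4]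

lemma phi_Qd {z : ℂ} (hz : z ∈ Qd) : phi z = fQ z := by
  obtain ⟨h1, g, hg, h2⟩ := rQ_spec hz.1
  exact (fQ_uniq hz h1 hg h2).symm

lemma Qd_compact (δ C : ℝ) : IsCompact {w : ℂ | |w.re| ≤ 1 ∧ |w.re| ≤ w.re ^ 2 + w.im ^ 2 ∧ δ ≤ w.im ∧ w.im ≤ C} := by
  have h1 := Complex.continuous_re
  have h2 := Complex.continuous_im
  apply Metric.isCompact_of_isClosed_isBounded
  · refine (isClosed_le h1.abs continuous_const).inter ((isClosed_le h1.abs ((h1.pow 2).add (h2.pow 2))).inter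
      ((isClosed_le continuous_const h2).inter (isClosed_le h2 continuous_const)))
  · rw [isBounded_iff_forall_norm_le]
    refine ⟨1 + (|δ| + |C|), fun w hw => (Complex.norm_le_abs_re_add_abs_im w).trans (add_le_add hw.1 ?_)⟩
    rw [abs_le]
    constructor
    · linarith [hw.2.2.1, neg_abs_le δ, abs_nonneg C]
    · linarith [hw.2.2.2, le_abs_self C, abs_nonneg δ]

lemma phi_cont (hT : TorsionFree Gam) {z₀ : ℂ} (hz : 0 < z₀.im) : ContinuousAt phi z₀ := by
  rw [ContinuousAt, tendsto_iff_ultrafilter]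
  intro F hF
  have hi : Tendsto Complex.im (𝓝 z₀) (𝓝 z₀.im) := Complex.continuous_im.continuousAt
  have e1 : ∀ᶠ z in (F : Filter ℂ), z₀.im / 2 < z.im := hF (hi.eventually (lt_mem_nhds (by linarith)))
  have e2 : ∀ᶠ z in (F : Filter ℂ), z.im < 2 * z₀.im := hF (hi.eventually (gt_mem_nhds (by linarith)))
  have e3 : ∀ᶠ z in (F : Filter ℂ), rQ z ∈ {w : ℂ | |w.re| ≤ 1 ∧ |w.re| ≤ w.re ^ 2 + w.im ^ 2 ∧ z₀.im / 2 ≤ w.im ∧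
      w.im ≤ 2 * z₀.im + 2 / z₀.im} := by
    filter_upwards [e1, e2] with z h1 h2
    have hz' : 0 < z.im := by linarith
    obtain ⟨h3, g, hg, h4⟩ := rQ_spec hz'
    refine ⟨h3.2.1, h3.2.2, by linarith [gam_im_le' h3 hg h4], (red_bound hz' hg h4).trans ?_⟩
    have : 1 / z.im ≤ 2 / z₀.im := by
      rw [div_le_div_iff₀ hz' hz]; linarith
    linarith
  obtain ⟨q, hq, hFq⟩ := (Qd_compact _ _).ultrafilter_le_nhds (F.map rQ) (by rw [le_principal_iff]; exact e3)
  have hq' : q ∈ Qd := ⟨by linarith [hq.2.2.1], hq.1, hq.2.1⟩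
  have hr : Tendsto rQ F (𝓝 q) := hFq
  obtain ⟨U, hU, V, hV, hUV⟩ := omega_pd hT (gam_omega hz.ne') (gam_omega hq'.1.ne')
  have e4 : ∀ᶠ z : ℂ in (F : Filter ℂ), (z : RSphere) ∈ U := hF (OnePoint.continuous_coe.continuousAt hU)
  have e5 : ∀ᶠ z : ℂ in (F : Filter ℂ), ((rQ z : ℂ) : RSphere) ∈ V := hr (OnePoint.continuous_coe.continuousAt hV)
  obtain ⟨z, h4, h5, h1⟩ := (e4.and (e5.and e1)).exists
  obtain ⟨h6, g, hg, h7⟩ := rQ_spec (z := z) (by linarith)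
  have h8 := hUV g hg _ h4 (by rw [h7]; exact h5)
  have h9 : phi z₀ = fQ q := by
    rw [← phi_Qd hq', phi_eq_iff hz hq'.1]; exact ⟨g, hg, h8⟩
  rw [h9]
  exact (fQ_cont.continuousAt (x := q)).tendsto.comp hr

lemma fQ_bdry {q : ℂ} (h1 : |q.re| ≤ 1) (h2 : |q.re| ≤ q.re ^ 2 + q.im ^ 2) (h3 : 0 ≤ q.im) (n1 : fQ q ≠ 1)
    (n2 : fQ q ≠ -1) : 0 < q.im := by
  rcases h3.lt_or_eq with h | h
  · exact h
  exfalso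
  rw [← h] at h2
  have h4 : q.re ^ 2 = |q.re| ^ 2 := (sq_abs _).symm
  have h5 : |q.re| * (1 - |q.re|) = 0 := by nlinarith [abs_nonneg q.re]
  have hs : sQ q = 0 := by rw [sQ, ← h, h4]; linarith
  rcases mul_eq_zero.1 h5 with h6 | h6
  · rw [abs_eq_zero] at h6
    apply n2; rw [fQ, hs, h6]; simp
  · apply n1; rw [fQ, hs]
    rcases (abs_eq zero_le_one).1 (by linarith : |q.re| = 1) with h7 | h7 <;> rw [h7] <;> simp

lemma fQ_closed {C : Set ℂ} (hC : ∀ z : ℂ, 0 < z.im → z ∈ closure C → z ∈ C) {v : ℂ} (h1 : v ≠ 1) (h2 : v ≠ -1)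
    (hv : v ∈ closure (fQ '' (Qd ∩ C))) : v ∈ fQ '' (Qd ∩ C) := by
  have hsub : fQ '' (Qd ∩ C) ∩ Metric.ball v 1 ⊆
      fQ '' (closure (Qd ∩ C) ∩ {w : ℂ | |w.re| ≤ 1 ∧ |w.re| ≤ w.re ^ 2 + w.im ^ 2 ∧ 0 ≤ w.im ∧ w.im ≤ ‖v‖ + 3}) := by
    rintro _ ⟨⟨q, hq, rfl⟩, hb⟩
    refine ⟨q, ⟨subset_closure hq, hq.1.2.1, hq.1.2.2, hq.1.1.le, ?_⟩, rfl⟩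
    have h3 := fQ_norm (sQ_nonneg hq.1)
    have h4 : ‖fQ q‖ < ‖v‖ + 1 := by
      rw [mem_ball_iff_norm] at hb
      have := norm_sub_norm_le (fQ q) v
      linarith
    have h5 : q.re ^ 2 + q.im ^ 2 - |q.re| ≤ ‖fQ q‖ := h3
    nlinarith [hq.1.2.1, sq_nonneg q.re, sq_nonneg (q.im - 1), norm_nonneg v]
  have hcl : IsClosed (fQ '' (closure (Qd ∩ C) ∩
      {w : ℂ | |w.re| ≤ 1 ∧ |w.re| ≤ w.re ^ 2 + w.im ^ 2 ∧ 0 ≤ w.im ∧ w.im ≤ ‖v‖ + 3})) :=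
    (((Qd_compact 0 _).inter_left isClosed_closure).image fQ_cont).isClosed
  have hv' : v ∈ closure (fQ '' (Qd ∩ C) ∩ Metric.ball v 1) := by
    rw [inter_comm]
    exact Metric.isOpen_ball.inter_closure ⟨Metric.mem_ball_self one_pos, hv⟩
  obtain ⟨q, ⟨hq, hq1, hq2, hq3, -⟩, rfl⟩ := (closure_minimal hsub hcl) hv'
  have hp := fQ_bdry hq1 hq2 hq3 h1 h2
  exact ⟨q, ⟨⟨hp, hq1, hq2⟩, hC q hp (closure_mono inter_subset_right hq)⟩, rfl⟩
end

noncomputable section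
open Set Filter Topology

/-- the component of the region of discontinuity -/
abbrev Om (G : Subgroup PSL2C) (z : RSphere) : Set RSphere := connectedComponentIn (omegaSet G) z

/-- stabilizer of a component -/
def Hs (G : Subgroup PSL2C) (z : RSphere) : Subgroup PSL2C where
  carrier := {g | g ∈ G ∧ ∀ y ∈ Om G z, g • y ∈ Om G z ∧ g⁻¹ • y ∈ Om G z}
  mul_mem' := by
    rintro a b ⟨ha, ha'⟩ ⟨hb, hb'⟩
    refine ⟨mul_mem ha hb, fun y hy => ?_⟩
    rw [mul_inv_rev, mul_smul, mul_smul]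
    exact ⟨(ha' _ (hb' y hy).1).1, (hb' _ (ha' y hy).2).2⟩
  one_mem' := ⟨one_mem _, fun y hy => by simpa using hy⟩
  inv_mem' := by
    rintro a ⟨ha, ha'⟩
    refine ⟨inv_mem ha, fun y hy => ?_⟩
    rw [inv_inv]; exact (ha' y hy).symm

lemma Hs_le (G : Subgroup PSL2C) (z : RSphere) : Hs G z ≤ G := fun _ h => h.1

lemma comp_smul {G : Subgroup PSL2C} {g : PSL2C} (hg : g ∈ G) {a y : RSphere} (hy : y ∈ Om G a) :
    g • y ∈ Om G (g • a) := by
  have ha : a ∈ omegaSet G := by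
    by_contra h
    rw [Om, connectedComponentIn_eq_empty h] at hy; exact hy
  have h1 : IsPreconnected ((fun x : RSphere => g • x) '' Om G a) :=
    isPreconnected_connectedComponentIn.image _ (continuous_const_smul g).continuousOn
  refine h1.subset_connectedComponentIn ⟨a, mem_connectedComponentIn ha, rfl⟩ ?_ ⟨y, hy, rfl⟩
  rintro _ ⟨u, hu, rfl⟩
  exact omega_smul hg (connectedComponentIn_subset _ _ hu)

lemma Hs_mem {G : Subgroup PSL2C} {z : RSphere} {g : PSL2C} (hg : g ∈ G) {y : RSphere} (hy : y ∈ Om G z)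
    (hgy : g • y ∈ Om G z) : g ∈ Hs G z := by
  have e1 : Om G z = Om G y := connectedComponentIn_eq hy
  have e2 : Om G z = Om G (g • y) := connectedComponentIn_eq hgy
  refine ⟨hg, fun u hu => ⟨?_, ?_⟩⟩
  · rw [e2]; exact comp_smul hg (e1 ▸ hu)
  · have := comp_smul (inv_mem hg) (e2 ▸ hu)
    rw [inv_smul_smul] at this
    rw [e1]; exact this

instance hsAction (G : Subgroup PSL2C) (z : RSphere) : MulAction ↥(Hs G z) ↥(Om G z) where
  smul h x := ⟨(h : PSL2C) • (x : RSphere), (h.2.2 x x.2).1⟩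
  one_smul x := Subtype.ext (one_smul PSL2C (x : RSphere))
  mul_smul a b x := Subtype.ext (mul_smul (a : PSL2C) (b : PSL2C) (x : RSphere))

lemma hs_coe {G : Subgroup PSL2C} {z : RSphere} (h : ↥(Hs G z)) (x : ↥(Om G z)) :
    ((h • x : ↥(Om G z)) : RSphere) = (h : PSL2C) • (x : RSphere) := rfl

lemma om_surf {G : Subgroup PSL2C} (hK : IsKleinian G) {z : RSphere} (hz : z ∈ omegaSet G) :
    Surf ↥(Hs G z) ↥(Om G z) := by
  obtain ⟨-, -, hT, ⟨q, -, -, hq, -⟩, -⟩ := hK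
  have hO : IsOpen (Om G z) := (omega_open G).connectedComponentIn
  have hsub : Om G z ⊆ omegaSet G := connectedComponentIn_subset _ _
  refine ⟨?_, ?_, ?_, ?_, ?_⟩
  · have h1 : IsConnected (Om G z) := isConnected_connectedComponentIn_iff.2 hz
    have := isConnected_iff_connectedSpace.1 h1
    exact isConnected_univ
  · obtain ⟨M, hM⟩ := exists_inf_to q
    have h1 : ∀ x : ↥(Om G z), ∃ w : ℂ, M • (w : RSphere) = x := fun x =>
      chart_range M (by rw [hM]; intro h; exact hq (h ▸ hsub x.2))
    choose e he using h1
    refine ⟨e, IsOpenEmbedding.of_comp e (chart_emb M) ?_⟩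
    have : (fun w : ℂ => M • (w : RSphere)) ∘ e = Subtype.val := funext he
    rw [this]; exact hO.isOpenEmbedding_subtypeVal
  · intro h
    exact ((continuous_const_smul (h : PSL2C)).comp continuous_subtype_val).subtype_mk _
  · intro x y
    obtain ⟨U, hU, V, hV, h⟩ := omega_pd hT (hsub x.2) (hsub y.2)
    refine ⟨Subtype.val ⁻¹' U, continuous_subtype_val.continuousAt hU, Subtype.val ⁻¹' V,
      continuous_subtype_val.continuousAt hV, fun g u hu hgu => Subtype.ext (h g g.2.1 u hu hgu)⟩
  · intro g x hgx
    exact Subtype.ext (omega_free hT g.2.1 (hsub x.2) (congrArg Subtype.val hgx))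

lemma oproj_eq {G : Subgroup PSL2C} {a b : ↥(omegaSet G)} : oproj G a = oproj G b ↔
    ∃ g ∈ G, g • (a : RSphere) = b := by
  have he : Equivalence (fun z w : ↥(omegaSet G) => ∃ g ∈ G, psl g ↑z = ↑w) := by
    refine ⟨fun a => ⟨1, one_mem _, psl_one _⟩, ?_, ?_⟩
    · rintro a b ⟨g, hg, h⟩
      exact ⟨g⁻¹, inv_mem hg, by rw [← h, ← smul_def', ← smul_def', inv_smul_smul]⟩
    · rintro a b c ⟨g, hg, h⟩ ⟨k, hk, h'⟩
      exact ⟨k * g, mul_mem hk hg, by rw [psl_mul, h, h']⟩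
  have h1 : oproj G a = oproj G b ↔ (orel G) a b := Quotient.eq
  rw [h1]
  exact he.eqvGen_iff

lemma oproj_cont (G : Subgroup PSL2C) : Continuous (oproj G) := continuous_quot_mk

lemma oproj_open (G : Subgroup PSL2C) : IsOpenMap (oproj G) := by
  intro U hU
  have hq : IsQuotientMap (oproj G) := isQuotientMap_quot_mk
  rw [← hq.isOpen_preimage]
  obtain ⟨V, hV, rfl⟩ := isOpen_induced_iff.1 hU
  have : oproj G ⁻¹' (oproj G '' (Subtype.val ⁻¹' V)) = ⋃ g ∈ G, Subtype.val ⁻¹' ((fun x : RSphere => g • x) ⁻¹' V) := by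
    ext y
    simp only [mem_preimage, mem_image, mem_iUnion]
    constructor
    · rintro ⟨x, hx, h⟩
      obtain ⟨g, hg, h'⟩ := oproj_eq.1 h.symm
      exact ⟨g, hg, by rw [h']; exact hx⟩
    · rintro ⟨g, hg, h⟩
      exact ⟨⟨g • (y : RSphere), omega_smul hg y.2⟩, h, (oproj_eq.2 ⟨g, hg, rfl⟩).symm⟩
  rw [this]
  exact isOpen_biUnion fun g _ => (hV.preimage (continuous_const_smul g)).preimage continuous_subtype_val

lemma comp_eq {G : Subgroup PSL2C} {z : RSphere} (hz : z ∈ omegaSet G) :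
    connectedComponent (oproj G ⟨z, hz⟩) = oproj G '' {y | (y : RSphere) ∈ Om G z} := by
  have hO : IsOpen (Om G z) := (omega_open G).connectedComponentIn
  have hsub : Om G z ⊆ omegaSet G := connectedComponentIn_subset _ _
  apply Subset.antisymm
  · refine IsClopen.connectedComponent_subset ⟨?_, ?_⟩ ⟨_, mem_connectedComponentIn hz, rfl⟩
    · have hq : IsQuotientMap (oproj G) := isQuotientMap_quot_mk
      rw [← hq.isClosed_preimage, ← isOpen_compl_iff, isOpen_iff_mem_nhds]
      intro y hy
      have h1 : Subtype.val ⁻¹' (Om G (y : RSphere)) ∈ 𝓝 y := continuous_subtype_val.continuousAt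
        ((omega_open G).connectedComponentIn.mem_nhds (mem_connectedComponentIn y.2))
      filter_upwards [h1] with u hu hu'
      apply hy
      obtain ⟨v, hv, h2⟩ := hu'
      obtain ⟨g, hg, h3⟩ := oproj_eq.1 h2.symm
      have e1 : Om G (y : RSphere) = Om G u := connectedComponentIn_eq hu
      have e2 : Om G z = Om G v := connectedComponentIn_eq hv
      have h4 : (y : RSphere) ∈ Om G u := e1 ▸ mem_connectedComponentIn y.2
      have h5 := comp_smul hg h4
      rw [h3, ← e2] at h5
      exact ⟨⟨g • (y : RSphere), omega_smul hg y.2⟩, h5, (oproj_eq.2 ⟨g, hg, rfl⟩).symm⟩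
    · exact oproj_open G _ (hO.preimage continuous_subtype_val)
  · have h1 : IsPreconnected {y : ↥(omegaSet G) | (y : RSphere) ∈ Om G z} := by
      have : Subtype.val '' {y : ↥(omegaSet G) | (y : RSphere) ∈ Om G z} = Om G z := by
        ext u; constructor
        · rintro ⟨v, hv, rfl⟩; exact hv
        · intro hu; exact ⟨⟨u, hsub hu⟩, hu, rfl⟩
      rw [← IsInducing.subtypeVal.isPreconnected_image, this]
      exact isPreconnected_connectedComponentIn
    exact (h1.image _ (oproj_cont G).continuousOn).subset_connectedComponent ⟨_, mem_connectedComponentIn hz, rfl⟩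

lemma cyc_curve {G : Subgroup PSL2C} (hK : IsKleinian G) {z : RSphere} (hz : z ∈ omegaSet G) {h : ↥(Hs G z)}
    (hh : Cyc ↥(Om G z) h) : ∃ f : C(S1, QuotOmega G), Function.Injective f ∧
        Set.range f ⊆ connectedComponent (oproj G ⟨z, hz⟩) ∧ RepresentedByOmega G f h := by
  have hsub : Om G z ⊆ omegaSet G := connectedComponentIn_subset _ _
  obtain ⟨γ, hc, hp, hi⟩ := cyc_line (om_surf hK hz) hh
  set δ : ℝ → ↥(omegaSet G) := fun t => ⟨γ t, hsub (γ t).2⟩ with hδ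
  have hδc : Continuous δ := (continuous_subtype_val.comp hc).subtype_mk _
  have hper : Function.Periodic (fun t => oproj G (δ t)) 1 := by
    intro t
    refine (oproj_eq.2 ⟨h, h.2.1, ?_⟩).symm
    simp only [hδ]; rw [hp]; rfl
  have hfc : Continuous (hper.lift : S1 → QuotOmega G) := by
    have hq : IsQuotientMap ((↑) : ℝ → S1) := QuotientAddGroup.isQuotientMap_mk _
    rw [hq.continuous_iff]
    exact (oproj_cont G).comp hδc
  refine ⟨⟨hper.lift, hfc⟩, ?_, ?_, h.2.1, ⟨δ, hδc⟩, ?_, fun t => rfl⟩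
  · intro a b
    induction a using QuotientAddGroup.induction_on with | H s =>
    induction b using QuotientAddGroup.induction_on with | H t =>
    intro hab
    have hab' : oproj G (δ s) = oproj G (δ t) := hab
    obtain ⟨g, hg, hg'⟩ := oproj_eq.1 hab'
    have hgH : g ∈ Hs G z := Hs_mem hg (γ s).2 (by
      have : g • (γ s : RSphere) = γ t := hg'
      rw [this]; exact (γ t).2)
    obtain ⟨n, hn⟩ := hi t s (pr_eq.2 ⟨⟨g, hgH⟩, Subtype.ext hg'⟩)
    rw [QuotientAddGroup.eq, AddSubgroup.mem_zmultiples_iff]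
    exact ⟨n, by rw [zsmul_eq_mul, mul_one, ← hn]; ring⟩
  · rintro _ ⟨a, rfl⟩
    induction a using QuotientAddGroup.induction_on with | H s =>
    rw [comp_eq hz]
    exact ⟨δ s, (γ s).2, rfl⟩
  · intro t
    change ((γ (t + 1) : ↥(Om G z)) : RSphere) = _
    rw [hp]; rfl
end

noncomputable section
open Set Filter Topology

lemma omega_mono {H G : Subgroup PSL2C} (h : H ≤ G) : omegaSet G ⊆ omegaSet H := by
  rintro z ⟨U, hU, hz, hf⟩
  exact ⟨U, hU, hz, hf.subset fun g hg => ⟨h hg.1, hg.2⟩⟩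

lemma cj_mono {M : PSL2C} {H G : Subgroup PSL2C} (h : H ≤ G) : cj M H ≤ cj M G := Subgroup.map_mono h

lemma cj_omega' {M : PSL2C} {G : Subgroup PSL2C} {w : RSphere} : w ∈ omegaSet (cj M G) ↔ M⁻¹ • w ∈ omegaSet G := by
  rw [← cj_omega (M := M) (z := M⁻¹ • w), smul_inv_smul]

lemma unip_omega {K : Subgroup PSL2C} (hK : ∀ k ∈ K, ∃ β, k = mk (Uu β)) {p : ℂ} (hp : (p : RSphere) ∈ omegaSet K)
    (w : ℂ) : (w : RSphere) ∈ omegaSet K := by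
  obtain ⟨U, hU, hpU, hf⟩ := hp
  obtain ⟨ε, hε, hb⟩ := ball_of_nhds hU hpU
  refine ⟨(fun z : ℂ => (z : RSphere)) '' Metric.ball w (ε / 2), OnePoint.isOpen_image_coe.2 Metric.isOpen_ball,
    ⟨w, Metric.mem_ball_self (by linarith), rfl⟩, hf.subset ?_⟩
  rintro g ⟨hg, _, ⟨_, ⟨u, hu, rfl⟩, rfl⟩, ⟨v, hv, hv'⟩⟩
  obtain ⟨β, rfl⟩ := hK g hg
  rw [← smul_def', Uu_smul] at hv'
  have e : v = u + β := OnePoint.coe_injective hv'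
  have hβ : ‖β‖ < ε := by
    have : β = (v - w) - (u - w) := by rw [e]; ring
    rw [mem_ball_iff_norm] at hu hv
    rw [this]
    exact (norm_sub_le _ _).trans_lt (by linarith)
  refine ⟨hg, _, ⟨_, hpU, rfl⟩, ?_⟩
  rw [← smul_def', Uu_smul]
  exact hb _ (by simpa using hβ)

lemma exists_fin {O : Set RSphere} (hO : IsOpen O) (hne : O.Nonempty) (M : PSL2C) : ∃ w : ℂ, M • (w : RSphere) ∈ O := by
  have h1 : IsOpen ((fun x : RSphere => M • x) ⁻¹' O) := hO.preimage (continuous_const_smul M)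
  obtain ⟨y, hy⟩ := hne
  obtain ⟨w, hw⟩ := (OnePoint.denseRange_coe (X := ℂ)).exists_mem_open h1 ⟨M⁻¹ • y, by simpa using hy⟩
  exact ⟨w, hw⟩

lemma unip_false {G : Subgroup PSL2C} (hK : IsKleinian G) {z : RSphere} (hz : z ∈ omegaSet G) {M : PSL2C}
    (hM : ∀ h ∈ Hs G z, ∃ β, M * h * M⁻¹ = mk (Uu β)) : False := by
  have hO : IsOpen (Om G z) := (omega_open G).connectedComponentIn
  have hsub : Om G z ⊆ omegaSet G := connectedComponentIn_subset _ _
  obtain ⟨p, hp⟩ := exists_fin hO ⟨z, mem_connectedComponentIn hz⟩ M⁻¹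
  have h1 : ∀ k ∈ cj M (Hs G z), ∃ β, k = mk (Uu β) := by
    intro k hk
    obtain ⟨β, hβ⟩ := hM _ (mem_cj.1 hk)
    exact ⟨β, by rw [← hβ]; group⟩
  have h2 : ∀ w : ℂ, M⁻¹ • (w : RSphere) ∈ omegaSet (Hs G z) := fun w =>
    cj_omega'.1 (unip_omega h1 (cj_omega'.2 (omega_mono (Hs_le G z) (hsub hp))) w)
  have hA : IsClopen {w : ℂ | M⁻¹ • (w : RSphere) ∈ Om G z} := by
    have hc : Continuous fun w : ℂ => M⁻¹ • (w : RSphere) := (chart_emb M⁻¹).continuous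
    refine ⟨?_, hO.preimage hc⟩
    refine isClosed_of_closure_subset fun w hw => ?_
    exact comp_closure hK hz (Hs_le G z) (fun g hg x hx hgx => Hs_mem hg hx hgx)
      (hc.closure_preimage_subset _ hw) (h2 w)
  have hU := hA.eq_univ ⟨p, hp⟩
  have h3 : ∀ a ∈ limitSet G, a = M⁻¹ • (OnePoint.infty : RSphere) := by
    intro a ha
    by_contra hne
    obtain ⟨w, rfl⟩ := chart_range M⁻¹ hne
    have : w ∈ {w : ℂ | M⁻¹ • (w : RSphere) ∈ Om G z} := by rw [hU]; trivial
    exact ha (hsub this)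
  obtain ⟨-, -, -, ⟨a, b, c, ha, hb, hc, hab, -⟩, -⟩ := hK
  exact hab ((h3 a ha).trans (h3 b hb).symm)

lemma Ll_inv (a : ℂ) : (Ll a)⁻¹ = Ll (-a) := by
  obtain ⟨i1, i2, i3, i4⟩ := sl_inv (Ll a)
  apply sl_ext
  · rw [i1]; simp [Ll]
  · rw [i2]; simp [Ll]
  · rw [i3]; simp [Ll]
  · rw [i4]; simp [Ll]

lemma gam_u : mk (Uu 2) ∈ Gam := Subgroup.subset_closure (Or.inl rfl)
lemma gam_l : mk (Ll 2) ∈ Gam := Subgroup.subset_closure (Or.inr rfl)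
lemma gam_u' : mk (Uu (-2)) ∈ Gam := by rw [← Uu_inv, mk_inv]; exact inv_mem gam_u
lemma gam_l' : mk (Ll (-2)) ∈ Gam := by rw [← Ll_inv, mk_inv]; exact inv_mem gam_l

lemma Ll_smul {β z : ℂ} (h : β * z + 1 ≠ 0) : mk (Ll β) • (z : RSphere) = ((z / (β * z + 1) : ℂ) : RSphere) := by
  rw [mk_smul_coe (by simpa [Ll] using h)]; simp [Ll]

lemma Ll_smul_infty {β z : ℂ} (h : β * z + 1 = 0) : mk (Ll β) • (z : RSphere) = OnePoint.infty := by
  rw [mk_smul_coe_infty (by simpa [Ll] using h)]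

lemma mk_ne_one {A : SL2C} (h : A.1 0 1 ≠ 0 ∨ A.1 1 0 ≠ 0) : mk A ≠ 1 := by
  intro h1
  rw [← mk_one, mk_eq_iff] at h1
  rcases h1 with rfl | rfl
  · simp at h
  · rw [sl_neg, sl_neg] at h; simp at h

lemma inf_lim {K : Subgroup PSL2C} (hT : TorsionFree K) (hG : Gam ≤ K) : (OnePoint.infty : RSphere) ∉ omegaSet K := fun h =>
  mk_ne_one (A := Uu 2) (Or.inl (by simp [Uu])) (omega_free hT (hG gam_u) h (mk_smul_infty_infty (by simp [Uu])))

lemma zero_lim {K : Subgroup PSL2C} (hT : TorsionFree K) (hG : Gam ≤ K) : ((0 : ℂ) : RSphere) ∉ omegaSet K := fun h =>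
  mk_ne_one (A := Ll 2) (Or.inr (by simp [Ll])) (omega_free hT (hG gam_l) h (by rw [Ll_smul (by simp)]; simp))

lemma one_lim {K : Subgroup PSL2C} (hT : TorsionFree K) (hG : Gam ≤ K) : ((1 : ℂ) : RSphere) ∉ omegaSet K := fun h => by
  refine mk_ne_one (A := Uu 2 * Ll (-2)) (Or.inl ?_) (omega_free hT (hG (mul_mem gam_u gam_l')) h ?_)
  · rw [sl_mul]; simp [Uu, Ll]
  · rw [mk_mul, mul_smul, Ll_smul (by norm_num), Uu_smul]; norm_num

lemma lim_of {K : Subgroup PSL2C} (hG : Gam ≤ K) {g : PSL2C} (hg : g ∈ Gam) {z : RSphere} (h : g • z ∉ omegaSet K) : z ∉ omegaSet K :=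
  fun hz => h (omega_smul (hG hg) hz)

lemma rat_lim {K : Subgroup PSL2C} (hT : TorsionFree K) (hG : Gam ≤ K) (n : ℕ) :
    ∀ p q : ℤ, p.natAbs + q.natAbs ≤ n → q ≠ 0 → (((p : ℂ) / (q : ℂ) : ℂ) : RSphere) ∉ omegaSet K := by
  induction n with
  | zero => intro p q h hq; omega
  | succ n ih =>
    intro p q h hq
    have hq' : (q : ℂ) ≠ 0 := by exact_mod_cast hq
    by_cases hp : p = 0
    · subst hp; simpa using zero_lim hT hG
    rcases lt_trichotomy p.natAbs q.natAbs with hlt | heq | hgt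
    · have key : ∀ e : ℤ, (e = 2 ∨ e = -2) → (e * p + q).natAbs < q.natAbs →
          (((p : ℂ) / (q : ℂ) : ℂ) : RSphere) ∉ omegaSet K := by
        intro e he h2
        have hg : mk (Ll (e : ℂ)) ∈ Gam := by
          rcases he with rfl | rfl
          · simpa using gam_l
          · simpa using gam_l'
        refine lim_of hG hg ?_
        by_cases h0 : e * p + q = 0
        · have h0' : (e : ℂ) * p + q = 0 := by exact_mod_cast h0
          rw [Ll_smul_infty (by field_simp; rw [h0', mul_zero])]
          exact inf_lim hT hG
        · have h0' : (e : ℂ) * p + q ≠ 0 := by exact_mod_cast h0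
          have h1' : (e : ℂ) * (p / q) + 1 ≠ 0 := by
            intro h; field_simp at h; rw [mul_zero] at h; exact h0' h
          rw [Ll_smul h1']
          have := ih p (e * p + q) (by omega) h0
          have e2 : ((p : ℂ) / q) / (e * (p / q) + 1) = (p : ℂ) / ((e * p + q : ℤ) : ℂ) := by
            have h3 : (e : ℂ) * (p / q) + 1 = (e * p + q) / q := by field_simp
            rw [h3]; push_cast; field_simp
          rw [e2]; exact this
      rcases (by omega : (2 * p + q).natAbs < q.natAbs ∨ (-2 * p + q).natAbs < q.natAbs) with h2 | h2
      · exact key 2 (Or.inl rfl) h2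
      · exact key (-2) (Or.inr rfl) h2
    · rcases Int.natAbs_eq_natAbs_iff.1 heq with rfl | rfl
      · rw [div_self hq']; exact one_lim hT hG
      · refine lim_of hG gam_u ?_
        rw [Uu_smul]
        have : (((-q : ℤ) : ℂ) / q + 2) = 1 := by push_cast; field_simp; ring
        rw [this]; exact one_lim hT hG
    · have key : ∀ e : ℤ, (e = 2 ∨ e = -2) → (p + e * q).natAbs < p.natAbs →
          (((p : ℂ) / (q : ℂ) : ℂ) : RSphere) ∉ omegaSet K := by
        intro e he h2
        have hg : mk (Uu (e : ℂ)) ∈ Gam := by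
          rcases he with rfl | rfl
          · simpa using gam_u
          · simpa using gam_u'
        refine lim_of hG hg ?_
        rw [Uu_smul]
        have := ih (p + e * q) q (by omega) hq
        have e2 : (p : ℂ) / q + e = ((p + e * q : ℤ) : ℂ) / q := by push_cast; field_simp
        rw [e2]; exact this
      rcases (by omega : (p + 2 * q).natAbs < p.natAbs ∨ (p + -2 * q).natAbs < p.natAbs) with h2 | h2
      · exact key 2 (Or.inl rfl) h2
      · exact key (-2) (Or.inr rfl) h2

lemma real_lim {K : Subgroup PSL2C} (hT : TorsionFree K) (hG : Gam ≤ K) {w : ℂ} (hw : w.im = 0) : (w : RSphere) ∉ omegaSet K := by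
  intro h
  have hc : Continuous fun r : ℝ => ((r : ℂ) : RSphere) := OnePoint.continuous_coe.comp Complex.continuous_ofReal
  have hw' : ((w.re : ℝ) : ℂ) = w := Complex.ext (by simp) (by simp [hw])
  obtain ⟨r, hr⟩ := Rat.denseRange_cast (𝕜 := ℝ) |>.exists_mem_open ((omega_open K).preimage hc) ⟨w.re, by
    rw [mem_preimage, hw']; exact h⟩
  have h2 := rat_lim hT hG _ r.num r.den le_rfl (by exact_mod_cast r.den_nz)
  apply h2
  have : ((r.num : ℂ) / ((r.den : ℤ) : ℂ)) = ((r : ℝ) : ℂ) := by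
    have := Rat.num_div_den r
    conv_rhs => rw [← this]
    push_cast; rfl
  rw [this]; exact hr
end

noncomputable section
open Set Filter Topology

lemma cj_closure (M x y : PSL2C) : cj M (Subgroup.closure {x, y}) = Subgroup.closure {M * x * M⁻¹, M * y * M⁻¹} := by
  rw [cj, MonoidHom.map_closure, image_pair]; rfl

lemma cj_comp (D M : PSL2C) (H : Subgroup PSL2C) : cj (D * M) H = cj D (cj M H) := by
  ext k
  rw [mem_cj, mem_cj, mem_cj, mul_inv_rev]
  simp only [mul_assoc]

/-- the half turn `z ↦ -z` -/
def Dd : SL2C := slm Complex.I 0 0 (-Complex.I) (by simp)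

lemma Dd_smul (w : ℂ) : (mk Dd)⁻¹ • (w : RSphere) = ((-w : ℂ) : RSphere) := by
  rw [inv_smul_eq_iff, mk_smul_coe (by simp [Dd, slm])]
  simp [Dd, slm]

lemma Dd_conj : cj (mk Dd) Gam = Gam := by
  have h1 : mk Dd * mk (Uu 2) * (mk Dd)⁻¹ = mk (Uu (-2)) := by
    rw [mul_inv_eq_iff_eq_mul, ← mk_mul, ← mk_mul]
    congr 1
    apply sl_ext <;> rw [sl_mul, sl_mul] <;> simp [Dd, slm, Uu]; ring
  have h2 : mk Dd * mk (Ll 2) * (mk Dd)⁻¹ = mk (Ll (-2)) := by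
    rw [mul_inv_eq_iff_eq_mul, ← mk_mul, ← mk_mul]
    congr 1
    apply sl_ext <;> rw [sl_mul, sl_mul] <;> simp [Dd, slm, Ll]; ring
  have h3 : cj (mk Dd) Gam = Subgroup.closure {mk (Uu (-2)), mk (Ll (-2))} := by
    rw [Gam, cj_closure, h1, h2]
  rw [h3]
  apply le_antisymm
  · rw [Subgroup.closure_le]
    rintro g (rfl | rfl)
    · exact gam_u'
    · exact gam_l'
  · rw [Gam, Subgroup.closure_le]
    rintro g (rfl | rfl)
    · have : mk (Uu (2 : ℂ)) = (mk (Uu (-2)))⁻¹ := by rw [← mk_inv, Uu_inv, neg_neg]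
      rw [this]; exact inv_mem (Subgroup.subset_closure (Or.inl rfl))
    · have : mk (Ll (2 : ℂ)) = (mk (Ll (-2)))⁻¹ := by rw [← mk_inv, Ll_inv, neg_neg]
      rw [this]; exact inv_mem (Subgroup.subset_closure (Or.inr rfl))

lemma half_conv : IsPreconnected {w : ℂ | 0 < w.im} ∧ IsPreconnected {w : ℂ | w.im < 0} :=
  ⟨(convex_halfSpace_im_gt 0).isPreconnected, (convex_halfSpace_im_lt 0).isPreconnected⟩

lemma ess_half {G : Subgroup PSL2C} (hK : IsKleinian G) {z : RSphere} (hz : z ∈ omegaSet G) {M : PSL2C}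
    (hM : cj M (Hs G z) = Gam) : M⁻¹ • (OnePoint.infty : RSphere) ∉ Om G z ∧
    ((∀ w : ℂ, M⁻¹ • (w : RSphere) ∈ Om G z ↔ 0 < w.im) ∨ ∀ w : ℂ, M⁻¹ • (w : RSphere) ∈ Om G z ↔ w.im < 0) := by
  have hO : IsOpen (Om G z) := (omega_open G).connectedComponentIn
  have hsub : Om G z ⊆ omegaSet G := connectedComponentIn_subset _ _
  have hT : TorsionFree (cj M G) := cj_free hK.2.2.1
  have hG : Gam ≤ cj M G := hM ▸ cj_mono (Hs_le G z)
  have hinf : M⁻¹ • (OnePoint.infty : RSphere) ∉ Om G z := fun h => inf_lim hT hG (cj_omega'.2 (hsub h))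
  refine ⟨hinf, ?_⟩
  set A : Set ℂ := {w : ℂ | M⁻¹ • (w : RSphere) ∈ Om G z} with hAdef
  have he := chart_emb M⁻¹
  have hc : Continuous fun w : ℂ => M⁻¹ • (w : RSphere) := he.continuous
  have hAo : IsOpen A := hO.preimage hc
  have him : (fun w : ℂ => M⁻¹ • (w : RSphere)) '' A = Om G z := by
    apply Subset.antisymm
    · rintro _ ⟨w, hw, rfl⟩; exact hw
    · intro x hx
      obtain ⟨w, rfl⟩ := chart_range M⁻¹ (x := x) (by rintro rfl; exact hinf hx)
      exact ⟨w, hx, rfl⟩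
  have hAc : IsPreconnected A := by
    rw [← he.isInducing.isPreconnected_image, him]; exact isPreconnected_connectedComponentIn
  have hAne : A.Nonempty := exists_fin hO ⟨z, mem_connectedComponentIn hz⟩ M⁻¹
  have hAr : ∀ w ∈ A, w.im ≠ 0 := fun w hw h0 => real_lim hT hG h0 (cj_omega'.2 (hsub hw))
  have hcl : ∀ w : ℂ, w.im ≠ 0 → w ∈ closure A → w ∈ A := by
    intro w hw hwA
    refine comp_closure hK hz (Hs_le G z) (fun g hg x hx hgx => Hs_mem hg hx hgx)
      (hc.closure_preimage_subset _ hwA) (cj_omega'.1 ?_)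
    rw [hM]; exact gam_omega hw
  have hup : IsOpen {w : ℂ | 0 < w.im} := isOpen_lt continuous_const Complex.continuous_im
  have hlo : IsOpen {w : ℂ | w.im < 0} := isOpen_lt Complex.continuous_im continuous_const
  rcases isPreconnected_iff_subset_of_disjoint.1 hAc _ _ hup hlo
    (fun w hw => (lt_or_gt_of_ne (hAr w hw)).symm) (by
      ext w; simp only [mem_inter_iff, mem_ofPred_eq, mem_empty_iff_false, iff_false]
      rintro ⟨-, h1, h2⟩; linarith) with hs | hs
  · left
    intro w
    refine ⟨fun h => hs h, fun h => ?_⟩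
    exact half_conv.1.subset_of_closure_inter_subset hAo (hAne.imp fun u hu => ⟨hs hu, hu⟩)
      (fun u hu => hcl u (ne_of_gt hu.2) hu.1) h
  · right
    intro w
    refine ⟨fun h => hs h, fun h => ?_⟩
    exact half_conv.2.subset_of_closure_inter_subset hAo (hAne.imp fun u hu => ⟨hs hu, hu⟩)
      (fun u hu => hcl u (ne_of_lt hu.2) hu.1) h

lemma ess_upper {G : Subgroup PSL2C} (hK : IsKleinian G) {z : RSphere} (hz : z ∈ omegaSet G) {M : PSL2C}
    (hM : cj M (Hs G z) = Gam) : ∃ M : PSL2C, cj M (Hs G z) = Gam ∧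
      M⁻¹ • (OnePoint.infty : RSphere) ∉ Om G z ∧ ∀ w : ℂ, M⁻¹ • (w : RSphere) ∈ Om G z ↔ 0 < w.im := by
  rcases (ess_half hK hz hM).2 with h | h
  · exact ⟨M, hM, (ess_half hK hz hM).1, h⟩
  · have hM' : cj (mk Dd * M) (Hs G z) = Gam := by rw [cj_comp, hM, Dd_conj]
    refine ⟨mk Dd * M, hM', (ess_half hK hz hM').1, fun w => ?_⟩
    rw [mul_inv_rev, mul_smul, Dd_smul, h]
    simp

/-- the plane punctured twice -/
def Yy : Set ℂ := {v | v ≠ 1 ∧ v ≠ -1}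

lemma Yy_homeo : Nonempty (↥Yy ≃ₜ ↥({((1 : ℂ) : RSphere), ((-1 : ℂ) : RSphere), OnePoint.infty}ᶜ : Set RSphere)) := by
  have he : ((fun v : ℂ => (v : RSphere)) '' Yy) =
      ({((1 : ℂ) : RSphere), ((-1 : ℂ) : RSphere), OnePoint.infty}ᶜ : Set RSphere) := by
    ext x
    simp only [mem_image, mem_compl_iff, mem_insert_iff, mem_singleton_iff, not_or]
    constructor
    · rintro ⟨v, hv, rfl⟩
      exact ⟨fun h => hv.1 (OnePoint.coe_injective h), fun h => hv.2 (OnePoint.coe_injective h), OnePoint.coe_ne_infty v⟩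
    · rintro ⟨h1, h2, h3⟩
      obtain ⟨v, rfl⟩ := OnePoint.ne_infty_iff_exists.1 h3
      exact ⟨v, ⟨fun h => h1 (by rw [h]), fun h => h2 (by rw [h])⟩, rfl⟩
  exact ⟨((OnePoint.isOpenEmbedding_coe (X := ℂ)).isEmbedding.homeomorphImage Yy).trans (Homeomorph.setCongr he)⟩

/-- the modular function on the upper half plane -/
def phiY (w : {w : ℂ // 0 < w.im}) : ↥Yy := ⟨phi w, phi_ne w.2⟩

lemma phiY_quot (hT : TorsionFree Gam) : IsQuotientMap phiY := by
  have hc : Continuous phiY := by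
    refine Continuous.subtype_mk ?_ _
    rw [continuous_iff_continuousAt]
    intro w
    exact (phi_cont hT w.2).comp continuous_subtype_val.continuousAt
  have hs : ∀ v : ↥Yy, ∃ q : ℂ, ∃ hq : q ∈ Qd, fQ q = v ∧ phiY ⟨q, hq.1⟩ = v := by
    intro v
    obtain ⟨q, hq, h⟩ := fQ_surj v.2.1 v.2.2
    exact ⟨q, hq, h, Subtype.ext ((phi_Qd hq).trans h)⟩
  rw [isQuotientMap_iff_isClosed]
  refine ⟨fun v => ?_, fun s => ⟨fun h => h.preimage hc, fun h => ?_⟩⟩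
  · obtain ⟨q, hq, -, h⟩ := hs v
    exact ⟨_, h⟩
  · set C : Set ℂ := Subtype.val '' (phiY ⁻¹' s) with hC
    have hC1 : ∀ w : ℂ, 0 < w.im → w ∈ closure C → w ∈ C := by
      intro w hw hwC
      have h1 : (⟨w, hw⟩ : {w : ℂ // 0 < w.im}) ∈ closure (phiY ⁻¹' s) := by
        rw [closure_subtype]; exact hwC
      rw [h.closure_eq] at h1
      exact ⟨_, h1, rfl⟩
    have hs' : Subtype.val '' s = fQ '' (Qd ∩ C) := by
      apply Subset.antisymm
      · rintro _ ⟨v, hv, rfl⟩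
        obtain ⟨q, hq, h1, h2⟩ := hs v
        exact ⟨q, ⟨hq, ⟨q, hq.1⟩, by rw [mem_preimage, h2]; exact hv, rfl⟩, h1⟩
      · rintro _ ⟨_, ⟨hq, w, hw, rfl⟩, rfl⟩
        exact ⟨_, hw, phi_Qd hq⟩
    refine isClosed_of_closure_subset fun v hv => ?_
    rw [closure_subtype, hs'] at hv
    have := fQ_closed hC1 v.2.1 v.2.2 hv
    rw [← hs'] at this
    obtain ⟨v', hv', h1⟩ := this
    rwa [← Subtype.ext h1]

lemma homeo_of_quot {X Y Z : Type*} [TopologicalSpace X] [TopologicalSpace Y] [TopologicalSpace Z] {f : X → Y} {g : X → Z}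
    (hf : IsQuotientMap f) (hg : IsQuotientMap g) (h : ∀ a b, f a = f b ↔ g a = g b) : Nonempty (Y ≃ₜ Z) := by
  have : Setoid.ker f = Setoid.ker g := by ext a b; exact h a b
  have e1 : Quotient (Setoid.ker f) ≃ₜ Y := IsQuotientMap.homeomorph (f := ⟨f, hf.continuous⟩) hf
  have e2 : Quotient (Setoid.ker g) ≃ₜ Z := IsQuotientMap.homeomorph (f := ⟨g, hg.continuous⟩) hg
  rw [this] at e1
  exact ⟨e1.symm.trans e2⟩

lemma ess_sphere {G : Subgroup PSL2C} (hK : IsKleinian G) {z : RSphere} (hz : z ∈ omegaSet G) {M : PSL2C}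
    (hM : cj M (Hs G z) = Gam) (hinf : M⁻¹ • (OnePoint.infty : RSphere) ∉ Om G z)
    (hup : ∀ w : ℂ, M⁻¹ • (w : RSphere) ∈ Om G z ↔ 0 < w.im) :
    IsTriplyPuncturedSphere ↥(connectedComponent (oproj G ⟨z, hz⟩)) := by
  have hsub : Om G z ⊆ omegaSet G := connectedComponentIn_subset _ _
  have hT : TorsionFree Gam := hM ▸ cj_free (fun g hg => hK.2.2.1 g (Hs_le G z hg))
  have hS := comp_eq hz
  set δ : {w : ℂ // 0 < w.im} → ↥(omegaSet G) := fun w => ⟨M⁻¹ • ((w : ℂ) : RSphere), hsub ((hup w).2 w.2)⟩ with hδ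
  have hδc : Continuous δ := ((chart_emb M⁻¹).continuous.comp continuous_subtype_val).subtype_mk _
  have hmem : ∀ w, oproj G (δ w) ∈ connectedComponent (oproj G ⟨z, hz⟩) := fun w => by
    rw [hS]; exact ⟨_, (hup w).2 w.2, rfl⟩
  have hop : IsOpenMap δ := by
    have h1 : IsOpenMap (Subtype.val ∘ δ) :=
      (chart_emb M⁻¹).isOpenMap.comp (isOpen_lt continuous_const Complex.continuous_im).isOpenMap_subtype_val
    exact (IsOpenEmbedding.of_comp δ (omega_open G).isOpenEmbedding_subtypeVal
      ((chart_emb M⁻¹).comp (isOpen_lt continuous_const Complex.continuous_im).isOpenEmbedding_subtypeVal)).isOpenMap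
  set π : {w : ℂ // 0 < w.im} → ↥(connectedComponent (oproj G ⟨z, hz⟩)) := fun w => ⟨oproj G (δ w), hmem w⟩ with hπ
  have hπc : Continuous π := ((oproj_cont G).comp hδc).subtype_mk _
  have hπo : IsOpenMap π := by
    intro U hU
    rw [isOpen_induced_iff]
    refine ⟨_, ((oproj_open G).comp hop) U hU, ?_⟩
    ext y; constructor
    · rintro ⟨w, hw, h⟩; exact ⟨w, hw, Subtype.ext h⟩
    · rintro ⟨w, hw, rfl⟩; exact ⟨w, hw, rfl⟩
  have hπs : Function.Surjective π := by
    rintro ⟨y, hy⟩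
    have hy' := hy
    rw [hS] at hy'
    obtain ⟨u, hu, rfl⟩ := hy'
    obtain ⟨w, hw⟩ := chart_range M⁻¹ (x := u) (by intro h; rw [← h] at hinf; exact hinf hu)
    have hw' : 0 < w.im := (hup w).1 (by rw [hw]; exact hu)
    exact ⟨⟨w, hw'⟩, Subtype.ext (congrArg (oproj G) (Subtype.ext hw))⟩
  have hπq : IsQuotientMap π := hπo.isQuotientMap hπc hπs
  obtain ⟨e⟩ := homeo_of_quot hπq (phiY_quot hT) (by
    intro a b
    have h1 : π a = π b ↔ oproj G (δ a) = oproj G (δ b) := Subtype.ext_iff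
    have h2 : phiY a = phiY b ↔ phi a = phi b := Subtype.ext_iff
    rw [h1, h2, oproj_eq, phi_eq_iff a.2 b.2]
    constructor
    · rintro ⟨g, hg, h⟩
      have h : g • (M⁻¹ • ((a : ℂ) : RSphere)) = M⁻¹ • ((b : ℂ) : RSphere) := h
      have hgH : g ∈ Hs G z := Hs_mem hg ((hup a).2 a.2) (by rw [h]; exact (hup b).2 b.2)
      refine ⟨M * g * M⁻¹, ?_, ?_⟩
      · rw [← hM, mem_cj]
        have : M⁻¹ * (M * g * M⁻¹) * M = g := by group
        rw [this]; exact hgH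
      · rw [mul_smul, mul_smul, h, smul_inv_smul]
    · rintro ⟨k, hk, h⟩
      rw [← hM, mem_cj] at hk
      refine ⟨_, Hs_le G z hk, ?_⟩
      change (M⁻¹ * k * M) • (M⁻¹ • ((a : ℂ) : RSphere)) = M⁻¹ • ((b : ℂ) : RSphere)
      rw [mul_smul, smul_inv_smul, mul_smul, h])
  obtain ⟨e'⟩ := Yy_homeo
  refine ⟨((1 : ℂ) : RSphere), ((-1 : ℂ) : RSphere), OnePoint.infty, ?_, OnePoint.coe_ne_infty _, OnePoint.coe_ne_infty _,
    ⟨e.trans e'⟩⟩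
  intro h
  have := OnePoint.coe_injective h
  norm_num at this

theorem final_main
    (G : Subgroup PSL2C) (hK : IsKleinian G)
    (x : QuotOmega G)
    (hS : ¬ IsTriplyPuncturedSphere ↥(connectedComponent x)) :
    ∃ g : PSL2C, g ∈ G ∧ IsLoxodromic g ∧
      ∃ f : C(S1, QuotOmega G), Function.Injective f ∧
        Set.range f ⊆ connectedComponent x ∧ RepresentedByOmega G f g := by
  obtain ⟨⟨z, hz⟩, rfl⟩ : ∃ y, oproj G y = x := Quotient.exists_rep x
  by_contra hno
  have hCnt : Countable G := kleinian_countable hK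
  have : Countable ↥(Hs G z) := (Subgroup.inclusion_injective (Hs_le G z)).countable
  rcases trichotomy (ρ := (Hs G z).subtype) (om_surf hK hz) (fun h hh => by
    refine par_of_not_lox hK.2.2.1 ⟨z, hz⟩ h.2.1 fun hl => hno ⟨h, h.2.1, hl, cyc_curve hK hz hh⟩)
    Subtype.val_injective with ⟨M, hM⟩ | ⟨a, b, hE, hc⟩
  · exact unip_false hK hz (M := M) fun h hh => hM ⟨h, hh⟩
  · obtain ⟨M, h1, h2⟩ := ess_norm hE
    have hH : Hs G z = Subgroup.closure {(a : PSL2C), (b : PSL2C)} := by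
      have := congrArg (Subgroup.map (Hs G z).subtype) hc
      rw [MonoidHom.map_closure, image_pair, ← MonoidHom.range_eq_map, Subgroup.range_subtype] at this
      exact this.symm
    have hM : cj M (Hs G z) = Gam := by
      rw [hH, cj_closure, Gam]
      have h1 : M * (a : PSL2C) * M⁻¹ = mk (Uu 2) := h1
      have h2 : M * (b : PSL2C) * M⁻¹ = mk (Ll 2) := h2
      rw [h1, h2]
    obtain ⟨M', h3, h4, h5⟩ := ess_upper hK hz hM
    exact hS (ess_sphere hK hz h3 h4 h5)
end

/-- **Lemma 3.6.** If some component `S` of `Ω(G)/G` is not a triply punctured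
sphere, then some loxodromic element of `G` represents a simple closed curve on
`S`. -/
theorem exists_loxodromic_simple_curve
    (G : Subgroup PSL2C) (hK : IsKleinian G)
    (x : QuotOmega G)
    (hS : ¬ IsTriplyPuncturedSphere ↥(connectedComponent x)) :
    ∃ g : PSL2C, g ∈ G ∧ IsLoxodromic g ∧
      ∃ f : C(S1, QuotOmega G), Function.Injective f ∧
        Set.range f ⊆ connectedComponent x ∧ RepresentedByOmega G f g := by
  exact final_main G hK x hS

end
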